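/- The Duflo map D restricts to an algebra isomorphism from S(g)^g onto U(g)^g: it maps S(g)^g bijectively onto U(g)^g and satisfies D(PQ) = D(P)·D(Q) for all P, Q ∈ S(g)^g, where S(g)^g carries the commutative product and U(g)^g the product of U(g). -/

import Mathlib

noncomputable section

open scoped BigOperators

/-- Formal exponential of a power series (intended for series with zero constant term). -/
def expPS (F : PowerSeries ℚ) : PowerSeries ℚ :=
  PowerSeries.mk fun n =>
    ∑ k ∈ Finset.range (n + 1), ((k.factorial : ℚ))⁻¹ * PowerSeries.coeff n (F ^ k)

/-- The power series of sinh(x/2)/(x/2) = Σ_{k≥0} x^{2k} / (4^k (2k+1)!). -/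
def sinhHalfSeries : PowerSeries ℚ :=
  PowerSeries.mk fun n => if n % 2 = 0 then ((4 ^ (n / 2) * (n + 1).factorial : ℚ))⁻¹ else 0

variable {K : Type} [Field K] [CharZero K]
variable {L : Type} [LieRing L] [LieAlgebra K L]
variable {m : ℕ}

/-- The polynomial function x ↦ Tr((ad_x)^n) on g, written in the coordinates given by the
basis `b` (the variable `X i` is the `i`-th coordinate, i.e. the dual basis vector `bᵢ*`). -/
def adTracePoly (b : Module.Basis (Fin m) K L) (n : ℕ) : MvPolynomial (Fin m) K :=
  ∑ f : Fin n → Fin m,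
    (LinearMap.trace K L (List.ofFn fun j => (LieAlgebra.ad K L (b (f j)) : Module.End K L)).prod) •
      ∏ j, MvPolynomial.X (f j)

/-- The degree-`r` homogeneous component `δ_r` of the formal series
`exp (Σ_{n ≥ 1} 2 c_{2n} T_{2n})` in S(g*). -/
def dufloSymbol (b : Module.Basis (Fin m) K L) (c : ℕ → ℚ) (r : ℕ) : MvPolynomial (Fin m) K :=
  MvPolynomial.homogeneousComponent r
    (∑ k ∈ Finset.range (r + 1), ((k.factorial : K))⁻¹ •
      (∑ n ∈ Finset.Icc 1 r, ((2 * c (2 * n) : ℚ) : K) • adTracePoly b (2 * n)) ^ k)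

/-- Symmetrization of the monomial with exponent vector `α`:
`(1/d!) Σ_{σ ∈ S_d} x_{σ(1)} ⋯ x_{σ(d)}` in U(g). -/
def symmMonomial (b : Module.Basis (Fin m) K L) (α : Fin m →₀ ℕ) : UniversalEnvelopingAlgebra K L :=
  ((α.toMultiset.toList.length.factorial : K))⁻¹ •
    ∑ σ : Equiv.Perm (Fin α.toMultiset.toList.length),
      (List.ofFn fun j =>
        UniversalEnvelopingAlgebra.ι K (b (α.toMultiset.toList.get (σ j)))).prod

/-- The symmetrization map β : S(g) → U(g). -/
def symmetrization (b : Module.Basis (Fin m) K L) (P : MvPolynomial (Fin m) K) :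
    UniversalEnvelopingAlgebra K L :=
  ∑ α ∈ P.support, MvPolynomial.coeff α P • symmMonomial b α

/-- The differential operator `∂^α = ∏ᵢ (∂/∂bᵢ)^(α i)` on S(g). -/
def diffOpMon (α : Fin m →₀ ℕ) : Module.End K (MvPolynomial (Fin m) K) :=
  ((List.finRange m).map fun i =>
    (((MvPolynomial.pderiv i).toLinearMap : Module.End K (MvPolynomial (Fin m) K)) ^ (α i))).prod

/-- The constant-coefficient differential operator `δ(∂)` applied to `P`; each dual basis
vector `bᵢ*` occurring in `δ` is replaced by `∂/∂bᵢ`. -/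
def diffOp (δ P : MvPolynomial (Fin m) K) : MvPolynomial (Fin m) K :=
  ∑ α ∈ δ.support, MvPolynomial.coeff α δ • diffOpMon (K := K) α P

/-- The Duflo map `D(P) = Σ_r β(δ_r(∂) P)` (a finite sum). -/
def duflo (b : Module.Basis (Fin m) K L) (c : ℕ → ℚ) (P : MvPolynomial (Fin m) K) :
    UniversalEnvelopingAlgebra K L :=
  ∑ r ∈ Finset.range (P.totalDegree + 1), symmetrization b (diffOp (dufloSymbol b c r) P)

/-- The degree-one polynomial representing `y ∈ g` in the coordinates given by `b`. -/
def linPoly (b : Module.Basis (Fin m) K L) (y : L) : MvPolynomial (Fin m) K :=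
  ∑ j, b.repr y j • MvPolynomial.X j

/-- The adjoint action of `x ∈ g` on S(g), extended from g as a derivation. -/
def adS (b : Module.Basis (Fin m) K L) (x : L) :
    MvPolynomial (Fin m) K →ₗ[K] MvPolynomial (Fin m) K :=
  (MvPolynomial.mkDerivation K fun i => linPoly b ⁅x, b i⁆).toLinearMap

end

noncomputable section

namespace Duflo

open SymmetricAlgebra Finset
open Module (Basis finBasis finrank End)
open Module.End (mul_apply one_apply)
open LinearMap (comp_apply trace mulLeft mulLeft_apply mulRight mulRight_apply)
open LinearMap renaming smul_apply → lsmul_apply, sub_apply → lsub_apply,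
  neg_apply → lneg_apply, add_apply → ladd_apply, zero_apply → lzero_apply,
  sum_apply → lsum_apply, ext → lext, congr_fun → lcongr_fun
open Finset.HasAntidiagonal renaming mem_antidiagonal → mem_anti
open Finset.Nat renaming sum_antidiagonal_eq_sum_range_succ_mk → sum_anti_range,
  sum_antidiagonal_succ → sum_anti_succ, sum_antidiagonal_succ' → sum_anti_succ'
open DFunLike renaming congr_fun → dcongr_fun
open Algebra renaming smul_def → asmul_def
open Submodule (span smul_mem subset_span span_le mem_span_singleton mem_span_singleton_self
  mem_comap mem_iSup_of_mem linearMap_qext mkQ_apply)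
open Nat (strong_induction_on exists_eq_add_of_le')
open Derivation (leibniz)
open CliffordAlgebra (involute)
open CliffordAlgebra renaming contractLeft → contr, contractLeft_ι_mul → contr_ι_mul
open SymmetricAlgebra renaming lift → slift
open Submodule.Quotient renaming mk_eq_zero → qmk_eq_zero

local notation "𝒮" => SymmetricAlgebra
local notation "𝒰" => UniversalEnvelopingAlgebra

scoped instance (priority := 2000) symmetricAlgebraAddCommMonoid {K V : Type} [Field K]
    [AddCommGroup V] [Module K V] : AddCommMonoid (𝒮 K V) :=
  NonUnitalNonAssocSemiring.toAddCommMonoid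

section

section PolyCoeff

variable {K : Type} [Field K] [CharZero K] {M : Type} [AddCommGroup M] [Module K M]

lemma eq_zero_of_forall_sum_pow_smul (N : ℕ) (v : ℕ → M)
    (h : ∀ t : K, ∑ i ∈ range N, t ^ i • v i = 0) {i : ℕ} (hi : i < N) : v i = 0 := by
  rw [← Module.forall_dual_apply_eq_zero_iff K]
  intro f
  let p : Polynomial K := ∑ j ∈ range N, Polynomial.monomial j (f (v j))
  have hp : p = 0 := by
    apply Polynomial.funext
    intro t
    have := congrArg f (h t)
    simp only [map_sum, map_smul, map_zero, smul_eq_mul] at this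
    simp only [p, Polynomial.eval_finsetSum, Polynomial.eval_monomial, Polynomial.eval_zero]
    rw [← this]
    exact sum_congr rfl fun j _ => mul_comm _ _
  have := congrArg (fun q => Polynomial.coeff q i) hp
  simpa [p, Polynomial.finsetSum_coeff, Polynomial.coeff_monomial, hi] using this

lemma mem_of_forall_sum_pow_smul (W : Submodule K M) (N : ℕ) (v : ℕ → M)
    (h : ∀ t : K, ∑ i ∈ range N, t ^ i • v i ∈ W) {i : ℕ} (hi : i < N) : v i ∈ W := by
  rw [← qmk_eq_zero]
  refine eq_zero_of_forall_sum_pow_smul (K := K) N (fun i => (Submodule.Quotient.mk (v i) : M ⧸ W))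
    (fun t => ?_) hi
  have := (qmk_eq_zero W).2 (h t)
  rw [← this, ← mkQ_apply, map_sum]
  simp

end PolyCoeff

section Sym

variable {K : Type} [Field K] [CharZero K] {V : Type} [AddCommGroup V] [Module K V]

/-- The divided power `x ^ n / n!` in the symmetric algebra. -/
def dp (x : V) (n : ℕ) : 𝒮 K V := (n.factorial : K)⁻¹ • (ι K V x) ^ n

@[simp] lemma dp_zero (x : V) : dp (K := K) x 0 = 1 := by simp [dp]

@[simp] lemma dp_one (x : V) : dp (K := K) x 1 = ι K V x := by simp [dp]

lemma pow_eq_dp (x : V) (n : ℕ) : (ι K V x) ^ n = (n.factorial : K) • dp x n := by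
  rw [dp, smul_smul, mul_inv_cancel₀ (by exact_mod_cast n.factorial_ne_zero), one_smul]

lemma inv_factorial_succ (n : ℕ) :
    ((n + 1 : ℕ) : K) * (((n + 1).factorial : ℕ) : K)⁻¹ = ((n.factorial : ℕ) : K)⁻¹ := by
  have h1 : ((n + 1 : ℕ) : K) ≠ 0 := by exact_mod_cast n.succ_ne_zero
  have h2 : ((n.factorial : ℕ) : K) ≠ 0 := by exact_mod_cast n.factorial_ne_zero
  rw [Nat.factorial_succ]; push_cast at h1 ⊢; field_simp

lemma ι_mul_dp (x : V) (n : ℕ) :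
    ι K V x * dp x n = ((n + 1 : ℕ) : K) • dp x (n + 1) := by
  rw [dp, dp, smul_smul, inv_factorial_succ, mul_smul_comm, pow_succ']

lemma span_range_pow :
    span K (Set.range fun p : V × ℕ => (ι K V p.1) ^ p.2) = ⊤ := by
  set W := span K (Set.range fun p : V × ℕ => (ι K V p.1) ^ p.2) with hW
  have hmem : ∀ x n, (ι K V x) ^ n ∈ W := fun x n => subset_span ⟨(x, n), rfl⟩
  have hmul : ∀ y : V, ∀ P ∈ W, P * ι K V y ∈ W := by
    intro y P hP
    induction hP using Submodule.span_induction with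
    | mem P h =>
      obtain ⟨⟨x, n⟩, rfl⟩ := h
      have key := mem_of_forall_sum_pow_smul (K := K) W (n + 2)
        (fun i => ((n + 1).choose i : K) • ((ι K V x) ^ (n + 1 - i) * (ι K V y) ^ i))
        (fun t => by
          have h1 := hmem (t • y + x) (n + 1)
          rw [map_add, map_smul, add_pow] at h1
          convert h1 using 2 with i hi
          rw [smul_pow, smul_mul_assoc, smul_mul_assoc, mul_comm (ι K V x ^ _),
            ← nsmul_eq_mul', ← Nat.cast_smul_eq_nsmul K])
        (i := 1) (by omega)
      have hn : ((n + 1 : ℕ) : K) ≠ 0 := by exact_mod_cast n.succ_ne_zero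
      simp only [Nat.choose_one_right, Nat.add_sub_cancel, pow_one] at key
      exact (Submodule.smul_mem_iff W hn).1 key
    | zero => simp
    | add P Q _ _ hP hQ => rw [add_mul]; exact W.add_mem hP hQ
    | smul a P _ hP => rw [smul_mul_assoc]; exact W.smul_mem a hP
  have hmul' : ∀ Q P : 𝒮 K V, P ∈ W → P * Q ∈ W := by
    intro Q
    induction Q using SymmetricAlgebra.induction with
    | algebraMap r =>
      intro P hP; rw [← Algebra.commutes, ← asmul_def]; exact W.smul_mem r hP
    | ι x => exact fun P hP => hmul x P hP
    | mul a b ha hb => intro P hP; rw [← mul_assoc]; exact hb _ (ha _ hP)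
    | add a b ha hb => intro P hP; rw [mul_add]; exact W.add_mem (ha _ hP) (hb _ hP)
  rw [eq_top_iff]
  intro Q _
  have := hmul' Q 1 (by simpa using hmem 0 0)
  simpa using this

lemma span_range_dp :
    span K (Set.range fun p : V × ℕ => dp (K := K) p.1 p.2) = ⊤ := by
  rw [eq_top_iff, ← span_range_pow, span_le]
  rintro _ ⟨⟨x, n⟩, rfl⟩
  simp only [pow_eq_dp]
  exact smul_mem _ _ (subset_span ⟨(x, n), rfl⟩)

lemma ext_dp {M : Type*} [AddCommMonoid M] [Module K M] {f g : 𝒮 K V →ₗ[K] M}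
    (h : ∀ x n, f (dp x n) = g (dp x n)) : f = g :=
  LinearMap.ext_on span_range_dp (by rintro _ ⟨⟨x, n⟩, rfl⟩; exact h x n)

lemma dp_induction {p : 𝒮 K V → Prop} (h : ∀ x n, p (dp x n))
    (hz : p 0) (ha : ∀ P Q, p P → p Q → p (P + Q)) (hs : ∀ (a : K) P, p P → p (a • P)) (P) : p P := by
  have : P ∈ span K (Set.range fun p : V × ℕ => dp (K := K) p.1 p.2) := by
    rw [span_range_dp]; trivial
  induction this using Submodule.span_induction with
  | mem P h' => obtain ⟨⟨x, n⟩, rfl⟩ := h'; exact h x n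
  | zero => exact hz
  | add P Q _ _ hP hQ => exact ha _ _ hP hQ
  | smul a P _ hP => exact hs _ _ hP

/-! ### Derivations -/

/-- The derivation of the symmetric algebra extending a linear map on generators. -/
def der (δ : V →ₗ[K] 𝒮 K V) :
    Derivation K (𝒮 K V) (𝒮 K V) :=
  let F : 𝒮 K V →ₐ[K] TrivSqZeroExt (𝒮 K V) (𝒮 K V) :=
    slift
      ((TrivSqZeroExt.inlAlgHom K (𝒮 K V) (𝒮 K V)).toLinearMap ∘ₗ ι K V
        + (TrivSqZeroExt.inrHom (𝒮 K V) (𝒮 K V)).restrictScalars K ∘ₗ δ)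
  have hF : ∀ P, (F P).fst = P := by
    intro P
    have : (TrivSqZeroExt.fstHom K (𝒮 K V) (𝒮 K V)).comp F
        = AlgHom.id K _ := by
      apply algHom_ext
      ext x
      simp [F]
    exact dcongr_fun this P
  { toFun := fun P => (F P).snd
    map_add' := by simp
    map_smul' := by simp
    map_one_eq_zero' := by simp
    leibniz' := by
      intro P Q
      change (F (P * Q)).snd = _
      rw [map_mul, TrivSqZeroExt.snd_mul, hF, hF]
      simp [mul_comm] }

@[simp] lemma der_ι (δ : V →ₗ[K] 𝒮 K V) (x : V) : der δ (ι K V x) = δ x := by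
  change TrivSqZeroExt.snd (slift _ (ι K V x)) = _
  rw [SymmetricAlgebra.lift_ι_apply]
  simp

lemma der_dp_succ (D : Derivation K (𝒮 K V) (𝒮 K V)) (x : V) (n : ℕ) :
    D (dp x (n + 1)) = dp x n * D (ι K V x) := by
  rw [dp, dp, D.map_smul, Derivation.leibniz_pow, ← inv_factorial_succ n,
    ← Nat.cast_smul_eq_nsmul K, Nat.add_sub_cancel, smul_eq_mul, smul_smul, smul_mul_assoc,
    mul_comm ((n + 1 : ℕ) : K)]

lemma der_dp_zero (D : Derivation K (𝒮 K V) (𝒮 K V)) (x : V) :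
    D (dp x 0) = 0 := by simp

lemma der_ext {D D' : Derivation K (𝒮 K V) (𝒮 K V)}
    (h : ∀ x, D (ι K V x) = D' (ι K V x)) : D = D' := by
  apply Derivation.coe_injective
  funext P
  have : (D : 𝒮 K V →ₗ[K] 𝒮 K V) = D' := by
    apply ext_dp
    rintro x (_ | n)
    · simp
    · simp only [Derivation.coeFn_coe, der_dp_succ, h]
  exact dcongr_fun this P

/-- The constant-coefficient vector field attached to a linear form. -/
def pd (ξ : V →ₗ[K] K) : Derivation K (𝒮 K V) (𝒮 K V) :=
  der ((Algebra.linearMap K (𝒮 K V)) ∘ₗ ξ)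

@[simp] lemma pd_ι (ξ : V →ₗ[K] K) (x : V) : pd ξ (ι K V x) = algebraMap K _ (ξ x) := by
  simp [pd]

lemma pd_dp_succ (ξ : V →ₗ[K] K) (x : V) (n : ℕ) : pd ξ (dp x (n + 1)) = ξ x • dp x n := by
  rw [der_dp_succ, pd_ι, mul_comm, asmul_def]

@[simp] lemma pd_dp_zero (ξ : V →ₗ[K] K) (x : V) : pd ξ (dp x 0) = 0 := der_dp_zero _ _

lemma pd_mul (ξ : V →ₗ[K] K) (P Q : 𝒮 K V) :
    pd ξ (P * Q) = P * pd ξ Q + pd ξ P * Q := by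
  rw [leibniz, smul_eq_mul, smul_eq_mul, mul_comm Q]

lemma pd_ι_mul (ξ : V →ₗ[K] K) (x : V) (P : 𝒮 K V) :
    pd ξ (ι K V x * P) = ι K V x * pd ξ P + ξ x • P := by
  rw [pd_mul, pd_ι, asmul_def]

lemma pd_add (ξ η : V →ₗ[K] K) (P : 𝒮 K V) : pd (ξ + η) P = pd ξ P + pd η P := by
  rw [show pd (ξ + η) = pd ξ + pd η from der_ext fun x => by simp]; rfl

lemma pd_smul (a : K) (ξ : V →ₗ[K] K) (P : 𝒮 K V) : pd (a • ξ) P = a • pd ξ P := by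
  rw [show pd (a • ξ) = a • pd ξ from der_ext fun x => by simp [asmul_def]]; rfl

lemma pd_comm (ξ η : V →ₗ[K] K) (P : 𝒮 K V) : pd ξ (pd η P) = pd η (pd ξ P) := by
  have : (pd ξ).toLinearMap ∘ₗ (pd η).toLinearMap
      = (pd η).toLinearMap ∘ₗ (pd ξ).toLinearMap := by
    apply ext_dp
    rintro x (_ | _ | n)
    · simp
    · simp
    · simp only [comp_apply, Derivation.coeFn_coe, pd_dp_succ, Derivation.map_smul, smul_smul, mul_comm]
  exact dcongr_fun this P

/-- `pd` as a linear map into endomorphisms. -/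
def pdL : (V →ₗ[K] K) →ₗ[K] End K (𝒮 K V) where
  toFun ξ := (pd ξ : 𝒮 K V →ₗ[K] 𝒮 K V)
  map_add' ξ η := lext fun P => pd_add ξ η P
  map_smul' a ξ := lext fun P => pd_smul a ξ P

@[simp] lemma pdL_apply (ξ : V →ₗ[K] K) (P : 𝒮 K V) : pdL ξ P = pd ξ P := rfl

lemma pd_sum {κ : Type*} (s : Finset κ) (ξ : κ → V →ₗ[K] K) (P : 𝒮 K V) :
    pd (∑ k ∈ s, ξ k) P = ∑ k ∈ s, pd (ξ k) P := by
  rw [← pdL_apply, map_sum, lsum_apply]; rfl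

/-- The Euler derivation. -/
def eul : Derivation K (𝒮 K V) (𝒮 K V) := der (ι K V)

lemma eul_dp (x : V) (n : ℕ) : eul (dp x n) = (n : K) • dp (K := K) x n := by
  cases n with
  | zero => simp [eul]
  | succ n => rw [eul, der_dp_succ, der_ι, mul_comm, ι_mul_dp]

/-- The functorial map on symmetric algebras. -/
def smap {V' : Type} [AddCommGroup V'] [Module K V'] (f : V →ₗ[K] V') :
    𝒮 K V →ₐ[K] 𝒮 K V' :=
  slift (ι K V' ∘ₗ f)

@[simp] lemma smap_ι {V' : Type} [AddCommGroup V'] [Module K V'] (f : V →ₗ[K] V') (x : V) :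
    smap f (ι K V x) = ι K V' (f x) := by simp [smap]

@[simp] lemma smap_dp {V' : Type} [AddCommGroup V'] [Module K V'] (f : V →ₗ[K] V') (x : V) (n : ℕ) :
    smap f (dp x n) = dp (f x) n := by simp [dp]

lemma smap_comp {V' V'' : Type} [AddCommGroup V'] [Module K V'] [AddCommGroup V''] [Module K V'']
    (g : V' →ₗ[K] V'') (f : V →ₗ[K] V') (P : 𝒮 K V) :
    smap g (smap f P) = smap (g ∘ₗ f) P := by
  rw [← AlgHom.comp_apply]; congr 1; apply algHom_ext; ext x; simp

lemma smap_id (P : 𝒮 K V) : smap (LinearMap.id) P = P := by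
  have : smap (LinearMap.id : V →ₗ[K] V) = AlgHom.id K _ := by
    apply algHom_ext; ext x; simp
  rw [this]; rfl

lemma dp_add (x y : V) (n : ℕ) :
    dp (K := K) (x + y) n = ∑ p ∈ antidiagonal n, dp x p.1 * dp y p.2 := by
  rw [dp, map_add, Commute.add_pow' (Commute.all _ _), smul_sum]
  refine sum_congr rfl fun p hp => ?_
  rw [mem_anti] at hp
  subst hp
  rw [pow_eq_dp, pow_eq_dp, ← Nat.cast_smul_eq_nsmul K, smul_mul_smul_comm, smul_smul, smul_smul]
  have h1 : ((p.1.factorial : ℕ) : K) ≠ 0 := by exact_mod_cast p.1.factorial_ne_zero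
  have h2 : ((p.2.factorial : ℕ) : K) ≠ 0 := by exact_mod_cast p.2.factorial_ne_zero
  have h3 : (((p.1 + p.2).factorial : ℕ) : K) ≠ 0 := by exact_mod_cast (p.1 + p.2).factorial_ne_zero
  have h4 : (((p.1 + p.2).choose p.1 : ℕ) : K) * (p.1.factorial : K) * (p.2.factorial : K)
      = ((p.1 + p.2).factorial : K) := by exact_mod_cast (by rw [Nat.choose_symm_add]; exact Nat.add_choose_mul_factorial_mul_factorial p.1 p.2 : (p.1 + p.2).choose p.1 * p.1.factorial * p.2.factorial = _)
  rw [← h4]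
  rw [← h4] at h3
  rw [inv_mul_eq_div, div_mul_eq_mul_div, mul_assoc, div_self, one_smul]
  · rwa [mul_assoc] at h3

lemma dp_smul (a : K) (x : V) (n : ℕ) : dp (K := K) (a • x) n = a ^ n • dp x n := by
  rw [dp, dp, map_smul, smul_pow, smul_comm]

end Sym

end

section

section ExpSeq

variable (K : Type) [Field K] [CharZero K] {R : Type} [Ring R] [Algebra K R]

/-- The coefficients of the exponential of the formal series `∑_{i ≥ 1} A i t ^ i`, defined by the
logarithmic-derivative recursion. -/
def expSeq (A : ℕ → R) : ℕ → R
  | 0 => 1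
  | n + 1 => ((n + 1 : ℕ) : K)⁻¹ •
      ∑ i : Fin (n + 1), ((i + 1 : ℕ) : K) • (A (i + 1) * expSeq A (n - i))

@[simp] lemma expSeq_zero (A : ℕ → R) : expSeq K A 0 = 1 := by rw [expSeq]

lemma expSeq_succ (A : ℕ → R) (n : ℕ) :
    ((n + 1 : ℕ) : K) • expSeq K A (n + 1)
      = ∑ p ∈ antidiagonal n, ((p.1 + 1 : ℕ) : K) • (A (p.1 + 1) * expSeq K A p.2) := by
  rw [expSeq, smul_smul, mul_inv_cancel₀ (by exact_mod_cast n.succ_ne_zero), one_smul,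
    sum_anti_range, sum_range]

lemma eq_expSeq (A G : ℕ → R) (h0 : G 0 = 1)
    (h : ∀ n, ((n + 1 : ℕ) : K) • G (n + 1)
      = ∑ p ∈ antidiagonal n, ((p.1 + 1 : ℕ) : K) • (A (p.1 + 1) * G p.2)) (n : ℕ) :
    G n = expSeq K A n := by
  induction n using strong_induction_on with
  | _ n ih =>
    cases n with
    | zero => simp [h0]
    | succ n =>
      have hn : ((n + 1 : ℕ) : K) ≠ 0 := by exact_mod_cast n.succ_ne_zero
      apply smul_right_injective _ hn
      change ((n + 1 : ℕ) : K) • G (n + 1) = ((n + 1 : ℕ) : K) • expSeq K A (n + 1)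
      rw [h, expSeq_succ]
      refine sum_congr rfl fun p hp => ?_
      rw [mem_anti] at hp
      rw [ih p.2 (by omega)]

lemma expSeq_congr {A A' : ℕ → R} (n : ℕ) (h : ∀ i, 1 ≤ i → i ≤ n → A i = A' i) :
    expSeq K A n = expSeq K A' n := by
  induction n using strong_induction_on with
  | _ n ih =>
    cases n with
    | zero => simp
    | succ n =>
      have hn : ((n + 1 : ℕ) : K) ≠ 0 := by exact_mod_cast n.succ_ne_zero
      apply smul_right_injective _ hn
      change ((n + 1 : ℕ) : K) • expSeq K A (n + 1) = ((n + 1 : ℕ) : K) • expSeq K A' (n + 1)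
      rw [expSeq_succ, expSeq_succ]
      refine sum_congr rfl fun p hp => ?_
      rw [mem_anti] at hp
      rw [ih p.2 (by omega) (fun i h1 h2 => h i h1 (by omega)), h (p.1 + 1) (by omega) (by omega)]

lemma expSeq_scale (A : ℕ → R) (t : K) (n : ℕ) :
    expSeq K (fun i => t ^ i • A i) n = t ^ n • expSeq K A n := by
  symm
  refine eq_expSeq K (fun i => t ^ i • A i) (fun n => t ^ n • expSeq K A n) (by simp) (fun n => ?_) n
  rw [smul_comm, expSeq_succ, smul_sum]
  refine sum_congr rfl fun p hp => ?_
  rw [mem_anti] at hp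
  rw [smul_comm, smul_mul_smul_comm, ← pow_add, show p.1 + 1 + p.2 = n + 1 by omega]

lemma map_expSeq {R' : Type} [Ring R'] [Algebra K R'] (φ : R →ₐ[K] R') (A : ℕ → R) (n : ℕ) :
    φ (expSeq K A n) = expSeq K (fun i => φ (A i)) n := by
  refine eq_expSeq K (fun i => φ (A i)) (fun n => φ (expSeq K A n)) (by simp) (fun n => ?_) n
  rw [← map_smul, expSeq_succ, map_sum]
  simp

variable {K}

section Comm

variable {R : Type} [CommRing R] [Algebra K R]

open PowerSeries in
lemma expSeq_derivative (A : ℕ → R) :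
    derivative R (mk (expSeq K A)) = derivative R (mk A) * mk (expSeq K A) := by
  ext n
  rw [coeff_derivative, coeff_mul]
  have := expSeq_succ K A n
  simp only [coeff_mk, coeff_derivative]
  rw [mul_comm, show ((n : R) + 1) = algebraMap K R ((n + 1 : ℕ) : K) by simp, ← asmul_def,
    this]
  refine sum_congr rfl fun p _ => ?_
  rw [asmul_def]; simp; ring

open PowerSeries in
lemma eq_expSeq_of_derivative (A : ℕ → R) (G : PowerSeries R) (h0 : coeff 0 G = 1) (N : ℕ)
    (h : ∀ n < N, coeff n (derivative R G) = coeff n (derivative R (mk A) * G))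
    (n : ℕ) (hn : n ≤ N) : coeff n G = expSeq K A n := by
  induction n using strong_induction_on with
  | _ n ih =>
    cases n with
    | zero => simpa using h0
    | succ n =>
      have hn0 : ((n + 1 : ℕ) : K) ≠ 0 := by exact_mod_cast n.succ_ne_zero
      have h1 := h n (by omega)
      rw [coeff_derivative, coeff_mul] at h1
      apply smul_right_injective _ hn0
      change ((n + 1 : ℕ) : K) • coeff (n + 1) G = ((n + 1 : ℕ) : K) • expSeq K A (n + 1)
      rw [expSeq_succ, asmul_def]
      rw [mul_comm, show algebraMap K R ((n + 1 : ℕ) : K) = ((n : R) + 1) by simp, h1]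
      refine sum_congr rfl fun p hp => ?_
      rw [mem_anti] at hp
      rw [asmul_def, coeff_derivative, coeff_mk, ih p.2 (by omega) (by omega)]
      simp; ring

open PowerSeries in
lemma expSeq_add (A B : ℕ → R) (n : ℕ) :
    expSeq K (fun i => A i + B i) n
      = ∑ p ∈ antidiagonal n, expSeq K A p.1 * expSeq K B p.2 := by
  rw [show ∑ p ∈ antidiagonal n, expSeq K A p.1 * expSeq K B p.2
    = coeff n (mk (expSeq K A) * mk (expSeq K B)) by simp [coeff_mul]]
  symm
  apply eq_expSeq_of_derivative (K := K) _ _ (by simp [coeff_mul]) n _ n le_rfl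
  intro k _
  congr 1
  rw [leibniz, expSeq_derivative, expSeq_derivative,
    show (mk fun i => A i + B i : PowerSeries R) = mk A + mk B by ext; simp, map_add]
  simp only [smul_eq_mul]
  ring

open PowerSeries in
/-- Truncated exponentials compute `expSeq`. -/
lemma coeff_sum_pow_eq_expSeq (F : PowerSeries R) (hF : coeff 0 F = 0) (n N : ℕ) (hn : n ≤ N) :
    coeff n (∑ k ∈ range (N + 1), ((k.factorial : ℕ) : K)⁻¹ • F ^ k)
      = expSeq K (fun i => coeff i F) n := by
  have hlow : ∀ k i : ℕ, i < k → coeff i (F ^ k) = 0 := by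
    intro k i hik
    exact coeff_of_lt_order i (lt_of_lt_of_le (by exact_mod_cast hik)
      (le_order_pow_of_constantCoeff_eq_zero k (by simpa using hF)))
  have hsm : ∀ (i : ℕ) (a : K) (G : PowerSeries R), coeff i (a • G) = a • coeff i G := fun _ _ _ => rfl
  refine eq_expSeq_of_derivative (K := K) _ _ ?_ N ?_ n hn
  · rw [map_sum, sum_eq_single 0]
    · simp
    · intro k _ hk
      rw [hsm, hlow k 0 (by omega), smul_zero]
    · simp
  · intro i hi
    have h1 : derivative R (∑ k ∈ range (N + 1), ((k.factorial : ℕ) : K)⁻¹ • F ^ k)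
        = derivative R F * ∑ k ∈ range N, ((k.factorial : ℕ) : K)⁻¹ • F ^ k := by
      rw [map_sum, sum_range_succ', mul_sum]
      have : derivative R (((Nat.factorial 0 : ℕ) : K)⁻¹ • F ^ 0) = 0 := by simp
      rw [this, add_zero]
      refine sum_congr rfl fun k _ => ?_
      have h2 : ∀ (a : K) (G : PowerSeries R), derivative R (a • G) = a • derivative R G := by
        intro a G; ext j; simp [coeff_derivative]
      rw [h2, Derivation.leibniz_pow, ← inv_factorial_succ k, ← Nat.cast_smul_eq_nsmul K,
        Nat.add_sub_cancel, smul_eq_mul, smul_smul, mul_smul_comm, mul_comm (F ^ k),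
        mul_comm ((k + 1 : ℕ) : K)]
    rw [h1, show (mk fun i => coeff i F) = F by ext; simp, sum_range_succ, mul_add, map_add]
    have : coeff i (derivative R F * (((N.factorial : ℕ) : K)⁻¹ • F ^ N)) = 0 := by
      rw [mul_smul_comm, hsm, coeff_mul, sum_eq_zero, smul_zero]
      intro p hp
      rw [mem_anti] at hp
      rw [hlow N p.2 (by omega), mul_zero]
    rw [this, add_zero]

end Comm

end ExpSeq

section LSum

variable {K : Type} [Field K] [CharZero K] {M M' : Type} [AddCommGroup M] [Module K M]
  [AddCommGroup M'] [Module K M']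

/-- The sum of a locally finite sequence of linear maps. -/
def lsum (f : ℕ → M →ₗ[K] M') (h : ∀ P, ∃ N, ∀ i, N ≤ i → f i P = 0) : M →ₗ[K] M' where
  toFun P := ∑ᶠ i, f i P
  map_add' P Q := by
    have hs : ∀ P, (Function.support fun i => f i P).Finite := fun P => by
      obtain ⟨N, hN⟩ := h P
      refine (Set.finite_lt_nat N).subset fun i hi => ?_
      by_contra hc
      exact hi (hN i (not_lt.1 hc))
    rw [← finsum_add_distrib (hs P) (hs Q)]
    simp
  map_smul' a P := by
    simp [smul_finsum]

lemma lsum_eq_sum (f : ℕ → M →ₗ[K] M') (h : ∀ P, ∃ N, ∀ i, N ≤ i → f i P = 0) {P : M} {N : ℕ}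
    (hN : ∀ i, N ≤ i → f i P = 0) : lsum f h P = ∑ i ∈ range N, f i P := by
  change ∑ᶠ i, f i P = _
  refine finsum_eq_sum_of_support_subset _ fun i hi => ?_
  by_contra hc
  exact hi (hN i (by simpa using hc))

end LSum

section Sigma

variable {K : Type} [Field K] [CharZero K] {V : Type} [AddCommGroup V] [Module K V]

lemma locFin_of_dp {M : Type} [AddCommGroup M] [Module K M] (f : ℕ → 𝒮 K V →ₗ[K] M)
    (h : ∀ x n i, n < i → f i (dp x n) = 0) (P) : ∃ N, ∀ i, N ≤ i → f i P = 0 := by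
  induction P using dp_induction (K := K) with
  | h x n => exact ⟨n + 1, fun i hi => h x n i hi⟩
  | hz => exact ⟨0, by simp⟩
  | ha P Q hP hQ =>
    obtain ⟨N, hN⟩ := hP
    obtain ⟨N', hN'⟩ := hQ
    exact ⟨max N N', fun i hi => by
      rw [map_add, hN i (le_trans (le_max_left _ _) hi), hN' i (le_trans (le_max_right _ _) hi),
        add_zero]⟩
  | hs a P hP =>
    obtain ⟨N, hN⟩ := hP
    exact ⟨N, fun i hi => by rw [map_smul, hN i hi, smul_zero]⟩

lemma algebraMapInv_dp_succ (x : V) (n : ℕ) :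
    (algebraMapInv : 𝒮 K V →ₐ[K] K) (dp x (n + 1)) = 0 := by
  simp [dp, algebraMapInv]

variable [FiniteDimensional K V] {A : Type} [Ring A] [Algebra K A]

variable (K) in
/-- Divided powers in an algebra. -/
def dvp (a : A) (n : ℕ) : A := ((n.factorial : ℕ) : K)⁻¹ • a ^ n

@[simp] lemma dvp_zero (a : A) : dvp K a 0 = 1 := by simp [dvp]

lemma mul_dvp (a : A) (n : ℕ) : a * dvp K a n = ((n + 1 : ℕ) : K) • dvp K a (n + 1) := by
  rw [dvp, dvp, smul_smul, inv_factorial_succ, mul_smul_comm, pow_succ']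

lemma dvp_ι (x : V) (n : ℕ) : dvp K (ι K V x) n = dp x n := rfl

/-- The degree `n` part of the symmetrization map. -/
def sgSeq (e : V →ₗ[K] A) : ℕ → 𝒮 K V →ₗ[K] A
  | 0 => Algebra.linearMap K A ∘ₗ (algebraMapInv : 𝒮 K V →ₐ[K] K).toLinearMap
  | n + 1 => ((n + 1 : ℕ) : K)⁻¹ • ∑ k, mulLeft K (e (finBasis K V k)) ∘ₗ
      sgSeq e n ∘ₗ (pd ((finBasis K V).coord k)).toLinearMap

lemma sgSeq_dp (e : V →ₗ[K] A) (n m : ℕ) (x : V) :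
    sgSeq e n (dp x m) = if m = n then dvp K (e x) n else 0 := by
  induction n generalizing m with
  | zero =>
    cases m with
    | zero => simp [sgSeq]
    | succ m => simp [sgSeq, algebraMapInv_dp_succ]
  | succ n ih =>
    have hn : ((n + 1 : ℕ) : K) ≠ 0 := by exact_mod_cast n.succ_ne_zero
    cases m with
    | zero => simp [sgSeq]
    | succ m =>
      simp only [sgSeq, lsmul_apply, lsum_apply, comp_apply,
        Derivation.coeFn_coe, pd_dp_succ, map_smul, ih, mulLeft_apply, add_left_inj]
      split_ifs with h
      · rw [← smul_right_injective _ hn |>.eq_iff]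
        simp only [smul_smul, mul_inv_cancel₀ hn, one_smul, ← mul_dvp]
        simp only [← smul_mul_assoc, ← sum_mul, ← map_smul, ← map_sum]
        congr 2
        exact (finBasis K V).sum_repr x
      · simp

/-- The symmetrization map attached to a linear map into an associative algebra. -/
def sg (e : V →ₗ[K] A) : 𝒮 K V →ₗ[K] A :=
  lsum (sgSeq e) (locFin_of_dp _ fun x n i h => by rw [sgSeq_dp, if_neg (by omega)])

@[simp] lemma sg_dp (e : V →ₗ[K] A) (x : V) (n : ℕ) : sg e (dp x n) = dvp K (e x) n := by
  rw [sg, lsum_eq_sum (N := n + 1), sum_eq_single n]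
  · simp [sgSeq_dp]
  · intro i _ h; rw [sgSeq_dp, if_neg (Ne.symm h)]
  · simp
  · intro i hi; rw [sgSeq_dp, if_neg (by omega)]

@[simp] lemma sg_one (e : V →ₗ[K] A) : sg e 1 = 1 := by
  rw [← dp_zero (0 : V), sg_dp, dvp_zero]

@[simp] lemma sg_ι (e : V →ₗ[K] A) (x : V) : sg e (ι K V x) = e x := by
  rw [← dp_one, sg_dp, dvp]; simp

lemma sg_eul (e : V →ₗ[K] A) {κ : Type*} [Fintype κ] (b : Basis κ K V)
    (P : 𝒮 K V) : sg e (eul P) = ∑ k, e (b k) * sg e (pd (b.coord k) P) := by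
  have : sg e ∘ₗ eul.toLinearMap
      = ∑ k, mulLeft K (e (b k)) ∘ₗ sg e ∘ₗ (pd (b.coord k)).toLinearMap := by
    apply ext_dp
    rintro x (_ | n)
    · simp
    · simp only [comp_apply, Derivation.coeFn_coe, eul_dp, map_smul, sg_dp,
        lsum_apply, pd_dp_succ, mulLeft_apply]
      simp only [← mul_dvp, mul_smul_comm]
      simp only [← smul_mul_assoc, ← sum_mul, ← map_smul, ← map_sum]
      congr 2
      exact (b.sum_repr x).symm
  simpa using dcongr_fun this P

lemma map_dvp {A' : Type} [Ring A'] [Algebra K A'] (φ : A →ₐ[K] A') (a : A) (n : ℕ) :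
    φ (dvp K a n) = dvp K (φ a) n := by simp [dvp]

lemma map_sg {A' : Type} [Ring A'] [Algebra K A'] (φ : A →ₐ[K] A') (e : V →ₗ[K] A)
    (P : 𝒮 K V) : φ (sg e P) = sg (φ.toLinearMap ∘ₗ e) P := by
  have : φ.toLinearMap ∘ₗ sg e = sg (φ.toLinearMap ∘ₗ e) := by
    apply ext_dp; intro x n; simp [map_dvp]
  exact dcongr_fun this P

lemma sg_smap {V' : Type} [AddCommGroup V'] [Module K V'] [FiniteDimensional K V']
    (e : V' →ₗ[K] A) (f : V →ₗ[K] V') (P : 𝒮 K V) :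
    sg e (smap f P) = sg (e ∘ₗ f) P := by
  have : sg e ∘ₗ (smap f).toLinearMap = sg (e ∘ₗ f) := by
    apply ext_dp; intro x n; simp
  exact dcongr_fun this P

lemma sg_of_commute {A : Type} [CommRing A] [Algebra K A] (e : V →ₗ[K] A)
    (P : 𝒮 K V) : sg e P = slift e P := by
  have : sg e = (slift e).toLinearMap := by
    apply ext_dp; intro x n; rw [sg_dp]; simp [dp, dvp]
  rw [this]; rfl

end Sigma

end

section

section SymOp

variable {K : Type} [Field K] [CharZero K] {V : Type} [AddCommGroup V] [Module K V]

/-- `A` is the constant-coefficient operator with symbol the degree `i` polynomial function `f`. -/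
structure SymOp (A : End K (𝒮 K V)) (i : ℕ) (f : V → K) : Prop where
  high : ∀ x n, A (dp x (n + i)) = f x • dp x n
  low : ∀ x n, n < i → A (dp x n) = 0

lemma SymOp.ext {A B : End K (𝒮 K V)} {i : ℕ} {f : V → K}
    (hA : SymOp A i f) (hB : SymOp B i f) : A = B := by
  apply ext_dp
  intro x n
  rcases lt_or_ge n i with h | h
  · rw [hA.low x n h, hB.low x n h]
  · obtain ⟨m, rfl⟩ := exists_eq_add_of_le' h
    rw [hA.high, hB.high]

lemma SymOp.one : SymOp (1 : End K (𝒮 K V)) 0 1 :=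
  ⟨fun x n => by simp, fun x n h => by omega⟩

lemma SymOp.zero (i : ℕ) : SymOp (0 : End K (𝒮 K V)) i 0 :=
  ⟨fun x n => by simp, fun x n h => by simp⟩

lemma SymOp.add {A B : End K (𝒮 K V)} {i : ℕ} {f g : V → K}
    (hA : SymOp A i f) (hB : SymOp B i g) : SymOp (A + B) i (f + g) :=
  ⟨fun x n => by simp [hA.high, hB.high, add_smul],
    fun x n h => by simp [hA.low x n h, hB.low x n h]⟩

lemma SymOp.smul {A : End K (𝒮 K V)} {i : ℕ} {f : V → K}
    (hA : SymOp A i f) (a : K) : SymOp (a • A) i (a • f) :=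
  ⟨fun x n => by simp [hA.high, smul_smul], fun x n h => by simp [hA.low x n h]⟩

lemma SymOp.sum {κ : Type*} (s : Finset κ) {A : κ → End K (𝒮 K V)} {i : ℕ}
    {f : κ → V → K} (h : ∀ k ∈ s, SymOp (A k) i (f k)) : SymOp (∑ k ∈ s, A k) i (∑ k ∈ s, f k) := by
  classical
  induction s using Finset.induction_on with
  | empty => simpa using SymOp.zero i
  | insert k s hk ih =>
    rw [sum_insert hk, sum_insert hk]
    exact (h k (by simp)).add (ih fun l hl => h l (by simp [hl]))

lemma SymOp.mul {A B : End K (𝒮 K V)} {i j : ℕ} {f g : V → K}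
    (hA : SymOp A i f) (hB : SymOp B j g) : SymOp (A * B) (i + j) (f * g) := by
  refine ⟨fun x n => ?_, fun x n h => ?_⟩
  · rw [mul_apply, ← add_assoc, hB.high, map_smul, hA.high, smul_smul, mul_comm]; rfl
  · rw [mul_apply]
    rcases lt_or_ge n j with h' | h'
    · rw [hB.low x n h', map_zero]
    · obtain ⟨m, rfl⟩ := exists_eq_add_of_le' h'
      rw [hB.high, map_smul, hA.low x m (by omega), smul_zero]

lemma SymOp.congr {A : End K (𝒮 K V)} {i j : ℕ} {f g : V → K}
    (hA : SymOp A i f) (hij : i = j) (hfg : ∀ x, f x = g x) : SymOp A j g := by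
  subst hij; rwa [← show f = g from funext hfg]

lemma symOp_pd (ξ : V →ₗ[K] K) : SymOp (pdL ξ) 1 ξ :=
  ⟨fun x n => pd_dp_succ ξ x n, fun x n h => by
    obtain rfl : n = 0 := by omega
    simp⟩

lemma SymOp.expSeq {A : ℕ → End K (𝒮 K V)} {f : ℕ → V → K}
    (h : ∀ i, SymOp (A i) i (f i)) (n : ℕ) :
    SymOp (expSeq K A n) n (fun x => Duflo.expSeq K (fun i => f i x) n) := by
  induction n using strong_induction_on with
  | _ n ih =>
    cases n with
    | zero =>
      rw [expSeq_zero]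
      exact SymOp.one.congr (g := fun x => _) rfl fun x => (expSeq_zero K _).symm
    | succ n =>
      have hn : ((n + 1 : ℕ) : K) ≠ 0 := by exact_mod_cast n.succ_ne_zero
      have h1 : ∀ {R : Type} [Ring R] [Algebra K R] (A : ℕ → R), Duflo.expSeq K A (n + 1)
          = ((n + 1 : ℕ) : K)⁻¹ • ∑ p ∈ antidiagonal n,
            ((p.1 + 1 : ℕ) : K) • (A (p.1 + 1) * Duflo.expSeq K A p.2) := by
        intro R _ _ A
        rw [← expSeq_succ, smul_smul, inv_mul_cancel₀ hn, one_smul]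
      rw [h1]
      refine ((SymOp.sum _ (i := n + 1) (f := fun p x => ((p.1 + 1 : ℕ) : K) *
        (f (p.1 + 1) x * Duflo.expSeq K (fun i => f i x) p.2)) fun p hp => ?_).smul _).congr
        (g := fun x => _) rfl fun x => ?_
      · rw [mem_anti] at hp
        exact (((h (p.1 + 1)).mul (ih p.2 (by omega))).smul _).congr (by omega) fun x => rfl
      · rw [h1]; simp

/-- The sum of a sequence of operators lowering the degree by `0, 1, 2, …`. -/
def serOp (B : ℕ → End K (𝒮 K V)) (h : ∀ i, ∃ f, SymOp (B i) i f) :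
    End K (𝒮 K V) :=
  lsum B (locFin_of_dp _ fun x n i hi => by obtain ⟨f, hf⟩ := h i; exact hf.low x n hi)

lemma serOp_dp {B : ℕ → End K (𝒮 K V)} {s : ℕ → V → K}
    (hs : ∀ i, SymOp (B i) i (s i)) (h : ∀ i, ∃ f, SymOp (B i) i f) (x : V) (n : ℕ) :
    serOp B h (dp x n) = ∑ p ∈ antidiagonal n, s p.1 x • dp x p.2 := by
  rw [serOp, lsum_eq_sum (N := n + 1) (hN := fun i hi => (hs i).low x n hi),
    sum_anti_range]
  refine sum_congr rfl fun i hi => ?_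
  rw [mem_range] at hi
  have := (hs i).high x (n - i)
  rwa [show n - i + i = n by omega] at this

lemma lsum_comp_comm {M M' : Type} [AddCommGroup M] [Module K M] [AddCommGroup M'] [Module K M']
    (f : ℕ → M →ₗ[K] M) (h) (f' : ℕ → M' →ₗ[K] M') (h') (φ : M →ₗ[K] M')
    (hc : ∀ i P, φ (f i P) = f' i (φ P)) (P : M) : φ (lsum f h P) = lsum f' h' (φ P) := by
  obtain ⟨N, hN⟩ := h P
  rw [lsum_eq_sum f h hN, lsum_eq_sum f' h' (N := N) (fun i hi => by rw [← hc, hN i hi, map_zero]),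
    map_sum]
  simp [hc]

lemma serOp_comm {B : ℕ → End K (𝒮 K V)} (h : ∀ i, ∃ f, SymOp (B i) i f)
    (φ : End K (𝒮 K V)) (hc : ∀ i, Commute φ (B i))
    (P : 𝒮 K V) : φ (serOp B h P) = serOp B h (φ P) :=
  lsum_comp_comm _ _ _ _ _ (fun i P => dcongr_fun (hc i).eq P) P

lemma expSeq_commute {R : Type} [Ring R] [Algebra K R] (A : ℕ → R) (X : R)
    (h : ∀ i, Commute X (A i)) (n : ℕ) : Commute X (expSeq K A n) := by
  induction n using strong_induction_on with
  | _ n ih =>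
    cases n with
    | zero => simp
    | succ n =>
      rw [expSeq]
      refine Commute.smul_right (Commute.sum_right _ _ _ fun i _ => Commute.smul_right ?_ _) _
      exact (h _).mul_right (ih _ (by omega))

lemma sum_coord_map {M : Type*} [AddCommGroup M] [Module K M] {κ : Type*} [Fintype κ]
    (b : Basis κ K V) (F : V →ₗ[K] M) (x : V) : ∑ k, b.coord k x • F (b k) = F x := by
  conv_rhs => rw [← b.sum_repr x, map_sum]
  exact sum_congr rfl fun k _ => (map_smul F _ _).symm

variable [FiniteDimensional K V] {E : Type} [AddCommGroup E] [Module K E]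

/-- Auxiliary operator with symbol `x ↦ tr (T ∘ ρ x ^ i)`. -/
def trOpAux (ρ : V →ₗ[K] End K E) : ℕ → End K E → End K (𝒮 K V)
  | 0, T => trace K E T • 1
  | i + 1, T => ∑ k, pdL ((finBasis K V).coord k) *
      trOpAux ρ i (T * ρ (finBasis K V k))

lemma trOpAux_add (ρ : V →ₗ[K] End K E) (i : ℕ) (T T' : End K E) :
    trOpAux ρ i (T + T') = trOpAux ρ i T + trOpAux ρ i T' := by
  induction i generalizing T T' with
  | zero => simp [trOpAux, add_smul]
  | succ i ih => simp [trOpAux, add_mul, mul_add, ih, sum_add_distrib]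

lemma trOpAux_smul (ρ : V →ₗ[K] End K E) (i : ℕ) (a : K) (T : End K E) :
    trOpAux ρ i (a • T) = a • trOpAux ρ i T := by
  induction i generalizing T with
  | zero => simp [trOpAux, smul_smul]
  | succ i ih => simp [trOpAux, ih, smul_sum]

/-- `trOpAux` as a linear map. -/
def trOpL (ρ : V →ₗ[K] End K E) (i : ℕ) :
    End K E →ₗ[K] End K (𝒮 K V) where
  toFun := trOpAux ρ i
  map_add' := trOpAux_add ρ i
  map_smul' := trOpAux_smul ρ i

lemma symOp_trOpL (ρ : V →ₗ[K] End K E) (i : ℕ) (T : End K E) :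
    SymOp (trOpL ρ i T) i (fun x => trace K E (T * ρ x ^ i)) := by
  change SymOp (trOpAux ρ i T) _ _
  induction i generalizing T with
  | zero => exact (SymOp.one.smul _).congr rfl fun x => by simp
  | succ i ih =>
    refine (SymOp.sum _ fun k _ =>
      ((symOp_pd ((finBasis K V).coord k)).mul (ih (T * ρ (finBasis K V k)))).congr
        (add_comm _ _) fun x => rfl).congr rfl fun x => ?_
    rw [Finset.sum_apply]
    simp only [Pi.mul_apply]
    have := sum_coord_map (finBasis K V) (trace K E ∘ₗ
      mulRight K (ρ x ^ i) ∘ₗ mulLeft K T ∘ₗ ρ) x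
    simp only [comp_apply, mulRight_apply, mulLeft_apply,
      smul_eq_mul] at this
    rw [this, pow_succ', mul_assoc]

/-- The constant-coefficient operator with symbol `x ↦ tr (ρ x ^ i)`. -/
def trOp (ρ : V →ₗ[K] End K E) (i : ℕ) : End K (𝒮 K V) := trOpL ρ i 1

lemma symOp_trOp (ρ : V →ₗ[K] End K E) (i : ℕ) :
    SymOp (trOp ρ i) i (fun x => trace K E (ρ x ^ i)) :=
  (symOp_trOpL ρ i 1).congr rfl fun x => by simp

lemma trOpAux_commute_mul (ρ : V →ₗ[K] End K E) (v : V) (hv : ρ v = 0) (i : ℕ)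
    (T : End K E) : Commute (mulLeft K (ι K V v)) (trOpAux ρ i T) := by
  induction i generalizing T with
  | zero => exact (Commute.one_right _).smul_right _
  | succ i ih =>
    rw [commute_iff_eq]
    apply lext
    intro P
    simp only [trOpAux, mul_apply, lsum_apply, mulLeft_apply,
      mul_sum]
    have h1 : ∀ T P, trOpAux ρ i T (ι K V v * P) = ι K V v * trOpAux ρ i T P := fun T P =>
      (dcongr_fun (ih T).eq P).symm
    simp only [h1, pdL_apply, pd_ι_mul, sum_add_distrib]
    rw [left_eq_add]
    simp only [← lsmul_apply, ← lsum_apply, ← trOpAux_smul]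
    change (∑ k, trOpL ρ i _) P = 0
    rw [← map_sum]
    simp only [← mul_smul_comm, ← mul_sum]
    rw [sum_coord_map _ ρ, hv]
    simp

lemma der_pd_comm (δ : V →ₗ[K] V) (ξ : V →ₗ[K] K) (P : 𝒮 K V) :
    der (ι K V ∘ₗ δ) (pd ξ P) = pd ξ (der (ι K V ∘ₗ δ) P) - pd (ξ ∘ₗ δ) P := by
  have : pd (ξ ∘ₗ δ) = ⁅pd ξ, der (ι K V ∘ₗ δ)⁆ := by
    apply der_ext
    intro x
    simp [Derivation.commutator_apply]
  rw [this, Derivation.commutator_apply]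
  abel

lemma sum_pd_comp {M : Type} [AddCommGroup M] [Module K M] {κ : Type*} [Fintype κ]
    (b : Basis κ K V) (δ : V →ₗ[K] V)
    (F : V →ₗ[K] (𝒮 K V →ₗ[K] M)) (P : 𝒮 K V) :
    ∑ k, F (b k) (pd (b.coord k ∘ₗ δ) P) = ∑ k, F (δ (b k)) (pd (b.coord k) P) := by
  have h1 : ∀ k, b.coord k ∘ₗ δ = ∑ l, (b.coord k (δ (b l))) • b.coord l := by
    intro k
    apply b.ext
    intro l
    classical
    simp [Finsupp.single_apply]
  have h2 : ∀ l, δ (b l) = ∑ k, b.coord k (δ (b l)) • b k := fun l => (b.sum_repr _).symm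
  simp only [h1, pd_sum, pd_smul, map_sum, map_smul]
  rw [sum_comm]
  refine sum_congr rfl fun l _ => ?_
  conv_rhs => rw [h2 l]
  simp only [map_sum, map_smul, lsum_apply, lsmul_apply]

lemma trOpAux_der (ρ : V →ₗ[K] End K E) (δ : V →ₗ[K] V) (Y : End K E)
    (hY : ∀ x, ρ (δ x) = Y * ρ x - ρ x * Y) (i : ℕ) (T : End K E)
    (P : 𝒮 K V) :
    der (ι K V ∘ₗ δ) (trOpAux ρ i T P)
      = trOpAux ρ i T (der (ι K V ∘ₗ δ) P) + trOpAux ρ i (Y * T - T * Y) P := by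
  induction i generalizing T P with
  | zero =>
    simp [trOpAux, LinearMap.trace_mul_comm K Y T]
  | succ i ih =>
    have hcomm : ∀ ξ T P, pd ξ (trOpAux ρ i T P) = trOpAux ρ i T (pd ξ P) := by
      intro ξ T P
      have h1 := (symOp_pd ξ).mul (symOp_trOpL ρ i T)
      have h2 := (symOp_trOpL ρ i T).mul (symOp_pd ξ)
      have := h1.ext (h2.congr (add_comm _ _) fun x => mul_comm _ _)
      exact dcongr_fun this P
    simp only [trOpAux, lsum_apply, mul_apply, pdL_apply, map_sum]
    simp only [der_pd_comm, ih, hcomm, map_sub, sum_sub_distrib, sum_add_distrib]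
    have key := sum_pd_comp (finBasis K V) δ
      (F := (trOpL ρ i) ∘ₗ (mulLeft K T) ∘ₗ ρ) P
    simp only [comp_apply, mulLeft_apply] at key
    have key' : ∀ S P, trOpL ρ i S P = trOpAux ρ i S P := fun _ _ => rfl
    simp only [key'] at key
    rw [key, sub_add, sub_eq_add_neg, ← sum_sub_distrib, ← sum_neg_distrib]
    congr 1
    refine sum_congr rfl fun k _ => ?_
    rw [← key', ← key', ← key', show (Y * T - T * Y) * ρ (finBasis K V k)
      = (Y * (T * ρ (finBasis K V k)) - T * ρ (finBasis K V k) * Y)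
        - T * ρ (δ (finBasis K V k)) by rw [hY]; noncomm_ring]
    simp only [map_sub, lsub_apply]
    abel

end SymOp

section JOp

variable {K : Type} [Field K] [CharZero K] {V : Type} [AddCommGroup V] [Module K V]
  [FiniteDimensional K V] {E : Type} [AddCommGroup E] [Module K E]

/-- The operator with symbol `exp (∑ w i * tr (ρ x ^ i))`. -/
def jop (w : ℕ → K) (ρ : V →ₗ[K] End K E) : End K (𝒮 K V) :=
  serOp (expSeq K fun i => w i • trOp ρ i) fun i =>
    ⟨_, SymOp.expSeq (fun i => (symOp_trOp ρ i).smul (w i)) i⟩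

/-- The coefficients of the symbol of `jop`. -/
def jsym (w : ℕ → K) (ρ : V →ₗ[K] End K E) (x : V) (n : ℕ) : K :=
  expSeq K (fun i => w i * trace K E (ρ x ^ i)) n

lemma jop_dp (w : ℕ → K) (ρ : V →ₗ[K] End K E) (x : V) (n : ℕ) :
    jop w ρ (dp x n) = ∑ p ∈ antidiagonal n, jsym w ρ x p.1 • dp x p.2 :=
  serOp_dp (s := fun n x => jsym w ρ x n)
    (SymOp.expSeq (fun i => (symOp_trOp ρ i).smul (w i))) _ x n

lemma jop_commute_mul (w : ℕ → K) (ρ : V →ₗ[K] End K E) (v : V) (hv : ρ v = 0)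
    (P : 𝒮 K V) : jop w ρ (ι K V v * P) = ι K V v * jop w ρ P :=
  (serOp_comm _ (mulLeft K (ι K V v)) (expSeq_commute _ _
    fun i => (trOpAux_commute_mul ρ v hv i 1).smul_right _) P).symm

lemma jop_der (w : ℕ → K) (ρ : V →ₗ[K] End K E) (δ : V →ₗ[K] V) (Y : End K E)
    (hY : ∀ x, ρ (δ x) = Y * ρ x - ρ x * Y) (P : 𝒮 K V) :
    der (ι K V ∘ₗ δ) (jop w ρ P) = jop w ρ (der (ι K V ∘ₗ δ) P) := by
  refine serOp_comm _ (der (ι K V ∘ₗ δ)).toLinearMap (expSeq_commute _ _ fun i =>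
    Commute.smul_right (lext fun P => ?_) _) P
  have := trOpAux_der ρ δ Y hY i 1 P
  simp only [mul_one, one_mul, sub_self] at this
  change _ = _ + trOpL ρ i 0 P at this
  rw [map_zero, lzero_apply, add_zero] at this
  exact this

lemma jop_smap {V' : Type} [AddCommGroup V'] [Module K V'] [FiniteDimensional K V']
    {E' : Type} [AddCommGroup E'] [Module K E'] (w w' : ℕ → K) (ρ : V →ₗ[K] End K E)
    (ρ' : V' →ₗ[K] End K E') (f : V →ₗ[K] V')
    (h : ∀ x i, 1 ≤ i → w i * trace K E (ρ x ^ i)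
      = w' i * trace K E' (ρ' (f x) ^ i))
    (P : 𝒮 K V) : smap f (jop w ρ P) = jop w' ρ' (smap f P) := by
  have : (smap f).toLinearMap ∘ₗ jop w ρ = jop w' ρ' ∘ₗ (smap f).toLinearMap := by
    apply ext_dp
    intro x n
    simp only [comp_apply, AlgHom.toLinearMap_apply, smap_dp, jop_dp, map_sum, map_smul]
    refine sum_congr rfl fun p _ => ?_
    congr 1
    exact expSeq_congr K _ fun i h1 _ => h x i h1
  exact dcongr_fun this P

lemma jop_jop_dp {E' : Type} [AddCommGroup E'] [Module K E'] (w w' : ℕ → K)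
    (ρ : V →ₗ[K] End K E) (ρ' : V →ₗ[K] End K E') (x : V) (n : ℕ) :
    jop w ρ (jop w' ρ' (dp x n)) = ∑ r ∈ antidiagonal n, expSeq K (fun i =>
      w i * trace K E (ρ x ^ i) + w' i * trace K E' (ρ' x ^ i)) r.1 • dp x r.2 := by
  have h2 : ∀ n, expSeq K (fun i => w i * trace K E (ρ x ^ i)
      + w' i * trace K E' (ρ' x ^ i)) n
      = ∑ p ∈ antidiagonal n, jsym w ρ x p.1 * jsym w' ρ' x p.2 := fun n => expSeq_add _ _ n
  simp only [jop_dp, map_sum, map_smul, h2, smul_sum, sum_smul, smul_smul]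
  rw [sum_sigma', sum_sigma']
  refine sum_bij' (fun s _ => ⟨(s.1.1 + s.2.1, s.2.2), (s.2.1, s.1.1)⟩)
    (fun s _ => ⟨(s.2.2, s.2.1 + s.1.2), (s.2.1, s.1.2)⟩) ?_ ?_ ?_ ?_ ?_
  on_goal 5 => rintro ⟨⟨a, b⟩, ⟨c, d⟩⟩ h; simp [mul_comm]
  all_goals rintro ⟨⟨a, b⟩, ⟨c, d⟩⟩ h; simp at h ⊢; omega

lemma jop_jop {E' E'' : Type} [AddCommGroup E'] [Module K E'] [AddCommGroup E''] [Module K E'']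
    (w w' w'' : ℕ → K) (ρ : V →ₗ[K] End K E)
    (ρ' : V →ₗ[K] End K E') (ρ'' : V →ₗ[K] End K E'')
    (h : ∀ x i, 1 ≤ i → w i * trace K E (ρ x ^ i) + w' i * trace K E' (ρ' x ^ i)
      = w'' i * trace K E'' (ρ'' x ^ i))
    (P : 𝒮 K V) : jop w ρ (jop w' ρ' P) = jop w'' ρ'' P := by
  have : jop w ρ ∘ₗ jop w' ρ' = jop w'' ρ'' := by
    apply ext_dp
    intro x n
    rw [comp_apply, jop_jop_dp, jop_dp]
    exact sum_congr rfl fun r _ => congrArg (· • _) (expSeq_congr K _ fun i h1 _ => h x i h1)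
  exact dcongr_fun this P

lemma jop_zero (ρ : V →ₗ[K] End K E) (P : 𝒮 K V) : jop 0 ρ P = P := by
  have : jop 0 ρ = LinearMap.id := by
    apply ext_dp
    intro x n
    have h0 : ∀ n, jsym (0 : ℕ → K) ρ x n = if n = 0 then 1 else 0 := by
      intro n
      symm
      refine eq_expSeq K _ (fun n => if n = 0 then (1 : K) else 0) (by simp) (fun n => ?_) n
      simp
    rw [jop_dp, sum_eq_single (0, n)]
    · simp [h0]
    · rintro ⟨a, b⟩ h hne
      simp at h
      rw [h0, if_neg, zero_smul]
      rintro rfl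
      exact hne (by simp at h; simp [h])
    · simp
  rw [this]; rfl

lemma jop_neg_cancel (w : ℕ → K) (ρ : V →ₗ[K] End K E) (P : 𝒮 K V) :
    jop w ρ (jop (-w) ρ P) = P := by
  rw [jop_jop w (-w) 0 ρ ρ ρ (fun x i _ => by simp), jop_zero]

lemma jop_neg_cancel' (w : ℕ → K) (ρ : V →ₗ[K] End K E) (P : 𝒮 K V) :
    jop (-w) ρ (jop w ρ P) = P := by
  rw [jop_jop (-w) w 0 ρ ρ ρ (fun x i _ => by simp), jop_zero]

end JOp

end

section

section Numerics

variable (K : Type) [Field K] [CharZero K]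

/-- The coefficients of the formal logarithm of the series with coefficients `s`. -/
def logSeq (s : ℕ → K) : ℕ → K
  | 0 => 0
  | n + 1 => s (n + 1) - ((n + 1 : ℕ) : K)⁻¹ *
      ∑ i : Fin n, ((i + 1 : ℕ) : K) * (logSeq s (i + 1) * s (n - i))

lemma eq_expSeq_logSeq (s : ℕ → K) (h0 : s 0 = 1) (n : ℕ) : s n = expSeq K (logSeq K s) n := by
  refine eq_expSeq K _ _ h0 (fun n => ?_) n
  have hn : ((n + 1 : ℕ) : K) ≠ 0 := by exact_mod_cast n.succ_ne_zero
  simp only [smul_eq_mul]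
  rw [sum_anti_range, sum_range_succ,
    logSeq, Nat.sub_self, h0, mul_one, mul_sub, mul_inv_cancel_left₀ hn,
    ← Fin.sum_univ_eq_sum_range (fun i => ((i + 1 : ℕ) : K) * (logSeq K s (i + 1) * s (n - i)))]
  ring

lemma expSeq_injective {A B : ℕ → K} (h : ∀ n, expSeq K A n = expSeq K B n) (i : ℕ) :
    A (i + 1) = B (i + 1) := by
  induction i using strong_induction_on with
  | _ n ih =>
    have h1 := expSeq_succ K A n
    rw [h, expSeq_succ K B n, sum_anti_range,
      sum_anti_range, sum_range_succ,
      sum_range_succ, sum_congr rfl fun i hi => by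
        rw [← ih i (mem_range.1 hi), ← h]] at h1
    have hn : ((n + 1 : ℕ) : K) ≠ 0 := by exact_mod_cast n.succ_ne_zero
    have h2 := add_left_cancel h1
    simp only [Nat.sub_self, expSeq_zero, mul_one, smul_eq_mul] at h2
    exact (mul_left_cancel₀ hn h2).symm

/-- Coefficients of `sinh (z / 2) / (z / 2)`. -/
def shC (n : ℕ) : K := if n % 2 = 0 then ((4 ^ (n / 2) * (n + 1).factorial : K))⁻¹ else 0

/-- Coefficients of `(exp z - 1) / z`. -/
def phC (n : ℕ) : K := (((n + 1).factorial : ℕ) : K)⁻¹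

/-- Coefficients of `(exp z - 1 - z) / z ^ 2`. -/
def chC (n : ℕ) : K := (((n + 2).factorial : ℕ) : K)⁻¹

/-- Coefficients of `log (sinh (z / 2) / (z / 2))`. -/
def hC : ℕ → K := logSeq K (shC K)

/-- Coefficients of `log ((exp z - 1) / z)`. -/
def gC (n : ℕ) : K := hC K n + if n = 1 then 2⁻¹ else 0

/-- Coefficients of `1 - (log ((exp z - 1) / z))'`. -/
def thC (n : ℕ) : K := (if n = 0 then 1 else 0) - ((n + 1 : ℕ) : K) * gC K (n + 1)

lemma shC_eq (n : ℕ) : shC K n = expSeq K (hC K) n :=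
  eq_expSeq_logSeq K _ (by simp [shC]) n

lemma hC_odd (n : ℕ) (hn : n % 2 = 1) : hC K n = 0 := by
  have h : ∀ n, expSeq K (hC K) n = expSeq K (fun i => (-1 : K) ^ i • hC K i) n := by
    intro n
    rw [expSeq_scale, ← shC_eq, shC]
    split_ifs with h
    · rw [(Nat.even_iff.2 h).neg_one_pow, one_smul]
    · simp
  obtain ⟨i, rfl⟩ : ∃ i, n = i + 1 := ⟨n - 1, by omega⟩
  have := expSeq_injective K h i
  rw [(Nat.odd_iff.2 hn).neg_one_pow, neg_smul, one_smul] at this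
  exact self_eq_neg.1 this

open PowerSeries in
lemma phC_eq (n : ℕ) : phC K n = expSeq K (gC K) n := by
  have key : (PowerSeries.mk (shC K)) * rescale (2⁻¹ : K) (exp K) = PowerSeries.mk (phC K) := by
    have hX : (X : PowerSeries K) ≠ 0 := X_ne_zero
    apply mul_left_cancel₀ hX
    have h1 : X * PowerSeries.mk (shC K) = rescale (2⁻¹ : K) (exp K) - rescale (-2⁻¹ : K) (exp K) := by
      ext n
      cases n with
      | zero => rw [map_sub, coeff_rescale, coeff_rescale]; simp
      | succ n =>
        rw [coeff_succ_X_mul, coeff_mk, map_sub, coeff_rescale, coeff_rescale, coeff_exp, shC]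
        have h3 : ((n + 1).factorial : K) ≠ 0 := by exact_mod_cast (n + 1).factorial_ne_zero
        split_ifs with h
        · have h2 : (n / 2) * 2 = n := by omega
          rw [show (-2⁻¹ : K) = (-1) * 2⁻¹ by ring, mul_pow,
            (Nat.odd_iff.2 (show (n + 1) % 2 = 1 by omega)).neg_one_pow,
            show (4 : K) ^ (n / 2) = 2 ^ n by rw [show (4 : K) = 2 ^ 2 by norm_num, ← pow_mul,
              mul_comm, h2]]
          push_cast
          field_simp
          simp; field_simp; ring
        · rw [show (-2⁻¹ : K) = (-1) * 2⁻¹ by ring, mul_pow,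
            (Nat.even_iff.2 (show (n + 1) % 2 = 0 by omega)).neg_one_pow]
          ring
    have h2 : X * PowerSeries.mk (phC K) = exp K - 1 := by
      ext n
      cases n with
      | zero => simp
      | succ n => rw [coeff_succ_X_mul, coeff_mk, map_sub, coeff_exp, coeff_one]; simp [phC]
    rw [← mul_assoc, h1, h2, sub_mul, exp_mul_exp_eq_exp_add, exp_mul_exp_eq_exp_add,
      show (2⁻¹ : K) + 2⁻¹ = 1 by norm_num, neg_add_cancel]
    simp
  have h4 : ∀ n, coeff n (rescale (2⁻¹ : K) (exp K))
      = expSeq K (fun i => if i = 1 then (2⁻¹ : K) else 0) n := by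
    refine eq_expSeq K _ _ (by simp) fun n => ?_
    rw [sum_eq_single (0, n)]
    · have hn : ((n + 1 : ℕ) : K) ≠ 0 := by exact_mod_cast n.succ_ne_zero
      simp only [coeff_rescale, coeff_exp, Nat.factorial_succ, smul_eq_mul]
      simp only [map_div₀, map_one, map_natCast, Nat.cast_mul]
      have h3 : (n.factorial : K) ≠ 0 := by exact_mod_cast n.factorial_ne_zero
      push_cast at hn ⊢
      field_simp
      simp; ring
    · rintro ⟨a, b⟩ h hne
      rw [mem_anti] at h
      rw [if_neg, zero_mul, smul_zero]
      rintro h'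
      simp at h h'
      exact hne (by simp [h'] at h ⊢; exact h)
    · simp
  have h5 := congrArg (coeff n) key
  rw [coeff_mk, coeff_mul] at h5
  rw [← h5, show gC K = fun n => hC K n + (fun i => if i = 1 then (2⁻¹ : K) else 0) n from rfl,
    expSeq_add]
  refine sum_congr rfl fun p _ => ?_
  rw [h4, coeff_mk, shC_eq]

lemma phC_zero : phC K 0 = 1 := by simp [phC]

lemma gC_of_two_le (n : ℕ) (hn : 2 ≤ n) : gC K n = hC K n := by simp [gC]; omega

lemma thC_succ (n : ℕ) : thC K (n + 1) = -(((n + 2 : ℕ) : K) * hC K (n + 2)) := by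
  rw [thC, gC_of_two_le K _ (by omega), if_neg n.succ_ne_zero, zero_sub]

lemma phC_thC (n : ℕ) : ∑ p ∈ antidiagonal n, thC K p.1 * phC K p.2 = chC K n := by
  simp only [thC, sub_mul, sum_sub_distrib]
  have h1 := expSeq_succ K (gC K) n
  simp only [← phC_eq, smul_eq_mul, ← mul_assoc] at h1
  rw [← h1, sum_eq_single (0, n)]
  · have hn : ((n + 1 : ℕ) : K) ≠ 0 := by exact_mod_cast n.succ_ne_zero
    have hn' : ((n + 2 : ℕ) : K) ≠ 0 := by exact_mod_cast (n + 1).succ_ne_zero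
    have h3 : (n.factorial : K) ≠ 0 := by exact_mod_cast n.factorial_ne_zero
    simp only [phC, chC, Nat.factorial_succ]
    have hn'' : (n : K) + 1 + 1 ≠ 0 := by rw [add_assoc, one_add_one_eq_two]; exact_mod_cast hn'
    push_cast at *
    simp only [one_mul]
    field_simp
    ring
  · rintro ⟨a, b⟩ h hne
    rw [mem_anti] at h
    rw [if_neg, zero_mul]
    rintro h'
    simp at h h'
    exact hne (by simp [h'] at h ⊢; exact h)
  · simp

end Numerics

end

section

/-- The data of a Fock module `F` over `V`, of a family of elements `e` of an algebra `A`
satisfying (super)commutation relations, and of a compatible sequence of quantization maps. -/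
structure GaussData (K V F A : Type) [Field K] [AddCommGroup V] [Module K V]
    [FiniteDimensional K V] [AddCommGroup F] [Module K F] [Ring A] [Algebra K A] where
  ε : K
  m : V →ₗ[K] End K F
  p : (V →ₗ[K] K) →ₗ[K] End K F
  vac : F
  e : V →ₗ[K] A
  B : V →ₗ[K] V →ₗ[K] K
  X : A
  a : End K V
  q : ℕ → F →ₗ[K] A
  κ : Type
  fin : Fintype κ
  u : κ → V
  v : κ → V
  ε_mul : ε * ε = 1
  p_m : ∀ ξ w f, p ξ (m w f) = ε • m w (p ξ f) + ξ w • f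
  m_m : ∀ w w' f, m w (m w' f) = ε • m w' (m w f)
  p_p : ∀ ξ ξ' f, p ξ (p ξ' f) = ε • p ξ' (p ξ f)
  p_vac : ∀ ξ, p ξ vac = 0
  e_e : ∀ w w', e w * e w' - ε • (e w' * e w) = algebraMap K A (B w w')
  X_e : ∀ w, X * e w - e w * X = e (a w)
  q_vac : q 0 vac = 1
  q_zero : ∀ f, q 0 (∑ k, m (finBasis K V k) (p ((finBasis K V).coord k) f))
    = ∑ k, e (finBasis K V k) * q 0 (p ((finBasis K V).coord k) f)
  q_succ : ∀ n f, ((n + 1 : ℕ) : K) • q (n + 1) f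
      + q (n + 1) (∑ k, m (finBasis K V k) (p ((finBasis K V).coord k) f))
    = X * q n f + ∑ k, e (finBasis K V k) * q (n + 1) (p ((finBasis K V).coord k) f)
  B_swap : ∀ w w', B w' w = -ε * B w w'
  sum_u : ∀ w, ∑ k, B w (u k) • v k = -a w
  sum_v : ∀ w, ∑ k, (ε * B w (v k)) • u k = -a w

namespace GaussData

variable {K V F A : Type} [Field K] [CharZero K] [AddCommGroup V] [Module K V]
    [FiniteDimensional K V] [AddCommGroup F] [Module K F] [Ring A] [Algebra K A]
    (d : GaussData K V F A)

instance : Fintype d.κ := d.fin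

/-- The number operator. -/
def E : End K F :=
  ∑ k, d.m (finBasis K V k) * d.p ((finBasis K V).coord k)

lemma E_apply (f : F) : d.E f
    = ∑ k, d.m (finBasis K V k) (d.p ((finBasis K V).coord k) f) := by
  simp [E]

/-- The operator `X ·` shifted by one step. -/
def prev : ℕ → F → A
  | 0, _ => 0
  | n + 1, f => d.X * d.q n f

lemma q_rec (n : ℕ) (f : F) : (n : K) • d.q n f + d.q n (d.E f) = d.prev n f
    + ∑ k, d.e (finBasis K V k) * d.q n (d.p ((finBasis K V).coord k) f) := by
  rw [E_apply]
  cases n with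
  | zero => simpa [prev] using d.q_zero f
  | succ n => exact d.q_succ n f

/-- The graded pieces of the Fock module. -/
def gr : ℕ → Submodule K F
  | 0 => span K {d.vac}
  | k + 1 => ⨆ w, (gr k).map (d.m w)

lemma vac_mem : d.vac ∈ d.gr 0 := mem_span_singleton_self _

lemma m_mem {k : ℕ} {f : F} (hf : f ∈ d.gr k) (w : V) : d.m w f ∈ d.gr (k + 1) :=
  mem_iSup_of_mem w (Submodule.mem_map_of_mem hf)

lemma gr_succ_induction {k : ℕ} {P : F → Prop} (h : ∀ w, ∀ f ∈ d.gr k, P (d.m w f)) (h0 : P 0)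
    (ha : ∀ f g, P f → P g → P (f + g)) {f : F} (hf : f ∈ d.gr (k + 1)) : P f := by
  refine Submodule.iSup_induction _ (motive := P) hf ?_ h0 ha
  rintro w _ ⟨g, hg, rfl⟩
  exact h w g hg

lemma p_gr_zero {f : F} (hf : f ∈ d.gr 0) (ξ) : d.p ξ f = 0 := by
  obtain ⟨c, rfl⟩ := mem_span_singleton.1 hf
  rw [map_smul, d.p_vac, smul_zero]

lemma p_mem {k : ℕ} {f : F} (hf : f ∈ d.gr (k + 1)) (ξ) : d.p ξ f ∈ d.gr k := by
  induction k generalizing f with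
  | zero =>
    refine d.gr_succ_induction (P := fun f => d.p ξ f ∈ d.gr 0) (fun w f hf => ?_) (by simp)
      (fun f g hf hg => by rw [map_add]; exact add_mem hf hg) hf
    rw [d.p_m, d.p_gr_zero hf, map_zero, smul_zero, zero_add]
    exact smul_mem _ _ hf
  | succ k ih =>
    refine d.gr_succ_induction (P := fun f => d.p ξ f ∈ d.gr (k + 1)) (fun w f hf => ?_) (by simp)
      (fun f g hf hg => by rw [map_add]; exact add_mem hf hg) hf
    rw [d.p_m]
    exact add_mem (smul_mem _ _ (d.m_mem (ih hf) w)) (smul_mem _ _ hf)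

lemma E_m (w : V) (f : F) : d.E (d.m w f) = d.m w (d.E f) + d.m w f := by
  simp only [E_apply, d.p_m, map_add, map_smul, sum_add_distrib, map_sum]
  congr 1
  · refine sum_congr rfl fun k _ => ?_
    rw [d.m_m, smul_smul, d.ε_mul, one_smul]
  · have := sum_coord_map (finBasis K V) (LinearMap.applyₗ f ∘ₗ d.m) w
    simpa using this

lemma E_gr {k : ℕ} {f : F} (hf : f ∈ d.gr k) : d.E f = (k : K) • f := by
  induction k generalizing f with
  | zero =>
    rw [E_apply, sum_eq_zero fun k _ => by rw [d.p_gr_zero hf, map_zero]]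
    simp
  | succ k ih =>
    refine d.gr_succ_induction (P := fun f => d.E f = ((k + 1 : ℕ) : K) • f) (fun w f hf => ?_)
      (by simp) (fun f g hf hg => by rw [map_add, hf, hg, smul_add]) hf
    rw [E_m, ih hf, map_smul]; push_cast; module

lemma E_p_gr {k : ℕ} {f : F} (hf : f ∈ d.gr k) (ξ) : d.E (d.p ξ f) = ((k : K) - 1) • d.p ξ f := by
  cases k with
  | zero => rw [d.p_gr_zero hf]; simp
  | succ k => rw [d.E_gr (d.p_mem hf ξ)]; push_cast; module

/-- Contraction against `w`. -/
def D (w : V) : End K F := d.p (d.B w)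

/-- The expansion of `q n (m w f)`. -/
def ex (w : V) (n : ℕ) (f : F) : A :=
  ∑ r ∈ antidiagonal n, (phC K r.1 • (d.e ((d.a ^ r.1) w) * d.q r.2 f)
    - chC K r.1 • d.q r.2 (d.D ((d.a ^ r.1) w) f))

lemma phC_succ (s : ℕ) : ((s + 2 : ℕ) : K) * phC K (s + 1) = phC K s := by
  simp only [phC]; exact inv_factorial_succ (s + 1)

lemma chC_eq (s : ℕ) : ((s + 2 : ℕ) : K) * chC K s = phC K s := phC_succ s

lemma X_mul_e (w : V) (y : A) : d.X * (d.e w * y) = d.e w * (d.X * y) + d.e (d.a w) * y := by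
  rw [← d.X_e, sub_mul, mul_assoc, mul_assoc]; abel

lemma e_mul_e (w w' : V) (y : A) :
    d.ε • (d.e w' * (d.e w * y)) = d.e w * (d.e w' * y) - d.B w w' • y := by
  rw [asmul_def (d.B w w'), ← d.e_e, sub_mul, smul_mul_assoc, mul_assoc, mul_assoc]; abel

lemma sum_e_p (ξ : V →ₗ[K] K) (T : F →ₗ[K] A) (f : F) :
    ∑ k, ξ (finBasis K V k) • T (d.p ((finBasis K V).coord k) f) = T (d.p ξ f) := by
  have h : ξ = ∑ k, ξ (finBasis K V k) • (finBasis K V).coord k :=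
    (finBasis K V).ext fun l => by simp
  have h' : T (d.p ξ f) = T (d.p (∑ k, ξ (finBasis K V k) • (finBasis K V).coord k) f) := by
    rw [← h]
  rw [h']
  simp only [map_sum, map_smul, lsum_apply, lsmul_apply]

lemma q_m_step (w : V) (n k : ℕ) {f : F} (hf : f ∈ d.gr k)
    (h1 : ∀ n', n = n' + 1 → d.q n' (d.m w f) = d.ex w n' f)
    (h2 : ∀ ξ, d.q n (d.m w (d.p ξ f)) = d.ex w n (d.p ξ f)) :
    d.q n (d.m w f) = d.ex w n f := by
  have hN : ((n + k + 1 : ℕ) : K) ≠ 0 := by exact_mod_cast (n + k).succ_ne_zero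
  have hrec := d.q_rec n (d.m w f)
  rw [d.E_gr (d.m_mem hf w), map_smul, ← add_smul] at hrec
  have hprev : d.prev n (d.m w f) = ∑ r ∈ antidiagonal n,
      (phC K r.1 • (d.e ((d.a ^ r.1) w) * d.prev r.2 f)
        - chC K r.1 • d.prev r.2 (d.D ((d.a ^ r.1) w) f)
        + (if r.1 = 0 then (0 : K) else phC K (r.1 - 1)) • (d.e ((d.a ^ r.1) w) * d.q r.2 f)) := by
    cases n with
    | zero => simp [prev]
    | succ n =>
      rw [sum_add_distrib, sum_anti_succ',
        sum_anti_succ]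
      simp only [prev, h1 n rfl, ex, mul_sum, mul_sub, mul_smul_comm, X_mul_e, smul_add,
        sum_add_distrib, sum_sub_distrib]
      simp only [pow_succ', mul_apply]
      simp
      abel
  have hsum : ∑ k, d.e (finBasis K V k)
        * d.q n (d.p ((finBasis K V).coord k) (d.m w f))
      = d.e w * d.q n f + ∑ r ∈ antidiagonal n,
      (phC K r.1 • (d.e ((d.a ^ r.1) w) * ∑ k, d.e (finBasis K V k)
          * d.q r.2 (d.p ((finBasis K V).coord k) f))
        - phC K r.1 • d.q r.2 (d.D ((d.a ^ r.1) w) f)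
        - chC K r.1 • ∑ k, d.e (finBasis K V k)
          * d.q r.2 (d.p ((finBasis K V).coord k) (d.D ((d.a ^ r.1) w) f))) := by
    simp only [d.p_m, map_add, map_smul, mul_add, sum_add_distrib, mul_smul_comm]
    rw [add_comm]
    congr 1
    · simp only [← smul_mul_assoc, ← sum_mul]
      rw [sum_coord_map]
    · simp only [h2, ex, mul_sum, smul_sum]
      rw [sum_comm]
      refine sum_congr rfl fun r _ => ?_
      rw [show d.q r.2 (d.D ((d.a ^ r.1) w) f) = _ from
        (d.sum_e_p (d.B ((d.a ^ r.1) w)) (d.q r.2) f).symm, ← smul_sum, ← smul_sum,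
        smul_sum, smul_sum, smul_sum, ← sum_sub_distrib,
        ← sum_sub_distrib]
      refine sum_congr rfl fun l _ => ?_
      rw [mul_sub, smul_sub, mul_smul_comm, mul_smul_comm, smul_comm d.ε, smul_comm d.ε,
        d.e_mul_e, smul_sub]
      congr 2
      rw [D, d.p_p, map_smul, mul_smul_comm, smul_smul, d.ε_mul, one_smul]
  rw [hprev, hsum] at hrec
  have h0 : d.e w * d.q n f = ∑ r ∈ antidiagonal n,
      (if r.1 = 0 then (1 : K) else 0) • (d.e ((d.a ^ r.1) w) * d.q r.2 f) := by
    rw [sum_eq_single (0, n)]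
    · simp
    · rintro ⟨a, b⟩ h hne
      rw [mem_anti] at h
      rw [if_neg, zero_smul]
      rintro h'
      simp at h h'
      exact hne (by simp [h'] at h ⊢; exact h)
    · simp
  rw [h0, ← sum_add_distrib, ← sum_add_distrib] at hrec
  apply smul_right_injective A hN
  change _ • _ = _ • _
  rw [ex, smul_sum]
  refine Eq.trans ?_ (hrec.trans (sum_congr rfl fun r hr => ?_))
  · push_cast; congr 1; ring
  rw [mem_anti] at hr
  have r1 := d.q_rec r.2 f
  have r2 := d.q_rec r.2 (d.D ((d.a ^ r.1) w) f)
  rw [d.E_gr hf, map_smul, ← add_smul] at r1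
  rw [D, d.E_p_gr hf, map_smul, ← add_smul, ← D] at r2
  replace r1 := congrArg (d.e ((d.a ^ r.1) w) * ·) r1
  simp only [mul_smul_comm, mul_add] at r1
  have hn : (n : K) = r.1 + r.2 := by rw [← hr]; push_cast; rfl
  have c1 : ((r.1 : K) + 1) * phC K r.1 = (if r.1 = 0 then (0 : K) else phC K (r.1 - 1))
      + (if r.1 = 0 then (1 : K) else 0) := by
    rcases r.1 with _ | s
    · simp [phC_zero]
    · have := phC_succ (K := K) s
      simp; push_cast at this; rw [← this]; ring
  have c2 := chC_eq (K := K) r.1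
  push_cast at c2 ⊢
  rw [hn]
  linear_combination (norm := module) (-phC K r.1) • r1 + chC K r.1 • r2
    - c1 • (d.e ((d.a ^ r.1) w) * d.q r.2 f) + c2 • (d.q r.2 (d.D ((d.a ^ r.1) w) f))

lemma q_m (w : V) (n k : ℕ) {f : F} (hf : f ∈ d.gr k) : d.q n (d.m w f) = d.ex w n f := by
  induction n generalizing k f with
  | zero =>
    induction k generalizing f with
    | zero =>
      refine d.q_m_step w 0 0 hf (by simp) fun ξ => ?_
      simp [d.p_gr_zero hf, ex]
    | succ k ih => exact d.q_m_step w 0 _ hf (by simp) fun ξ => ih (d.p_mem hf ξ)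
  | succ n ihn =>
    have h1 : ∀ k (f : F), f ∈ d.gr k → ∀ n', n + 1 = n' + 1 → d.q n' (d.m w f) = d.ex w n' f := by
      rintro k f hf n' h
      obtain rfl : n = n' := by omega
      exact ihn k hf
    induction k generalizing f with
    | zero =>
      refine d.q_m_step w _ 0 hf (h1 0 f hf) fun ξ => ?_
      simp [d.p_gr_zero hf, ex]
    | succ k ih => exact d.q_m_step w _ _ hf (h1 _ f hf) fun ξ => ih (d.p_mem hf ξ)

end GaussData

end

section

lemma trace_of_sum {K V κ : Type} [Field K] [AddCommGroup V] [Module K V] [FiniteDimensional K V]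
    [Fintype κ] (T : End K V) (ξ : κ → V →ₗ[K] K) (y : κ → V)
    (h : ∀ w, T w = ∑ k, ξ k w • y k) : trace K V T = ∑ k, ξ k (y k) := by
  have : T = ∑ k, (ξ k).smulRight (y k) := by
    ext w; simp [h]
  rw [this, map_sum]
  simp [LinearMap.trace_smulRight]

lemma expSeq_single_add {K A : Type} [Field K] [CharZero K] [Ring A] [Algebra K A] (X : A)
    (w : ℕ → K) (Ψ : ℕ → A) (h0 : Ψ 0 = 1)
    (h : ∀ n, ((n + 1 : ℕ) : K) • Ψ (n + 1) = X * Ψ n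
      + ∑ r ∈ antidiagonal n, (((r.1 + 1 : ℕ) : K) * w (r.1 + 1)) • Ψ r.2) (n : ℕ) :
    Ψ n = ∑ r ∈ antidiagonal n, expSeq K w r.1 • dvp K X r.2 := by
  let Z : ℕ → Polynomial K := fun i => (if i = 1 then Polynomial.X else 0) + Polynomial.C (w i)
  have h1 : Ψ n = expSeq K (fun i => Polynomial.aeval X (Z i)) n := by
    refine eq_expSeq K _ _ h0 (fun n => ?_) n
    rw [h]
    simp only [Z, map_add, add_mul, smul_add, sum_add_distrib]
    congr 1
    · rw [sum_eq_single (0, n)]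
      · simp
      · rintro ⟨a, b⟩ h hne
        rw [mem_anti] at h
        rw [if_neg, map_zero, zero_mul, smul_zero]
        rintro h'
        simp at h h'
        exact hne (by simp [h'] at h ⊢; exact h)
      · simp
    · refine sum_congr rfl fun r _ => ?_
      rw [Polynomial.aeval_C, ← asmul_def, smul_smul]
  have h2 : ∀ n, expSeq K (fun i => if i = 1 then (Polynomial.X : Polynomial K) else 0) n
      = dvp K Polynomial.X n := by
    intro n
    symm
    refine eq_expSeq K _ _ (by simp) (fun n => ?_) n
    rw [sum_eq_single (0, n), ← mul_dvp]
    · simp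
    · rintro ⟨a, b⟩ h hne
      rw [mem_anti] at h
      rw [if_neg, zero_mul, smul_zero]
      rintro h'
      simp at h h'
      exact hne (by simp [h'] at h ⊢; exact h)
    · simp
  rw [h1, ← map_expSeq, expSeq_add, map_sum, ← Nat.sum_antidiagonal_swap]
  refine sum_congr rfl fun r _ => ?_
  have h3 := map_expSeq K (Algebra.ofId K (Polynomial K)) w r.1
  simp only [Algebra.ofId_apply, Polynomial.algebraMap_eq] at h3
  simp only [Prod.fst_swap, Prod.snd_swap]
  rw [h2, ← h3, map_mul, map_dvp, Polynomial.aeval_X, Polynomial.aeval_C, ← Algebra.commutes,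
    ← asmul_def]

lemma sum_antidiagonal_assoc {M : Type} [AddCommMonoid M] (n : ℕ) (f : ℕ → ℕ → ℕ → M) :
    ∑ r ∈ antidiagonal n, ∑ s ∈ antidiagonal r.1, f s.1 s.2 r.2
      = ∑ r ∈ antidiagonal n, ∑ s ∈ antidiagonal r.2, f r.1 s.1 s.2 := by
  rw [sum_sigma', sum_sigma']
  refine sum_bij' (fun s _ => ⟨(s.2.1, s.2.2 + s.1.2), (s.2.2, s.1.2)⟩)
    (fun s _ => ⟨(s.1.1 + s.2.1, s.2.2), (s.1.1, s.2.1)⟩) ?_ ?_ ?_ ?_ ?_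
  on_goal 5 => rintro ⟨⟨a, b⟩, ⟨c, d⟩⟩ h; rfl
  all_goals rintro ⟨⟨a, b⟩, ⟨c, d⟩⟩ h; simp at h ⊢; omega

namespace GaussData

variable {K V F A : Type} [Field K] [CharZero K] [AddCommGroup V] [Module K V]
    [FiniteDimensional K V] [AddCommGroup F] [Module K F] [Ring A] [Algebra K A]
    (d : GaussData K V F A)

/-- The quadratic element `½ ∑ u k v k` acting on the Fock module. -/
def lam : End K F := (2⁻¹ : K) • ∑ k, d.m (d.u k) * d.m (d.v k)

/-- The divided powers of `-lam` applied to the vacuum. -/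
def G (j : ℕ) : F := dvp K (-d.lam) j d.vac

lemma lam_apply (f : F) : d.lam f = (2⁻¹ : K) • ∑ k, d.m (d.u k) (d.m (d.v k) f) := by
  simp [lam]

lemma G_succ (j : ℕ) : ((j + 1 : ℕ) : K) • d.G (j + 1) = -d.lam (d.G j) := by
  rw [G, ← lsmul_apply, ← mul_dvp]; rfl

lemma lam_gr {k : ℕ} {f : F} (hf : f ∈ d.gr k) : d.lam f ∈ d.gr (k + 2) := by
  rw [lam_apply]
  exact smul_mem _ _ (Submodule.sum_mem _ fun i _ => d.m_mem (d.m_mem hf _) _)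

lemma G_zero : d.G 0 = d.vac := by simp [G]

lemma G_mem (j : ℕ) : d.G j ∈ d.gr (2 * j) := by
  induction j with
  | zero => rw [G_zero]; exact d.vac_mem
  | succ j ih =>
    have hn : ((j + 1 : ℕ) : K) ≠ 0 := by exact_mod_cast j.succ_ne_zero
    have : d.G (j + 1) = ((j + 1 : ℕ) : K)⁻¹ • -d.lam (d.G j) := by
      rw [← G_succ, smul_smul, inv_mul_cancel₀ hn, one_smul]
    rw [this]
    exact smul_mem _ _ (neg_mem (d.lam_gr ih))

/-- The vector dual to `ξ` with respect to the quadratic element. -/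
def dual (ξ : V →ₗ[K] K) : V :=
  (2⁻¹ : K) • ∑ k, ((d.ε * ξ (d.v k)) • d.u k + ξ (d.u k) • d.v k)

lemma p_lam (ξ : V →ₗ[K] K) (f : F) : d.p ξ (d.lam f) = d.lam (d.p ξ f) + d.m (d.dual ξ) f := by
  simp only [lam_apply, dual, map_smul, map_sum, d.p_m, map_add, lsmul_apply,
    lsum_apply, ladd_apply]
  rw [← smul_add, ← sum_add_distrib]
  congr 1
  refine sum_congr rfl fun k _ => ?_
  have := d.ε_mul
  linear_combination (norm := module) this • ((d.m (d.u k)) ((d.m (d.v k)) ((d.p ξ) f)))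

lemma dual_B (w : V) : d.dual (d.B w) = -d.a w := by
  rw [dual, sum_add_distrib, d.sum_u, d.sum_v]
  module

lemma m_lam (w : V) (f : F) : d.m w (d.lam f) = d.lam (d.m w f) := by
  simp only [lam_apply, map_smul, map_sum]
  congr 1
  refine sum_congr rfl fun k _ => ?_
  rw [d.m_m, d.m_m w, map_smul, smul_smul, d.ε_mul, one_smul]

lemma p_G_succ (ξ : V →ₗ[K] K) (j : ℕ) : d.p ξ (d.G (j + 1)) = -d.m (d.dual ξ) (d.G j) := by
  have hn : ∀ j : ℕ, ((j + 1 : ℕ) : K) ≠ 0 := fun j => by exact_mod_cast j.succ_ne_zero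
  induction j with
  | zero =>
    have := congrArg (d.p ξ) (d.G_succ 0)
    rw [G_zero] at this ⊢
    rw [map_smul, map_neg, p_lam, d.p_vac, map_zero] at this
    simpa using this
  | succ j ih =>
    apply smul_right_injective F (hn (j + 1))
    change _ • _ = _ • _
    have h1 := congrArg (d.p ξ) (d.G_succ (j + 1))
    have h2 := congrArg (d.m (d.dual ξ)) (d.G_succ j)
    rw [map_smul, map_neg, p_lam, ih, map_neg, ← m_lam] at h1
    rw [map_smul, map_neg] at h2
    rw [h1]
    push_cast at *
    linear_combination (norm := module) h2

lemma D_G_succ (w : V) (j : ℕ) : d.D w (d.G (j + 1)) = d.m (d.a w) (d.G j) := by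
  rw [D, p_G_succ, dual_B, map_neg, lneg_apply, neg_neg]

lemma D_G_zero (w : V) : d.D w (d.G 0) = 0 := by rw [G_zero, D, d.p_vac]

/-- The quantization of the exponential of `-lam`. -/
def Ψ (n : ℕ) : A := ∑ r ∈ antidiagonal n, d.q r.1 (d.G r.2)

/-- The quantization of the exponential of `-lam` multiplied by an operator. -/
def ΨT (T : End K F) (n : ℕ) : A := ∑ r ∈ antidiagonal n, d.q r.1 (T (d.G r.2))

lemma A1_eq (w : V) (n : ℕ) : d.ΨT (d.m w) n = d.e w * d.Ψ n := by
  induction n using strong_induction_on generalizing w with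
  | _ n ih =>
    have hD : ∀ w n, ∑ r ∈ antidiagonal n, d.q r.1 (d.D w (d.G r.2))
        = match n with
          | 0 => 0
          | n + 1 => d.ΨT (d.m (d.a w)) n := by
      intro w n
      cases n with
      | zero => simp [D_G_zero]
      | succ n =>
        rw [sum_anti_succ', D_G_zero, map_zero, zero_add]
        simp only [D_G_succ]
        rfl
    have h1 : d.ΨT (d.m w) n = ∑ r ∈ antidiagonal n,
        (phC K r.1 • (d.e ((d.a ^ r.1) w) * d.Ψ r.2)
          - chC K r.1 • ∑ s ∈ antidiagonal r.2, d.q s.1 (d.D ((d.a ^ r.1) w) (d.G s.2))) := by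
      simp only [ΨT, d.q_m w _ _ (d.G_mem _), ex]
      rw [sum_antidiagonal_assoc (f := fun a b c => phC K a • (d.e ((d.a ^ a) w) * d.q b (d.G c))
        - chC K a • d.q b (d.D ((d.a ^ a) w) (d.G c)))]
      refine sum_congr rfl fun r _ => ?_
      rw [sum_sub_distrib, ← smul_sum, ← smul_sum, ← mul_sum]
      rfl
    rw [h1, sum_sub_distrib]
    cases n with
    | zero => simp [D_G_zero, phC_zero]
    | succ n =>
      rw [sum_anti_succ, sum_anti_succ'
        (f := fun r : ℕ × ℕ => chC K r.1 • ∑ s ∈ antidiagonal r.2,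
          d.q s.1 (d.D ((d.a ^ r.1) w) (d.G s.2)))]
      simp only [hD, phC_zero, pow_zero, one_smul, smul_zero, zero_add, one_apply]
      rw [add_sub_assoc, ← sum_sub_distrib, sum_eq_zero, add_zero]
      intro r hr
      rw [mem_anti] at hr
      rw [ih r.2 (by omega), ← mul_apply, ← pow_succ', sub_eq_zero]
      rfl

lemma A2_eq (v w : V) (n : ℕ) : d.ΨT (d.m v * d.m w) n = d.e v * (d.e w * d.Ψ n)
    - ∑ r ∈ antidiagonal n, (thC K r.1 * d.B ((d.a ^ r.1) v) w) • d.Ψ r.2 := by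
  induction n using strong_induction_on generalizing v with
  | _ n ih =>
    have hD : ∀ v n, ∑ r ∈ antidiagonal n, d.q r.1 (d.D v (d.m w (d.G r.2)))
        = (match n with
          | 0 => 0
          | n + 1 => d.ΨT (d.m (d.a v) * d.m w) n) + d.B v w • d.Ψ n := by
      intro v n
      have h1 : ∀ f, d.D v (d.m w f) = d.ε • d.m w (d.D v f) + d.B v w • f := fun f => d.p_m _ _ _
      simp only [h1, map_add, sum_add_distrib, map_smul, ← smul_sum]
      congr 1
      cases n with
      | zero => simp [D_G_zero]
      | succ n =>
        rw [sum_anti_succ', D_G_zero, map_zero, map_zero, zero_add,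
          smul_sum]
        simp only [D_G_succ, ΨT, mul_apply]
        refine sum_congr rfl fun r _ => ?_
        rw [d.m_m (d.a v), map_smul]
    have h1 : d.ΨT (d.m v * d.m w) n = ∑ r ∈ antidiagonal n,
        (phC K r.1 • (d.e ((d.a ^ r.1) v) * d.ΨT (d.m w) r.2)
          - chC K r.1 • ∑ s ∈ antidiagonal r.2, d.q s.1 (d.D ((d.a ^ r.1) v) (d.m w (d.G s.2)))) := by
      simp only [ΨT, mul_apply, d.q_m v _ _ (d.m_mem (d.G_mem _) w), ex]
      rw [sum_antidiagonal_assoc (f := fun a b c =>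
        phC K a • (d.e ((d.a ^ a) v) * d.q b (d.m w (d.G c)))
        - chC K a • d.q b (d.D ((d.a ^ a) v) (d.m w (d.G c))))]
      refine sum_congr rfl fun r _ => ?_
      rw [sum_sub_distrib, ← smul_sum, ← smul_sum, ← mul_sum]
    have h2 : ∑ r ∈ antidiagonal n, (thC K r.1 * d.B ((d.a ^ r.1) v) w) • d.Ψ r.2
        = ∑ r ∈ antidiagonal n, (chC K r.1 * d.B ((d.a ^ r.1) v) w) • d.Ψ r.2
        - (match n with
          | 0 => 0
          | n + 1 => ∑ r ∈ antidiagonal n, chC K r.1 • ∑ s ∈ antidiagonal r.2,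
            (thC K s.1 * d.B ((d.a ^ s.1) ((d.a ^ (r.1 + 1)) v)) w) • d.Ψ s.2) := by
      cases n with
      | zero =>
        have := phC_thC K 0
        simp [phC_zero] at this
        simp [this]
      | succ n =>
        have h3 : ∀ r : ℕ × ℕ, chC K r.1 • ∑ s ∈ antidiagonal r.2,
            (thC K s.1 * d.B ((d.a ^ s.1) ((d.a ^ (r.1 + 1)) v)) w) • d.Ψ s.2
            = ∑ s ∈ antidiagonal r.2, (phC K (r.1 + 1) * thC K s.1
              * d.B ((d.a ^ (r.1 + 1 + s.1)) v) w) • d.Ψ s.2 := by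
          intro r
          rw [smul_sum]
          refine sum_congr rfl fun s _ => ?_
          rw [smul_smul, ← mul_apply, ← pow_add, add_comm s.1, mul_assoc]
          rfl
        simp only [h3]
        have h4 : ∑ r ∈ antidiagonal (n + 1), ∑ s ∈ antidiagonal r.2, (phC K r.1 * thC K s.1
              * d.B ((d.a ^ (r.1 + s.1)) v) w) • d.Ψ s.2
            = ∑ r ∈ antidiagonal (n + 1), (chC K r.1 * d.B ((d.a ^ r.1) v) w) • d.Ψ r.2 := by
          rw [← sum_antidiagonal_assoc (f := fun a b c => (phC K a * thC K b
              * d.B ((d.a ^ (a + b)) v) w) • d.Ψ c)]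
          refine sum_congr rfl fun r _ => ?_
          rw [← phC_thC, ← Nat.sum_antidiagonal_swap, sum_mul, sum_smul]
          refine sum_congr rfl fun s hs => ?_
          rw [mem_anti] at hs
          rw [Prod.fst_swap, Prod.snd_swap, mul_comm (phC K _), add_comm s.2, hs]
        rw [← h4, sum_anti_succ
          (f := fun r : ℕ × ℕ => ∑ s ∈ antidiagonal r.2, (phC K r.1 * thC K s.1
              * d.B ((d.a ^ (r.1 + s.1)) v) w) • d.Ψ s.2)]
        simp [phC_zero]
    rw [h1, h2, sum_sub_distrib]
    simp only [A1_eq, hD, smul_add, sum_add_distrib, smul_smul]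
    rw [← sub_sub, sub_sub_eq_add_sub, sub_left_inj]
    cases n with
    | zero => simp [phC_zero]
    | succ n =>
      rw [sum_anti_succ, sum_anti_succ' (n := n)]
      simp only [phC_zero, pow_zero, one_smul, smul_zero, zero_add, one_apply]
      rw [add_sub_assoc, add_right_inj, ← sum_sub_distrib]
      refine sum_congr rfl fun r hr => ?_
      rw [mem_anti] at hr
      rw [ih r.2 (by omega), ← mul_apply, ← pow_succ', smul_sub,
        show phC K (r.1 + 1) = chC K r.1 from rfl, sub_sub_cancel]

end GaussData

end

section

namespace GaussData

variable {K V F A : Type} [Field K] [CharZero K] [AddCommGroup V] [Module K V]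
    [FiniteDimensional K V] [AddCommGroup F] [Module K F] [Ring A] [Algebra K A]
    (d : GaussData K V F A)

lemma sum_B_pow (s : ℕ) : ∑ k, d.B ((d.a ^ s) (d.u k)) (d.v k)
    = -d.ε * trace K V (d.a ^ (s + 1)) := by
  have h := trace_of_sum (-(d.a ^ (s + 1))) (fun k => d.ε • d.B.flip (d.v k))
    (fun k => (d.a ^ s) (d.u k)) (fun w => by
      rw [pow_succ, lneg_apply, mul_apply, ← map_neg, ← d.sum_v]
      simp)
  rw [map_neg] at h
  simp only [lsmul_apply, LinearMap.flip_apply, smul_eq_mul] at h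
  rw [← mul_sum] at h
  linear_combination -d.ε * h - (∑ k, d.B ((d.a ^ s) (d.u k)) (d.v k)) * d.ε_mul

lemma sum_B_uv : ∑ k, d.B (d.u k) (d.v k) = d.ε * trace K V d.a := by
  have h := trace_of_sum (-d.a) (fun k => d.B.flip (d.u k)) d.v (fun w => by
      rw [lneg_apply, ← d.sum_u]; simp)
  simp only [LinearMap.flip_apply, fun k => d.B_swap (d.u k) (d.v k), ← mul_sum,
    map_neg] at h
  have h2 := congrArg (fun x => d.ε * x) h
  simp only [← mul_assoc, mul_neg, neg_mul, d.ε_mul, one_mul] at h2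
  linear_combination h2

lemma trace_a : trace K V d.a = 0 := by
  have h1 := d.sum_B_uv
  have h2 := d.sum_B_pow 0
  simp only [pow_zero, one_apply, zero_add, pow_one] at h2
  rw [h1] at h2
  have h3 := congrArg (fun x => d.ε * x) h2
  simp only [neg_mul, mul_neg, ← mul_assoc, d.ε_mul, one_mul] at h3
  have : (2 : K) * trace K V d.a = 0 := by linear_combination h3
  simpa using this

/-- The quadratic element `½ ∑ u k v k` in the algebra `A`. -/
def gam : A := (2⁻¹ : K) • ∑ k, d.e (d.u k) * d.e (d.v k)

lemma sum_e_dual : ∑ k, d.e (finBasis K V k) * d.e (d.dual ((finBasis K V).coord k))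
    = ∑ k, d.e (d.u k) * d.e (d.v k) := by
  have h : ∀ x y : V, ∑ k, d.e (finBasis K V k)
      * ((finBasis K V).coord k x • d.e y) = d.e x * d.e y := by
    intro x y
    simp only [mul_smul_comm, ← smul_mul_assoc, ← sum_mul]
    rw [sum_coord_map]
  have h0 : ∑ k, algebraMap K A (d.B (d.u k) (d.v k)) = 0 := by
    rw [← map_sum, d.sum_B_uv, d.trace_a, mul_zero, map_zero]
  simp only [dual, map_smul, map_sum, map_add, mul_smul_comm, ← smul_sum, mul_sum,
    mul_add, sum_add_distrib, mul_smul]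
  have h' : ∀ x y : d.κ → V, ∑ k, ∑ l, (finBasis K V).coord k (x l)
      • (d.e (finBasis K V k) * d.e (y l)) = ∑ l, d.e (x l) * d.e (y l) := by
    intro x y
    rw [sum_comm]
    simp only [← mul_smul_comm, h]
  simp only [h']
  have h1 : ∑ k, d.ε • (d.e (d.v k) * d.e (d.u k)) = ∑ k, d.e (d.u k) * d.e (d.v k) := by
    rw [← sub_eq_zero, ← neg_eq_zero, neg_sub, ← sum_sub_distrib, ← h0]
    exact sum_congr rfl fun k _ => d.e_e _ _
  rw [← smul_sum] at h1
  rw [h1, ← two_smul K, smul_smul, inv_mul_cancel₀ two_ne_zero, one_smul]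

lemma Ψ_rec (n : ℕ) : ((n + 1 : ℕ) : K) • d.Ψ (n + 1) = (d.X - d.gam) * d.Ψ n
      + ∑ r ∈ antidiagonal n, (((r.1 + 1 : ℕ) : K)
        * (-(2⁻¹ * d.ε) * hC K (r.1 + 1) * trace K V (d.a ^ (r.1 + 1)))) • d.Ψ r.2 := by
  have hs : ∑ r ∈ antidiagonal (n + 1), (((r.1 : K) • d.q r.1 (d.G r.2) + d.q r.1 (d.E (d.G r.2))))
      = ((n + 1 : ℕ) : K) • d.Ψ (n + 1) - d.ΨT d.lam n := by
    have h1 : d.ΨT d.lam n = -∑ r ∈ antidiagonal (n + 1), (r.2 : K) • d.q r.1 (d.G r.2) := by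
      rw [sum_anti_succ']
      simp only [← map_smul, G_succ, Nat.cast_zero, zero_smul, map_zero, zero_add, map_neg,
        sum_neg_distrib, neg_neg]
      rfl
    rw [h1, sub_neg_eq_add, Ψ, smul_sum, ← sum_add_distrib]
    refine sum_congr rfl fun r hr => ?_
    rw [mem_anti] at hr
    rw [d.E_gr (d.G_mem _), map_smul, ← hr]
    push_cast; module
  simp only [q_rec, sum_add_distrib] at hs
  have hp : ∑ r ∈ antidiagonal (n + 1), d.prev r.1 (d.G r.2) = d.X * d.Ψ n := by
    rw [sum_anti_succ, Ψ, mul_sum]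
    simp [prev]
  have hq : ∑ r ∈ antidiagonal (n + 1), ∑ k, d.e (finBasis K V k)
      * d.q r.1 (d.p ((finBasis K V).coord k) (d.G r.2)) = -((2 : K) • (d.gam * d.Ψ n)) := by
    rw [sum_anti_succ']
    simp only [p_G_succ, G_zero, d.p_vac, map_zero, mul_zero, sum_const_zero, zero_add,
      map_neg, mul_neg, sum_neg_distrib]
    rw [sum_comm]
    congr 1
    simp only [← mul_sum]
    rw [← smul_mul_assoc, gam, smul_smul, mul_inv_cancel₀ two_ne_zero, one_smul, ← sum_e_dual,
      sum_mul]
    refine sum_congr rfl fun k _ => ?_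
    rw [mul_assoc, ← A1_eq]; rfl
  have hl : d.ΨT d.lam n = d.gam * d.Ψ n + (2⁻¹ * d.ε : K) • ∑ r ∈ antidiagonal n,
      (thC K r.1 * trace K V (d.a ^ (r.1 + 1))) • d.Ψ r.2 := by
    have h1 : d.ΨT d.lam n = (2⁻¹ : K) • ∑ k, d.ΨT (d.m (d.u k) * d.m (d.v k)) n := by
      simp only [ΨT, lam_apply, map_smul, map_sum, ← smul_sum]
      rw [sum_comm]; rfl
    rw [h1]
    simp only [A2_eq, sum_sub_distrib, ← mul_assoc]
    rw [← sum_mul, smul_sub, ← smul_mul_assoc, ← gam, sub_eq_add_neg, mul_smul, ← smul_neg]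
    congr 2
    rw [sum_comm, smul_sum, ← sum_neg_distrib]
    refine sum_congr rfl fun r _ => ?_
    rw [← sum_smul, ← mul_sum, sum_B_pow]
    module
  rw [hp, hq, hl] at hs
  have ht : ∑ r ∈ antidiagonal n, (((r.1 + 1 : ℕ) : K)
        * (-(2⁻¹ * d.ε) * hC K (r.1 + 1) * trace K V (d.a ^ (r.1 + 1)))) • d.Ψ r.2
      = (2⁻¹ * d.ε : K) • ∑ r ∈ antidiagonal n,
      (thC K r.1 * trace K V (d.a ^ (r.1 + 1))) • d.Ψ r.2 := by
    rw [smul_sum]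
    refine sum_congr rfl fun r _ => ?_
    rw [smul_smul]
    congr 1
    rcases r.1 with _ | s
    · simp [d.trace_a]
    · rw [thC_succ]; push_cast; ring
  rw [ht, sub_mul]
  linear_combination (norm := module) -hs

lemma Ψ_zero : d.Ψ 0 = 1 := by simp [Ψ, G_zero, d.q_vac]

theorem Ψ_eq (n : ℕ) : d.Ψ n = ∑ r ∈ antidiagonal n,
    expSeq K (fun i => -(2⁻¹ * d.ε) * hC K i * trace K V (d.a ^ i)) r.1
      • dvp K (d.X - d.gam) r.2 :=
  expSeq_single_add _ _ _ d.Ψ_zero d.Ψ_rec n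

end GaussData

end

section

section

variable {K : Type} [Field K] [CharZero K] {V : Type} [AddCommGroup V] [Module K V]
  [FiniteDimensional K V]

lemma eq_zero_of_eul {M : Type} [AddCommGroup M] [Module K M] {κ : Type*} [Fintype κ]
    (b : Basis κ K V) (T : V →ₗ[K] End K M) (F : 𝒮 K V →ₗ[K] M)
    (h : ∀ P, F (eul P) = ∑ k, T (b k) (F (pd (b.coord k) P))) (h1 : F 1 = 0) : F = 0 := by
  apply ext_dp
  intro x n
  induction n with
  | zero => simpa using h1
  | succ n ih =>
    have := h (dp x (n + 1))
    simp only [pd_dp_succ, eul_dp, map_smul, ih, lzero_apply, map_zero, smul_zero,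
      sum_const_zero] at this ⊢
    exact (smul_eq_zero.1 this).resolve_left (by exact_mod_cast n.succ_ne_zero)

lemma eul_der (δ : V →ₗ[K] V) (P : 𝒮 K V) :
    der (ι K V ∘ₗ δ) (eul P) = eul (der (ι K V ∘ₗ δ) P) := by
  have : ⁅der (ι K V ∘ₗ δ), eul⁆ = (0 : Derivation K (𝒮 K V) _) := by
    apply der_ext
    intro x
    simp [Derivation.commutator_apply, eul]
  have := dcongr_fun this P
  rwa [Derivation.commutator_apply, Derivation.zero_apply, sub_eq_zero] at this

lemma sg_der {A : Type} [Ring A] [Algebra K A] (e : V →ₗ[K] A) (δ : V →ₗ[K] V) (X : A)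
    (h : ∀ x, e (δ x) = X * e x - e x * X) (P : 𝒮 K V) :
    sg e (der (ι K V ∘ₗ δ) P) = X * sg e P - sg e P * X := by
  let F : 𝒮 K V →ₗ[K] A := sg e ∘ₗ (der (ι K V ∘ₗ δ)).toLinearMap
    - (mulLeft K X ∘ₗ sg e - mulRight K X ∘ₗ sg e)
  have hF : ∀ P, F P = sg e (der (ι K V ∘ₗ δ) P) - (X * sg e P - sg e P * X) := fun P => rfl
  have : F = 0 := by
    refine eq_zero_of_eul (finBasis K V) (LinearMap.mul K A ∘ₗ e) F (fun P => ?_)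
      (by simp [hF])
    have h1 := sum_pd_comp (finBasis K V) δ
      ((LinearMap.llcomp K (𝒮 K V) A A).flip (sg e) ∘ₗ LinearMap.mul K A ∘ₗ e) P
    simp only [comp_apply, LinearMap.flip_apply, LinearMap.llcomp_apply,
      LinearMap.mul_apply', h] at h1 ⊢
    simp only [hF, eul_der, sg_eul e (finBasis K V), der_pd_comm]
    simp only [map_sub, mul_sub, sub_mul, sum_sub_distrib, h1, mul_sum,
      sum_mul, mul_assoc]
    abel
  have h2 := dcongr_fun this P
  rwa [hF, lzero_apply, sub_eq_zero] at h2

lemma sg_ι_mul_dp {A : Type} [Ring A] [Algebra K A] (e : V →ₗ[K] A) (δ : End K V) (z : V)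
    (h : ∀ x, e z * e x = e x * e z + e (δ x)) (y : V) (m : ℕ) :
    sg e (ι K V y * dp z m) = ∑ r ∈ antidiagonal m,
      phC K r.1 • (e ((δ ^ r.1) y) * dvp K (e z) r.2) := by
  induction m with
  | zero => simp [phC_zero]
  | succ m ih =>
    have hm : ((m + 2 : ℕ) : K) ≠ 0 := by exact_mod_cast (m + 1).succ_ne_zero
    have h1 := sg_eul e (finBasis K V) (ι K V y * dp z (m + 1))
    have h2 : eul (ι K V y * dp z (m + 1)) = ((m + 2 : ℕ) : K) • (ι K V y * dp z (m + 1)) := by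
      rw [leibniz, eul_dp, eul, der_ι, smul_eq_mul, smul_eq_mul, mul_smul_comm,
        mul_comm (dp z (m + 1))]
      push_cast; module
    have h3 : ∀ (x : V) (Y : A), ∑ k, (finBasis K V).coord k x
        • (e (finBasis K V k) * Y) = e x * Y := by
      intro x Y
      simp only [← smul_mul_assoc, ← sum_mul, sum_coord_map]
    simp only [h2, pd_ι_mul, pd_dp_succ, map_smul, map_add, mul_add, sum_add_distrib,
      mul_smul_comm, h3, ih, sg_dp] at h1
    apply smul_right_injective A hm
    change _ • _ = _ • _
    rw [h1, smul_sum, mul_sum]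
    simp only [mul_smul_comm, smul_mul_assoc, ← mul_assoc, h, add_mul, smul_add]
    simp only [mul_assoc, mul_dvp, sum_add_distrib]
    have e1 : ∑ r ∈ antidiagonal (m + 1), ((m + 2 : ℕ) : K) • phC K r.1
          • (e ((δ ^ r.1) y) * dvp K (e z) r.2)
        = ∑ r ∈ antidiagonal (m + 1), ((r.2 : K) * phC K r.1)
          • (e ((δ ^ r.1) y) * dvp K (e z) r.2)
        + ∑ r ∈ antidiagonal (m + 1), (((r.1 + 1 : ℕ) : K) * phC K r.1)
          • (e ((δ ^ r.1) y) * dvp K (e z) r.2) := by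
      rw [← sum_add_distrib]
      refine sum_congr rfl fun r hr => ?_
      rw [mem_anti] at hr
      rw [smul_smul, ← add_smul, ← add_mul]
      congr 2
      rw [← Nat.cast_add]; congr 1; omega
    rw [e1, sum_anti_succ', sum_anti_succ (n := m)
      (f := fun r => (((r.1 + 1 : ℕ) : K) * phC K r.1) • (e ((δ ^ r.1) y) * dvp K (e z) r.2))]
    have e2 : ∀ s, ((s + 1 + 1 : ℕ) : K) * phC K (s + 1) = phC K s := GaussData.phC_succ
    simp only [e2, phC_zero, pow_succ', mul_apply]
    simp [smul_smul, mul_comm]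
    abel

/-- Iterates of the operator `∑ ρ (b k) ⊗ ∂ k`. -/
def itr {E M : Type} [AddCommGroup E] [Module K E] [AddCommGroup M] [Module K M]
    (ρ : V →ₗ[K] End K E) (F : E →ₗ[K] 𝒮 K V →ₗ[K] M) :
    ℕ → E →ₗ[K] 𝒮 K V →ₗ[K] M
  | 0 => F
  | n + 1 => ∑ k, (LinearMap.llcomp K _ _ _).flip (pdL ((finBasis K V).coord k))
      ∘ₗ itr ρ F n ∘ₗ ρ (finBasis K V k)

variable {E M : Type} [AddCommGroup E] [Module K E] [AddCommGroup M] [Module K M]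
    (ρ : V →ₗ[K] End K E) (F : E →ₗ[K] 𝒮 K V →ₗ[K] M)

lemma itr_zero : itr ρ F 0 = F := rfl

lemma itr_succ (n : ℕ) (x : E) (P : 𝒮 K V) : itr ρ F (n + 1) x P
    = ∑ k, itr ρ F n (ρ (finBasis K V k) x) (pd ((finBasis K V).coord k) P) := by
  simp [itr]

lemma itr_dp (n m : ℕ) (x : E) (y : V) : itr ρ F n x (dp y (m + n)) = F ((ρ y ^ n) x) (dp y m) := by
  induction n generalizing x with
  | zero => rfl
  | succ n ih =>
    rw [itr_succ, ← add_assoc]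
    simp only [pd_dp_succ, map_smul, ih]
    have := sum_coord_map (finBasis K V) (((F ∘ₗ (ρ y ^ n)).flip (dp y m)) ∘ₗ ρ.flip x) y
    simp only [comp_apply, LinearMap.flip_apply] at this
    rw [this, pow_succ, mul_apply]

lemma itr_dp_lt (n m : ℕ) (h : m < n) (x : E) (y : V) : itr ρ F n x (dp y m) = 0 := by
  induction n generalizing x m with
  | zero => omega
  | succ n ih =>
    rw [itr_succ]
    cases m with
    | zero => simp
    | succ m => simp [pd_dp_succ, ih m (by omega)]

/-- The locally finite sum of the operators `w n • itr ρ F n`. -/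
def itrSum (w : ℕ → K) (x : E) : 𝒮 K V →ₗ[K] M :=
  lsum (fun n => w n • itr ρ F n x) (locFin_of_dp _ fun y m n h => by
    rw [lsmul_apply, itr_dp_lt _ _ _ _ h, smul_zero])

lemma itrSum_dp (w : ℕ → K) (x : E) (y : V) (m : ℕ) : itrSum ρ F w x (dp y m)
    = ∑ r ∈ antidiagonal m, w r.1 • F ((ρ y ^ r.1) x) (dp y r.2) := by
  rw [itrSum, lsum_eq_sum (N := m + 1), sum_anti_range]
  · refine sum_congr rfl fun i hi => ?_
    have : i ≤ m := by simpa [Nat.lt_succ_iff] using hi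
    conv_lhs => rw [← Nat.sub_add_cancel this]
    rw [lsmul_apply, itr_dp]
  · intro i hi
    rw [lsmul_apply, itr_dp_lt _ _ _ _ (by omega), smul_zero]

/-- `itrSum` as a linear map. -/
def itrSumL (w : ℕ → K) : E →ₗ[K] 𝒮 K V →ₗ[K] M where
  toFun := itrSum ρ F w
  map_add' x y := ext_dp fun z m => by
    simp [itrSum_dp, sum_add_distrib]
  map_smul' a x := ext_dp fun z m => by
    simp [itrSum_dp, smul_sum, smul_comm a]

lemma itrSumL_dp (w : ℕ → K) (x : E) (y : V) (m : ℕ) : itrSumL ρ F w x (dp y m)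
    = ∑ r ∈ antidiagonal m, w r.1 • F ((ρ y ^ r.1) x) (dp y r.2) := itrSum_dp ρ F w x y m

end

end

section

section

variable {K : Type} [Field K] [CharZero K] {L : Type} [LieRing L] [LieAlgebra K L]

/-- The adjoint representation as a linear map. -/
abbrev adL (K L : Type) [Field K] [LieRing L] [LieAlgebra K L] : L →ₗ[K] End K L :=
  (LieAlgebra.ad K L : L →ₗ[K] End K L)

lemma adL_apply (x y : L) : adL K L x y = ⁅x, y⁆ := rfl

variable (K) in
lemma bracket_pow_identity (z x y : L) (k : ℕ) :
    ∑ r ∈ antidiagonal k, (phC K r.1 * phC K r.2) • ⁅(adL K L z ^ r.1) x, (adL K L z ^ r.2) y⁆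
      = phC K (k + 1) • ∑ r ∈ antidiagonal k,
        (adL K L z ^ r.1) (⁅x, (adL K L z ^ r.2) y⁆ + ⁅(adL K L z ^ r.2) x, y⁆) := by
  induction k with
  | zero =>
    simp [phC]
    norm_num
    rw [← two_smul K, smul_smul]; norm_num
  | succ k ih =>
    have hk : ((k + 3 : ℕ) : K) ≠ 0 := by exact_mod_cast (k + 2).succ_ne_zero
    have e2 : ∀ s, ((s + 1 + 1 : ℕ) : K) * phC K (s + 1) = phC K s := GaussData.phC_succ
    have hc : ∀ r ∈ antidiagonal (k + 1), ((k + 3 : ℕ) : K) • (phC K r.1 * phC K r.2) •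
          ⁅(adL K L z ^ r.1) x, (adL K L z ^ r.2) y⁆
        = (((r.1 + 1 : ℕ) : K) * phC K r.1 * phC K r.2) •
          ⁅(adL K L z ^ r.1) x, (adL K L z ^ r.2) y⁆ + (phC K r.1 * (((r.2 + 1 : ℕ) : K)
            * phC K r.2)) • ⁅(adL K L z ^ r.1) x, (adL K L z ^ r.2) y⁆ := by
      intro r hr
      rw [mem_anti] at hr
      rw [show k + 3 = (r.1 + 1) + (r.2 + 1) by omega]
      push_cast; module
    have h1 := congrArg (adL K L z) ih
    have hl : ∀ u v : L, adL K L z ⁅u, v⁆ = ⁅adL K L z u, v⁆ + ⁅u, adL K L z v⁆ :=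
      fun u v => leibniz_lie z u v
    simp only [map_sum, map_smul, map_add, hl, smul_add, sum_add_distrib] at h1
    apply smul_right_injective L hk
    change _ • _ = _ • _
    rw [smul_sum, sum_congr rfl hc, sum_add_distrib,
      sum_anti_succ, sum_anti_succ' (n := k)
        (f := fun r => (phC K r.1 * (((r.2 + 1 : ℕ) : K)
            * phC K r.2)) • ⁅(adL K L z ^ r.1) x, (adL K L z ^ r.2) y⁆), smul_smul,
      show ((k + 3 : ℕ) : K) * phC K (k + 1 + 1) = phC K (k + 1) from GaussData.phC_succ (k + 1),
      sum_anti_succ (n := k)]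
    simp only [e2, phC_zero, pow_succ', mul_apply, pow_zero,
      one_apply, map_add, smul_add, sum_add_distrib, lie_add]
    simp only [Nat.cast_zero, zero_add, Nat.cast_one, mul_one, one_mul]
    linear_combination (norm := module) h1

variable [FiniteDimensional K L]

/-- Coefficients of the inverse of the series `phC`. -/
def psC (K : Type) [Field K] [CharZero K] : ℕ → K := expSeq K fun i => -gC K i

lemma phC_psC (n : ℕ) : ∑ r ∈ antidiagonal n, phC K r.1 * psC K r.2 = if n = 0 then 1 else 0 := by
  simp only [phC_eq, psC]
  rw [← expSeq_add]
  simp only [add_neg_cancel]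
  symm
  refine eq_expSeq K (fun _ => (0 : K)) (fun n => if n = 0 then 1 else 0) (by simp) (fun n => ?_) n
  simp

/-- Multiplication of the symmetric algebra by generators. -/
def mulι (K V : Type) [Field K] [AddCommGroup V] [Module K V] :
    V →ₗ[K] 𝒮 K V →ₗ[K] 𝒮 K V :=
  LinearMap.mul K (𝒮 K V) ∘ₗ ι K V

@[simp] lemma mulι_apply {V : Type} [AddCommGroup V] [Module K V] (x : V) (P) :
    mulι K V x P = ι K V x * P := rfl

variable (K L) in
/-- The action of a Lie algebra on its symmetric algebra transported from left multiplication on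
the enveloping algebra. -/
def lamA : L →ₗ[K] End K (𝒮 K L) := itrSumL (adL K L) (mulι K L) (psC K)

lemma sum_phC_itr {V E M : Type} [AddCommGroup V] [Module K V] [FiniteDimensional K V]
    [AddCommGroup E] [Module K E] [AddCommGroup M] [Module K M]
    (ρ : V →ₗ[K] End K E) (F : E →ₗ[K] 𝒮 K V →ₗ[K] M)
    (x : E) (z : V) (m : ℕ) :
    ∑ r ∈ antidiagonal m, phC K r.1 • itrSumL ρ F (psC K) ((ρ z ^ r.1) x) (dp z r.2)
      = F x (dp z m) := by
  simp only [itrSumL_dp, smul_sum, smul_smul]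
  rw [← sum_antidiagonal_assoc (f := fun a b c => (phC K a * psC K b) •
    F ((ρ z ^ b) ((ρ z ^ a) x)) (dp z c))]
  have h : ∀ r : ℕ × ℕ, ∑ s ∈ antidiagonal r.1, (phC K s.1 * psC K s.2) •
      F ((ρ z ^ s.2) ((ρ z ^ s.1) x)) (dp z r.2) = if r.1 = 0 then F x (dp z r.2) else 0 := by
    intro r
    trans (∑ s ∈ antidiagonal r.1, (phC K s.1 * psC K s.2)) • F ((ρ z ^ r.1) x) (dp z r.2)
    · rw [sum_smul]
      refine sum_congr rfl fun s hs => ?_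
      rw [mem_anti] at hs
      rw [← mul_apply, ← pow_add, add_comm s.2, hs]
    · rw [phC_psC]
      rcases r.1 with _ | n <;> simp
  simp only [h]
  rw [sum_eq_single (0, m)]
  · simp
  · rintro ⟨a, b⟩ h hne
    rw [mem_anti] at h
    refine if_neg fun h' => hne ?_
    simp at h h'
    simp [h'] at h ⊢; exact h
  · simp

lemma eq_of_sum_phC {V E M : Type} [AddCommGroup V] [Module K V]
    [AddCommGroup E] [Module K E] [AddCommGroup M] [Module K M]
    (ρ : V →ₗ[K] End K E) {F G : E →ₗ[K] 𝒮 K V →ₗ[K] M}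
    (h : ∀ x z m, ∑ r ∈ antidiagonal m, phC K r.1 • F ((ρ z ^ r.1) x) (dp z r.2)
      = ∑ r ∈ antidiagonal m, phC K r.1 • G ((ρ z ^ r.1) x) (dp z r.2)) : F = G := by
  apply lext
  intro x
  apply ext_dp
  intro z m
  induction m using strong_induction_on generalizing x with
  | _ m ih =>
    have := h x z m
    rw [← sub_eq_zero, ← sum_sub_distrib, sum_eq_single (0, m)] at this
    · simpa [phC_zero, sub_eq_zero] using this
    · rintro ⟨a, b⟩ h hne
      rw [mem_anti] at h
      simp only at h ⊢
      rcases a with _ | a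
      · simp at h; exact absurd (by rw [h]) hne
      · rw [ih b (by omega), sub_self]
    · simp

end

end

section

section

variable {K : Type} [Field K] [CharZero K] {V : Type} [AddCommGroup V] [Module K V]
  [FiniteDimensional K V] {E M : Type} [AddCommGroup E] [Module K E] [AddCommGroup M] [Module K M]
    (ρ : V →ₗ[K] End K E) (F : E →ₗ[K] 𝒮 K V →ₗ[K] M)

/-- The product `ι y * dp z (m - 1)`. -/
def udp (K : Type) [Field K] {V : Type} [AddCommGroup V] [Module K V] (y z : V) :
    ℕ → 𝒮 K V
  | 0 => 0
  | m + 1 => ι K V y * dp z m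

lemma sum_pd_udp (G : V →ₗ[K] 𝒮 K V →ₗ[K] M) (y z : V) (m : ℕ) :
    ∑ k, G (finBasis K V k) (pd ((finBasis K V).coord k) (ι K V y * dp z m))
      = G z (udp K y z m) + G y (dp z m) := by
  simp only [pd_ι_mul, map_add, sum_add_distrib, map_smul]
  congr 1
  · cases m with
    | zero => simp [udp]
    | succ m =>
      simp only [pd_dp_succ, udp, mul_smul_comm, map_smul]
      exact sum_coord_map (finBasis K V) (G.flip _) z
  · exact sum_coord_map (finBasis K V) (G.flip _) y

lemma itr_succ_ι_mul_dp (y z : V) (x : E) (n m : ℕ) :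
    itr ρ F (n + 1) x (ι K V y * dp z m)
      = itr ρ F n (ρ z x) (udp K y z m) + itr ρ F n (ρ y x) (dp z m) := by
  rw [itr_succ]
  exact sum_pd_udp ((itr ρ F n) ∘ₗ ρ.flip x) y z m

lemma itr_ι_mul_dp (y z : V) (n : ℕ) (x : E) (m : ℕ) :
    itr ρ F (n + 1) x (ι K V y * dp z (m + n)) = F ((ρ z ^ (n + 1)) x) (udp K y z m)
      + F (∑ r ∈ antidiagonal n, (ρ z ^ r.1) (ρ y ((ρ z ^ r.2) x))) (dp z m) := by
  induction n generalizing x with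
  | zero => rw [itr_succ_ι_mul_dp]; simp [itr_zero]
  | succ n ih =>
    rw [itr_succ_ι_mul_dp, itr_dp, ← add_assoc,
      show udp K y z (m + n + 1) = ι K V y * dp z (m + n) from rfl]
    rw [ih, sum_anti_succ' (n := n)]
    simp only [pow_succ (ρ z) (_ + 1), pow_succ (ρ z), mul_apply, map_add,
      ladd_apply, pow_zero, one_apply]
    abel

lemma itr_ι_mul_dp_lt (y z : V) (n : ℕ) (x : E) (m : ℕ) (h : m < n) :
    itr ρ F (n + 1) x (ι K V y * dp z m) = 0 := by
  induction n generalizing x m with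
  | zero => omega
  | succ n ih =>
    rw [itr_succ_ι_mul_dp, itr_dp_lt _ _ _ _ h, add_zero]
    cases m with
    | zero => simp [udp]
    | succ m => exact ih _ _ (by omega)

lemma itrSumL_ι_mul_dp (w : ℕ → K) (y z : V) (x : E) (m : ℕ) :
    itrSumL ρ F w x (ι K V y * dp z m)
      = ∑ r ∈ antidiagonal m, w r.1 • F ((ρ z ^ r.1) x) (ι K V y * dp z r.2)
      + ∑ r ∈ antidiagonal m, w (r.1 + 1) •
        F (∑ s ∈ antidiagonal r.1, (ρ z ^ s.1) (ρ y ((ρ z ^ s.2) x))) (dp z r.2) := by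
  rw [show itrSumL ρ F w x (ι K V y * dp z m) = itrSum ρ F w x (ι K V y * dp z m) from rfl,
    itrSum, lsum_eq_sum (N := m + 2)]
  · rw [sum_range_succ']
    have h1 : ∑ i ∈ range (m + 1), (w (i + 1) • itr ρ F (i + 1) x) (ι K V y * dp z m)
        = ∑ r ∈ antidiagonal m, w (r.1 + 1) • itr ρ F (r.1 + 1) x (ι K V y * dp z (r.2 + r.1)) := by
      rw [sum_anti_range]
      refine sum_congr rfl fun i hi => ?_
      have : i ≤ m := by simpa [Nat.lt_succ_iff] using hi
      simp only [Nat.sub_add_cancel this]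
      rfl
    have h2 : ∑ r ∈ antidiagonal m, w r.1 • F ((ρ z ^ r.1) x) (ι K V y * dp z r.2)
        = ∑ r ∈ antidiagonal (m + 1), w r.1 • F ((ρ z ^ r.1) x) (udp K y z r.2) := by
      rw [sum_anti_succ']
      simp [udp]
    rw [h1, h2, sum_anti_succ]
    simp only [itr_ι_mul_dp, smul_add, sum_add_distrib, itr_zero, lsmul_apply, udp,
      pow_zero, one_apply]
    abel
  · intro i hi
    obtain ⟨j, rfl⟩ : ∃ j, i = j + 1 := ⟨i - 1, by omega⟩
    rw [lsmul_apply, itr_ι_mul_dp_lt _ _ _ _ _ _ _ (by omega), smul_zero]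

end

section

variable {K : Type} [Field K] [CharZero K] {L : Type} [LieRing L] [LieAlgebra K L]
  [FiniteDimensional K L]

lemma lamA_dp (x z : L) (m : ℕ) : ∑ r ∈ antidiagonal m,
    phC K r.1 • lamA K L ((adL K L z ^ r.1) x) (dp z r.2) = ι K L x * dp z m :=
  sum_phC_itr (adL K L) (mulι K L) x z m

lemma itrSumL_lamA (x : L) (P : 𝒮 K L) :
    itrSumL (adL K L) (lamA K L) (phC K) x P = ι K L x * P := by
  have : itrSumL (adL K L) (lamA K L) (phC K) x = mulι K L x := by
    apply ext_dp
    intro z m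
    rw [itrSumL_dp, lamA_dp]; rfl
  rw [this]; rfl

lemma lamA_polarized (x y z : L) (m : ℕ) :
    ∑ r ∈ antidiagonal m, phC K r.1 • lamA K L ((adL K L z ^ r.1) x) (ι K L y * dp z r.2)
      = ι K L x * (ι K L y * dp z m) - ∑ r ∈ antidiagonal m, phC K (r.1 + 1) •
        lamA K L (∑ s ∈ antidiagonal r.1,
          (adL K L z ^ s.1) (⁅y, (adL K L z ^ s.2) x⁆)) (dp z r.2) := by
  rw [← itrSumL_lamA x, itrSumL_ι_mul_dp, eq_sub_iff_add_eq]
  rfl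

lemma lamA_lamA_sum (x y z : L) (m : ℕ) :
    ∑ r ∈ antidiagonal m, ∑ s ∈ antidiagonal r.1, (phC K s.1 * phC K s.2) •
      lamA K L ((adL K L z ^ s.1) x) (lamA K L ((adL K L z ^ s.2) y) (dp z r.2))
      = ι K L x * (ι K L y * dp z m) - ∑ r ∈ antidiagonal m, phC K (r.1 + 1) •
        lamA K L (∑ s ∈ antidiagonal r.1,
          (adL K L z ^ s.1) (⁅y, (adL K L z ^ s.2) x⁆)) (dp z r.2) := by
  rw [← lamA_polarized, sum_antidiagonal_assoc (f := fun a b c => (phC K a * phC K b) •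
      lamA K L ((adL K L z ^ a) x) (lamA K L ((adL K L z ^ b) y) (dp z c)))]
  refine sum_congr rfl fun r _ => ?_
  rw [← lamA_dp, map_sum, smul_sum]
  refine sum_congr rfl fun s _ => ?_
  rw [map_smul, smul_smul]

lemma lamA_lie (x y : L) : lamA K L x * lamA K L y - lamA K L y * lamA K L x
    = lamA K L ⁅x, y⁆ := by
  rw [← sub_eq_zero]
  let C : L → L → End K (𝒮 K L) := fun x y =>
    lamA K L x * lamA K L y - lamA K L y * lamA K L x - lamA K L ⁅x, y⁆
  have hC : ∀ x y P, C x y P = lamA K L x (lamA K L y P) - lamA K L y (lamA K L x P)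
    - lamA K L ⁅x, y⁆ P := fun _ _ _ => rfl
  have H : ∀ x y z m, ∑ r ∈ antidiagonal m, ∑ s ∈ antidiagonal r.1, (phC K s.1 * phC K s.2) •
      C ((adL K L z ^ s.1) x) ((adL K L z ^ s.2) y) (dp z r.2) = 0 := by
    intro x y z m
    simp only [hC, smul_sub, sum_sub_distrib]
    rw [lamA_lamA_sum]
    have h1 : ∑ r ∈ antidiagonal m, ∑ s ∈ antidiagonal r.1, (phC K s.1 * phC K s.2) •
        lamA K L ((adL K L z ^ s.2) y) (lamA K L ((adL K L z ^ s.1) x) (dp z r.2))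
        = ∑ r ∈ antidiagonal m, ∑ s ∈ antidiagonal r.1, (phC K s.1 * phC K s.2) •
        lamA K L ((adL K L z ^ s.1) y) (lamA K L ((adL K L z ^ s.2) x) (dp z r.2)) := by
      refine sum_congr rfl fun r _ => ?_
      rw [← Nat.sum_antidiagonal_swap]
      refine sum_congr rfl fun s _ => ?_
      rw [Prod.fst_swap, Prod.snd_swap, mul_comm]
    have h2 : ∀ r : ℕ × ℕ, ∑ s ∈ antidiagonal r.1, (phC K s.1 * phC K s.2) •
        lamA K L ⁅(adL K L z ^ s.1) x, (adL K L z ^ s.2) y⁆ (dp z r.2)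
        = phC K (r.1 + 1) • lamA K L (∑ s ∈ antidiagonal r.1,
          (adL K L z ^ s.1) (⁅x, (adL K L z ^ s.2) y⁆ + ⁅(adL K L z ^ s.2) x, y⁆)) (dp z r.2) := by
      intro r
      rw [← lsmul_apply, ← map_smul, ← bracket_pow_identity]
      simp
    rw [h1, lamA_lamA_sum]
    simp only [h2]
    have h3 : ∀ s : ℕ × ℕ, (adL K L z ^ s.1) (⁅x, (adL K L z ^ s.2) y⁆ + ⁅(adL K L z ^ s.2) x, y⁆)
        = (adL K L z ^ s.1) ⁅x, (adL K L z ^ s.2) y⁆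
          - (adL K L z ^ s.1) ⁅y, (adL K L z ^ s.2) x⁆ := by
      intro s
      rw [sub_eq_add_neg, ← map_neg, lie_skew, ← map_add]
    simp only [h3, sum_sub_distrib, map_sub, lsub_apply, smul_sub]
    rw [mul_left_comm]
    abel
  change C x y = 0
  apply ext_dp
  intro z m
  induction m using strong_induction_on generalizing x y with
  | _ m ih =>
    have := H x y z m
    rw [sum_eq_single (0, m)] at this
    · simpa [phC_zero] using this
    · rintro ⟨a, b⟩ h hne
      rw [mem_anti] at h
      refine sum_eq_zero fun s _ => ?_
      simp only at h ⊢
      rcases a with _ | a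
      · simp at h; exact absurd (by rw [h]) hne
      · rw [ih b (by omega), lzero_apply, smul_zero]
    · simp

attribute [local instance] LieRing.ofAssociativeRing

variable (K L) in
/-- The action `lamA` as a Lie algebra homomorphism. -/
def lamHom : L →ₗ⁅K⁆ End K (𝒮 K L) :=
  { lamA K L with
    map_lie' := fun {x y} => (lamA_lie x y).symm }

/-- The canonical linear map into the universal enveloping algebra. -/
def uι (K L : Type) [Field K] [LieRing L] [LieAlgebra K L] :
    L →ₗ[K] 𝒰 K L :=
  (UniversalEnvelopingAlgebra.ι K : L →ₗ⁅K⁆ 𝒰 K L).toLinearMap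

/-- The symmetrization map. -/
def symm (K L : Type) [Field K] [CharZero K] [LieRing L] [LieAlgebra K L]
    [FiniteDimensional K L] : 𝒮 K L →ₗ[K] 𝒰 K L :=
  sg (uι K L)

lemma symm_dp (x : L) (n : ℕ) :
    symm K L (dp x n) = dvp K (uι K L x) n := sg_dp _ x n

lemma lamA_self (x : L) (n : ℕ) : lamA K L x (dp x n) = ι K L x * dp x n := by
  have h : ∀ i, 1 ≤ i → (adL K L x ^ i) x = 0 := by
    intro i hi
    obtain ⟨j, rfl⟩ := exists_eq_add_of_le' hi
    rw [pow_succ, mul_apply, adL_apply, lie_self, map_zero]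
  rw [lamA, itrSumL_dp, sum_eq_single (0, n)]
  · simp [psC]
  · rintro ⟨a, b⟩ hm hne
    rw [mem_anti] at hm
    rcases a with _ | a
    · simp at hm; exact absurd (by rw [hm]) hne
    · rw [h _ (by omega), map_zero, lzero_apply, smul_zero]
  · simp

lemma lift_uι {A : Type} [Ring A] [Algebra K A] (f : L →ₗ⁅K⁆ A) (x : L) :
    UniversalEnvelopingAlgebra.lift K f (uι K L x) = f x :=
  UniversalEnvelopingAlgebra.lift_ι_apply K f x

lemma lift_symm (P : 𝒮 K L) :
    UniversalEnvelopingAlgebra.lift K (lamHom K L) (symm K L P) 1 = P := by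
  have : (LinearMap.applyₗ (1 : 𝒮 K L) ∘ₗ
      (UniversalEnvelopingAlgebra.lift K (lamHom K L)).toLinearMap) ∘ₗ symm K L = LinearMap.id := by
    apply ext_dp
    intro x n
    simp only [comp_apply, symm_dp, AlgHom.toLinearMap_apply, map_dvp, lift_uι, LinearMap.applyₗ_apply_apply, LinearMap.id_apply]
    change dvp K (lamA K L x) n 1 = _
    induction n with
    | zero => simp
    | succ n ih =>
      have hn : ((n + 1 : ℕ) : K) ≠ 0 := by exact_mod_cast n.succ_ne_zero
      apply smul_right_injective _ hn
      change _ • _ = _ • _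
      rw [← lsmul_apply, ← mul_dvp, mul_apply, ih, lamA_self, ι_mul_dp]
  exact dcongr_fun this P

lemma symm_injective : Function.Injective (symm K L) :=
  Function.LeftInverse.injective (g := fun u =>
    UniversalEnvelopingAlgebra.lift K (lamHom K L) u 1) lift_symm

lemma uι_mul_uι (x y : L) :
    uι K L x * uι K L y = uι K L y * uι K L x + uι K L ⁅x, y⁆ := by
  change UniversalEnvelopingAlgebra.ι K x * UniversalEnvelopingAlgebra.ι K y
    = _ + UniversalEnvelopingAlgebra.ι K ⁅x, y⁆
  rw [LieHom.map_lie, LieRing.of_associative_ring_bracket]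
  change _ = uι K L y * uι K L x + (uι K L x * uι K L y - uι K L y * uι K L x)
  abel

lemma symm_lamA (x : L) (P : 𝒮 K L) :
    symm K L (lamA K L x P) = uι K L x * symm K L P := by
  let F : L →ₗ[K] 𝒮 K L →ₗ[K] 𝒰 K L :=
    LinearMap.llcomp K _ _ _ (symm K L) ∘ₗ lamA K L
  let G : L →ₗ[K] 𝒮 K L →ₗ[K] 𝒰 K L :=
    (LinearMap.llcomp K _ _ _).flip (symm K L) ∘ₗ LinearMap.mul K _ ∘ₗ
      uι K L
  have hF : ∀ x P, F x P = symm K L (lamA K L x P) := fun _ _ => rfl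
  have hG : ∀ x P, G x P = uι K L x * symm K L P := fun _ _ => rfl
  have : F = G := by
    refine eq_of_sum_phC (adL K L) fun x z m => ?_
    simp only [hF, hG, ← map_smul (symm K L), ← map_sum]
    rw [lamA_dp, symm, sg_ι_mul_dp _ (adL K L z) z (fun y => uι_mul_uι z y)]
    refine sum_congr rfl fun r _ => ?_
    rw [sg_dp]
  exact dcongr_fun (dcongr_fun this x) P

lemma uea_induction {p : Submodule K (𝒰 K L)} (h1 : 1 ∈ p)
    (hm : ∀ x : L, ∀ u ∈ p, uι K L x * u ∈ p) : p = ⊤ := by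
  have hs : ∀ a b : 𝒰 K L, a ∈ Algebra.adjoin K
      (Set.range (uι K L : L → 𝒰 K L)) →
      b ∈ p → a * b ∈ p := by
    intro a b ha
    induction ha using Algebra.adjoin_induction generalizing b with
    | mem x hx => obtain ⟨y, rfl⟩ := hx; exact fun hb => hm y b hb
    | algebraMap r => exact fun hb => by rw [← asmul_def]; exact p.smul_mem _ hb
    | add x y _ _ hx hy => exact fun hb => by rw [add_mul]; exact p.add_mem (hx b hb) (hy b hb)
    | mul x y _ _ hx hy => exact fun hb => by rw [mul_assoc]; exact hx _ (hy b hb)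
  have htop : Algebra.adjoin K
      (Set.range (uι K L)) = ⊤ := by
    set S := Algebra.adjoin K
      (Set.range (uι K L))
    let f : L →ₗ⁅K⁆ S :=
      { toFun := fun x => ⟨UniversalEnvelopingAlgebra.ι K x, Algebra.subset_adjoin ⟨x, rfl⟩⟩
        map_add' := fun x y => Subtype.ext (by simp)
        map_smul' := fun a x => Subtype.ext (by simp)
        map_lie' := fun {x y} => Subtype.ext (by
          simp [LieRing.of_associative_ring_bracket]) }
    have hid : S.val.comp (UniversalEnvelopingAlgebra.lift K f) = AlgHom.id K _ := by
      apply UniversalEnvelopingAlgebra.hom_ext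
      ext x
      simp [f]
    rw [eq_top_iff]
    intro u _
    have := dcongr_fun hid u
    rw [AlgHom.id_apply] at this
    rw [← this]
    exact Subtype.prop _
  rw [eq_top_iff]
  intro u _
  rw [← mul_one u]
  exact hs u 1 (by rw [htop]; trivial) h1

lemma symm_surjective : Function.Surjective (symm K L) := by
  rw [← LinearMap.range_eq_top]
  refine uea_induction ⟨1, ?_⟩ ?_
  · rw [← dp_zero (0 : L), symm_dp, dvp_zero]
  · rintro x _ ⟨P, rfl⟩
    exact ⟨lamA K L x P, symm_lamA x P⟩

lemma symm_bijective : Function.Bijective (symm K L) := ⟨symm_injective, symm_surjective⟩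

end

end

section

section

variable (K L : Type) [Field K] [CharZero K] [LieRing L] [LieAlgebra K L]
  [FiniteDimensional K L]

/-- The weights of the Duflo symbol. -/
def dW (i : ℕ) : K := 2⁻¹ * hC K i

/-- The Duflo map on the symmetric algebra. -/
def dfl : 𝒮 K L →ₗ[K] 𝒰 K L :=
  symm K L ∘ₗ jop (dW K) (adL K L)

variable {K L}

lemma dfl_apply (P : 𝒮 K L) :
    dfl K L P = sg (uι K L) (jop (dW K) (adL K L) P) := rfl

/-- The adjoint action on the symmetric algebra. -/
def adD (x : L) : Derivation K (𝒮 K L) (𝒮 K L) :=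
  der (ι K L ∘ₗ adL K L x)

variable (K) in
/-- Invariant elements of the symmetric algebra. -/
def IsInv (P : 𝒮 K L) : Prop := ∀ x : L, adD x P = 0

lemma IsInv.mul {P Q : 𝒮 K L} (hP : IsInv K P) (hQ : IsInv K Q) :
    IsInv K (P * Q) := fun x => by rw [leibniz, hP, hQ, smul_zero, smul_zero, add_zero]

lemma adL_lie (x y : L) : adL K L (adL K L x y)
    = adL K L x * adL K L y - adL K L y * adL K L x := by
  ext z
  simp only [adL_apply, lsub_apply, mul_apply]
  rw [lie_lie]

lemma symm_adD (x : L) (P : 𝒮 K L) :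
    symm K L (adD x P) = uι K L x * symm K L P - symm K L P * uι K L x :=
  sg_der (uι K L) (adL K L x) (uι K L x)
    (fun y => by rw [adL_apply, uι_mul_uι x y]; abel) P

lemma adD_jop (w : ℕ → K) (x : L) (P : 𝒮 K L) :
    adD x (jop w (adL K L) P) = jop w (adL K L) (adD x P) :=
  jop_der w (adL K L) (adL K L x) (adL K L x) (fun y => adL_lie x y) P

lemma dfl_adD (x : L) (P : 𝒮 K L) :
    dfl K L (adD x P) = uι K L x * dfl K L P - dfl K L P * uι K L x := by
  rw [dfl, comp_apply, ← adD_jop, symm_adD]; rfl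

lemma jop_bijective (w : ℕ → K) {E : Type} [AddCommGroup E] [Module K E]
    (ρ : L →ₗ[K] End K E) : Function.Bijective (jop w ρ) :=
  Function.bijective_iff_has_inverse.2 ⟨jop (-w) ρ, jop_neg_cancel' w ρ, jop_neg_cancel w ρ⟩

lemma dfl_bijective : Function.Bijective (dfl K L) :=
  symm_bijective.comp (jop_bijective _ _)

lemma isInv_iff (P : 𝒮 K L) :
    IsInv K P ↔ ∀ x : L, uι K L x * dfl K L P = dfl K L P * uι K L x := by
  refine forall_congr' fun x => ?_
  rw [← sub_eq_zero (a := uι K L x * dfl K L P), ← dfl_adD, map_eq_zero_iff _ dfl_bijective.1]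

lemma jop_isInv (w : ℕ → K) {P : 𝒮 K L} (hP : IsInv K P) :
    IsInv K (jop w (adL K L) P) := fun x => by rw [adD_jop, hP, map_zero]

variable (K L) in
/-- Multiplicativity of the Duflo map on invariants. -/
def DufloMul : Prop := ∀ P Q : 𝒮 K L, IsInv K P → IsInv K Q →
  dfl K L (P * Q) = dfl K L P * dfl K L Q

end

end

section

/-- A Fock space generated from a vacuum vector by finitely many creation operators, which pairwise
commute up to signs. -/
structure Fock (K W J : Type) [Field K] [AddCommGroup W] [Module K W] [Fintype J]
    [DecidableEq J] where
  m : J → End K W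
  p : J → End K W
  s : J → J → K
  vac : W
  eps : W →ₗ[K] K
  m_m : ∀ i j w, m i (m j w) = s i j • m j (m i w)
  p_m : ∀ i j w, p i (m j w) = s i j • m j (p i w) + (if i = j then w else 0)
  s_mul : ∀ i j, s i j * s i j = 1
  p_vac : ∀ i, p i vac = 0
  eps_vac : eps vac = 1
  eps_m : ∀ i w, eps (m i w) = 0
  gen : ∀ N : Submodule K W, vac ∈ N → (∀ i, ∀ w ∈ N, m i w ∈ N) → N = ⊤

namespace Fock

variable {K W J M : Type} [Field K] [CharZero K] [AddCommGroup W] [Module K W] [Fintype J]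
    [DecidableEq J] [AddCommGroup M] [Module K M] (d : Fock K W J)

/-- The number operator. -/
def E : End K W := ∑ j, d.m j * d.p j

lemma E_apply (w : W) : d.E w = ∑ j, d.m j (d.p j w) := by simp [E]

lemma E_vac : d.E d.vac = 0 := by simp [E_apply, d.p_vac]

lemma E_m (j : J) (w : W) : d.E (d.m j w) = d.m j (d.E w) + d.m j w := by
  simp only [E_apply, d.p_m, map_add, map_smul, sum_add_distrib, map_sum]
  congr 1
  · refine sum_congr rfl fun k _ => ?_
    rw [d.m_m, smul_smul, d.s_mul, one_smul]
  · rw [sum_eq_single j (fun i _ hi => by rw [if_neg hi, map_zero]) (by simp), if_pos rfl]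

/-- The homogeneous components. -/
def gr : ℕ → Submodule K W
  | 0 => span K {d.vac}
  | k + 1 => ⨆ j, (gr k).map (d.m j)

lemma gr_succ_induction {k : ℕ} {P : W → Prop} (h : ∀ j, ∀ f ∈ d.gr k, P (d.m j f)) (h0 : P 0)
    (ha : ∀ f g, P f → P g → P (f + g)) {f : W} (hf : f ∈ d.gr (k + 1)) : P f := by
  refine Submodule.iSup_induction _ (motive := P) hf ?_ h0 ha
  rintro w _ ⟨g, hg, rfl⟩
  exact h w g hg

lemma m_mem {k : ℕ} {f : W} (hf : f ∈ d.gr k) (j : J) : d.m j f ∈ d.gr (k + 1) :=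
  mem_iSup_of_mem j (Submodule.mem_map_of_mem hf)

lemma E_gr {k : ℕ} {f : W} (hf : f ∈ d.gr k) : d.E f = (k : K) • f := by
  induction k generalizing f with
  | zero =>
    obtain ⟨c, rfl⟩ := mem_span_singleton.1 hf
    rw [map_smul, E_vac]; simp
  | succ k ih =>
    refine d.gr_succ_induction (P := fun f => d.E f = ((k + 1 : ℕ) : K) • f) (fun w f hf => ?_)
      (by simp) (fun f g hf hg => by rw [map_add, hf, hg, smul_add]) hf
    rw [E_m, ih hf, map_smul]
    push_cast
    rw [add_smul, one_smul]

lemma p_gr_zero {f : W} (hf : f ∈ d.gr 0) (i : J) : d.p i f = 0 := by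
  obtain ⟨c, rfl⟩ := mem_span_singleton.1 hf
  rw [map_smul, d.p_vac, smul_zero]

lemma p_mem {k : ℕ} {f : W} (hf : f ∈ d.gr (k + 1)) (i : J) : d.p i f ∈ d.gr k := by
  induction k generalizing f with
  | zero =>
    refine d.gr_succ_induction (P := fun f => d.p i f ∈ d.gr 0) (fun j f hf => ?_) (by simp)
      (fun f g hf hg => by rw [map_add]; exact add_mem hf hg) hf
    rw [d.p_m, d.p_gr_zero hf, map_zero, smul_zero, zero_add]
    split_ifs
    · exact hf
    · exact zero_mem _
  | succ k ih =>
    refine d.gr_succ_induction (P := fun f => d.p i f ∈ d.gr (k + 1)) (fun j f hf => ?_) (by simp)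
      (fun f g hf hg => by rw [map_add]; exact add_mem hf hg) hf
    rw [d.p_m]
    refine add_mem (smul_mem _ _ (d.m_mem (ih hf) j)) ?_
    split_ifs
    · exact hf
    · exact zero_mem _

lemma iSup_gr : ⨆ k, d.gr k = ⊤ := by
  refine d.gen _ (mem_iSup_of_mem 0 (mem_span_singleton_self _)) ?_
  intro i w hw
  refine Submodule.iSup_induction _ (motive := fun w => d.m i w ∈ ⨆ k, d.gr k) hw ?_ (by simp) ?_
  · intro k x hx
    exact mem_iSup_of_mem (k + 1) (d.m_mem hx i)
  · intro x y hx hy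
    rw [map_add]; exact add_mem hx hy

lemma induction_gr {P : W → Prop} (h : ∀ k, ∀ w ∈ d.gr k, P w) (h0 : P 0)
    (ha : ∀ f g, P f → P g → P (f + g)) (w : W) : P w :=
  Submodule.iSup_induction _ (motive := P) (d.iSup_gr ▸ Submodule.mem_top : w ∈ ⨆ k, d.gr k)
    h h0 ha

variable (t : J → End K M)

/-- The operator `f ↦ ∑ tⱼ ∘ f ∘ pⱼ`. -/
def Z : End K (W →ₗ[K] M) where
  toFun f := ∑ j, t j ∘ₗ f ∘ₗ d.p j
  map_add' f g := by
    rw [← sum_add_distrib]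
    refine sum_congr rfl fun j _ => ?_
    rw [LinearMap.add_comp, LinearMap.comp_add]
  map_smul' c f := by
    rw [RingHom.id_apply, smul_sum]
    refine sum_congr rfl fun j _ => ?_
    rw [LinearMap.smul_comp, LinearMap.comp_smul]

lemma Z_apply (f : W →ₗ[K] M) (w : W) : d.Z t f w = ∑ j, t j (f (d.p j w)) := by
  simp [Z, lsum_apply]

lemma eq_zero_of_Z (f : W →ₗ[K] M) (h : ∀ w, f (d.E w) = d.Z t f w) (h0 : f d.vac = 0) :
    f = 0 := by
  have : ∀ k, ∀ w ∈ d.gr k, f w = 0 := by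
    intro k
    induction k with
    | zero =>
      intro w hw
      obtain ⟨c, rfl⟩ := mem_span_singleton.1 hw
      rw [map_smul, h0, smul_zero]
    | succ k ih =>
      intro w hw
      have h1 := h w
      rw [d.E_gr hw, Z_apply, sum_eq_zero fun j _ => by rw [ih _ (d.p_mem hw j), map_zero],
        map_smul] at h1
      exact (smul_eq_zero.1 h1).resolve_left (by exact_mod_cast k.succ_ne_zero)
  ext w
  exact d.induction_gr (P := fun w => f w = 0) this (map_zero f)
    (fun x y hx hy => by rw [map_add, hx, hy, add_zero]) w

lemma exists_quant (c : M) : ∃ Q : W →ₗ[K] M, Q d.vac = c ∧ ∀ w, Q (d.E w) = d.Z t Q w := by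
  let f0 : W →ₗ[K] M := d.eps.smulRight c
  let f : ℕ → W →ₗ[K] M := fun n => (n.factorial : K)⁻¹ • (d.Z t ^ n) f0
  have hs : ∀ n, ((n + 1 : ℕ) : K) • f (n + 1) = d.Z t (f n) := by
    intro n
    simp only [f]
    rw [smul_smul, pow_succ', mul_apply, map_smul, inv_factorial_succ]
  have hf : ∀ n k, ∀ w ∈ d.gr k, n ≠ k → f n w = 0 := by
    intro n
    induction n with
    | zero =>
      intro k w hw hk
      obtain ⟨k, rfl⟩ := Nat.exists_eq_succ_of_ne_zero hk.symm
      refine d.gr_succ_induction (P := fun w => f 0 w = 0) (fun j w _ => ?_) (by simp)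
        (fun f g hf hg => by rw [map_add, hf, hg, add_zero]) hw
      simp [f, f0, d.eps_m]
    | succ n ih =>
      intro k w hw hk
      have h1 := dcongr_fun (hs n) w
      rw [lsmul_apply, Z_apply, sum_eq_zero] at h1
      · exact (smul_eq_zero.1 h1).resolve_left (by exact_mod_cast n.succ_ne_zero)
      · intro j _
        cases k with
        | zero => rw [d.p_gr_zero hw, map_zero, map_zero]
        | succ k => rw [ih k _ (d.p_mem hw j) (by omega), map_zero]
  have hfin : ∀ w, ∃ N, ∀ i, N ≤ i → f i w = 0 := by
    refine d.induction_gr (fun k w hw => ⟨k + 1, fun i hi => hf i k w hw (by omega)⟩)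
      ⟨0, fun i _ => map_zero _⟩ ?_
    rintro x y ⟨N, hN⟩ ⟨N', hN'⟩
    exact ⟨N + N', fun i hi => by rw [map_add, hN i (by omega), hN' i (by omega), add_zero]⟩
  have hQ : ∀ k, ∀ w ∈ d.gr k, lsum f hfin w = f k w := by
    intro k w hw
    rw [lsum_eq_sum (N := k + 1) _ _ fun i hi => hf i k w hw (by omega)]
    exact sum_eq_single_of_mem k (by simp) fun i _ hi => hf i k w hw hi
  refine ⟨lsum f hfin, ?_, ?_⟩
  · rw [hQ 0 d.vac (mem_span_singleton_self _)]
    simp [f, f0, d.eps_vac]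
  · refine d.induction_gr (fun k w hw => ?_) (by simp)
      (fun x y hx hy => by rw [map_add, map_add, map_add, hx, hy])
    rw [d.E_gr hw, map_smul, hQ k w hw, Z_apply]
    cases k with
    | zero =>
      simp only [d.p_gr_zero hw, map_zero, sum_const_zero]
      simp
    | succ k =>
      rw [← lsmul_apply, hs, Z_apply]
      exact sum_congr rfl fun j _ => by rw [hQ k _ (d.p_mem hw j)]

/-- The operator measuring the failure of the quantization recursion. -/
def N : End K (W →ₗ[K] M) := LinearMap.lcomp K M d.E - d.Z t

lemma N_apply (f : W →ₗ[K] M) (w : W) : d.N t f w = f (d.E w) - d.Z t f w := rfl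

lemma eq_zero_of_N (C : Submodule K (W →ₗ[K] M)) (hC : ∀ f ∈ C, d.N t f ∈ C) (w₀ : W)
    (hw : ∀ f ∈ C, d.N t f w₀ = 0) (f : W →ₗ[K] M) (hf : f ∈ C) (hv : f d.vac = 0) :
    f w₀ = 0 := by
  obtain ⟨n, hn⟩ : ∃ n, ∀ f : W →ₗ[K] M, (∀ k < n, ∀ w ∈ d.gr k, f w = 0) → f w₀ = 0 := by
    refine d.induction_gr (P := fun w₀ => ∃ n, ∀ f : W →ₗ[K] M,
      (∀ k < n, ∀ w ∈ d.gr k, f w = 0) → f w₀ = 0) (fun k w hw => ⟨k + 1, fun f h => h k (by omega)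
        w hw⟩) ⟨0, fun f _ => map_zero f⟩ ?_ w₀
    rintro x y ⟨n, hn⟩ ⟨n', hn'⟩
    exact ⟨n + n', fun f h => by
      rw [map_add, hn f fun k hk => h k (by omega), hn' f fun k hk => h k (by omega), add_zero]⟩
  have key : ∀ j k, k + 1 + j = n + 1 → ∀ f ∈ C, (∀ i < k + 1, ∀ w ∈ d.gr i, f w = 0) →
      f w₀ = 0 := by
    intro j
    induction j with
    | zero =>
      intro k hk f _ h
      exact hn f fun i hi => h i (by omega)
    | succ j ih =>
      intro k hk f hf h
      have h1 := ih (k + 1) (by omega) (((k + 1 : ℕ) : K) • f - d.N t f)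
        (C.sub_mem (C.smul_mem _ hf) (hC f hf)) ?_
      · rw [lsub_apply, hw f hf, sub_zero, lsmul_apply] at h1
        exact (smul_eq_zero.1 h1).resolve_left (by exact_mod_cast k.succ_ne_zero)
      · intro i hi w hw
        have hz : d.Z t f w = 0 := by
          rw [Z_apply]
          refine sum_eq_zero fun l _ => ?_
          cases i with
          | zero => rw [d.p_gr_zero hw, map_zero, map_zero]
          | succ i => rw [h i (by omega) _ (d.p_mem hw l), map_zero]
        rw [lsub_apply, N_apply, hz, sub_zero, d.E_gr hw, map_smul, lsmul_apply,
          ← sub_smul]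
        rcases Nat.lt_succ_iff_lt_or_eq.1 hi with hi | rfl
        · rw [h i hi w hw, smul_zero]
        · rw [sub_self, zero_smul]
  refine key n 0 (by omega) f hf fun i hi w hw => ?_
  obtain rfl : i = 0 := by omega
  obtain ⟨c, rfl⟩ := mem_span_singleton.1 hw
  rw [map_smul, hv, smul_zero]

end Fock

end

section

open TensorProduct

section

variable (K V : Type) [Field K] [CharZero K] [AddCommGroup V] [Module K V]

/-- The exterior algebra, as a Clifford algebra. -/
abbrev Ext := CliffordAlgebra (0 : QuadraticForm K V)

/-- The underlying space of the Weil algebra. -/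
def Wl := 𝒮 K V ⊗[K] Ext K V

instance : AddCommGroup (Wl K V) :=
  inferInstanceAs (AddCommGroup (𝒮 K V ⊗[K] Ext K V))

instance : Module K (Wl K V) :=
  inferInstanceAs (Module K (𝒮 K V ⊗[K] Ext K V))

/-- The canonical bilinear map to the Weil algebra. -/
def tm : 𝒮 K V →ₗ[K] Ext K V →ₗ[K] Wl K V :=
  TensorProduct.mk K (𝒮 K V) (Ext K V)

/-- Multiplication by even generators. -/
def wX : V →ₗ[K] End K (Wl K V) :=
  LinearMap.rTensorHom (Ext K V) ∘ₗ LinearMap.mul K _ ∘ₗ SymmetricAlgebra.ι K V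

/-- Multiplication by odd generators. -/
def wM : V →ₗ[K] End K (Wl K V) :=
  LinearMap.lTensorHom (𝒮 K V) ∘ₗ LinearMap.mul K _ ∘ₗ CliffordAlgebra.ι _

/-- Differentiation with respect to even generators. -/
def wD : (V →ₗ[K] K) →ₗ[K] End K (Wl K V) := LinearMap.rTensorHom (Ext K V) ∘ₗ pdL

/-- Differentiation with respect to odd generators. -/
def wP : (V →ₗ[K] K) →ₗ[K] End K (Wl K V) :=
  LinearMap.lTensorHom (𝒮 K V) ∘ₗ contr

/-- The parity operator. -/
def wA : End K (Wl K V) :=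
  LinearMap.lTensor (𝒮 K V) involute.toLinearMap

variable {K V}

@[simp] lemma wX_tmul (v : V) (s : 𝒮 K V) (f : Ext K V) :
    wX K V v (tm K V s f) = tm K V (SymmetricAlgebra.ι K V v * s) f := rfl

@[simp] lemma wM_tmul (v : V) (s : 𝒮 K V) (f : Ext K V) :
    wM K V v (tm K V s f) = tm K V s (CliffordAlgebra.ι _ v * f) := rfl

@[simp] lemma wD_tmul (ξ : V →ₗ[K] K) (s : 𝒮 K V) (f : Ext K V) :
    wD K V ξ (tm K V s f) = tm K V (pd ξ s) f := by
  rfl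

@[simp] lemma wP_tmul (ξ : V →ₗ[K] K) (s : 𝒮 K V) (f : Ext K V) :
    wP K V ξ (tm K V s f) = tm K V s (contr ξ f) := rfl

@[simp] lemma wA_tmul (s : 𝒮 K V) (f : Ext K V) :
    wA K V (tm K V s f) = tm K V s (involute f) := rfl

lemma eq_of_tm {M : Type} [AddCommGroup M] [Module K M] (F G : Wl K V →ₗ[K] M)
    (h : ∀ s f, F (tm K V s f) = G (tm K V s f)) (u) : F u = G u :=
  dcongr_fun (TensorProduct.ext' (M := 𝒮 K V) (N := Ext K V)
    (g := F) (h := G) h) u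

lemma wX_wX (v w : V) (u : Wl K V) : wX K V v (wX K V w u) = wX K V w (wX K V v u) :=
  eq_of_tm (wX K V v * wX K V w) (wX K V w * wX K V v)
    (fun s f => by simp [mul_apply, mul_left_comm]) u

lemma wX_wM (v w : V) (u : Wl K V) : wX K V v (wM K V w u) = wM K V w (wX K V v u) :=
  eq_of_tm (wX K V v * wM K V w) (wM K V w * wX K V v)
    (fun s f => by simp [mul_apply]) u

lemma ext_ι_ι (v w : V) (f : Ext K V) : CliffordAlgebra.ι _ v * (CliffordAlgebra.ι _ w * f)
    = - (CliffordAlgebra.ι _ w * (CliffordAlgebra.ι _ v * f)) := by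
  rw [eq_neg_iff_add_eq_zero, ← mul_assoc, ← mul_assoc, ← add_mul,
    CliffordAlgebra.ι_mul_ι_add_swap]
  simp [QuadraticMap.polar]

lemma wM_wM (v w : V) (u : Wl K V) : wM K V v (wM K V w u) = -wM K V w (wM K V v u) :=
  eq_of_tm (wM K V v * wM K V w) (-(wM K V w * wM K V v))
    (fun s f => by
      simp only [mul_apply, wM_tmul, lneg_apply]
      rw [ext_ι_ι, map_neg]) u

lemma wD_wX (ξ : V →ₗ[K] K) (v : V) (u : Wl K V) :
    wD K V ξ (wX K V v u) = wX K V v (wD K V ξ u) + ξ v • u :=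
  eq_of_tm (wD K V ξ * wX K V v) (wX K V v * wD K V ξ + ξ v • 1)
    (fun s f => by
      simp only [mul_apply, ladd_apply, lsmul_apply,
        one_apply, wX_tmul, wD_tmul]
      rw [pd_ι_mul, map_add, map_smul, ladd_apply, lsmul_apply]) u

lemma wD_wM (ξ : V →ₗ[K] K) (v : V) (u : Wl K V) :
    wD K V ξ (wM K V v u) = wM K V v (wD K V ξ u) :=
  eq_of_tm (wD K V ξ * wM K V v) (wM K V v * wD K V ξ)
    (fun s f => by simp [mul_apply]) u

lemma wP_wX (ξ : V →ₗ[K] K) (v : V) (u : Wl K V) :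
    wP K V ξ (wX K V v u) = wX K V v (wP K V ξ u) :=
  eq_of_tm (wP K V ξ * wX K V v) (wX K V v * wP K V ξ)
    (fun s f => by simp [mul_apply]) u

lemma wP_wM (ξ : V →ₗ[K] K) (v : V) (u : Wl K V) :
    wP K V ξ (wM K V v u) = ξ v • u - wM K V v (wP K V ξ u) :=
  eq_of_tm (wP K V ξ * wM K V v) (ξ v • 1 - wM K V v * wP K V ξ)
    (fun s f => by
      simp [mul_apply, contr_ι_mul]) u

lemma wD_wP (ξ η : V →ₗ[K] K) (u : Wl K V) :
    wD K V ξ (wP K V η u) = wP K V η (wD K V ξ u) :=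
  eq_of_tm (wD K V ξ * wP K V η) (wP K V η * wD K V ξ)
    (fun s f => by simp [mul_apply]) u

lemma wD_wD (ξ η : V →ₗ[K] K) (u : Wl K V) :
    wD K V ξ (wD K V η u) = wD K V η (wD K V ξ u) :=
  eq_of_tm (wD K V ξ * wD K V η) (wD K V η * wD K V ξ)
    (fun s f => by simp [mul_apply, pd_comm]) u

lemma wP_wP (ξ η : V →ₗ[K] K) (u : Wl K V) :
    wP K V ξ (wP K V η u) = -wP K V η (wP K V ξ u) :=
  eq_of_tm (wP K V ξ * wP K V η) (-(wP K V η * wP K V ξ))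
    (fun s f => by
      simp only [mul_apply, wP_tmul, lneg_apply]
      rw [CliffordAlgebra.contractLeft_comm, map_neg]) u

lemma wA_wX (v : V) (u : Wl K V) : wA K V (wX K V v u) = wX K V v (wA K V u) :=
  eq_of_tm (wA K V * wX K V v) (wX K V v * wA K V)
    (fun s f => by simp [mul_apply]) u

lemma wA_wM (v : V) (u : Wl K V) : wA K V (wM K V v u) = -wM K V v (wA K V u) :=
  eq_of_tm (wA K V * wM K V v) (-(wM K V v * wA K V))
    (fun s f => by simp [mul_apply]) u

lemma wA_wD (ξ : V →ₗ[K] K) (u : Wl K V) : wA K V (wD K V ξ u) = wD K V ξ (wA K V u) :=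
  eq_of_tm (wA K V * wD K V ξ) (wD K V ξ * wA K V)
    (fun s f => by simp [mul_apply]) u

lemma involute_contractLeft {Q : QuadraticForm K V} (ξ : V →ₗ[K] K) (f : CliffordAlgebra Q) :
    involute (contr ξ f)
      = -contr ξ (involute f) := by
  induction f using CliffordAlgebra.left_induction with
  | algebraMap r => simp
  | add x y hx hy => simp only [map_add, hx, hy]; abel
  | ι_mul x v hx =>
    simp only [contr_ι_mul, map_sub, map_smul, map_mul, map_neg, hx,
      CliffordAlgebra.involute_ι, neg_mul]
    simp

lemma wA_wP (ξ : V →ₗ[K] K) (u : Wl K V) : wA K V (wP K V ξ u) = -wP K V ξ (wA K V u) :=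
  eq_of_tm (wA K V * wP K V ξ) (-(wP K V ξ * wA K V))
    (fun s f => by simp [mul_apply, involute_contractLeft]) u

lemma tensor_gen (N : Submodule K (𝒮 K V ⊗[K] Ext K V)) (h1 : 1 ∈ N)
    (hX : ∀ v, ∀ w ∈ N,
      LinearMap.rTensor (Ext K V) (mulLeft K (SymmetricAlgebra.ι K V v)) w ∈ N)
    (hM : ∀ v, ∀ w ∈ N, LinearMap.lTensor (𝒮 K V)
      (mulLeft K (CliffordAlgebra.ι (0 : QuadraticForm K V) v)) w ∈ N) : N = ⊤ := by
  have hf : ∀ f : Ext K V, (1 : 𝒮 K V) ⊗ₜ[K] f ∈ N := by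
    intro f
    induction f using CliffordAlgebra.left_induction with
    | algebraMap r =>
      rw [Algebra.algebraMap_eq_smul_one, tmul_smul]
      exact N.smul_mem _ h1
    | add x y hx hy => rw [tmul_add]; exact N.add_mem hx hy
    | ι_mul x v hx => exact hM v _ hx
  have hs : ∀ s : 𝒮 K V, ∀ w ∈ N,
      LinearMap.rTensor (Ext K V) (mulLeft K s) w ∈ N := by
    intro s
    induction s using SymmetricAlgebra.induction with
    | algebraMap r =>
      intro w hw
      have : mulLeft K (algebraMap K (𝒮 K V) r) = r • LinearMap.id := by
        ext x; simp [asmul_def]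
      rw [this, LinearMap.rTensor_smul, lsmul_apply, LinearMap.rTensor_id]
      exact N.smul_mem _ hw
    | ι x => exact hX x
    | add a b ha hb =>
      intro w hw
      have : mulLeft K (a + b) = mulLeft K a + mulLeft K b := by
        ext x; simp [add_mul]
      rw [this, LinearMap.rTensor_add, ladd_apply]
      exact N.add_mem (ha w hw) (hb w hw)
    | mul a b ha hb =>
      intro w hw
      rw [LinearMap.mulLeft_mul, LinearMap.rTensor_comp, comp_apply]
      exact ha _ (hb w hw)
  rw [eq_top_iff, ← TensorProduct.span_tmul_eq_top, span_le]
  rintro _ ⟨s, f, rfl⟩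
  have := hs s _ (hf f)
  rwa [LinearMap.rTensor_tmul, mulLeft_apply, mul_one] at this

lemma wl_gen (N : Submodule K (Wl K V)) (h1 : tm K V 1 1 ∈ N)
    (hX : ∀ v, ∀ w ∈ N, wX K V v w ∈ N) (hM : ∀ v, ∀ w ∈ N, wM K V v w ∈ N) : N = ⊤ :=
  tensor_gen N h1 hX hM

variable (K V)

/-- The augmentation of the Weil algebra. -/
def wEps : Wl K V →ₗ[K] K := LinearMap.mul' K K ∘ₗ TensorProduct.map
    (SymmetricAlgebra.algebraMapInv : 𝒮 K V →ₐ[K] K).toLinearMap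
    (ExteriorAlgebra.algebraMapInv : ExteriorAlgebra K V →ₐ[K] K).toLinearMap

variable {K V} in
@[simp] lemma wEps_tm (s : 𝒮 K V) (f : Ext K V) : wEps K V (tm K V s f)
    = SymmetricAlgebra.algebraMapInv s * (ExteriorAlgebra.algebraMapInv : _ →ₐ[K] K) f := rfl

variable [FiniteDimensional K V]

/-- The Fock space structure on the Weil algebra. -/
def wFock : Fock K (Wl K V) (Fin (finrank K V) ⊕ Fin (finrank K V)) where
  m := Sum.elim (fun i => wX K V (finBasis K V i)) (fun i => wM K V (finBasis K V i))
  p := Sum.elim (fun i => wD K V ((finBasis K V).coord i))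
    (fun i => wP K V ((finBasis K V).coord i))
  s := Sum.elim (fun _ _ => 1) (fun _ => Sum.elim (fun _ => 1) (fun _ => -1))
  vac := tm K V 1 1
  eps := wEps K V
  m_m := by
    rintro (i | i) (j | j) w <;> simp only [Sum.elim_inl, Sum.elim_inr, one_smul, neg_smul]
    · exact wX_wX _ _ _
    · exact wX_wM _ _ _
    · exact (wX_wM _ _ _).symm
    · exact wM_wM _ _ _
  p_m := by
    rintro (i | i) (j | j) w <;> simp only [Sum.elim_inl, Sum.elim_inr, one_smul, neg_smul,
      reduceCtorEq, if_false, add_zero, Sum.inl.injEq, Sum.inr.injEq]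
    · rw [wD_wX]; congr 1
      rw [Module.Basis.coord_apply, Module.Basis.repr_self, Finsupp.single_apply, ite_smul,
        one_smul, zero_smul]
      simp only [eq_comm]
    · exact wD_wM _ _ _
    · exact wP_wX _ _ _
    · rw [wP_wM, sub_eq_neg_add]; congr 1
      rw [Module.Basis.coord_apply, Module.Basis.repr_self, Finsupp.single_apply, ite_smul,
        one_smul, zero_smul]
      simp only [eq_comm]
  s_mul := by rintro (i | i) (j | j) <;> simp
  p_vac := by rintro (i | i) <;> simp
  eps_vac := by simp
  eps_m := by
    rintro (i | i) w
    · refine eq_of_tm (wEps K V ∘ₗ wX K V _) 0 (fun s f => ?_) w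
      simp [SymmetricAlgebra.algebraMapInv]
    · refine eq_of_tm (wEps K V ∘ₗ wM K V _) 0 (fun s f => ?_) w
      simp
      right; left
      exact ExteriorAlgebra.lift_ι_apply _ _ _ _
  gen := by
    intro N h1 hN
    refine wl_gen N h1 (fun v w hw => ?_) (fun v w hw => ?_)
    · rw [← (finBasis K V).sum_repr v, map_sum, lsum_apply]
      refine N.sum_mem fun i _ => ?_
      rw [map_smul, lsmul_apply]
      exact N.smul_mem _ (hN (Sum.inl i) w hw)
    · rw [← (finBasis K V).sum_repr v, map_sum, lsum_apply]
      refine N.sum_mem fun i _ => ?_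
      rw [map_smul, lsmul_apply]
      exact N.smul_mem _ (hN (Sum.inr i) w hw)
end

end

section

/-- A nondegenerate invariant symmetric bilinear form. -/
structure InvForm (K L : Type) [Field K] [LieRing L] [LieAlgebra K L] where
  B : L →ₗ[K] L →ₗ[K] K
  symm : ∀ x y, B x y = B y x
  inv : ∀ x y z, B ⁅x, y⁆ z = B x ⁅y, z⁆
  nondeg : ∀ x, (∀ y, B x y = 0) → x = 0

namespace InvForm

variable {K L M : Type} [Field K] [CharZero K] [LieRing L] [LieAlgebra K L] [FiniteDimensional K L]
  [AddCommGroup M] [Module K M] (d : InvForm K L)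

lemma bijective : Function.Bijective d.B := by
  have hi : Function.Injective d.B := by
    rw [injective_iff_map_eq_zero]
    intro x hx
    exact d.nondeg x fun y => by rw [hx, lzero_apply]
  exact ⟨hi, (LinearMap.injective_iff_surjective_of_finrank_eq_finrank
    (Subspace.dual_finrank_eq (K := K) (V := L)).symm).1 hi⟩

/-- The chosen basis. -/
abbrev bas (K L : Type) [Field K] [LieRing L] [LieAlgebra K L] [FiniteDimensional K L] :=
  finBasis K L

/-- The dual basis. -/
def up (i : Fin (finrank K L)) : L := (d.bijective.2 ((bas K L).coord i)).choose

lemma B_up (i : Fin (finrank K L)) : d.B (d.up i) = (bas K L).coord i :=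
  (d.bijective.2 ((bas K L).coord i)).choose_spec

lemma sum_up (v : L) : ∑ i, d.B v (d.up i) • bas K L i = v := by
  conv_rhs => rw [← (bas K L).sum_repr v]
  refine sum_congr rfl fun i _ => ?_
  rw [d.symm, d.B_up, Module.Basis.coord_apply]

lemma sum_dn (v : L) : ∑ i, d.B v (bas K L i) • d.up i = v := by
  apply d.bijective.1
  ext w
  simp only [map_sum, map_smul, lsum_apply, lsmul_apply, B_up]
  conv_rhs => rw [← (bas K L).sum_repr w, map_sum]
  refine sum_congr rfl fun i _ => ?_
  rw [map_smul, smul_eq_mul, smul_eq_mul, mul_comm]; rfl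

lemma sum_adj (F : L →ₗ[K] L →ₗ[K] M) (S T : L →ₗ[K] L) (h : ∀ x y, d.B (S x) y = d.B x (T y)) :
    ∑ i, F (S (bas K L i)) (d.up i) = ∑ i, F (bas K L i) (T (d.up i)) := by
  have h1 : ∀ i, F (S (bas K L i)) (d.up i)
      = ∑ j, F (bas K L j) (d.B (T (d.up j)) (bas K L i) • d.up i) := by
    intro i
    conv_lhs => rw [← d.sum_up (S (bas K L i)), map_sum, lsum_apply]
    refine sum_congr rfl fun j _ => ?_
    rw [map_smul, map_smul, lsmul_apply, h, d.symm]
  rw [sum_congr rfl fun i _ => h1 i, sum_comm]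
  refine sum_congr rfl fun j _ => ?_
  rw [← map_sum, d.sum_dn]

lemma sum_swap (F : L →ₗ[K] L →ₗ[K] M) :
    ∑ i, F (bas K L i) (d.up i) = ∑ i, F (d.up i) (bas K L i) := by
  have h1 : ∀ i, F (bas K L i) (d.up i)
      = ∑ j, F (d.up j) (d.B (bas K L j) (bas K L i) • d.up i) := by
    intro i
    conv_lhs => rw [← d.sum_dn (bas K L i), map_sum, lsum_apply]
    refine sum_congr rfl fun j _ => ?_
    rw [map_smul, map_smul, lsmul_apply, d.symm]
  rw [sum_congr rfl fun i _ => h1 i, sum_comm]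
  refine sum_congr rfl fun j _ => ?_
  rw [← map_sum, d.sum_dn]

lemma ad_adj (x y z : L) : d.B ⁅x, y⁆ z = d.B y (-⁅x, z⁆) := by
  rw [← lie_skew, map_neg, lneg_apply, d.inv, map_neg]

/-- Bilinearity of an unbundled function. -/
structure Bil (K : Type) {L M : Type} [Field K] [AddCommGroup L] [Module K L] [AddCommGroup M]
    [Module K M] (F : L → L → M) : Prop where
  add_left : ∀ x x' y, F (x + x') y = F x y + F x' y
  smul_left : ∀ (c : K) x y, F (c • x) y = c • F x y
  add_right : ∀ x y y', F x (y + y') = F x y + F x y'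
  smul_right : ∀ (c : K) x y, F x (c • y) = c • F x y

/-- The bundled bilinear map. -/
def Bil.toLin {F : L → L → M} (hF : Bil K F) : L →ₗ[K] L →ₗ[K] M :=
  LinearMap.mk₂ K F hF.add_left hF.smul_left hF.add_right hF.smul_right

lemma sum_ad {F : L → L → M} (hF : Bil K F) (x : L) :
    ∑ i, F ⁅x, bas K L i⁆ (d.up i) = -∑ i, F (bas K L i) ⁅x, d.up i⁆ := by
  have := d.sum_adj hF.toLin (adL K L x) (-adL K L x) (fun y z => by
    simpa using d.ad_adj x y z)
  simp only [lneg_apply, map_neg, sum_neg_distrib] at this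
  exact this

lemma swap {F : L → L → M} (hF : Bil K F) :
    ∑ i, F (bas K L i) (d.up i) = ∑ i, F (d.up i) (bas K L i) := d.sum_swap hF.toLin

lemma Bil.ad {F : L → L → M} (hF : Bil K F) (x : L) : Bil K fun u v => F u ⁅x, v⁆ :=
  ⟨fun _ _ _ => hF.add_left _ _ _, fun _ _ _ => hF.smul_left _ _ _,
    fun _ _ _ => by rw [lie_add, hF.add_right], fun _ _ _ => by rw [lie_smul, hF.smul_right]⟩

lemma sum_ad' {F : L → L → M} (hF : Bil K F) (x : L) :
    ∑ i, F ⁅x, bas K L i⁆ (d.up i) = -∑ i, F (d.up i) ⁅x, bas K L i⁆ := by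
  rw [d.sum_ad hF, d.swap (hF.ad x)]

lemma sum_cyc {G : L → L → L → M} (h12 : ∀ w, Bil K fun u v => G u v w)
    (h23 : ∀ u, Bil K (G u)) :
    ∑ a, ∑ c, G ⁅bas K L a, bas K L c⁆ (d.up c) (d.up a)
      = ∑ a, ∑ c, G (d.up a) (d.up c) ⁅bas K L c, bas K L a⁆ := by
  have h1 : ∀ a, ∑ c, G ⁅bas K L a, bas K L c⁆ (d.up c) (d.up a)
      = ∑ c, G (bas K L c) ⁅d.up c, bas K L a⁆ (d.up a) := by
    intro a
    rw [d.sum_ad (h12 (d.up a)), ← sum_neg_distrib]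
    refine sum_congr rfl fun c _ => ?_
    rw [← lie_skew (d.up c), ← neg_one_smul K ⁅bas K L a, d.up c⁆, (h12 _).smul_right,
      neg_one_smul]
  rw [sum_congr rfl fun a _ => h1 a, sum_comm]
  have h2 : ∀ c, ∑ a, G (bas K L c) ⁅d.up c, bas K L a⁆ (d.up a)
      = ∑ a, G (bas K L c) (d.up a) ⁅bas K L a, d.up c⁆ := by
    intro c
    rw [d.sum_ad' (h23 (bas K L c)), ← sum_neg_distrib]
    refine sum_congr rfl fun a _ => ?_
    rw [← lie_skew (bas K L a), ← neg_one_smul K ⁅d.up c, bas K L a⁆, (h23 _).smul_right,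
      neg_one_smul]
  rw [sum_congr rfl fun a _ => h2 a]
  have h3 : Bil K fun u v => ∑ a, G u (d.up a) ⁅bas K L a, v⁆ := by
    refine ⟨fun _ _ _ => ?_, fun _ _ _ => ?_, fun _ _ _ => ?_, fun _ _ _ => ?_⟩
    · simp only [(h12 _).add_left, sum_add_distrib]
    · simp only [(h12 _).smul_left, smul_sum]
    · simp only [lie_add, (h23 _).add_right, sum_add_distrib]
    · simp only [lie_smul, (h23 _).smul_right, smul_sum]
  exact d.swap h3

end InvForm

end

section

open TensorProduct InvForm

section

variable (K L : Type) [Field K] [CharZero K] [LieRing L] [LieAlgebra K L] [FiniteDimensional K L]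

/-- The Koszul differential. -/
def wd : End K (Wl K L) := ∑ i, wX K L (bas K L i) * wP K L ((bas K L).coord i)

/-- The homotopy operator for the Koszul differential. -/
def wh : End K (Wl K L) := ∑ i, wM K L (bas K L i) * wD K L ((bas K L).coord i)

/-- The number operator. -/
def wE : End K (Wl K L) := ∑ i, wX K L (bas K L i) * wD K L ((bas K L).coord i)
  + ∑ i, wM K L (bas K L i) * wP K L ((bas K L).coord i)

variable {K L}

lemma wd_apply (u : Wl K L) :
    wd K L u = ∑ i, wX K L (bas K L i) (wP K L ((bas K L).coord i) u) := by simp [wd]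

lemma wh_apply (u : Wl K L) :
    wh K L u = ∑ i, wM K L (bas K L i) (wD K L ((bas K L).coord i) u) := by simp [wh]

lemma wE_apply (u : Wl K L) :
    wE K L u = ∑ i, wX K L (bas K L i) (wD K L ((bas K L).coord i) u)
      + ∑ i, wM K L (bas K L i) (wP K L ((bas K L).coord i) u) := by simp [wE]

lemma wFock_E (u : Wl K L) : (wFock K L).E u = wE K L u := by
  rw [Fock.E_apply, wE_apply, Fintype.sum_sum_type]; rfl

lemma sum_bas {M : Type} [AddCommGroup M] [Module K M] (F : L →ₗ[K] M) (v : L) :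
    ∑ i, (bas K L).coord i v • F (bas K L i) = F v := by
  conv_rhs => rw [← (bas K L).sum_repr v, map_sum]
  exact sum_congr rfl fun i _ => by rw [map_smul]; rfl

lemma sum_cobas {M : Type} [AddCommGroup M] [Module K M] (F : (L →ₗ[K] K) →ₗ[K] M)
    (ξ : L →ₗ[K] K) : ∑ i, ξ (bas K L i) • F ((bas K L).coord i) = F ξ := by
  have : ξ = ∑ i, ξ (bas K L i) • (bas K L).coord i := by
    ext v
    rw [← sum_bas ξ v]
    simp only [smul_eq_mul, lsum_apply, lsmul_apply, mul_comm]
  conv_rhs => rw [this, map_sum]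
  simp

lemma sum_cobas_apply (F : (L →ₗ[K] K) →ₗ[K] End K (Wl K L)) (ξ : L →ₗ[K] K) (u) :
    ∑ i, ξ (bas K L i) • F ((bas K L).coord i) u = F ξ u := by
  have := sum_cobas (M := End K (Wl K L)) F ξ
  rw [← this]
  simp only [lsum_apply, lsmul_apply]

lemma sum_bas_apply {M : Type} [AddCommGroup M] [Module K M] (F : L →ₗ[K] End K M) (v : L)
    (u) : ∑ i, (bas K L).coord i v • F (bas K L i) u = F v u := by
  conv_rhs => rw [← sum_bas F v]
  simp

lemma wD_wd (ξ : L →ₗ[K] K) (u : Wl K L) :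
    wD K L ξ (wd K L u) = wd K L (wD K L ξ u) + wP K L ξ u := by
  simp only [wd_apply, map_sum, wD_wX, wD_wP, sum_add_distrib, sum_cobas_apply]

lemma wP_wd (ξ : L →ₗ[K] K) (u : Wl K L) : wP K L ξ (wd K L u) = -wd K L (wP K L ξ u) := by
  simp only [wd_apply, map_sum, wP_wX]
  rw [← sum_neg_distrib]
  exact sum_congr rfl fun i _ => by rw [wP_wP, map_neg]

lemma wd_wX (v : L) (u : Wl K L) : wd K L (wX K L v u) = wX K L v (wd K L u) := by
  simp only [wd_apply, map_sum, wP_wX]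
  exact sum_congr rfl fun i _ => wX_wX _ _ _

lemma wd_wM (v : L) (u : Wl K L) : wd K L (wM K L v u) = wX K L v u - wM K L v (wd K L u) := by
  simp only [wd_apply, map_sum, wP_wM, map_sub, map_smul, sum_sub_distrib, sum_bas_apply,
    wX_wM]

lemma wd_wh (u : Wl K L) : wd K L (wh K L u) + wh K L (wd K L u) = wE K L u := by
  rw [wh_apply, wh_apply, map_sum]
  simp only [wd_wM, wD_wd, map_add, wE_apply, sum_add_distrib, sum_sub_distrib]
  abel

lemma wE_wX (v : L) (u : Wl K L) : wE K L (wX K L v u) = wX K L v (wE K L u) + wX K L v u := by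
  simp only [wE_apply, wD_wX, wP_wX, map_add, map_sum, map_smul, sum_add_distrib,
    sum_bas_apply, wX_wM]
  have : ∀ i w, wX K L (bas K L i) (wX K L v w) = wX K L v (wX K L (bas K L i) w) :=
    fun i w => wX_wX _ _ _
  simp only [this]
  abel

lemma wE_wP (ξ : L →ₗ[K] K) (u : Wl K L) :
    wE K L (wP K L ξ u) = wP K L ξ (wE K L u) - wP K L ξ u := by
  have : ∀ i, wP K L ((bas K L).coord i) (wP K L ξ u) = - wP K L ξ (wP K L ((bas K L).coord i) u) :=
    fun i => wP_wP _ _ _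
  simp only [wE_apply, wD_wP, wP_wX, wP_wM, map_add, map_sum, map_neg, this, sum_sub_distrib,
    sum_neg_distrib, sum_cobas_apply]
  abel

lemma wE_wD (ξ : L →ₗ[K] K) (u : Wl K L) :
    wE K L (wD K L ξ u) = wD K L ξ (wE K L u) - wD K L ξ u := by
  have : ∀ i, wD K L ((bas K L).coord i) (wD K L ξ u) = wD K L ξ (wD K L ((bas K L).coord i) u) :=
    fun i => wD_wD _ _ _
  simp only [wE_apply, ← wD_wP, wD_wX, wD_wM, map_add, map_sum, this, sum_add_distrib,
    sum_cobas_apply]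
  abel

lemma wE_wM (v : L) (u : Wl K L) : wE K L (wM K L v u) = wM K L v (wE K L u) + wM K L v u := by
  have : ∀ i w, wM K L (bas K L i) (wM K L v w) = -wM K L v (wM K L (bas K L i) w) :=
    fun i w => wM_wM _ _ _
  simp only [wE_apply, wD_wM, wP_wM, map_add, map_sub, map_sum, map_smul, sum_add_distrib,
    sum_sub_distrib, sum_bas_apply, wX_wM, this, sum_neg_distrib]
  abel

lemma wE_wd (u : Wl K L) : wE K L (wd K L u) = wd K L (wE K L u) := by
  conv_lhs => rw [wd_apply, map_sum]
  simp only [wE_wX, wE_wP, map_sub, sub_add_cancel]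
  rw [wd_apply]

lemma wA_wh (u : Wl K L) : wA K L (wh K L u) = -wh K L (wA K L u) := by
  simp only [wh_apply, map_sum, wA_wM, wA_wD, sum_neg_distrib]

lemma wA_wE (u : Wl K L) : wA K L (wE K L u) = wE K L (wA K L u) := by
  simp only [wE_apply, map_sum, map_add, wA_wM, wA_wD, wA_wX, wA_wP, map_neg, neg_neg]

end

namespace InvForm

variable {K L : Type} [Field K] [CharZero K] [LieRing L] [LieAlgebra K L] [FiniteDimensional K L]
  (d : InvForm K L)

/-- The contraction operators. -/
def wι (b : L) : End K (Wl K L) := wP K L (d.B b)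
  + ∑ i, wM K L ⁅b, bas K L i⁆ * wD K L ((bas K L).coord i)

lemma wι_apply (b : L) (u : Wl K L) : d.wι b u = wP K L (d.B b) u
    + ∑ i, wM K L ⁅b, bas K L i⁆ (wD K L ((bas K L).coord i) u) := by simp [wι]

lemma sum_brk (b v : L) (u : Wl K L) : ∑ i, (bas K L).coord i v • wM K L ⁅b, bas K L i⁆ u
    = wM K L ⁅b, v⁆ u := sum_bas_apply (wM K L ∘ₗ adL K L b) v u

lemma wι_wX (b v : L) (u : Wl K L) :
    d.wι b (wX K L v u) = wX K L v (d.wι b u) + wM K L ⁅b, v⁆ u := by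
  simp only [wι_apply, wP_wX, wD_wX, map_add, map_sum, map_smul, sum_add_distrib, sum_brk,
    wX_wM, add_assoc]

lemma wι_wM (b v : L) (u : Wl K L) :
    d.wι b (wM K L v u) = d.B b v • u - wM K L v (d.wι b u) := by
  have : ∀ i w, wM K L ⁅b, bas K L i⁆ (wM K L v w) = -wM K L v (wM K L ⁅b, bas K L i⁆ w) :=
    fun i w => wM_wM _ _ _
  simp only [wι_apply, wP_wM, wD_wM, map_add, map_sum, this, sum_neg_distrib]
  abel

lemma wD_wι (ξ : L →ₗ[K] K) (b : L) (u : Wl K L) :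
    wD K L ξ (d.wι b u) = d.wι b (wD K L ξ u) := by
  simp only [wι_apply, map_add, map_sum, wD_wP, wD_wM]
  congr 1
  exact sum_congr rfl fun i _ => by rw [wD_wD]

lemma wP_wι (ξ : L →ₗ[K] K) (b : L) (u : Wl K L) : wP K L ξ (d.wι b u)
    = ∑ i, ξ ⁅b, bas K L i⁆ • wD K L ((bas K L).coord i) u - d.wι b (wP K L ξ u) := by
  simp only [wι_apply, map_add, map_sum, wP_wM, sum_sub_distrib, wD_wP]
  rw [wP_wP]
  abel

lemma wι_wh (b : L) (u : Wl K L) : d.wι b (wh K L u) + wh K L (d.wι b u) = wD K L (d.B b) u := by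
  rw [wh_apply, wh_apply, map_sum]
  simp only [wι_wM, wD_wι, sum_sub_distrib, sum_cobas_apply]
  abel

lemma wE_wι (b : L) (u : Wl K L) :
    wE K L (d.wι b u) = d.wι b (wE K L u) - wP K L (d.B b) u := by
  simp only [wι_apply, map_add, map_sum, wE_wP, wE_wM, wE_wD, map_sub, sub_add_cancel]
  abel

end InvForm

end

section

open TensorProduct InvForm

section

variable {K V A : Type} [Field K] [CharZero K] [AddCommGroup V] [Module K V]
  [FiniteDimensional K V] [Ring A] [Algebra K A]

lemma sg_mul_of_commute (e : V →ₗ[K] A) (h : ∀ x y, e x * e y = e y * e x)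
    (P Q : 𝒮 K V) : sg e (P * Q) = sg e P * sg e Q := by
  have hc := Algebra.isMulCommutative_adjoin K (s := Set.range e) (by
    rintro _ ⟨x, rfl⟩ _ ⟨y, rfl⟩; exact h x y)
  let _ : CommRing (Algebra.adjoin K (Set.range e)) :=
    { (inferInstance : Ring (Algebra.adjoin K (Set.range e))) with mul_comm := hc.is_comm.comm }
  let e' : V →ₗ[K] Algebra.adjoin K (Set.range e) :=
    LinearMap.codRestrict (Subalgebra.toSubmodule (Algebra.adjoin K (Set.range e))) e
      (fun x => Algebra.subset_adjoin ⟨x, rfl⟩)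
  have he : ∀ P, sg e P = (Algebra.adjoin K (Set.range e)).val (slift e' P) :=
    fun P => by rw [← sg_of_commute, map_sg]; rfl
  rw [he, he, he, map_mul, map_mul]

lemma commute_sg (e : V →ₗ[K] A) (a : A) (h : ∀ x, Commute a (e x)) (P : 𝒮 K V) :
    Commute a (sg e P) := by
  refine dp_induction (p := fun P => Commute a (sg e P)) (fun x n => ?_) (by simp)
    (fun P Q hP hQ => by rw [map_add]; exact hP.add_right hQ)
    (fun c P hP => by rw [map_smul]; exact hP.smul_right c) P
  rw [sg_dp, dvp]
  exact ((h x).pow_right n).smul_right _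

end

namespace InvForm

variable {K L : Type} [Field K] [CharZero K] [LieRing L] [LieAlgebra K L] [FiniteDimensional K L]
  (d : InvForm K L)

/-- The quadratic correction term. -/
def lamW : L →ₗ[K] End K (Wl K L) where
  toFun x := (2⁻¹ : K) • ∑ a, wM K L ⁅x, bas K L a⁆ * wM K L (d.up a)
  map_add' x y := by simp only [add_lie, map_add, add_mul, sum_add_distrib, smul_add]
  map_smul' c x := by
    simp only [smul_lie, map_smul, smul_mul_assoc, ← smul_sum, RingHom.id_apply]
    rw [smul_comm]

/-- The horizontal even operators. -/
def hat : L →ₗ[K] End K (Wl K L) where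
  toFun x := wX K L x - d.lamW x
  map_add' x y := by rw [map_add, map_add]; abel
  map_smul' c x := by rw [map_smul, map_smul, RingHom.id_apply, smul_sub]

lemma lamW_apply (x : L) (u : Wl K L) : d.lamW x u
    = (2⁻¹ : K) • ∑ a, wM K L ⁅x, bas K L a⁆ (wM K L (d.up a) u) := by
  simp [lamW]

lemma hat_apply (x : L) (u : Wl K L) : d.hat x u = wX K L x u - d.lamW x u := rfl

lemma lamW_wX (x v : L) (u : Wl K L) : d.lamW x (wX K L v u) = wX K L v (d.lamW x u) := by
  simp only [lamW_apply, map_smul, map_sum, wX_wM]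

lemma lamW_wM (x v : L) (u : Wl K L) : d.lamW x (wM K L v u) = wM K L v (d.lamW x u) := by
  simp only [lamW_apply, map_smul, map_sum]
  congr 1
  refine sum_congr rfl fun a _ => ?_
  rw [wM_wM (d.up a), map_neg, wM_wM _ v, neg_neg]

lemma lamW_lamW (x y : L) (u : Wl K L) : d.lamW x (d.lamW y u) = d.lamW y (d.lamW x u) := by
  conv_lhs => rw [lamW_apply (x := y), map_smul, map_sum]
  simp only [lamW_wM]
  rw [lamW_apply (x := y)]

lemma hat_wM (x v : L) (u : Wl K L) : d.hat x (wM K L v u) = wM K L v (d.hat x u) := by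
  simp only [hat_apply, map_sub, lamW_wM, wX_wM]

lemma hat_hat (x y : L) (u : Wl K L) : d.hat x (d.hat y u) = d.hat y (d.hat x u) := by
  simp only [hat_apply, map_sub, lamW_wX, d.lamW_lamW x y, wX_wX x y]
  abel

lemma wA_hat (x : L) (u : Wl K L) : wA K L (d.hat x u) = d.hat x (wA K L u) := by
  simp only [hat_apply, map_sub, wA_wX, lamW_apply, map_smul, map_sum, wA_wM, map_neg, neg_neg]

lemma sum_B_left (b : L) (F : L →ₗ[K] End K (Wl K L)) (u : Wl K L) :
    ∑ a, d.B b (d.up a) • F (bas K L a) u = F b u := by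
  conv_rhs => rw [← d.sum_up b]
  simp

lemma sum_B_right (b : L) (F : L →ₗ[K] End K (Wl K L)) (u : Wl K L) :
    ∑ a, d.B b (bas K L a) • F (d.up a) u = F b u := by
  conv_rhs => rw [← d.sum_dn b]
  simp

lemma wι_lamW (b x : L) (u : Wl K L) :
    d.wι b (d.lamW x u) = d.lamW x (d.wι b u) + wM K L ⁅b, x⁆ u := by
  have h1 : ∑ a, d.B b ⁅x, bas K L a⁆ • wM K L (d.up a) u = wM K L ⁅b, x⁆ u := by
    simp only [← d.inv]; exact d.sum_B_right _ _ _
  have h2 : ∑ a, d.B b (d.up a) • wM K L ⁅x, bas K L a⁆ u = wM K L ⁅x, b⁆ u :=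
    d.sum_B_left b (wM K L ∘ₗ adL K L x) u
  have h3 : wM K L ⁅x, b⁆ u = - wM K L ⁅b, x⁆ u := by rw [← lie_skew, map_neg]; rfl
  rw [lamW_apply, lamW_apply]
  simp only [map_smul, map_sum, wι_wM, map_sub, sum_sub_distrib, h1, h2, h3]
  module

lemma wι_hat (b x : L) (u : Wl K L) : d.wι b (d.hat x u) = d.hat x (d.wι b u) := by
  simp only [hat_apply, map_sub, wι_wX, wι_lamW]
  abel

lemma wd_lamW (x : L) (u : Wl K L) : wd K L (d.lamW x u)
    = d.lamW x (wd K L u) + ∑ a, wX K L ⁅x, bas K L a⁆ (wM K L (d.up a) u) := by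
  have hb : Bil K fun v w => wX K L v (wM K L w u) :=
    ⟨fun _ _ _ => by simp, fun _ _ _ => by simp, fun _ _ _ => by simp, fun _ _ _ => by simp⟩
  have h1 := d.sum_ad' hb x
  simp only [wX_wM] at h1
  rw [lamW_apply, lamW_apply]
  simp only [map_smul, map_sum, wd_wM, map_sub, wX_wM, sum_sub_distrib] at h1 ⊢
  have h2 : ∑ a, wM K L ⁅x, bas K L a⁆ (wX K L (d.up a) u)
      = - ∑ a, wM K L (d.up a) (wX K L ⁅x, bas K L a⁆ u) := by rw [h1, neg_neg]
  rw [h2]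
  module

lemma sum_lamW (x : L) (u : Wl K L) :
    ∑ a, d.lamW ⁅bas K L a, x⁆ (wM K L (d.up a) u) = 0 := by
  let T : Wl K L := ∑ a, ∑ c,
    wM K L ⁅⁅bas K L a, x⁆, bas K L c⁆ (wM K L (d.up c) (wM K L (d.up a) u))
  let R : Wl K L := ∑ a, ∑ c,
    wM K L ⁅x, ⁅bas K L a, bas K L c⁆⁆ (wM K L (d.up c) (wM K L (d.up a) u))
  have h1 : T = R := by
    have hb : Bil K fun v w => ∑ c, wM K L ⁅v, bas K L c⁆ (wM K L (d.up c) (wM K L w u)) :=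
      ⟨fun _ _ _ => by simp [sum_add_distrib], fun _ _ _ => by simp [smul_sum],
        fun _ _ _ => by simp [sum_add_distrib], fun _ _ _ => by simp [smul_sum]⟩
    have h1 := d.sum_ad hb x
    have hb2 : ∀ w, Bil K fun v v' => wM K L v (wM K L v' (wM K L ⁅x, w⁆ u)) := fun w =>
      ⟨fun _ _ _ => by simp, fun _ _ _ => by simp, fun _ _ _ => by simp, fun _ _ _ => by simp⟩
    have hb3 : ∀ v, Bil K fun v' w => wM K L v (wM K L v' (wM K L ⁅x, w⁆ u)) := fun w =>
      ⟨fun _ _ _ => by simp, fun _ _ _ => by simp, fun _ _ _ => by simp, fun _ _ _ => by simp⟩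
    have h2 := d.sum_cyc (G := fun v v' w => wM K L v (wM K L v' (wM K L ⁅x, w⁆ u))) hb2 hb3
    have h3 : T = -∑ a, ∑ c, wM K L ⁅⁅x, bas K L a⁆, bas K L c⁆
        (wM K L (d.up c) (wM K L (d.up a) u)) := by
      simp only [T, ← sum_neg_distrib]
      refine sum_congr rfl fun a _ => sum_congr rfl fun c _ => ?_
      rw [← lie_skew x, neg_lie, map_neg, lneg_apply]
      simp
    rw [h3, h1, neg_neg]
    refine h2.trans ?_
    simp only [R]
    rw [sum_comm]
    refine sum_congr rfl fun a _ => sum_congr rfl fun c _ => ?_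
    rw [wM_wM (d.up a), map_neg, wM_wM (d.up c), neg_neg]
  have h2 : T + T = -R := by
    conv_lhs => enter [2]; simp only [T]; rw [sum_comm]
    simp only [T, R, ← sum_add_distrib, ← sum_neg_distrib]
    refine sum_congr rfl fun a _ => sum_congr rfl fun c _ => ?_
    have hJ : ⁅⁅bas K L a, x⁆, bas K L c⁆ - ⁅⁅bas K L c, x⁆, bas K L a⁆
        = -⁅x, ⁅bas K L a, bas K L c⁆⁆ := by
      rw [leibniz_lie x, ← lie_skew (bas K L a) x, ← lie_skew ⁅bas K L c, x⁆,
        ← lie_skew x (bas K L c), neg_lie, lie_neg]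
      abel
    rw [wM_wM (d.up a) (d.up c), map_neg, ← sub_eq_add_neg, ← lsub_apply, ← map_sub, hJ,
      map_neg, lneg_apply]
  have h3 : (3 : K) • T = 0 := by
    rw [h1] at h2 ⊢
    linear_combination (norm := module) h2
  have h4 : T = 0 := (smul_eq_zero.1 h3).resolve_left (by norm_num)
  simp only [lamW_apply, ← smul_sum]
  exact (congrArg _ h4).trans (smul_zero _)

lemma wd_hat (x : L) (u : Wl K L) : wd K L (d.hat x u)
    = d.hat x (wd K L u) + ∑ a, d.hat ⁅bas K L a, x⁆ (wM K L (d.up a) u) := by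
  simp only [hat_apply, map_sub, sum_sub_distrib, d.sum_lamW, wd_wX, wd_lamW, sub_zero]
  have : ∀ a, wX K L ⁅bas K L a, x⁆ (wM K L (d.up a) u)
      = -wX K L ⁅x, bas K L a⁆ (wM K L (d.up a) u) := fun a => by
    rw [← lie_skew, map_neg, lneg_apply]
  simp only [this, sum_neg_distrib]
  abel

/-- The action of the symmetric algebra by horizontal operators. -/
def hatS : 𝒮 K L →ₗ[K] End K (Wl K L) := sg d.hat

lemma hatS_mul (P Q : 𝒮 K L) : d.hatS (P * Q) = d.hatS P * d.hatS Q :=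
  sg_mul_of_commute _ (fun x y => lext fun u => d.hat_hat x y u) P Q

lemma hatS_comm (T : End K (Wl K L)) (h : ∀ x u, T (d.hat x u) = d.hat x (T u))
    (P : 𝒮 K L) (u : Wl K L) : T (d.hatS P u) = d.hatS P (T u) :=
  lcongr_fun (commute_sg d.hat T (fun x => lext (h x)) P).eq u

lemma wι_hatS (b : L) (P : 𝒮 K L) (u : Wl K L) :
    d.wι b (d.hatS P u) = d.hatS P (d.wι b u) := d.hatS_comm _ (d.wι_hat b) P u

lemma wA_hatS (P : 𝒮 K L) (u : Wl K L) :
    wA K L (d.hatS P u) = d.hatS P (wA K L u) := d.hatS_comm _ d.wA_hat P u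

lemma wM_hatS (v : L) (P : 𝒮 K L) (u : Wl K L) :
    wM K L v (d.hatS P u) = d.hatS P (wM K L v u) :=
  d.hatS_comm _ (fun x u => (d.hat_wM x v u).symm) P u

lemma wd_hatS (P : 𝒮 K L) (u : Wl K L) : wd K L (d.hatS P u)
    = d.hatS P (wd K L u) + ∑ a, d.hatS (adD (bas K L a) P) (wM K L (d.up a) u) := by
  refine dp_induction (p := fun P => wd K L (d.hatS P u)
    = d.hatS P (wd K L u) + ∑ a, d.hatS (adD (bas K L a) P) (wM K L (d.up a) u)) (fun x n => ?_)
    (by simp) (fun P Q hP hQ => ?_) (fun c P hP => ?_) P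
  · induction n with
    | zero =>
      rw [dp_zero]; simp [hatS]
    | succ n ih =>
      have hn : ((n + 1 : ℕ) : K) ≠ 0 := by exact_mod_cast n.succ_ne_zero
      have hx : ∀ y, d.hatS (ι K L y) = d.hat y := fun y => sg_ι _ _
      have h1 := congrArg (wd K L) (lcongr_fun (congrArg d.hatS (ι_mul_dp x n)) u)
      have h2 := lcongr_fun (congrArg d.hatS (ι_mul_dp x n)) (wd K L u)
      have h3 : ∀ a v, d.hatS (adD (bas K L a) (ι K L x * dp x n)) v = _ := fun a v =>
        lcongr_fun (congrArg (fun P => d.hatS (adD (bas K L a) P)) (ι_mul_dp x n)) v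
      rw [hatS_mul, mul_apply, hx, wd_hat, ih] at h1
      rw [hatS_mul, mul_apply, hx] at h2
      simp only [leibniz, smul_eq_mul, map_add, hatS_mul, ladd_apply,
        mul_apply, hx, adD, der_ι, comp_apply, adL_apply, Derivation.map_smul,
        map_smul, lsmul_apply] at h3
      apply smul_right_injective _ hn
      change _ • _ = _ • _
      rw [smul_add, smul_sum]
      simp only [map_smul, lsmul_apply] at h1 h2
      simp only [adD]
      rw [← h1, ← h2, ← sum_congr rfl fun a _ => h3 a (wM K L (d.up a) u)]
      simp only [wM_hatS, map_add, map_sum, sum_add_distrib, add_assoc, adD]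
      congr 2
      refine sum_congr rfl fun a _ => ?_
      rw [d.hatS_comm _ (d.hat_hat _)]
  · simp only [map_add, ladd_apply, hP, hQ, sum_add_distrib]; abel
  · rw [map_smul, lsmul_apply, map_smul, hP, lsmul_apply, smul_add,
      smul_sum]
    simp only [Derivation.map_smul, map_smul, lsmul_apply]

lemma wd_hatS_of_isInv {P : 𝒮 K L} (hP : IsInv K P) (u : Wl K L) :
    wd K L (d.hatS P u) = d.hatS P (wd K L u) := by
  rw [wd_hatS, sum_eq_zero, add_zero]
  intro a _
  rw [hP, map_zero, lzero_apply]

end InvForm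

end

section

open TensorProduct InvForm

/-- An algebra with the operators of a noncommutative Weil algebra. -/
structure WeilData {K L : Type} [Field K] [CharZero K] [LieRing L] [LieAlgebra K L]
    (d : InvForm K L) (A : Type) [Ring A] [Algebra K A] where
  e : L →ₗ[K] A
  x : L →ₗ[K] A
  al : A →ₐ[K] A
  dd : A
  e_e : ∀ a b, e a * e b + e b * e a = algebraMap K A (d.B a b)
  x_e : ∀ a b, x a * e b = e b * x a + e ⁅a, b⁆
  al_e : ∀ a, al (e a) = -e a
  al_x : ∀ a, al (x a) = x a
  dd_e : ∀ a, dd * e a + e a * dd = x a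
  dd_x : ∀ a, dd * x a = x a * dd
  hor : ∀ u, al u = -u → (∀ b, e b * u = al u * e b) → u = 0

namespace WeilData

variable {K L A : Type} [Field K] [CharZero K] [LieRing L] [LieAlgebra K L]
  [FiniteDimensional K L] {d : InvForm K L} [Ring A] [Algebra K A] (q : WeilData d A)

/-- The differential. -/
def D : End K A := mulLeft K q.dd - mulRight K q.dd ∘ₗ q.al.toLinearMap

/-- The contractions. -/
def I (b : L) : End K A :=
  mulLeft K (q.e b) - mulRight K (q.e b) ∘ₗ q.al.toLinearMap

lemma D_apply (u : A) : q.D u = q.dd * u - q.al u * q.dd := rfl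

lemma I_apply (b : L) (u : A) : q.I b u = q.e b * u - q.al u * q.e b := rfl

lemma D_x (v : L) (u : A) : q.D (q.x v * u) = q.x v * q.D u := by
  simp only [D_apply, map_mul, q.al_x, mul_sub, ← mul_assoc, q.dd_x]

lemma D_e (v : L) (u : A) : q.D (q.e v * u) = q.x v * u - q.e v * q.D u := by
  simp only [D_apply, map_mul, q.al_e, mul_sub, ← q.dd_e]
  noncomm_ring

lemma I_x (b v : L) (u : A) : q.I b (q.x v * u) = q.x v * q.I b u + q.e ⁅b, v⁆ * u := by
  simp only [I_apply, map_mul, q.al_x, mul_sub, ← mul_assoc, q.x_e]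
  rw [← lie_skew b v, map_neg]
  noncomm_ring

lemma I_e (b v : L) (u : A) : q.I b (q.e v * u) = d.B b v • u - q.e v * q.I b u := by
  have := congrArg (· * u) (q.e_e b v)
  simp only [← asmul_def] at this
  rw [← this]
  simp only [I_apply, map_mul, q.al_e, mul_sub]
  noncomm_ring

lemma al_x_mul (v : L) (u : A) : q.al (q.x v * u) = q.x v * q.al u := by
  rw [map_mul, q.al_x]

lemma al_e_mul (v : L) (u : A) : q.al (q.e v * u) = -(q.e v * q.al u) := by
  rw [map_mul, q.al_e, neg_mul]

/-- Left multiplications by generators. -/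
def t : Fin (finrank K L) ⊕ Fin (finrank K L) → End K A :=
  Sum.elim (fun i => mulLeft K (q.x (bas K L i)))
    (fun i => mulLeft K (q.e (bas K L i)))

/-- Left multiplications by generators, twisted by parity. -/
def t' : Fin (finrank K L) ⊕ Fin (finrank K L) → End K A :=
  Sum.elim (fun i => mulLeft K (q.x (bas K L i)))
    (fun i => -mulLeft K (q.e (bas K L i)))

/-- The operator `f ↦ ∑ tⱼ ∘ f ∘ ∂ⱼ`. -/
abbrev Z : End K (Wl K L →ₗ[K] A) := (wFock K L).Z q.t

/-- The twisted version of `Z`. -/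
abbrev Z' : End K (Wl K L →ₗ[K] A) := (wFock K L).Z q.t'

lemma Z_apply (f : Wl K L →ₗ[K] A) (w : Wl K L) : q.Z f w
    = ∑ i, q.x (bas K L i) * f (wD K L ((bas K L).coord i) w)
      + ∑ i, q.e (bas K L i) * f (wP K L ((bas K L).coord i) w) := by
  rw [Fock.Z_apply, Fintype.sum_sum_type]; rfl

lemma Z'_apply (f : Wl K L →ₗ[K] A) (w : Wl K L) : q.Z' f w
    = ∑ i, q.x (bas K L i) * f (wD K L ((bas K L).coord i) w)
      - ∑ i, q.e (bas K L i) * f (wP K L ((bas K L).coord i) w) := by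
  rw [Fock.Z_apply, Fintype.sum_sum_type, sub_eq_add_neg, ← sum_neg_distrib]; rfl

lemma sum_coord_e (v : L) (u : A) :
    ∑ i, (bas K L).coord i v • (q.e (bas K L i) * u) = q.e v * u := by
  conv_rhs => rw [← sum_bas q.e v, sum_mul]
  simp only [smul_mul_assoc]

lemma sum_coord_x (v : L) (u : A) :
    ∑ i, (bas K L).coord i v • (q.x (bas K L i) * u) = q.x v * u := by
  conv_rhs => rw [← sum_bas q.x v, sum_mul]
  simp only [smul_mul_assoc]

lemma sum_coord_f (f : Wl K L →ₗ[K] A) (F : (L →ₗ[K] K) →ₗ[K] End K (Wl K L))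
    (ξ : L →ₗ[K] K) (w) : ∑ i, ξ (bas K L i) • f (F ((bas K L).coord i) w) = f (F ξ w) := by
  rw [← sum_cobas_apply F ξ w, map_sum]
  simp only [map_smul]

lemma D_Z (f : Wl K L →ₗ[K] A) (w : Wl K L) : q.D (q.Z f w) - q.Z f (wd K L w)
    = q.Z' (q.D ∘ₗ f - f ∘ₗ wd K L) w := by
  simp only [Z_apply, Z'_apply, map_add, map_sum, D_x, D_e, wD_wd, wP_wd, lsub_apply,
    comp_apply, mul_sub, mul_add, mul_neg, map_neg, sum_sub_distrib,
    sum_add_distrib, sum_neg_distrib]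
  abel

lemma I_Z (b : L) (f : Wl K L →ₗ[K] A) (w : Wl K L) : q.I b (q.Z f w) - q.Z f (d.wι b w)
    = f (wP K L (d.B b) w) + q.Z' (q.I b ∘ₗ f - f ∘ₗ d.wι b) w := by
  have h : ∑ i, q.e (bas K L i) * ∑ j, (bas K L).coord i ⁅b, bas K L j⁆ •
      f (wD K L ((bas K L).coord j) w) = ∑ j, q.e ⁅b, bas K L j⁆ *
        f (wD K L ((bas K L).coord j) w) := by
    simp only [mul_sum]
    rw [sum_comm]
    refine sum_congr rfl fun j _ => ?_
    rw [← q.sum_coord_e]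
    simp only [mul_smul_comm]
  simp only [Z_apply, Z'_apply, map_add, map_sum, map_smul, I_x, I_e, wD_wι, wP_wι,
    lsub_apply, comp_apply, mul_sub, mul_add, mul_neg, map_neg, map_sub,
    sum_sub_distrib, sum_add_distrib, sum_neg_distrib, h, sum_coord_f]
  abel

lemma al_Z (f : Wl K L →ₗ[K] A) (w : Wl K L) : q.al (q.Z f w) - q.Z f (wA K L w)
    = q.Z' (q.al.toLinearMap ∘ₗ f - f ∘ₗ wA K L) w := by
  have h1 : ∀ i, wD K L ((bas K L).coord i) (wA K L w) = wA K L (wD K L ((bas K L).coord i) w) :=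
    fun i => (wA_wD _ _).symm
  have h2 : ∀ i, wP K L ((bas K L).coord i) (wA K L w) = -wA K L (wP K L ((bas K L).coord i) w) :=
    fun i => by rw [wA_wP, neg_neg]
  simp only [Z_apply, Z'_apply, map_add, map_sum, al_x_mul, al_e_mul, h1, h2, lsub_apply,
    comp_apply, mul_sub, mul_add, mul_neg, map_neg, sum_sub_distrib,
    sum_add_distrib, sum_neg_distrib, AlgHom.toLinearMap_apply]
  abel

/-- Linear maps compatible with differentials, contractions and parity. -/
def C : Submodule K (Wl K L →ₗ[K] A) where
  carrier := {f | (∀ w, q.D (f w) = f (wd K L w)) ∧ (∀ b w, q.I b (f w) = f (d.wι b w)) ∧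
    ∀ w, q.al (f w) = f (wA K L w)}
  zero_mem' := by simp
  add_mem' := by
    rintro f g ⟨h1, h2, h3⟩ ⟨h4, h5, h6⟩
    exact ⟨fun w => by simp [h1, h4], fun b w => by simp [h2, h5], fun w => by simp [h3, h6]⟩
  smul_mem' := by
    rintro c f ⟨h1, h2, h3⟩
    exact ⟨fun w => by simp [h1], fun b w => by simp [h2], fun w => by simp [h3]⟩

lemma wd_vac : wd K L (wFock K L).vac = 0 := by
  rw [wd_apply]
  exact sum_eq_zero fun i _ => by
    rw [show wP K L ((bas K L).coord i) (wFock K L).vac = 0 from (wFock K L).p_vac (Sum.inr i),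
      map_zero]

lemma wι_vac (b : L) : d.wι b (wFock K L).vac = 0 := by
  rw [wι_apply, sum_eq_zero fun i _ => by
    rw [show wD K L ((bas K L).coord i) (wFock K L).vac = 0 from (wFock K L).p_vac (Sum.inl i),
      map_zero], add_zero, ← sum_cobas_apply]
  exact sum_eq_zero fun i _ => by
    rw [show wP K L ((bas K L).coord i) (wFock K L).vac = 0 from (wFock K L).p_vac (Sum.inr i),
      smul_zero]

lemma wA_vac : wA K L (wFock K L).vac = (wFock K L).vac := by
  change wA K L (tm K L 1 1) = tm K L 1 1
  rw [wA_tmul, map_one involute]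

/-- A quantization map. -/
def Q : Wl K L →ₗ[K] A := ((wFock K L).exists_quant q.t 1).choose

lemma Q_vac : q.Q (wFock K L).vac = 1 := ((wFock K L).exists_quant q.t 1).choose_spec.1

lemma Q_wE (w : Wl K L) : q.Q (wE K L w) = q.Z q.Q w := by
  rw [← wFock_E]; exact ((wFock K L).exists_quant q.t 1).choose_spec.2 w

lemma Q_mem : q.Q ∈ q.C := by
  refine ⟨fun w => ?_, fun b w => ?_, fun w => ?_⟩
  · have := (wFock K L).eq_zero_of_Z q.t' (q.D ∘ₗ q.Q - q.Q ∘ₗ wd K L) (fun w => by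
      rw [← D_Z, wFock_E, lsub_apply, comp_apply, comp_apply, Q_wE,
        ← wE_wd, Q_wE])
      (by simp [wd_vac, Q_vac, D_apply])
    exact sub_eq_zero.1 (lcongr_fun this w)
  · have := (wFock K L).eq_zero_of_Z q.t' (q.I b ∘ₗ q.Q - q.Q ∘ₗ d.wι b) (fun w => by
      have h : d.wι b (wE K L w) = wE K L (d.wι b w) + wP K L (d.B b) w := by
        rw [wE_wι, sub_add_cancel]
      have h2 := q.I_Z b q.Q w
      rw [wFock_E, lsub_apply, comp_apply, comp_apply, Q_wE, h,
        map_add, Q_wE, ← sub_sub, h2, add_sub_cancel_left])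
      (by simp [wι_vac, Q_vac, I_apply])
    exact sub_eq_zero.1 (lcongr_fun this w)
  · have := (wFock K L).eq_zero_of_Z q.t' (q.al.toLinearMap ∘ₗ q.Q - q.Q ∘ₗ wA K L) (fun w => by
      rw [← al_Z, wFock_E, lsub_apply, comp_apply, comp_apply, Q_wE,
        wA_wE, Q_wE]; rfl)
      (by simp [wA_vac, Q_vac])
    exact sub_eq_zero.1 (lcongr_fun this w)

/-- The number operator defect. -/
abbrev N : End K (Wl K L →ₗ[K] A) := (wFock K L).N q.t

lemma N_apply (f : Wl K L →ₗ[K] A) (w : Wl K L) : q.N f w = f (wE K L w) - q.Z f w := by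
  rw [Fock.N_apply, wFock_E]

lemma N_mem (f : Wl K L →ₗ[K] A) (hf : f ∈ q.C) : q.N f ∈ q.C := by
  obtain ⟨h1, h2, h3⟩ := hf
  have e1 : q.D ∘ₗ f - f ∘ₗ wd K L = 0 := by ext w; simp [h1]
  have e2 : ∀ b, q.I b ∘ₗ f - f ∘ₗ d.wι b = 0 := fun b => by ext w; simp [h2]
  have e3 : q.al.toLinearMap ∘ₗ f - f ∘ₗ wA K L = 0 := by ext w; simp [h3]
  refine ⟨fun w => ?_, fun b w => ?_, fun w => ?_⟩
  · have := q.D_Z f w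
    rw [e1, map_zero, lzero_apply, sub_eq_zero] at this
    rw [N_apply, N_apply, map_sub, h1, this, wE_wd]
  · have := q.I_Z b f w
    rw [e2, map_zero, lzero_apply, add_zero] at this
    rw [N_apply, N_apply, map_sub, h2, eq_add_of_sub_eq this, wE_wι, map_sub]
    abel
  · have := q.al_Z f w
    rw [e3, map_zero, lzero_apply, sub_eq_zero] at this
    rw [N_apply, N_apply, map_sub, h3, this, wA_wE]

lemma N_eq_zero (f : Wl K L →ₗ[K] A) (hf : f ∈ q.C) (w : Wl K L) (hd : wd K L w = 0)
    (hι : ∀ b, d.wι b w = 0) (hA : wA K L w = w) : q.N f w = 0 := by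
  obtain ⟨h1, h2, h3⟩ := hf
  have key : f (wh K L w) - ∑ i, q.e (bas K L i) * f (wD K L ((bas K L).coord i) w) = 0 := by
    apply q.hor
    · simp only [map_sub, map_sum, al_e_mul, h3, wA_wh, wA_wD, hA, map_neg,
        sum_neg_distrib]
      abel
    · intro b
      have e1 : d.wι b (wh K L w) = wD K L (d.B b) w := by
        rw [← d.wι_wh b w, hι, map_zero, add_zero]
      have e2 : ∀ ξ, d.wι b (wD K L ξ w) = 0 := fun ξ => by rw [← d.wD_wι, hι, map_zero]
      rw [← sub_eq_zero, ← I_apply]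
      simp only [map_sub, map_sum, I_e, h2, e1, e2, map_zero, mul_zero, sub_zero, sum_coord_f,
        sub_self]
  have k2 := congrArg q.D key
  have e1 : wd K L (wh K L w) = wE K L w := by rw [← wd_wh w, hd, map_zero, add_zero]
  have e2 : ∀ ξ, wd K L (wD K L ξ w) = - wP K L ξ w := fun ξ => by
    rw [eq_neg_iff_add_eq_zero, ← wD_wd, hd, map_zero]
  simp only [map_sub, map_sum, D_e, h1, e1, e2, map_zero, map_neg, mul_neg, sub_neg_eq_add,
    sum_add_distrib] at k2
  rw [N_apply, Z_apply, k2]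

lemma eq_zero_of_mem (f : Wl K L →ₗ[K] A) (hf : f ∈ q.C) (h0 : f (wFock K L).vac = 0)
    (w : Wl K L) (hd : wd K L w = 0) (hι : ∀ b, d.wι b w = 0) (hA : wA K L w = w) : f w = 0 :=
  (wFock K L).eq_zero_of_N q.t q.C q.N_mem w (fun f hf => q.N_eq_zero f hf w hd hι hA) f hf h0

/-- The quantization of horizontal elements. -/
def QS (P : 𝒮 K L) : A := q.Q (d.hatS P (wFock K L).vac)

lemma QS_mul {P R : 𝒮 K L} (hP : IsInv K P) (hR : IsInv K R) :
    q.QS (R * P) = q.QS P * q.QS R := by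
  obtain ⟨h1, h2, h3⟩ := q.Q_mem
  have hd : ∀ {P}, IsInv K P → wd K L (d.hatS P (wFock K L).vac) = 0 := fun hP => by
    rw [d.wd_hatS_of_isInv hP, wd_vac, map_zero]
  have hι : ∀ b P, d.wι b (d.hatS P (wFock K L).vac) = 0 := fun b P => by
    rw [d.wι_hatS, wι_vac, map_zero]
  have hA : ∀ P, wA K L (d.hatS P (wFock K L).vac) = d.hatS P (wFock K L).vac := fun P => by
    rw [d.wA_hatS, wA_vac]
  have c1 : q.al (q.QS R) = q.QS R := by rw [QS, h3, hA]
  have c2 : q.dd * q.QS R = q.QS R * q.dd := by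
    have := h1 (d.hatS R (wFock K L).vac)
    rw [hd hR, map_zero, D_apply, sub_eq_zero] at this
    rw [← c1]; exact (congrArg (q.dd * ·) c1).trans this
  have c3 : ∀ b, q.e b * q.QS R = q.QS R * q.e b := fun b => by
    have := h2 b (d.hatS R (wFock K L).vac)
    rw [hι, map_zero, I_apply, sub_eq_zero] at this
    rw [← c1]; exact (congrArg (q.e b * ·) c1).trans this
  have key := q.eq_zero_of_mem (q.Q ∘ₗ d.hatS R - mulRight K (q.QS R) ∘ₗ q.Q)
    (q.C.sub_mem ⟨fun w => ?_, fun b w => ?_, fun w => ?_⟩ ⟨fun w => ?_, fun b w => ?_, fun w => ?_⟩)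
    ?_ (d.hatS P (wFock K L).vac) (hd hP) (fun b => hι b P) (hA P)
  · rw [lsub_apply, sub_eq_zero] at key
    rw [QS, d.hatS_mul]
    exact key
  · rw [comp_apply, h1, d.wd_hatS_of_isInv hR]; rfl
  · rw [comp_apply, h2, d.wι_hatS]; rfl
  · rw [comp_apply, h3, d.wA_hatS]; rfl
  · rw [comp_apply, comp_apply, mulRight_apply,
      mulRight_apply, ← h1, D_apply, D_apply, map_mul, c1, sub_mul, mul_assoc, mul_assoc,
      mul_assoc, ← c2]
  · rw [comp_apply, comp_apply, mulRight_apply,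
      mulRight_apply, ← h2, I_apply, I_apply, map_mul, c1, sub_mul, mul_assoc, mul_assoc,
      mul_assoc, ← c3]
  · rw [comp_apply, comp_apply, mulRight_apply,
      mulRight_apply, ← h3, map_mul, c1]
  · rw [lsub_apply, comp_apply, comp_apply, Q_vac,
      mulRight_apply, one_mul, QS, sub_self]

end WeilData

end

section

open TensorProduct InvForm

section

variable {K A : Type} [Field K] [CharZero K] [Ring A] [Algebra K A]

lemma dvp_add_of_commute {a b : A} (h : Commute a b) (n : ℕ) :
    dvp K (a + b) n = ∑ p ∈ antidiagonal n, dvp K a p.1 * dvp K b p.2 := by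
  rw [dvp, h.add_pow', smul_sum]
  refine sum_congr rfl fun p hp => ?_
  obtain rfl : p.1 + p.2 = n := mem_anti.1 hp
  have h1 : (p.1.factorial : K) ≠ 0 := by exact_mod_cast p.1.factorial_ne_zero
  have h2 : (p.2.factorial : K) ≠ 0 := by exact_mod_cast p.2.factorial_ne_zero
  have h3 : ((p.1 + p.2).factorial : K) ≠ 0 := by exact_mod_cast (p.1 + p.2).factorial_ne_zero
  have h4 : (((p.1 + p.2).choose p.1 : ℕ) : K) * (p.1.factorial : K) * (p.2.factorial : K)
      = ((p.1 + p.2).factorial : K) := by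
    exact_mod_cast (by rw [Nat.choose_symm_add]; exact Nat.add_choose_mul_factorial_mul_factorial p.1 p.2 : (p.1 + p.2).choose p.1 * p.1.factorial * p.2.factorial = _)
  rw [← Nat.cast_smul_eq_nsmul K, smul_smul, dvp, dvp, smul_mul_smul_comm]
  congr 1
  field_simp
  linear_combination h4

end

namespace WeilData

variable {K L A : Type} [Field K] [CharZero K] [LieRing L] [LieAlgebra K L]
  [FiniteDimensional K L] {d : InvForm K L} [Ring A] [Algebra K A] (q : WeilData d A)

lemma wE_tm (s : 𝒮 K L) (f : Ext K L) : wE K L (tm K L s f)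
    = ∑ i, tm K L (ι K L (bas K L i) * pd ((bas K L).coord i) s) f
      + ∑ i, tm K L s (CliffordAlgebra.ι _ (bas K L i)
          * contr ((bas K L).coord i) f) := by
  simp [wE_apply]

lemma Z_tm (g : Wl K L →ₗ[K] A) (s : 𝒮 K L) (f : Ext K L) : q.Z g (tm K L s f)
    = ∑ i, q.x (bas K L i) * g (tm K L (pd ((bas K L).coord i) s) f)
      + ∑ i, q.e (bas K L i) * g (tm K L s
          (contr ((bas K L).coord i) f)) := by
  simp [Z_apply]

/-- The Gaussian integration data attached to an element. -/
def gauss (x : L) : GaussData K L (Ext K L) A where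
  ε := -1
  m := LinearMap.mul K _ ∘ₗ CliffordAlgebra.ι _
  p := contr
  vac := 1
  e := q.e
  B := d.B
  X := q.x x
  a := adL K L x
  q n := q.Q ∘ₗ tm K L (dp x n)
  κ := Fin (finrank K L)
  fin := inferInstance
  u k := ⁅x, bas K L k⁆
  v k := d.up k
  ε_mul := by norm_num
  p_m ξ w f := by
    simp only [comp_apply, LinearMap.mul_apply_apply, contr_ι_mul]
    module
  m_m w w' f := by
    simp only [comp_apply, LinearMap.mul_apply_apply, neg_smul, one_smul]
    exact ext_ι_ι w w' f
  p_p ξ η f := by rw [CliffordAlgebra.contractLeft_comm, neg_smul, one_smul]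
  p_vac ξ := CliffordAlgebra.contractLeft_one (Q := 0) ξ
  e_e w w' := by rw [neg_smul, one_smul, sub_neg_eq_add, q.e_e]
  X_e w := by rw [q.x_e, add_sub_cancel_left]; rfl
  q_vac := by rw [dp_zero]; exact q.Q_vac
  q_zero f := by
    have := q.Q_wE (tm K L (dp x 0) f)
    rw [wE_tm, Z_tm] at this
    simpa using this
  q_succ n f := by
    have := q.Q_wE (tm K L (dp x (n + 1)) f)
    rw [wE_tm, Z_tm] at this
    simp only [pd_dp_succ, map_smul, mul_smul_comm, lsmul_apply, q.sum_coord_x,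
      map_add, map_sum] at this
    have h : ∑ i, (bas K L).coord i x • q.Q (tm K L (ι K L (bas K L i) * dp x n) f)
        = ((n + 1 : ℕ) : K) • q.Q (tm K L (dp x (n + 1)) f) := by
      have h0 : ((n + 1 : ℕ) : K) • q.Q (tm K L (dp x (n + 1)) f)
          = q.Q (tm K L (ι K L x * dp x n) f) := by
        rw [ι_mul_dp, map_smul, lsmul_apply, map_smul]
      rw [h0]
      exact sum_bas (q.Q ∘ₗ (tm K L).flip f ∘ₗ mulRight K (dp x n) ∘ₗ ι K L) x
    rw [h] at this
    simpa using this
  B_swap w w' := by rw [d.symm]; ring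
  sum_u w := by
    simp only [← d.inv]
    rw [d.sum_dn, adL_apply, lie_skew]
  sum_v w := by
    have := congrArg (adL K L x) (d.sum_up w)
    simp only [map_sum, map_smul, adL_apply] at this
    simp only [neg_mul, one_mul, neg_smul, sum_neg_distrib, this, adL_apply]

lemma dvp_wX (x : L) (n : ℕ) (s : 𝒮 K L) (f : Ext K L) :
    dvp K (wX K L x) n (tm K L s f) = tm K L (dp x n * s) f := by
  have : ∀ n, (wX K L x ^ n) (tm K L s f) = tm K L (ι K L x ^ n * s) f := by
    intro n
    induction n with
    | zero => simp
    | succ n ih => rw [pow_succ', mul_apply, ih, wX_tmul, pow_succ', mul_assoc]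
  rw [dvp, lsmul_apply, this, dp, smul_mul_assoc, map_smul, lsmul_apply]

lemma dvp_lamW (x : L) (n : ℕ) (s : 𝒮 K L) (f : Ext K L) :
    dvp K (-d.lamW x) n (tm K L s f) = tm K L s (dvp K (-(q.gauss x).lam) n f) := by
  have h0 : ∀ f, (-d.lamW x) (tm K L s f) = tm K L s ((-(q.gauss x).lam) f) := fun f => by
    rw [lneg_apply, lneg_apply, lamW_apply, GaussData.lam_apply, map_neg,
      map_smul, map_sum]
    rfl
  have : ∀ n, ((-d.lamW x) ^ n) (tm K L s f) = tm K L s (((-(q.gauss x).lam) ^ n) f) := by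
    intro n
    induction n with
    | zero => simp
    | succ n ih => rw [pow_succ', mul_apply, ih, h0, pow_succ', mul_apply]
  rw [dvp, lsmul_apply, this, dvp, lsmul_apply, map_smul]

lemma QS_dp (x : L) (n : ℕ) : q.QS (dp x n) = (q.gauss x).Ψ n := by
  have hc : Commute (wX K L x) (-d.lamW x) :=
    lext fun u => by
      simp only [mul_apply, lneg_apply, map_neg, lamW_wX]
  have hh : d.hat x = wX K L x + -d.lamW x := sub_eq_add_neg _ _
  rw [QS, hatS, sg_dp, hh, dvp_add_of_commute hc, lsum_apply, map_sum]
  refine sum_congr rfl fun p _ => ?_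
  rw [mul_apply]
  change q.Q (dvp K (wX K L x) p.1 (dvp K (-d.lamW x) p.2 (tm K L 1 1))) = _
  rw [q.dvp_lamW, dvp_wX, mul_one]
  rfl

/-- The generators commuting with the Clifford generators. -/
def y : L →ₗ[K] A where
  toFun x := q.x x - (2⁻¹ : K) • ∑ k, q.e ⁅x, bas K L k⁆ * q.e (d.up k)
  map_add' a b := by
    simp only [add_lie, map_add, add_mul, sum_add_distrib, smul_add]; abel
  map_smul' c a := by
    simp only [smul_lie, map_smul, smul_mul_assoc, ← smul_sum, RingHom.id_apply, smul_sub]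
    rw [smul_comm]

lemma QS_eq (P : 𝒮 K L) : q.QS P = sg q.y (jop (dW K) (adL K L) P) := by
  let T : 𝒮 K L →ₗ[K] A := q.Q ∘ₗ LinearMap.applyₗ (wFock K L).vac ∘ₗ d.hatS
  have : T = sg q.y ∘ₗ jop (dW K) (adL K L) := by
    refine ext_dp fun x n => ?_
    change q.QS (dp x n) = _
    rw [QS_dp, GaussData.Ψ_eq, comp_apply, jop_dp, map_sum]
    refine sum_congr rfl fun p _ => ?_
    rw [map_smul, sg_dp, jsym]
    have h : (fun i => -(2⁻¹ * (-1 : K)) * hC K i * trace K L (adL K L x ^ i))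
        = fun i => dW K i * trace K L (adL K L x ^ i) := by
      ext i; rw [dW]; ring
    change expSeq K (fun i => -(2⁻¹ * (-1 : K)) * hC K i * trace K L (adL K L x ^ i)) p.1
      • dvp K (q.y x) p.2 = _
    rw [h]
  exact lcongr_fun this P

lemma sg_y_mul {P R : 𝒮 K L} (hP : IsInv K P) (hR : IsInv K R) :
    sg q.y (jop (dW K) (adL K L) (P * R)) = sg q.y (jop (dW K) (adL K L) P)
      * sg q.y (jop (dW K) (adL K L) R) := by
  rw [← QS_eq, ← QS_eq, ← QS_eq, mul_comm, q.QS_mul hP hR]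

end WeilData

end

section

open TensorProduct InvForm

namespace InvForm

section

variable {K L A : Type} [Field K] [CharZero K] [LieRing L] [LieAlgebra K L]
  [FiniteDimensional K L] (d : InvForm K L) [Ring A] [Algebra K A]

/-- The spin element attached to `ad x`. -/
def spin (e : L →ₗ[K] A) : L →ₗ[K] A where
  toFun x := (2⁻¹ : K) • ∑ k, e ⁅x, bas K L k⁆ * e (d.up k)
  map_add' a b := by
    simp only [add_lie, map_add, add_mul, sum_add_distrib, smul_add]
  map_smul' c a := by
    simp only [smul_lie, map_smul, smul_mul_assoc, ← smul_sum, RingHom.id_apply]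
    rw [smul_comm]

lemma spin_apply (e : L →ₗ[K] A) (x : L) :
    d.spin e x = (2⁻¹ : K) • ∑ k, e ⁅x, bas K L k⁆ * e (d.up k) := rfl

lemma bil_mul (f g : L →ₗ[K] A) : Bil K fun u v => f u * g v :=
  ⟨fun _ _ _ => by simp [add_mul], fun _ _ _ => by simp, fun _ _ _ => by simp [mul_add],
    fun _ _ _ => by simp⟩

variable {d} {X e : L →ₗ[K] A} (hE : ∀ a b, e a * e b + e b * e a = algebraMap K A (d.B a b))
  (hX : ∀ a b, X a * X b = X b * X a + X ⁅a, b⁆) (hC : ∀ a b, X a * e b = e b * X a)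

include hE

lemma spin_e (x v : L) : d.spin e x * e v = e v * d.spin e x + e ⁅x, v⁆ := by
  have h : ∀ k, e ⁅x, bas K L k⁆ * e (d.up k) * e v = e v * (e ⁅x, bas K L k⁆ * e (d.up k))
      + d.B (d.up k) v • e ⁅x, bas K L k⁆ + d.B ⁅x, v⁆ (bas K L k) • e (d.up k) := by
    intro k
    have h1 := hE (d.up k) v
    have h2 := hE ⁅x, bas K L k⁆ v
    have h3 : d.B ⁅x, bas K L k⁆ v = -d.B ⁅x, v⁆ (bas K L k) := by
      rw [d.ad_adj, map_neg, d.symm]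
    rw [h3] at h2
    rw [map_neg, ← neg_eq_iff_eq_neg] at h2
    rw [asmul_def, Algebra.commutes, ← h1, asmul_def, ← h2]
    noncomm_ring
  simp only [spin_apply, smul_mul_assoc, mul_smul_comm, sum_mul, mul_sum, h,
    sum_add_distrib]
  have h4 : ∑ k, d.B (d.up k) v • e ⁅x, bas K L k⁆ = e ⁅x, v⁆ := by
    have := congrArg (fun z => e ⁅x, z⁆) (d.sum_up v)
    simpa [lie_sum, d.symm v] using this
  have h5 : ∑ k, d.B ⁅x, v⁆ (bas K L k) • e (d.up k) = e ⁅x, v⁆ := by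
    have := congrArg e (d.sum_dn ⁅x, v⁆)
    simpa using this
  rw [h4, h5]
  module

lemma spin_spin (x y : L) : d.spin e x * d.spin e y = d.spin e y * d.spin e x + d.spin e ⁅x, y⁆ := by
  have h : ∀ k, d.spin e x * (e ⁅y, bas K L k⁆ * e (d.up k))
      = (e ⁅y, bas K L k⁆ * e (d.up k)) * d.spin e x
        + e ⁅x, ⁅y, bas K L k⁆⁆ * e (d.up k) + e ⁅y, bas K L k⁆ * e ⁅x, d.up k⁆ := by
    intro k
    rw [← mul_assoc, spin_e hE, add_mul, mul_assoc, spin_e hE]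
    noncomm_ring
  have h1 := d.sum_ad (bil_mul (e ∘ₗ adL K L y) e) x
  simp only [comp_apply, adL_apply] at h1
  rw [spin_apply d e y, mul_smul_comm, mul_sum]
  simp only [h, sum_add_distrib]
  rw [← neg_eq_iff_eq_neg] at h1
  rw [← h1, spin_apply d e ⁅x, y⁆, smul_mul_assoc, sum_mul]
  simp only [lie_lie, map_sub, sub_mul, sum_sub_distrib]
  module

include hX hC

lemma X_spin (x y : L) : X x * d.spin e y = d.spin e y * X x := by
  rw [spin_apply, mul_smul_comm, smul_mul_assoc, mul_sum, sum_mul]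
  congr 1
  refine sum_congr rfl fun k _ => ?_
  rw [← mul_assoc, hC, mul_assoc, hC, mul_assoc]

lemma hat_inv (Y : L →ₗ[K] A) (hY : ∀ a b, (X a + d.spin e a) * Y b
    = Y b * (X a + d.spin e a) + Y ⁅a, b⁆) (x : L) :
    (X x + d.spin e x) * ∑ k, Y (bas K L k) * e (d.up k)
      = (∑ k, Y (bas K L k) * e (d.up k)) * (X x + d.spin e x) := by
  have h : ∀ k, (X x + d.spin e x) * (Y (bas K L k) * e (d.up k))
      = (Y (bas K L k) * e (d.up k)) * (X x + d.spin e x)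
        + Y ⁅x, bas K L k⁆ * e (d.up k) + Y (bas K L k) * e ⁅x, d.up k⁆ := by
    intro k
    have h2 : (X x + d.spin e x) * e (d.up k)
        = e (d.up k) * (X x + d.spin e x) + e ⁅x, d.up k⁆ := by
      rw [add_mul, hC, spin_e hE]; noncomm_ring
    rw [← mul_assoc, hY, add_mul, mul_assoc, h2]
    noncomm_ring
  rw [mul_sum, sum_mul]
  simp only [h, sum_add_distrib]
  rw [d.sum_ad (bil_mul Y e) x]
  abel

/-- The noncommutative Weil algebra structure built from commuting copies of the Lie algebra and
of the Clifford generators. -/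
def weilData (al : A →ₐ[K] A) (hae : ∀ a, al (e a) = -e a) (hax : ∀ a, al (X a) = X a)
    (hor : ∀ u, al u = -u → (∀ b, e b * u = al u * e b) → u = 0) : WeilData d A where
  e := e
  x := X + d.spin e
  al := al
  dd := ∑ k, X (bas K L k) * e (d.up k) + (3⁻¹ : K) • ∑ k, d.spin e (bas K L k) * e (d.up k)
  e_e := hE
  x_e a b := by rw [ladd_apply, add_mul, hC, spin_e hE]; noncomm_ring
  al_e := hae
  al_x a := by simp [spin_apply, hae, hax]
  dd_e v := by
    have h1 : ∀ k, X (bas K L k) * e (d.up k) * e v + e v * (X (bas K L k) * e (d.up k))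
        = d.B v (d.up k) • X (bas K L k) := by
      intro k
      rw [← mul_assoc (e v), ← hC, mul_assoc, mul_assoc, ← mul_add, hE, d.symm, ← Algebra.commutes,
        asmul_def]
    have h2 : ∀ k, d.spin e (bas K L k) * e (d.up k) * e v
          + e v * (d.spin e (bas K L k) * e (d.up k))
        = d.B v (d.up k) • d.spin e (bas K L k) + e ⁅v, bas K L k⁆ * e (d.up k) := by
      intro k
      have := spin_e hE (bas K L k) v
      rw [← sub_eq_iff_eq_add'] at this
      rw [← lie_skew v, map_neg, ← this, d.symm, asmul_def, Algebra.commutes, ← hE]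
      noncomm_ring
    have h3 : ∑ k, d.B v (d.up k) • X (bas K L k) = X v := by
      simpa using congrArg X (d.sum_up v)
    have h4 : ∑ k, d.B v (d.up k) • d.spin e (bas K L k) = d.spin e v := by
      simpa using congrArg (d.spin e) (d.sum_up v)
    have h5 : ∑ k, e ⁅v, bas K L k⁆ * e (d.up k) = (2 : K) • d.spin e v := by
      rw [spin_apply, smul_smul, mul_inv_cancel₀ two_ne_zero, one_smul]
    have h6 : (∑ k, X (bas K L k) * e (d.up k)) * e v + e v * ∑ k, X (bas K L k) * e (d.up k)
        = X v := by
      rw [sum_mul, mul_sum, ← sum_add_distrib, ← h3]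
      exact sum_congr rfl fun k _ => h1 k
    have h7 : (∑ k, d.spin e (bas K L k) * e (d.up k)) * e v
        + e v * ∑ k, d.spin e (bas K L k) * e (d.up k) = (3 : K) • d.spin e v := by
      rw [sum_mul, mul_sum, ← sum_add_distrib,
        sum_congr rfl fun k _ => h2 k, sum_add_distrib, h4, h5]
      module
    rw [add_mul, mul_add, smul_mul_assoc, mul_smul_comm, add_add_add_comm, h6, ← smul_add, h7,
      smul_smul, inv_mul_cancel₀ three_ne_zero, one_smul, ladd_apply]
  dd_x a := by
    rw [ladd_apply, add_mul, mul_add (X a + _), smul_mul_assoc, mul_smul_comm,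
      hat_inv hE hX hC X, hat_inv hE hX hC (d.spin e)]
    · intro a b
      rw [add_mul, X_spin hE hX hC, spin_spin hE]; noncomm_ring
    · intro a b
      rw [add_mul, ← X_spin hE hX hC, hX]; noncomm_ring
  hor := hor

lemma weilData_y (al : A →ₐ[K] A) (hae : ∀ a, al (e a) = -e a) (hax : ∀ a, al (X a) = X a)
    (hor : ∀ u, al u = -u → (∀ b, e b * u = al u * e b) → u = 0) :
    (weilData hE hX hC al hae hax hor).y = X := by
  ext x
  change (X x + d.spin e x) - d.spin e x = _
  abel

end

section

variable {K L : Type} [Field K] [CharZero K] [LieRing L] [LieAlgebra K L]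
  [FiniteDimensional K L] (d : InvForm K L)

/-- The quadratic form `½ B(v, v)`. -/
def quad : QuadraticForm K L := (2⁻¹ : K) • LinearMap.BilinMap.toQuadraticMap d.B

lemma quad_polar (v w : L) : QuadraticMap.polar d.quad v w = d.B v w := by
  simp only [QuadraticMap.polar, quad, _root_.smul_apply, LinearMap.BilinMap.toQuadraticMap_apply, map_add,
    ladd_apply, smul_eq_mul]
  rw [d.symm w v]; ring

/-- The Clifford algebra with coefficients in the enveloping algebra. -/
abbrev WA := 𝒰 K L ⊗[K] CliffordAlgebra d.quad

/-- Clifford generators. -/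
def waE : L →ₗ[K] d.WA :=
  (Algebra.TensorProduct.includeRight (R := K) (A := 𝒰 K L)
    (B := CliffordAlgebra d.quad)).toLinearMap ∘ₗ CliffordAlgebra.ι d.quad

/-- Lie algebra generators. -/
def waX : L →ₗ[K] d.WA :=
  (Algebra.TensorProduct.includeLeft (R := K) (S := K) (A := 𝒰 K L)
    (B := CliffordAlgebra d.quad)).toLinearMap ∘ₗ uι K L

/-- Parity. -/
def waA : d.WA →ₐ[K] d.WA :=
  Algebra.TensorProduct.map (AlgHom.id K _) involute

/-- Contractions. -/
def waP (ξ : L →ₗ[K] K) : End K d.WA :=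
  (contr (Q := d.quad) ξ).lTensor _

lemma waE_apply (v : L) : d.waE v = 1 ⊗ₜ CliffordAlgebra.ι d.quad v := rfl

lemma waX_apply (v : L) : d.waX v = uι K L v ⊗ₜ 1 := rfl

lemma waA_tmul (u : 𝒰 K L) (c : CliffordAlgebra d.quad) :
    d.waA (u ⊗ₜ c) = u ⊗ₜ involute c := rfl

lemma waP_tmul (ξ : L →ₗ[K] K) (u : 𝒰 K L) (c : CliffordAlgebra d.quad) :
    d.waP ξ (u ⊗ₜ c) = u ⊗ₜ contr ξ c := rfl

lemma wa_ext {M : Type} [AddCommGroup M] [Module K M] (F G : d.WA →ₗ[K] M)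
    (h : ∀ u c, F (u ⊗ₜ c) = G (u ⊗ₜ c)) (w : d.WA) : F w = G w :=
  lcongr_fun (TensorProduct.ext' h) w

lemma waE_waE (a b : L) : d.waE a * d.waE b + d.waE b * d.waE a = algebraMap K d.WA (d.B a b) := by
  rw [waE_apply, waE_apply, Algebra.TensorProduct.tmul_mul_tmul,
    Algebra.TensorProduct.tmul_mul_tmul, ← TensorProduct.tmul_add,
    CliffordAlgebra.ι_mul_ι_add_swap, quad_polar, mul_one, Algebra.algebraMap_eq_smul_one,
    TensorProduct.tmul_smul, ← Algebra.TensorProduct.one_def, Algebra.algebraMap_eq_smul_one]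

lemma waX_waX (a b : L) : d.waX a * d.waX b = d.waX b * d.waX a + d.waX ⁅a, b⁆ := by
  simp only [waX_apply, Algebra.TensorProduct.tmul_mul_tmul, mul_one, uι_mul_uι a b,
    TensorProduct.add_tmul]

lemma waX_waE (a b : L) : d.waX a * d.waE b = d.waE b * d.waX a := by
  simp only [waX_apply, waE_apply, Algebra.TensorProduct.tmul_mul_tmul, mul_one, one_mul]

lemma waA_waE (a : L) : d.waA (d.waE a) = -d.waE a := by
  rw [waE_apply, waA_tmul, CliffordAlgebra.involute_ι, TensorProduct.tmul_neg]

lemma waA_waX (a : L) : d.waA (d.waX a) = d.waX a := by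
  rw [waX_apply, waA_tmul, map_one]

lemma waP_waE (ξ : L →ₗ[K] K) (v : L) (u : d.WA) :
    d.waP ξ (d.waE v * u) = ξ v • u - d.waE v * d.waP ξ u := by
  refine d.wa_ext (d.waP ξ ∘ₗ mulLeft K (d.waE v))
    (ξ v • LinearMap.id - mulLeft K (d.waE v) ∘ₗ d.waP ξ) (fun a c => ?_) u
  simp only [comp_apply, mulLeft_apply, lsub_apply,
    lsmul_apply, LinearMap.id_apply, waE_apply, waP_tmul,
    Algebra.TensorProduct.tmul_mul_tmul, one_mul, contr_ι_mul,
    TensorProduct.tmul_sub, TensorProduct.tmul_smul]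

lemma waP_waP (ξ η : L →ₗ[K] K) (u : d.WA) : d.waP ξ (d.waP η u) = -d.waP η (d.waP ξ u) := by
  refine d.wa_ext (d.waP ξ ∘ₗ d.waP η) (-(d.waP η ∘ₗ d.waP ξ)) (fun a c => ?_) u
  simp only [comp_apply, lneg_apply, waP_tmul]
  rw [CliffordAlgebra.contractLeft_comm, TensorProduct.tmul_neg]

lemma waA_waP (ξ : L →ₗ[K] K) (u : d.WA) : d.waA (d.waP ξ u) = -d.waP ξ (d.waA u) := by
  refine d.wa_ext (d.waA.toLinearMap ∘ₗ d.waP ξ) (-(d.waP ξ ∘ₗ d.waA.toLinearMap))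
    (fun a c => ?_) u
  simp only [comp_apply, lneg_apply, AlgHom.toLinearMap_apply, waP_tmul,
    waA_tmul]
  rw [involute_contractLeft, TensorProduct.tmul_neg]

lemma waE_sub (b : L) (u : d.WA) : d.waE b * u - d.waA u * d.waE b = d.waP (d.B b) u := by
  refine d.wa_ext (mulLeft K (d.waE b)
    - mulRight K (d.waE b) ∘ₗ d.waA.toLinearMap) (d.waP (d.B b)) (fun a c => ?_) u
  simp only [comp_apply, lsub_apply, AlgHom.toLinearMap_apply, waP_tmul,
    waA_tmul, mulLeft_apply, mulRight_apply, waE_apply,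
    Algebra.TensorProduct.tmul_mul_tmul, one_mul, mul_one]
  rw [← TensorProduct.tmul_sub]
  congr 1
  induction c using CliffordAlgebra.left_induction with
  | algebraMap r => simp [Algebra.commutes]
  | add x y hx hy => rw [map_add, mul_add, add_mul, map_add, ← hx, ← hy]; abel
  | ι_mul c m hc =>
    have := CliffordAlgebra.ι_mul_ι_add_swap (Q := d.quad) b m
    rw [quad_polar] at this
    rw [contr_ι_mul, ← hc, asmul_def, ← this, map_mul,
      CliffordAlgebra.involute_ι]
    noncomm_ring

/-- Creation operators. -/
def waM (v : L) : End K d.WA := mulLeft K (d.waE v) - (2⁻¹ : K) • d.waP (d.B v)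

lemma waM_apply (v : L) (u : d.WA) : d.waM v u = d.waE v * u - (2⁻¹ : K) • d.waP (d.B v) u := rfl

lemma waP_waM (ξ : L →ₗ[K] K) (v : L) (u : d.WA) :
    d.waP ξ (d.waM v u) = ξ v • u - d.waM v (d.waP ξ u) := by
  rw [waM_apply, waM_apply, map_sub, waP_waE, map_smul, waP_waP]
  module

lemma waM_waM (v w : L) (u : d.WA) : d.waM v (d.waM w u) = -d.waM w (d.waM v u) := by
  have h := congrArg (· * u) (d.waE_waE v w)
  simp only [← asmul_def, add_mul, mul_assoc] at h
  simp only [waM_apply, map_sub, map_smul, waP_waE, mul_sub, mul_smul_comm, d.waP_waP (d.B v),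
    smul_sub, smul_neg]
  rw [d.symm w v]
  linear_combination (norm := module) h

lemma waA_waM (v : L) (u : d.WA) : d.waA (d.waM v u) = -d.waM v (d.waA u) := by
  rw [waM_apply, waM_apply, map_sub, map_mul, waA_waE, map_smul, waA_waP, neg_mul]
  module

/-- The number operator. -/
def waN : End K d.WA := ∑ i, d.waM (bas K L i) ∘ₗ d.waP ((bas K L).coord i)

lemma waN_apply (u : d.WA) : d.waN u
    = ∑ i, d.waM (bas K L i) (d.waP ((bas K L).coord i) u) := by
  simp [waN]

lemma waM_add (v w : L) (u : d.WA) : d.waM (v + w) u = d.waM v u + d.waM w u := by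
  have : d.waP (d.B v + d.B w) = d.waP (d.B v) + d.waP (d.B w) := by
    rw [waP, map_add, LinearMap.lTensor_add]; rfl
  simp only [waM_apply, map_add, add_mul, this, ladd_apply, smul_add]
  abel

lemma waM_smul (c : K) (v : L) (u : d.WA) : d.waM (c • v) u = c • d.waM v u := by
  have : d.waP (c • d.B v) = c • d.waP (d.B v) := by
    rw [waP, map_smul, LinearMap.lTensor_smul]; rfl
  simp only [waM_apply, map_smul, smul_mul_assoc, this, lsmul_apply, smul_sub]
  rw [smul_comm]

lemma waN_waM (v : L) (u : d.WA) : d.waN (d.waM v u) = d.waM v (d.waN u) + d.waM v u := by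
  rw [waN_apply, waN_apply, map_sum]
  have h : ∀ i, d.waM (bas K L i) (d.waP ((bas K L).coord i) (d.waM v u))
      = (bas K L).coord i v • d.waM (bas K L i) u
        + d.waM v (d.waM (bas K L i) (d.waP ((bas K L).coord i) u)) := by
    intro i
    rw [waP_waM, map_sub, map_smul, waM_waM]; abel
  have h2 : ∑ i, (bas K L).coord i v • d.waM (bas K L i) u = d.waM v u :=
    sum_bas (⟨⟨fun v => d.waM v u, fun v w => d.waM_add v w u⟩, fun c v => d.waM_smul c v u⟩ :
      L →ₗ[K] d.WA) v
  rw [sum_congr rfl fun i _ => h i, sum_add_distrib, h2, add_comm]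

/-- The homogeneous parts for the number operator and parity. -/
def waDeg (k : ℕ) : Submodule K d.WA :=
  LinearMap.ker (d.waN - (k : K) • LinearMap.id)
    ⊓ LinearMap.ker (d.waA.toLinearMap - ((-1) ^ k : K) • LinearMap.id)

lemma mem_waDeg (k : ℕ) (u : d.WA) : u ∈ d.waDeg k ↔ d.waN u = (k : K) • u
    ∧ d.waA u = ((-1) ^ k : K) • u := by
  simp [waDeg, sub_eq_zero]

/-- Words in the creation operators. -/
inductive IsWord : ℕ → d.WA → Prop
  | base (u : 𝒰 K L) : IsWord 0 (u ⊗ₜ 1)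
  | step (k : ℕ) (v : L) (u : d.WA) : IsWord k u → IsWord (k + 1) (d.waM v u)

lemma IsWord.mem_waDeg {k : ℕ} {u : d.WA} (h : d.IsWord k u) : u ∈ d.waDeg k := by
  induction h with
  | base u =>
    rw [InvForm.mem_waDeg, waN_apply, waA_tmul]
    simp [waP_tmul, CliffordAlgebra.contractLeft_one]
  | step k v u h ih =>
    rw [InvForm.mem_waDeg] at ih ⊢
    rw [waN_waM, waA_waM, ih.1, ih.2, map_smul, map_smul]
    constructor
    · push_cast; module
    · rw [pow_succ]; module

/-- The span of the words. -/
def wordSpan : Submodule K d.WA := span K {u | ∃ k, d.IsWord k u}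

lemma waM_mem (v : L) {u : d.WA} (h : u ∈ d.wordSpan) : d.waM v u ∈ d.wordSpan := by
  have : d.wordSpan ≤ d.wordSpan.comap (d.waM v) := by
    refine span_le.2 ?_
    rintro u ⟨k, hk⟩
    exact subset_span ⟨k + 1, .step k v u hk⟩
  exact this h

lemma waP_mem (ξ : L →ₗ[K] K) {u : d.WA} (h : u ∈ d.wordSpan) : d.waP ξ u ∈ d.wordSpan := by
  have : d.wordSpan ≤ d.wordSpan.comap (d.waP ξ) := by
    refine span_le.2 ?_
    rintro u ⟨k, hk⟩
    change d.waP ξ u ∈ d.wordSpan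
    induction hk with
    | base u =>
      rw [waP_tmul, CliffordAlgebra.contractLeft_one, TensorProduct.tmul_zero]
      exact zero_mem _
    | step k v u h ih =>
      rw [waP_waM]
      exact sub_mem (smul_mem _ _ (subset_span ⟨k, h⟩)) (d.waM_mem v ih)
  exact this h

lemma mem_wordSpan (u : d.WA) : u ∈ d.wordSpan := by
  induction u using TensorProduct.induction_on with
  | zero => exact zero_mem _
  | add x y hx hy => exact add_mem hx hy
  | tmul a c =>
    induction c using CliffordAlgebra.left_induction with
    | algebraMap r =>
      rw [Algebra.algebraMap_eq_smul_one, TensorProduct.tmul_smul]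
      exact smul_mem _ _ (subset_span ⟨0, .base a⟩)
    | add x y hx hy => rw [TensorProduct.tmul_add]; exact add_mem hx hy
    | ι_mul c v hc =>
      have : (a ⊗ₜ[K] (CliffordAlgebra.ι d.quad v * c) : d.WA) = d.waM v (a ⊗ₜ c)
          + (2⁻¹ : K) • d.waP (d.B v) (a ⊗ₜ c) := by
        rw [waM_apply, sub_add_cancel, waE_apply, Algebra.TensorProduct.tmul_mul_tmul, one_mul]
      rw [this]
      exact add_mem (d.waM_mem v hc) (smul_mem _ _ (d.waP_mem _ hc))

lemma _root_.Duflo.eq_zero_of_sum_eigen {M : Type} [AddCommGroup M] [Module K M]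
    (N : End K M) (w : ℕ → M) (hw : ∀ k, N (w k) = (k : K) • w k) (s : Finset ℕ) :
    ∀ c : ℕ → K, ∑ k ∈ s, c k • w k = 0 → ∀ k ∈ s, c k • w k = 0 := by
  induction s using Finset.induction_on with
  | empty => simp
  | insert a s ha ih =>
    intro c h
    have h1 := congrArg N h
    simp only [map_sum, map_smul, hw, map_zero] at h1
    rw [sum_insert ha] at h h1
    have h2 : ∑ k ∈ s, (c k * ((k : K) - a)) • w k = 0 := by
      have : ∀ k, (c k * ((k : K) - a)) • w k = c k • (k : K) • w k - (a : K) • c k • w k := by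
        intro k; module
      simp only [this, sum_sub_distrib, ← smul_sum]
      linear_combination (norm := module) h1 - (a : K) • h
    have h3 : ∀ k ∈ s, c k • w k = 0 := by
      intro k hk
      have := ih _ h2 k hk
      have hne : (k : K) - a ≠ 0 := by
        rw [sub_ne_zero]
        intro h
        exact ha (Nat.cast_injective h ▸ hk)
      rw [mul_comm, mul_smul] at this
      exact (smul_eq_zero.1 this).resolve_left hne
    intro k hk
    rcases mem_insert.1 hk with rfl | hk
    · rwa [sum_eq_zero h3, add_zero] at h
    · exact h3 k hk

lemma waHor (u : d.WA) (hu : d.waA u = -u) (h : ∀ b, d.waE b * u = d.waA u * d.waE b) : u = 0 := by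
  have hp : ∀ ξ, d.waP ξ u = 0 := by
    intro ξ
    obtain ⟨b, rfl⟩ := d.bijective.2 ξ
    rw [← waE_sub, h, sub_self]
  have hN : d.waN u = 0 := by simp [waN_apply, hp]
  have hle : d.wordSpan ≤ ⨆ k, d.waDeg k := by
    refine span_le.2 ?_
    rintro u ⟨k, hk⟩
    exact mem_iSup_of_mem k (hk.mem_waDeg)
  obtain ⟨f, hf, hsum⟩ := (Submodule.mem_iSup_iff_exists_finsupp _ _).1 (hle (d.mem_wordSpan u))
  simp only [InvForm.mem_waDeg] at hf
  rw [Finsupp.sum] at hsum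
  have h1 : ∀ k ∈ f.support, (k : K) • f k = 0 := by
    refine eq_zero_of_sum_eigen d.waN f (fun k => (hf k).1) _ (fun k => (k : K)) ?_
    rw [← hN, ← hsum, map_sum]
    exact sum_congr rfl fun k _ => (hf k).1.symm
  have h2 : u = f 0 := by
    rw [← hsum]
    refine sum_eq_single 0 (fun k hk h0 => ?_) (fun h0 => by simpa using h0)
    exact (smul_eq_zero.1 (h1 k hk)).resolve_left (by exact_mod_cast h0)
  have h3 : d.waA u = u := by rw [h2, (hf 0).2, pow_zero, one_smul]
  have h4 : (2 : K) • u = 0 := by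
    rw [two_smul]; nth_rewrite 1 [← h3]; rw [hu, neg_add_cancel]
  exact (smul_eq_zero.1 h4).resolve_left two_ne_zero

/-- The Duflo isomorphism for quadratic Lie algebras. -/
theorem dufloMul (d : InvForm K L) : DufloMul K L := by
  intro P R hP hR
  let q := weilData d.waE_waE d.waX_waX d.waX_waE d.waA d.waA_waE d.waA_waX d.waHor
  have hs : ∀ T, sg d.waX T = Algebra.TensorProduct.includeLeft (R := K) (S := K)
      (A := 𝒰 K L) (B := CliffordAlgebra d.quad) (Duflo.symm K L T) := by
    intro T
    rw [Duflo.symm, map_sg]; rfl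
  have h := q.sg_y_mul hP hR
  rw [weilData_y, hs, hs, hs, ← map_mul] at h
  have : Invertible (2 : K) := invertibleOfNonzero two_ne_zero
  exact Algebra.TensorProduct.includeLeft_injective
    (FaithfulSMul.algebraMap_injective K (CliffordAlgebra d.quad)) h

end

end InvForm

end

section

section

variable {K : Type} [Field K] [CharZero K] {V : Type} [AddCommGroup V] [Module K V]

/-- Divided powers indexed by integers, vanishing in negative degrees. -/
def dpz (x : V) (n : ℤ) : 𝒮 K V := if 0 ≤ n then dp x n.toNat else 0

lemma dpz_natCast (x : V) (n : ℕ) : dpz (K := K) x n = dp x n := by simp [dpz]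

lemma dpz_of_neg (x : V) {n : ℤ} (h : n < 0) : dpz (K := K) x n = 0 := if_neg (by omega)

lemma dpz_cases {p : ℤ → Prop} (h1 : ∀ n : ℕ, p n) (h2 : ∀ n : ℤ, n < 0 → p n) (n : ℤ) : p n := by
  rcases lt_or_ge n 0 with h | h
  · exact h2 n h
  · obtain ⟨m, rfl⟩ := Int.eq_ofNat_of_zero_le h; exact h1 m

lemma pd_dpz (ξ : V →ₗ[K] K) (x : V) (n : ℤ) : pd ξ (dpz x n) = ξ x • dpz x (n - 1) := by
  induction n using dpz_cases with
  | h2 n h => rw [dpz_of_neg x h, dpz_of_neg x (by omega), map_zero, smul_zero]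
  | h1 n =>
    rcases n with _ | n
    · rw [dpz_natCast, dpz_of_neg x (by simp), pd_dp_zero, smul_zero]
    · rw [dpz_natCast, pd_dp_succ, ← dpz_natCast]; congr 2; push_cast; ring

lemma itr_dpz [FiniteDimensional K V] {E M : Type} [AddCommGroup E] [Module K E] [AddCommGroup M]
    [Module K M] (ρ : V →ₗ[K] End K E) (F : E →ₗ[K] 𝒮 K V →ₗ[K] M)
    (i : ℕ) (x : E) (y : V) (n : ℤ) :
    itr ρ F i x (dpz y n) = F ((ρ y ^ i) x) (dpz y (n - i)) := by
  induction n using dpz_cases with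
  | h2 n h => rw [dpz_of_neg y h, dpz_of_neg y (by omega), map_zero, map_zero]
  | h1 n =>
    rcases lt_or_ge n i with h | h
    · rw [dpz_natCast, itr_dp_lt _ _ _ _ h, dpz_of_neg y (by omega), map_zero]
    · obtain ⟨m, rfl⟩ := exists_eq_add_of_le' h
      rw [dpz_natCast, itr_dp, ← dpz_natCast]; congr 2; push_cast; ring

lemma ext_dpz {M : Type*} [AddCommMonoid M] [Module K M] {f g : 𝒮 K V →ₗ[K] M}
    (h : ∀ x n, f (dpz x n) = g (dpz x n)) : f = g :=
  ext_dp fun x n => by simpa only [dpz_natCast] using h x n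

end

/-- An abelian ideal together with a projection onto it. -/
structure AbIdeal (K L : Type) [Field K] [LieRing L] [LieAlgebra K L] where
  a : LieIdeal K L
  pr : L →ₗ[K] L
  ab : ∀ x ∈ a, ∀ y ∈ a, ⁅x, y⁆ = 0
  pr_mem : ∀ x, pr x ∈ a
  pr_eq : ∀ x ∈ a, pr x = x

namespace AbIdeal

variable {K L : Type} [Field K] [CharZero K] [LieRing L] [LieAlgebra K L] [FiniteDimensional K L]
  (d : AbIdeal K L)

lemma ad_pow_mem {w : L} (hw : w ∈ d.a) (x : L) (i : ℕ) : (adL K L x ^ i) w ∈ d.a := by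
  induction i with
  | zero => exact hw
  | succ i ih => rw [pow_succ', mul_apply]; exact lie_mem_right K L d.a x _ ih

/-- The operator `e^x ↦ ad_x^i (w) e^x`. -/
def R (K L : Type) [Field K] [CharZero K] [LieRing L] [LieAlgebra K L] [FiniteDimensional K L]
    (i : ℕ) : L →ₗ[K] End K (𝒮 K L) := itr (adL K L) (mulι K L) i

lemma R_dpz (i : ℕ) (w x : L) (n : ℤ) :
    R K L i w (dpz x n) = ι K L ((adL K L x ^ i) w) * dpz x (n - i) := by
  rw [R, itr_dpz, mulι_apply]

lemma R_zero (w : L) (P : 𝒮 K L) : R K L 0 w P = ι K L w * P := rfl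

lemma R_ι_mul (i : ℕ) {w w' : L} (hw : w ∈ d.a) (hw' : w' ∈ d.a) (P : 𝒮 K L) :
    R K L i w (ι K L w' * P) = ι K L w' * R K L i w P := by
  induction i generalizing w P with
  | zero => rw [R_zero, R_zero]; ring
  | succ i ih =>
    have hs : ∀ (w : L) (P : 𝒮 K L), R K L (i + 1) w P
      = ∑ k, R K L i (adL K L (finBasis K L k) w) (pd ((finBasis K L).coord k) P) :=
      fun w P => itr_succ _ _ _ _ _
    have h0 : ∑ k, (finBasis K L).coord k w' •
        R K L i (adL K L (finBasis K L k) w) P = 0 := by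
      refine (sum_coord_map (finBasis K L)
        ((LinearMap.applyₗ P ∘ₗ R K L i) ∘ₗ (adL K L).flip w) w').trans ?_
      simp [d.ab w' hw' w hw]
    rw [hs, hs, mul_sum]
    simp only [pd_ι_mul, map_add, map_smul, sum_add_distrib]
    rw [h0, add_zero]
    exact sum_congr rfl fun k _ => ih (lie_mem_right K L d.a _ _ hw) _

/-- The operator `e^x ↦ ad_x^j (pr x) e^x`. -/
def Γ (j : ℕ) : End K (𝒮 K L) :=
  ∑ k, R K L j (d.pr (finBasis K L k)) * pdL ((finBasis K L).coord k)

lemma Γ_apply (j : ℕ) (P : 𝒮 K L) : d.Γ j P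
    = ∑ k, R K L j (d.pr (finBasis K L k)) (pd ((finBasis K L).coord k) P) := by
  simp [Γ]

lemma Γ_dpz (j : ℕ) (x : L) (n : ℤ) :
    d.Γ j (dpz x n) = ι K L ((adL K L x ^ j) (d.pr x)) * dpz x (n - 1 - j) := by
  rw [Γ_apply]
  simp only [pd_dpz, map_smul]
  exact (sum_coord_map (finBasis K L)
    ((LinearMap.applyₗ (dpz x (n - 1)) ∘ₗ R K L j) ∘ₗ d.pr) x).trans (R_dpz j (d.pr x) x (n - 1))

lemma Γ_ι_mul (j : ℕ) {v : L} (hv : v ∈ d.a) (Q : 𝒮 K L) :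
    d.Γ j (ι K L v * Q) = R K L j v Q + ι K L v * d.Γ j Q := by
  rw [Γ_apply, Γ_apply]
  simp only [pd_ι_mul, map_add, map_smul, sum_add_distrib]
  rw [mul_sum, add_comm]
  congr 1
  · refine (sum_coord_map (finBasis K L)
      ((LinearMap.applyₗ Q ∘ₗ R K L j) ∘ₗ d.pr) v).trans ?_
    simp [d.pr_eq v hv]
  · exact sum_congr rfl fun k _ => d.R_ι_mul j (d.pr_mem _) hv _

lemma Γ_R (i j : ℕ) {w : L} (hw : w ∈ d.a) (P : 𝒮 K L) :
    d.Γ j (R K L i w P) = R K L i w (d.Γ j P) + R K L (i + j) w P := by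
  have : d.Γ j ∘ₗ R K L i w = R K L i w ∘ₗ d.Γ j + R K L (i + j) w := by
    apply ext_dpz
    intro x n
    simp only [comp_apply, ladd_apply]
    rw [R_dpz, d.Γ_ι_mul j (d.ad_pow_mem hw x i), Γ_dpz, Γ_dpz,
      d.R_ι_mul i hw (d.ad_pow_mem (d.pr_mem x) x j), R_dpz, R_dpz, R_dpz, ← mul_apply,
      ← pow_add, add_comm j i, add_comm]
    congr 1
    · rw [show n - 1 - (j : ℤ) - i = n - i - 1 - j by ring]; ring
    · rw [show n - ((i + j : ℕ) : ℤ) = n - i - j by push_cast; ring]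
  exact dcongr_fun this P

/-- The graded parts of the operator `e^x ↦ e^{φ(ad x) (pr x) + x - pr x}`. -/
def T (k : ℕ) : End K (𝒮 K L) := expSeq K (fun i => gC K i • d.Γ i) k

lemma T_zero : d.T 0 = 1 := by simp [T]

lemma T_succ (k : ℕ) (P : 𝒮 K L) : ((k + 1 : ℕ) : K) • d.T (k + 1) P
    = ∑ p ∈ antidiagonal k, (((p.1 + 1 : ℕ) : K) * gC K (p.1 + 1)) • d.Γ (p.1 + 1) (d.T p.2 P) := by
  have := dcongr_fun (expSeq_succ K (fun i => gC K i • d.Γ i) k) P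
  simpa [mul_smul, T] using this

lemma phC_rec (k : ℕ) : ((k + 1 : ℕ) : K) * phC K (k + 1)
    = ∑ p ∈ antidiagonal k, ((p.1 + 1 : ℕ) : K) * gC K (p.1 + 1) * phC K p.2 := by
  have := expSeq_succ K (gC K) k
  simp only [phC_eq]
  simpa [mul_assoc] using this

lemma sum_antidiagonal_left_comm {M : Type} [AddCommMonoid M] (n : ℕ) (f : ℕ → ℕ → ℕ → M) :
    ∑ p ∈ antidiagonal n, ∑ q ∈ antidiagonal p.2, f p.1 q.1 q.2
      = ∑ p ∈ antidiagonal n, ∑ q ∈ antidiagonal p.2, f q.1 p.1 q.2 := by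
  rw [← sum_antidiagonal_assoc, ← sum_antidiagonal_assoc n (fun a b c => f b a c)]
  refine sum_congr rfl fun r _ => ?_
  exact (Nat.sum_antidiagonal_swap (f := fun s => f s.2 s.1 r.2))

lemma T_R (k i : ℕ) {w : L} (hw : w ∈ d.a) (P : 𝒮 K L) :
    d.T k (R K L i w P) = ∑ p ∈ antidiagonal k, phC K p.1 • R K L (p.1 + i) w (d.T p.2 P) := by
  induction k using strong_induction_on with
  | _ k ih =>
    rcases k with _ | k
    · simp [T_zero, phC_zero]
    apply smul_right_injective (𝒮 K L)
      (show ((k + 1 : ℕ) : K) ≠ 0 by exact_mod_cast k.succ_ne_zero)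
    change _ • _ = _ • _
    rw [T_succ]
    have hl : ∀ p ∈ antidiagonal k, (((p.1 + 1 : ℕ) : K) * gC K (p.1 + 1)) •
        d.Γ (p.1 + 1) (d.T p.2 (R K L i w P))
        = ∑ q ∈ antidiagonal p.2, (((p.1 + 1 : ℕ) : K) * gC K (p.1 + 1) * phC K q.1) •
            R K L (q.1 + i) w (d.Γ (p.1 + 1) (d.T q.2 P))
          + ∑ q ∈ antidiagonal p.2, (((p.1 + 1 : ℕ) : K) * gC K (p.1 + 1) * phC K q.1) •
            R K L (p.1 + q.1 + (1 + i)) w (d.T q.2 P) := by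
      intro p hp
      rw [mem_anti] at hp
      rw [ih p.2 (by omega), map_sum, smul_sum, ← sum_add_distrib]
      refine sum_congr rfl fun q hq => ?_
      rw [map_smul, d.Γ_R _ _ hw, smul_smul, smul_add,
        show q.1 + i + (p.1 + 1) = p.1 + q.1 + (1 + i) by ring]
    rw [sum_congr rfl hl, sum_add_distrib,
      sum_antidiagonal_left_comm k (fun a b c => (((a + 1 : ℕ) : K) * gC K (a + 1) * phC K b) •
            R K L (b + i) w (d.Γ (a + 1) (d.T c P))),
      ← sum_antidiagonal_assoc k (fun a b c => (((a + 1 : ℕ) : K) * gC K (a + 1) * phC K b) •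
            R K L (a + b + (1 + i)) w (d.T c P))]
    have h1 : ∀ p ∈ antidiagonal k, ∑ q ∈ antidiagonal p.2,
        (((q.1 + 1 : ℕ) : K) * gC K (q.1 + 1) * phC K p.1) •
            R K L (p.1 + i) w (d.Γ (q.1 + 1) (d.T q.2 P))
        = (((p.2 + 1 : ℕ) : K) * phC K p.1) • R K L (p.1 + i) w (d.T (p.2 + 1) P) := by
      intro p hp
      rw [mul_comm, mul_smul, ← map_smul, T_succ, map_sum, smul_sum]
      refine sum_congr rfl fun q _ => ?_
      rw [map_smul, smul_smul, mul_comm]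
    have h2 : ∀ p ∈ antidiagonal k, ∑ q ∈ antidiagonal p.1,
        (((q.1 + 1 : ℕ) : K) * gC K (q.1 + 1) * phC K q.2) •
            R K L (q.1 + q.2 + (1 + i)) w (d.T p.2 P)
        = (((p.1 + 1 : ℕ) : K) * phC K (p.1 + 1)) • R K L (p.1 + 1 + i) w (d.T p.2 P) := by
      intro p hp
      rw [phC_rec, sum_smul]
      refine sum_congr rfl fun q hq => ?_
      rw [mem_anti] at hq
      rw [hq, add_assoc]
    rw [sum_congr rfl h1, sum_congr rfl h2]
    have h3 : ∀ p ∈ antidiagonal (k + 1), ((k + 1 : ℕ) : K) • phC K p.1 •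
        R K L (p.1 + i) w (d.T p.2 P)
        = ((p.2 : K) * phC K p.1) • R K L (p.1 + i) w (d.T p.2 P)
          + ((p.1 : K) * phC K p.1) • R K L (p.1 + i) w (d.T p.2 P) := by
      intro p hp
      rw [mem_anti] at hp
      rw [← hp]; push_cast; module
    rw [smul_sum, sum_congr rfl h3, sum_add_distrib,
      sum_anti_succ', sum_anti_succ]
    simp

lemma R_T (k s : ℕ) {w : L} (hw : w ∈ d.a) (z : L) (n : ℤ) :
    R K L s w (d.T k (dpz z n)) = ι K L ((adL K L z ^ s) w) * d.T k (dpz z (n - s)) := by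
  induction k using strong_induction_on generalizing s w n with
  | _ k ih =>
    rcases k with _ | k
    · simp [T_zero, R_dpz]
    apply smul_right_injective (𝒮 K L)
      (show ((k + 1 : ℕ) : K) ≠ 0 by exact_mod_cast k.succ_ne_zero)
    change _ • _ = _ • _
    rw [← map_smul, T_succ, ← mul_smul_comm, T_succ, map_sum, mul_sum]
    refine sum_congr rfl fun p hp => ?_
    rw [mem_anti] at hp
    have h := d.Γ_R s (p.1 + 1) hw (d.T p.2 (dpz z n))
    have hz := d.ad_pow_mem hw z s
    rw [ih p.2 (by omega) s hw n, ih p.2 (by omega) _ hw n, d.Γ_ι_mul _ hz,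
      ih p.2 (by omega) _ hz, ← mul_apply, ← pow_add, add_comm (p.1 + 1) s] at h
    rw [map_smul, mul_smul_comm]
    congr 1
    have e : n - ((s + (p.1 + 1) : ℕ) : ℤ) = n - s - (p.1 + 1 : ℕ) := by push_cast; ring
    rw [e, add_comm] at h
    exact (add_right_cancel h).symm

lemma T_ι_mul (k : ℕ) {w : L} (hw : w ∈ d.a) (z : L) (n : ℤ) :
    d.T k (ι K L w * dpz z n) = ∑ p ∈ antidiagonal k,
      phC K p.1 • (ι K L ((adL K L z ^ p.1) w) * d.T p.2 (dpz z (n - p.1))) := by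
  rw [← R_zero, d.T_R k 0 hw]
  refine sum_congr rfl fun p _ => ?_
  rw [add_zero, d.R_T _ _ hw]

end AbIdeal

end

section

lemma sg_ι_mul_of_commute {K V A : Type} [Field K] [CharZero K] [AddCommGroup V] [Module K V]
    [FiniteDimensional K V] [Ring A] [Algebra K A] (e : V →ₗ[K] A) (w : V)
    (h : ∀ x, e w * e x = e x * e w) (P : 𝒮 K V) :
    sg e (ι K V w * P) = e w * sg e P := by
  have : sg e ∘ₗ mulLeft K (ι K V w) = mulLeft K (e w) ∘ₗ sg e := by
    apply ext_dp
    intro z n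
    let f : (K × K) →ₗ[K] V :=
      (LinearMap.toSpanSingleton K V w).coprod (LinearMap.toSpanSingleton K V z)
    have h1 : ι K V w * dp z n = smap f (ι K (K × K) (1, 0) * dp (0, 1) n) := by
      rw [map_mul, smap_ι, smap_dp]; simp [f]
    have hf : ∀ v, f v = v.1 • w + v.2 • z := fun v => by simp [f]
    simp only [comp_apply, mulLeft_apply]
    rw [h1, sg_smap, sg_mul_of_commute, sg_ι, sg_dp, sg_dp]
    · simp [hf]
    · intro x y
      simp only [comp_apply, hf, map_add, map_smul, add_mul, mul_add, smul_mul_smul_comm,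
        h z]
      module
  exact dcongr_fun this P

namespace AbIdeal

variable {K L : Type} [Field K] [CharZero K] [LieRing L] [LieAlgebra K L] [FiniteDimensional K L]
  (d : AbIdeal K L)

local notation "U" => 𝒰 K L

lemma uι_comm {w w' : L} (hw : w ∈ d.a) (hw' : w' ∈ d.a) :
    uι K L w * uι K L w' = uι K L w' * uι K L w := by
  rw [uι_mul_uι, d.ab w hw w' hw', map_zero, add_zero]

/-- Left multiplication by the component in the ideal plus right multiplication by the rest. -/
def lr : L →ₗ[K] End K U :=
  LinearMap.mul K U ∘ₗ uι K L ∘ₗ d.pr + (LinearMap.mul K U).flip ∘ₗ uι K L ∘ₗ (LinearMap.id - d.pr)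

lemma lr_apply (x : L) (u : U) :
    d.lr x u = uι K L (d.pr x) * u + u * uι K L (x - d.pr x) := by
  simp [lr, mul_sub]

/-- The ordering map `e^x ↦ e^{pr x} e^{x - pr x}`. -/
def N : 𝒮 K L →ₗ[K] U := LinearMap.applyₗ (1 : U) ∘ₗ sg d.lr

lemma N_ι_mul {w : L} (hw : w ∈ d.a) (P : 𝒮 K L) :
    d.N (ι K L w * P) = uι K L w * d.N P := by
  have hl : ∀ u, d.lr w u = uι K L w * u := fun u => by rw [lr_apply, d.pr_eq w hw]; simp
  rw [N, comp_apply, sg_ι_mul_of_commute]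
  · exact hl _
  · intro x
    ext u
    simp only [mul_apply]
    rw [hl, lr_apply, lr_apply, hl, mul_add, ← mul_assoc, ← mul_assoc, ← mul_assoc,
      d.uι_comm hw (d.pr_mem x)]

lemma N_dp_of_pr {y : L} (hy : d.pr y = 0) (n : ℕ) : d.N (dp y n) = dvp K (uι K L y) n := by
  have h : d.lr y = mulRight K (uι K L y) := by
    ext u; simp [lr_apply, hy]
  have h2 : (mulRight K (uι K L y) ^ n) 1 = uι K L y ^ n := by
    rw [LinearMap.pow_mulRight]; simp
  simp [N, sg_dp, h, dvp, h2]

lemma pr_sub (x : L) : d.pr (x - d.pr x) = 0 := by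
  rw [map_sub, d.pr_eq _ (d.pr_mem x), sub_self]

lemma Γ_dp_of_pr (j : ℕ) {y : L} (hy : d.pr y = 0) (n : ℕ) : d.Γ j (dp y n) = 0 := by
  rw [← dpz_natCast, Γ_dpz, hy]; simp

lemma T_dp_of_pr (k : ℕ) {y : L} (hy : d.pr y = 0) (n : ℕ) : d.T (k + 1) (dp y n) = 0 := by
  induction k using strong_induction_on with
  | _ k ih =>
    have h : ((k + 1 : ℕ) : K) • d.T (k + 1) (dp y n) = 0 := by
      rw [T_succ]
      refine sum_eq_zero fun p hp => ?_
      rw [mem_anti] at hp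
      obtain ⟨i, j⟩ := p
      rcases j with _ | j
      · simp [T_zero, d.Γ_dp_of_pr _ hy]
      · rw [ih j (by simp at hp; omega), map_zero, smul_zero]
    exact (smul_eq_zero.1 h).resolve_left (by exact_mod_cast k.succ_ne_zero)

lemma symm_ι_mul_dp (w z : L) (m : ℕ) : symm K L (ι K L w * dp z m) = ∑ p ∈ antidiagonal m,
    phC K p.1 • (uι K L ((adL K L z ^ p.1) w) * symm K L (dp z p.2)) := by
  rw [symm, sg_ι_mul_dp _ (adL K L z) z (fun y => uι_mul_uι z y)]
  simp only [sg_dp]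

lemma sum_range_T_ι_mul (M m : ℕ) {w : L} (hw : w ∈ d.a) (z : L) :
    ∑ k ∈ range M, d.T k (ι K L w * dp z m) = ∑ p ∈ antidiagonal m,
      phC K p.1 • (ι K L ((adL K L z ^ p.1) w) *
        ∑ k ∈ range (M - p.1), d.T k (dp z p.2)) := by
  have h : ∀ k ∈ range M, d.T k (ι K L w * dp z m) = ∑ i ∈ range (m + 1), if i ≤ k then
      phC K i • (ι K L ((adL K L z ^ i) w) * d.T (k - i) (dp z (m - i))) else 0 := by
    intro k hk
    rw [← dpz_natCast, d.T_ι_mul k hw, sum_anti_range,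
      ← sum_filter]
    symm
    apply sum_subset_zero_on_sdiff
    · intro i hi; simp at hi ⊢; omega
    · intro i hi
      simp only [mem_sdiff, mem_filter, mem_range, not_and, not_le] at hi
      rw [dpz_of_neg z (by omega), map_zero, mul_zero, smul_zero]
    · intro i hi
      simp only [mem_filter, mem_range] at hi
      rw [← Nat.cast_sub (by omega), dpz_natCast]
  rw [sum_congr rfl h, sum_comm, sum_anti_range]
  refine sum_congr rfl fun i hi => ?_
  rw [mul_sum, smul_sum, ← sum_filter]
  refine sum_bij' (fun k _ => k - i) (fun k _ => k + i) ?_ ?_ ?_ ?_ ?_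
  all_goals intro k hk
  all_goals simp only [mem_filter, mem_range] at hk ⊢
  all_goals try omega

lemma symm_dp_eq (m : ℕ) (z : L) (M : ℕ) (hM : m < M) :
    symm K L (dp z m) = d.N (∑ k ∈ range M, d.T k (dp z m)) := by
  induction m using strong_induction_on generalizing z M with
  | _ m ih =>
    let Δ : 𝒮 K L →ₗ[K] U := symm K L - ∑ k ∈ range M, d.N ∘ₗ d.T k
    have hΔ : ∀ P, Δ P = symm K L P - d.N (∑ k ∈ range M, d.T k P) := fun P => by
      simp [Δ, lsum_apply]
    have h0 : ∀ (z w : L) (j : ℕ), w ∈ d.a → j < m → Δ (ι K L w * dp z j) = 0 := by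
      intro z w j hw hj
      rw [hΔ, symm_ι_mul_dp, d.sum_range_T_ι_mul M j hw, map_sum, ← sum_sub_distrib]
      refine sum_eq_zero fun p hp => ?_
      rw [mem_anti] at hp
      rw [map_smul, d.N_ι_mul (d.ad_pow_mem hw z _), ← ih p.2 (by omega) z (M - p.1) (by omega),
        sub_self]
    suffices hz : Δ (dp z m) = 0 by rw [hΔ] at hz; exact sub_eq_zero.1 hz
    set w := d.pr z with hw
    set y := z - d.pr z with hy
    have hwm : w ∈ d.a := d.pr_mem z
    have hzz : z = w + y := by simp [hw, hy]
    have hc : ∀ j i, i < j → j ≤ m → Δ (ι K L w * (dp w i * dp y (j - 1 - i))) = 0 := by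
      intro j i hi hj
      refine eq_zero_of_forall_sum_pow_smul (K := K) j
        (fun i => Δ (ι K L w * (dp w i * dp y (j - 1 - i)))) (fun t => ?_) hi
      rw [← h0 (t • w + y) w (j - 1) hwm (by omega), dp_add,
        sum_anti_range, show (j - 1).succ = j by omega,
        mul_sum, map_sum]
      refine sum_congr rfl fun i _ => ?_
      rw [dp_smul, smul_mul_assoc, mul_smul_comm, map_smul]
    rw [hzz, dp_add, sum_anti_range, sum_range_succ',
      map_add, map_sum, sum_eq_zero, zero_add, dp_zero, one_mul, hΔ]
    · have hy0 : d.pr y = 0 := d.pr_sub z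
      obtain ⟨M, rfl⟩ := Nat.exists_eq_succ_of_ne_zero (show M ≠ 0 by omega)
      rw [sum_range_succ', sum_eq_zero fun k _ => d.T_dp_of_pr k hy0 _, zero_add,
        T_zero, one_apply, d.N_dp_of_pr hy0, symm_dp, sub_self]
    · intro i hi
      have hi' : i < m := by simpa using hi
      have h := hc m i hi' le_rfl
      rw [← mul_assoc, ι_mul_dp, smul_mul_assoc, map_smul] at h
      have := (smul_eq_zero.1 h).resolve_left (by exact_mod_cast i.succ_ne_zero)
      rw [show m - (i + 1) = m - 1 - i by omega]
      exact this

lemma exists_symm_eq (P : 𝒮 K L) :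
    ∃ M₀, ∀ M, M₀ ≤ M → symm K L P = d.N (∑ k ∈ range M, d.T k P) := by
  refine dp_induction (p := fun P => ∃ M₀, ∀ M, M₀ ≤ M →
    symm K L P = d.N (∑ k ∈ range M, d.T k P)) (fun x n => ⟨n + 1, fun M hM =>
      d.symm_dp_eq n x M (by omega)⟩) ⟨0, by simp⟩ ?_ ?_ P
  · rintro P Q ⟨a, ha⟩ ⟨b, hb⟩
    refine ⟨a + b, fun M hM => ?_⟩
    simp only [map_add, sum_add_distrib]
    rw [ha M (by omega), hb M (by omega)]
  · rintro c P ⟨a, ha⟩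
    refine ⟨a, fun M hM => ?_⟩
    simp only [map_smul, ← smul_sum]
    rw [ha M hM]

/-- The span of the divided powers of degree at most `n`. -/
def filt (n : ℕ) : Submodule K (𝒮 K L) :=
  span K {P | ∃ x m, m ≤ n ∧ dp x m = P}

lemma filt_mono {m n : ℕ} (h : m ≤ n) : filt (K := K) (L := L) m ≤ filt n :=
  Submodule.span_mono fun _ ⟨x, k, hk, e⟩ => ⟨x, k, hk.trans h, e⟩

lemma exists_mem_filt (P : 𝒮 K L) : ∃ n, P ∈ filt n := by
  refine dp_induction (p := fun P => ∃ n, P ∈ filt n)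
    (fun x n => ⟨n, subset_span ⟨x, n, le_rfl, rfl⟩⟩) ⟨0, zero_mem _⟩ ?_ ?_ P
  · rintro P Q ⟨a, ha⟩ ⟨b, hb⟩
    exact ⟨a + b, add_mem (filt_mono (by omega) ha) (filt_mono (by omega) hb)⟩
  · rintro c P ⟨a, ha⟩
    exact ⟨a, smul_mem _ _ ha⟩

lemma finiteDimensional_filt (n : ℕ) : FiniteDimensional K (filt (K := K) (L := L) n) := by
  let W : Submodule K (𝒮 K L) := 1 ⊔ LinearMap.range (ι K L)
  have h1 : (1 : Submodule K (𝒮 K L)) ≤ W := le_sup_left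
  have hW : (W ^ n).FG := by
    refine Submodule.FG.pow (Submodule.FG.sup ?_ ?_) n
    · exact Submodule.one_eq_span (R := K) (A := 𝒮 K L) ▸
        Submodule.fg_span_singleton 1
    · exact Module.Finite.iff_fg.1 inferInstance
  have hle : filt n ≤ W ^ n := by
    refine span_le.2 ?_
    rintro _ ⟨x, m, hm, rfl⟩
    refine pow_le_pow_right₀ h1 hm (smul_mem _ _ (Submodule.pow_mem_pow _ ?_ m))
    exact le_sup_right (α := Submodule K (𝒮 K L)) (LinearMap.mem_range_self _ x)
  have := Module.Finite.iff_fg.2 hW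
  exact Submodule.finiteDimensional_of_le hle

lemma ι_mul_dp_mem_filt (v x : L) (m : ℕ) : ι K L v * dp x m ∈ filt (m + 1) := by
  have := mem_of_forall_sum_pow_smul (K := K) (filt (m + 1)) (m + 2)
    (fun i => dp v i * dp x (m + 1 - i)) (fun t => by
      have : dp (K := K) (t • v + x) (m + 1) ∈ filt (m + 1) :=
        subset_span ⟨_, _, le_rfl, rfl⟩
      rw [dp_add, sum_anti_range] at this
      convert this using 2 with i hi
      rw [dp_smul, smul_mul_assoc]) (show 1 < m + 2 by omega)
  simpa using this

lemma Γ_mem_filt (j n : ℕ) {P : 𝒮 K L} (hP : P ∈ filt n) : d.Γ j P ∈ filt n := by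
  revert P
  change filt n ≤ (filt n).comap (d.Γ j)
  refine span_le.2 ?_
  rintro _ ⟨x, m, hm, rfl⟩
  rw [SetLike.mem_coe, mem_comap, ← dpz_natCast, Γ_dpz]
  rcases lt_or_ge m (1 + j) with h | h
  · rw [dpz_of_neg x (by omega), mul_zero]; exact zero_mem _
  · obtain ⟨k, rfl⟩ := Nat.exists_eq_add_of_le h
    rw [show ((1 + j + k : ℕ) : ℤ) - 1 - j = (k : ℕ) by push_cast; ring, dpz_natCast]
    exact filt_mono (by omega) (ι_mul_dp_mem_filt _ _ _)

lemma T_mem_filt (k n : ℕ) {P : 𝒮 K L} (hP : P ∈ filt n) : d.T k P ∈ filt n := by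
  induction k using strong_induction_on with
  | _ k ih =>
    rcases k with _ | k
    · simpa [T_zero] using hP
    · have h : ((k + 1 : ℕ) : K) • d.T (k + 1) P ∈ filt n := by
        rw [T_succ]
        refine sum_mem fun p hp => ?_
        rw [mem_anti] at hp
        exact smul_mem _ _ (d.Γ_mem_filt _ _ (ih _ (by omega)))
      exact ((filt n).smul_mem_iff (by exact_mod_cast k.succ_ne_zero)).1 h

lemma symm_eq_of_mem_filt (n : ℕ) {P : 𝒮 K L} (hP : P ∈ filt n) :
    symm K L P = d.N (∑ k ∈ range (n + 1), d.T k P) := by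
  have : filt n ≤ LinearMap.eqLocus (symm K L) (d.N ∘ₗ ∑ k ∈ range (n + 1), d.T k) := by
    refine span_le.2 ?_
    rintro _ ⟨x, m, hm, rfl⟩
    rw [SetLike.mem_coe, LinearMap.mem_eqLocus, comp_apply, lsum_apply]
    exact d.symm_dp_eq m x _ (by omega)
  simpa [lsum_apply] using this hP

lemma N_injective : Function.Injective d.N := by
  rw [injective_iff_map_eq_zero]
  intro P hP
  obtain ⟨n, hn⟩ := exists_mem_filt P
  have := finiteDimensional_filt (K := K) (L := L) n
  let t : filt (K := K) (L := L) n →ₗ[K] filt (K := K) (L := L) n :=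
    (∑ k ∈ range (n + 1), d.T k).restrict (p := filt n) (q := filt n) fun P hP => by
      rw [lsum_apply]; exact sum_mem fun k _ => d.T_mem_filt k n hP
  have ht : ∀ Q : filt (K := K) (L := L) n, symm K L (Q : 𝒮 K L) = d.N (t Q) := fun Q => by
    rw [d.symm_eq_of_mem_filt n Q.2]; simp [t, lsum_apply]
  have hi : Function.Injective t := by
    rw [injective_iff_map_eq_zero]
    intro Q hQ
    have := ht Q
    rw [hQ] at this
    exact Subtype.ext (symm_injective (by rw [this]; simp))
  obtain ⟨Q, hQ⟩ := LinearMap.injective_iff_surjective.1 hi ⟨P, hn⟩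
  have h := ht Q
  rw [hQ] at h
  change _ = d.N P at h
  rw [hP] at h
  have h0 : (Q : 𝒮 K L) = 0 := symm_injective (by rw [h, map_zero])
  have h1 : Q = 0 := Subtype.ext h0
  rw [h1, map_zero] at hQ
  exact congrArg Subtype.val hQ.symm

lemma N_surjective : Function.Surjective d.N := fun u => by
  obtain ⟨P, rfl⟩ := symm_surjective (K := K) (L := L) u
  obtain ⟨n, hn⟩ := exists_mem_filt P
  exact ⟨_, (d.symm_eq_of_mem_filt n hn).symm⟩

/-- Invariance under the abelian ideal. -/
def AInv (P : 𝒮 K L) : Prop := ∀ w ∈ d.a, adD w P = 0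

lemma pd_adD {w : L} {ξ : L →ₗ[K] K} (h : ∀ y, ξ ⁅w, y⁆ = 0) (P : 𝒮 K L) :
    adD w (pd ξ P) = pd ξ (adD w P) := by
  rw [adD, der_pd_comm, show ξ ∘ₗ adL K L w = 0 from lext h, ← pdL_apply 0, map_zero]
  simp

/-- The representation on the ideal, extended by zero on the complement. -/
def rh : L →ₗ[K] End K L :=
  (LinearMap.mul K (End K L)).flip d.pr ∘ₗ adL K L

lemma rh_apply (x y : L) : d.rh x y = ⁅x, d.pr y⁆ := rfl

lemma rh_pow (x y : L) (i : ℕ) : (d.rh x ^ (i + 1)) y = (adL K L x ^ (i + 1)) (d.pr y) := by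
  induction i with
  | zero => simp [rh_apply, adL_apply]
  | succ i ih =>
    rw [pow_succ', mul_apply, ih, rh_apply,
      d.pr_eq _ (d.ad_pow_mem (d.pr_mem y) x (i + 1))]
    conv_rhs => rw [pow_succ' _ (i + 1), mul_apply]
    rfl

lemma R_eq_zero (i : ℕ) {w : L} (hw : w ∈ d.a) {P : 𝒮 K L} (hP : d.AInv P) :
    R K L (i + 1) w P = 0 := by
  let F : L →ₗ[K] 𝒮 K L →ₗ[K] 𝒮 K L :=
    { toFun := fun v => (adD (K := K) v).toLinearMap
      map_add' := fun v v' => by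
        ext P
        change adD (v + v') P = adD v P + adD v' P
        rw [← Derivation.add_apply]
        exact dcongr_fun (der_ext fun x => by simp [adD]) P
      map_smul' := fun c v => by
        ext P
        change adD (c • v) P = c • adD v P
        rw [← Derivation.smul_apply]
        exact dcongr_fun (der_ext fun x => by simp [adD]) P }
  have h1 : R K L (i + 1) w = - itr (adL K L) F i w := by
    apply ext_dpz
    intro x n
    rw [lneg_apply, R_dpz, itr_dpz]
    change _ = - adD _ _
    have h : ∀ (u : L) (m : ℤ), adD (K := K) u (dpz x m) = ι K L ⁅u, x⁆ * dpz x (m - 1) := by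
      intro u m
      induction m using dpz_cases with
      | h2 n h => rw [dpz_of_neg x h, dpz_of_neg x (by omega), map_zero, mul_zero]
      | h1 n =>
        rcases n with _ | n
        · rw [dpz_natCast, dpz_of_neg x (by simp), der_dp_zero, mul_zero]
        · rw [dpz_natCast, der_dp_succ, adD, der_ι, mul_comm, ← dpz_natCast, comp_apply,
            adL_apply]
          congr 2; push_cast; ring
    rw [h, ← neg_mul, ← map_neg, lie_skew, pow_succ', mul_apply, adL_apply]
    congr 2; push_cast; ring
  rw [h1, lneg_apply, neg_eq_zero]
  clear h1
  induction i generalizing w P with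
  | zero => exact hP w hw
  | succ i ih =>
    rw [itr_succ]
    let G : L →ₗ[K] (𝒮 K L →ₗ[K] 𝒮 K L) :=
      itr (adL K L) F i ∘ₗ (adL K L).flip w
    have h2 := sum_pd_comp (finBasis K L) ((LinearMap.id : L →ₗ[K] L) - d.pr) G P
    have h3 : ∀ k, G (((LinearMap.id : L →ₗ[K] L) - d.pr) (finBasis K L k))
        = itr (adL K L) F i (adL K L (finBasis K L k) w) := by
      intro k
      simp only [G, comp_apply, LinearMap.flip_apply, lsub_apply, map_sub]
      rw [show adL K L (d.pr (finBasis K L k)) w = 0 from d.ab _ (d.pr_mem _) _ hw]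
      simp
    simp only [h3] at h2
    rw [← h2]
    refine sum_eq_zero fun k _ => ?_
    refine ih (lie_mem_right K L d.a _ _ hw) fun w' hw' => ?_
    rw [pd_adD, hP w' hw', map_zero]
    intro y
    have : ⁅w', y⁆ ∈ d.a := lie_mem_left K L d.a _ _ hw'
    simp [d.pr_eq _ this]

lemma Γ_eq_of_AInv (i : ℕ) {P : 𝒮 K L} (hP : d.AInv P) :
    d.Γ (i + 1) P = - trOp d.rh (i + 1) P := by
  have h : ∀ P, d.Γ (i + 1) P = ∑ k, pd ((finBasis K L).coord k)
      (R K L (i + 1) (d.pr (finBasis K L k)) P) - trOp d.rh (i + 1) P := by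
    intro P
    have : d.Γ (i + 1) = ∑ k, pdL ((finBasis K L).coord k) ∘ₗ
      (R K L (i + 1) (d.pr (finBasis K L k))) - trOp d.rh (i + 1) := by
      apply ext_dpz
      intro x n
      have ht : trOp d.rh (i + 1) (dpz x n)
          = trace K L (d.rh x ^ (i + 1)) • dpz x (n - (i + 1 : ℕ)) := by
        induction n using dpz_cases with
        | h2 n h => rw [dpz_of_neg x h, dpz_of_neg x (by omega), map_zero, smul_zero]
        | h1 n =>
          rcases lt_or_ge n (i + 1) with h | h
          · rw [dpz_natCast, (symOp_trOp _ _).low _ _ h, dpz_of_neg x (by omega), smul_zero]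
          · obtain ⟨m, rfl⟩ := exists_eq_add_of_le' h
            rw [dpz_natCast, (symOp_trOp _ _).high, ← dpz_natCast]
            congr 2; push_cast; ring
      rw [lsub_apply, ht, Γ_apply, lsum_apply, eq_sub_iff_add_eq,
        LinearMap.trace_eq_matrix_trace K (finBasis K L), Matrix.trace, sum_smul,
        ← sum_add_distrib]
      refine sum_congr rfl fun k _ => ?_
      rw [comp_apply, R_dpz, pdL_apply, pd_ι_mul, pd_dpz, pd_dpz, map_smul, R_dpz,
        Matrix.diag_apply, LinearMap.toMatrix_apply, mul_smul_comm, rh_pow]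
      congr 1
      rw [show n - 1 - ((i + 1 : ℕ) : ℤ) = n - ((i + 1 : ℕ) : ℤ) - 1 by ring]
    rw [this]; simp [lsum_apply]
  rw [h, sum_eq_zero, zero_sub]
  intro k _
  rw [d.R_eq_zero i (d.pr_mem _) hP, map_zero]

lemma rh_lie {w : L} (hw : w ∈ d.a) (x : L) :
    d.rh (adL K L w x) = 0 := by
  ext y
  rw [rh_apply, adL_apply, lzero_apply]
  exact d.ab _ (lie_mem_left K L d.a _ _ hw) _ (d.pr_mem y)

lemma trOp_AInv (i : ℕ) {P : 𝒮 K L} (hP : d.AInv P) : d.AInv (trOp d.rh i P) := by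
  intro w hw
  have := trOpAux_der d.rh (adL K L w) 0 (fun x => by rw [d.rh_lie hw]; simp) i 1 P
  rw [zero_mul, mul_zero, sub_zero] at this
  change _ = _ + trOpL d.rh i 0 P at this
  rw [map_zero, lzero_apply, add_zero] at this
  refine this.trans ?_
  rw [show der (ι K L ∘ₗ adL K L w) P = 0 from hP w hw, map_zero]

lemma T_eq_of_AInv (k : ℕ) {P : 𝒮 K L} (hP : d.AInv P) :
    d.T k P = expSeq K (fun i => (-gC K i) • trOp d.rh i) k P
      ∧ d.AInv (expSeq K (fun i => (-gC K i) • trOp d.rh i) k P) := by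
  induction k using strong_induction_on with
  | _ k ih =>
    rcases k with _ | k
    · simpa [T_zero] using hP
    · have h1 : ((k + 1 : ℕ) : K) • d.T (k + 1) P
          = ((k + 1 : ℕ) : K) • expSeq K (fun i => (-gC K i) • trOp d.rh i) (k + 1) P := by
        rw [T_succ, ← lsmul_apply, expSeq_succ, lsum_apply]
        refine sum_congr rfl fun p hp => ?_
        rw [mem_anti] at hp
        obtain ⟨e, h⟩ := ih p.2 (by omega)
        rw [e, d.Γ_eq_of_AInv _ h]
        simp [mul_smul]
      have h2 : d.AInv (((k + 1 : ℕ) : K) • expSeq K (fun i => (-gC K i) • trOp d.rh i) (k + 1) P) := by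
        rw [← lsmul_apply, expSeq_succ, lsum_apply]
        intro w hw
        rw [map_sum]
        refine sum_eq_zero fun p hp => ?_
        rw [mem_anti] at hp
        obtain ⟨e, h⟩ := ih p.2 (by omega)
        rw [lsmul_apply, mul_apply, lsmul_apply, Derivation.map_smul,
          Derivation.map_smul, d.trOp_AInv _ h w hw, smul_zero, smul_zero]
      have hk : ((k + 1 : ℕ) : K) ≠ 0 := by exact_mod_cast k.succ_ne_zero
      refine ⟨smul_right_injective _ hk h1, fun w hw => smul_right_injective _ hk ?_⟩
      change _ • _ = _ • _
      rw [← Derivation.map_smul, h2 w hw, smul_zero]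

lemma symm_eq_N_jop {P : 𝒮 K L} (hP : d.AInv P) :
    symm K L P = d.N (jop (fun i => -gC K i) d.rh P) := by
  obtain ⟨M₀, h⟩ := d.exists_symm_eq P
  have h2 : ∃ M₁, ∀ i, M₁ ≤ i → expSeq K (fun i => (-gC K i) • trOp d.rh i) i P = 0 :=
    locFin_of_dp (f := fun i => expSeq K (fun i => (-gC K i) • trOp d.rh i) i)
      (fun x n i hi => (SymOp.expSeq (fun i => (symOp_trOp d.rh i).smul (-gC K i)) i).low x n hi) P
  obtain ⟨M₁, h2⟩ := h2
  have hM : jop (fun i => -gC K i) d.rh P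
      = ∑ k ∈ range (M₀ + M₁), expSeq K (fun i => (-gC K i) • trOp d.rh i) k P := by
    rw [jop, serOp, lsum_eq_sum (N := M₀ + M₁)]
    exact fun i hi => h2 i (by omega)
  rw [hM, h (M₀ + M₁) (by omega)]
  congr 1
  exact sum_congr rfl fun k _ => (d.T_eq_of_AInv k hP).1

end AbIdeal

end

section

lemma exists_ginv {K V E : Type} [Field K] [AddCommGroup V] [Module K V] [AddCommGroup E]
    [Module K E] (s : V →ₗ[K] E) : ∃ g : E →ₗ[K] V, ∀ x, s (g (s x)) = s x := by
  obtain ⟨g₀, h₀⟩ := s.rangeRestrict.exists_rightInverse_of_surjective s.range_rangeRestrict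
  obtain ⟨g, hg⟩ := LinearMap.exists_extend g₀
  refine ⟨g, fun x => ?_⟩
  have h1 : g (s x) = g₀ (s.rangeRestrict x) := by
    rw [← hg]; rfl
  have h2 := dcongr_fun h₀ (s.rangeRestrict x)
  rw [h1]
  exact congrArg Subtype.val h2

section

variable {K : Type} [Field K] [CharZero K] {V : Type} [AddCommGroup V] [Module K V]

/-- The ideal of the symmetric algebra generated by a subspace. -/
def idl (I : Submodule K V) : Submodule K (𝒮 K V) :=
  span K {P | ∃ w ∈ I, ∃ Q, ι K V w * Q = P}

lemma ι_mul_mem_idl {I : Submodule K V} {w : V} (hw : w ∈ I) (Q : 𝒮 K V) :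
    ι K V w * Q ∈ idl I := subset_span ⟨w, hw, Q, rfl⟩

lemma idl_le {I : Submodule K V} {W : Submodule K (𝒮 K V)}
    (h : ∀ w ∈ I, ∀ Q, ι K V w * Q ∈ W) : idl I ≤ W :=
  span_le.2 fun _ ⟨w, hw, Q, e⟩ => e ▸ h w hw Q

lemma dp_sub_dp_mem_idl {I : Submodule K V} {x y : V} (h : x - y ∈ I) (n : ℕ) :
    dp (K := K) x n - dp y n ∈ idl I := by
  obtain ⟨w, hw, rfl⟩ : ∃ w ∈ I, x = w + y := ⟨x - y, h, by simp⟩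
  rw [dp_add, sum_anti_range, sum_range_succ', dp_zero,
    one_mul, Nat.sub_zero, add_sub_cancel_right]
  refine sum_mem fun i _ => ?_
  have hk : ((i + 1 : ℕ) : K) ≠ 0 := by exact_mod_cast i.succ_ne_zero
  refine ((idl I).smul_mem_iff hk).1 ?_
  rw [← smul_mul_assoc, ← ι_mul_dp, mul_assoc]
  exact ι_mul_mem_idl hw _

lemma sub_smap_mem_idl {I : Submodule K V} (q : V →ₗ[K] V) (hq : ∀ x, x - q x ∈ I)
    (F : 𝒮 K V) : F - smap q F ∈ idl I := by
  refine dp_induction (p := fun F => F - smap q F ∈ idl I) (fun x n => ?_) ?_ ?_ ?_ F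
  · rw [smap_dp]; exact dp_sub_dp_mem_idl (hq x) n
  · simp
  · intro F G hF hG; rw [map_add, add_sub_add_comm]; exact add_mem hF hG
  · intro c F hF; rw [map_smul, ← smul_sub]; exact smul_mem _ _ hF

lemma mem_idl_of_smap {E : Type} [AddCommGroup E] [Module K E] (s : V →ₗ[K] E)
    {F : 𝒮 K V} (h : smap s F = 0) : F ∈ idl (LinearMap.ker s) := by
  obtain ⟨g, hg⟩ := exists_ginv s
  have := sub_smap_mem_idl (I := LinearMap.ker s) (g ∘ₗ s) (fun x => by simp [hg]) F
  rwa [← smap_comp, h, map_zero, sub_zero] at this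

lemma smap_der {E : Type} [AddCommGroup E] [Module K E] (s : V →ₗ[K] E) (δ : V →ₗ[K] V)
    (δ' : E →ₗ[K] E) (h : ∀ x, s (δ x) = δ' (s x)) (P : 𝒮 K V) :
    smap s (der (ι K V ∘ₗ δ) P) = der (ι K E ∘ₗ δ') (smap s P) := by
  have : (smap s).toLinearMap ∘ₗ (der (ι K V ∘ₗ δ)).toLinearMap
      = (der (ι K E ∘ₗ δ')).toLinearMap ∘ₗ (smap s).toLinearMap := by
    apply ext_dp
    intro x n
    change smap s (der (ι K V ∘ₗ δ) (dp x n)) = der (ι K E ∘ₗ δ') (smap s (dp x n))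
    rw [smap_dp]
    rcases n with _ | n
    · rw [der_dp_zero, der_dp_zero, map_zero]
    · rw [der_dp_succ, der_dp_succ, map_mul, der_ι, der_ι, smap_dp, comp_apply,
        comp_apply, smap_ι, h]
  exact dcongr_fun this P

lemma exists_eigen (δ : V →ₗ[K] V) (hδ : ∀ x, δ (δ x) = δ x) (P : 𝒮 K V) :
    ∃ (N : ℕ) (w : ℕ → 𝒮 K V), (∀ i, N ≤ i → w i = 0) ∧ P = ∑ i ∈ range N, w i ∧
      w 0 = smap (LinearMap.id - δ) P ∧ ∀ i, der (ι K V ∘ₗ δ) (w i) = (i : K) • w i := by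
  refine dp_induction (p := fun P => ∃ (N : ℕ) (w : ℕ → 𝒮 K V),
    (∀ i, N ≤ i → w i = 0) ∧ P = ∑ i ∈ range N, w i ∧
      w 0 = smap (LinearMap.id - δ) P ∧ ∀ i, der (ι K V ∘ₗ δ) (w i) = (i : K) • w i)
    (fun x n => ?_) ⟨0, 0, by simp⟩ ?_ ?_ P
  · refine ⟨n + 1, fun i => if i ≤ n then dp (δ x) i * dp (x - δ x) (n - i) else 0,
      fun i hi => if_neg (by omega), ?_, ?_, fun i => ?_⟩
    · conv_lhs => rw [show x = δ x + (x - δ x) by abel, dp_add,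
        sum_anti_range]
      exact sum_congr rfl fun i hi => (if_pos (by simpa [Nat.lt_succ_iff] using hi)).symm
    · simp [smap_dp, dp_zero]
    · dsimp only
      split_ifs with h
      · have h1 : der (ι K V ∘ₗ δ) (dp (x - δ x) (n - i)) = 0 := by
          rcases n - i with _ | m
          · exact der_dp_zero _ _
          · rw [der_dp_succ, der_ι, comp_apply, map_sub, hδ, sub_self, map_zero, mul_zero]
        have h2 : der (ι K V ∘ₗ δ) (dp (δ x) i) = (i : K) • dp (δ x) i := by
          rcases i with _ | m
          · rw [der_dp_zero]; simp
          · rw [der_dp_succ, der_ι, comp_apply, hδ, mul_comm, ι_mul_dp]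
        rw [leibniz, h1, h2, smul_zero, zero_add, smul_eq_mul, mul_smul_comm, mul_comm]
      · simp
  · rintro P Q ⟨N, w, h1, h2, h3, h4⟩ ⟨N', w', h1', h2', h3', h4'⟩
    have e1 : P = ∑ i ∈ range (N + N'), w i := by
      rw [h2, sum_range_add, left_eq_add]
      exact sum_eq_zero fun i _ => h1 _ (by omega)
    have e2 : Q = ∑ i ∈ range (N + N'), w' i := by
      rw [h2', add_comm, sum_range_add, left_eq_add]
      exact sum_eq_zero fun i _ => h1' _ (by omega)
    refine ⟨N + N', w + w', fun i hi => ?_, ?_, ?_, fun i => ?_⟩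
    · rw [Pi.add_apply, h1 i (by omega), h1' i (by omega), add_zero]
    · simp only [Pi.add_apply, sum_add_distrib]
      rw [← e1, ← e2]
    · rw [Pi.add_apply, h3, h3', map_add]
    · rw [Pi.add_apply, map_add, h4, h4', smul_add]
  · rintro c P ⟨N, w, h1, h2, h3, h4⟩
    refine ⟨N, c • w, fun i hi => ?_, ?_, ?_, fun i => ?_⟩
    · rw [Pi.smul_apply, h1 i hi, smul_zero]
    · simp only [Pi.smul_apply, ← smul_sum]
      rw [← h2]
    · rw [Pi.smul_apply, h3, map_smul]
    · rw [Pi.smul_apply, Derivation.map_smul, h4, smul_comm]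

lemma sub_smap_mem_of_der
    (W : Submodule K (𝒮 K V)) (δ : V →ₗ[K] V) (hδ : ∀ x, δ (δ x) = δ x)
    (hW : ∀ F ∈ W, der (ι K V ∘ₗ δ) F ∈ W) {P : 𝒮 K V}
    (hP : der (ι K V ∘ₗ δ) P ∈ W) : P - smap (LinearMap.id - δ) P ∈ W := by
  obtain ⟨N, w, h1, h2, h3, h4⟩ := exists_eigen δ hδ P
  have h5 : ∀ i ∈ range N, (i : K) • W.mkQ (w i) = 0 := by
    refine eq_zero_of_sum_eigen (W.mapQ W (der (ι K V ∘ₗ δ)).toLinearMap hW)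
      (fun i => W.mkQ (w i)) (fun i => ?_) (range N) (fun i => (i : K)) ?_
    · rw [mkQ_apply, Submodule.mapQ_apply]
      exact congrArg W.mkQ (h4 i)
    · rw [h2, map_sum, ← qmk_eq_zero, ← mkQ_apply, map_sum] at hP
      simpa only [h4, map_smul] using hP
  rw [← qmk_eq_zero, ← mkQ_apply, map_sub, sub_eq_zero, ← h3]
  conv_lhs => rw [h2, map_sum]
  refine sum_eq_single 0 (fun i hi h0 => ?_) (fun h0 => ?_)
  · exact (smul_eq_zero.1 (h5 i hi)).resolve_left (by exact_mod_cast h0)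
  · rw [h1 0 (by simpa using h0), map_zero]

lemma smap_eq_of_der {E : Type} [AddCommGroup E] [Module K E] (s : V →ₗ[K] E) (δ : V →ₗ[K] V)
    (δ' : E →ₗ[K] E) (h : ∀ x, s (δ x) = δ' (s x)) (hδ : ∀ x, δ (δ x) = δ x)
    {P : 𝒮 K V} (hP : smap s (der (ι K V ∘ₗ δ) P) = 0) :
    smap s P = smap s (smap (LinearMap.id - δ) P) := by
  refine sub_eq_zero.1 ((map_sub _ _ _).symm.trans (sub_smap_mem_of_der
    (LinearMap.ker (smap s).toLinearMap) δ hδ (fun F hF => ?_) hP))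
  rw [LinearMap.mem_ker] at hF ⊢
  exact (smap_der s δ δ' h F).trans ((congrArg _ hF).trans (map_zero _))

lemma eq_zero_of_forall_lift [FiniteDimensional K V] {F : 𝒮 K V}
    (h : ∀ l : V →ₗ[K] K, slift l F = 0) : F = 0 := by
  let b := finBasis K V
  rw [← (equivMvPolynomial b).map_eq_zero_iff]
  apply MvPolynomial.funext
  intro x
  rw [map_zero, ← h (b.constr K x)]
  have : (MvPolynomial.aeval x).comp (equivMvPolynomial b).toAlgHom
      = slift (b.constr K x) := by
    apply algHom_ext
    apply b.ext
    intro i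
    simp
  have := dcongr_fun this F
  rw [← this]
  rfl

end

end

section

lemma jop_jop_congr {K V E₁ E₂ E₃ E₄ : Type} [Field K] [CharZero K] [AddCommGroup V] [Module K V]
    [FiniteDimensional K V] [AddCommGroup E₁] [Module K E₁] [AddCommGroup E₂] [Module K E₂]
    [AddCommGroup E₃] [Module K E₃] [AddCommGroup E₄] [Module K E₄]
    (w₁ w₂ w₃ w₄ : ℕ → K) (ρ₁ : V →ₗ[K] End K E₁) (ρ₂ : V →ₗ[K] End K E₂)
    (ρ₃ : V →ₗ[K] End K E₃) (ρ₄ : V →ₗ[K] End K E₄)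
    (h : ∀ x i, 1 ≤ i →
      w₁ i * trace K E₁ (ρ₁ x ^ i) + w₂ i * trace K E₂ (ρ₂ x ^ i)
      = w₃ i * trace K E₃ (ρ₃ x ^ i) + w₄ i * trace K E₄ (ρ₄ x ^ i))
    (P : 𝒮 K V) : jop w₁ ρ₁ (jop w₂ ρ₂ P) = jop w₃ ρ₃ (jop w₄ ρ₄ P) := by
  have : jop w₁ ρ₁ ∘ₗ jop w₂ ρ₂ = jop w₃ ρ₃ ∘ₗ jop w₄ ρ₄ := by
    apply ext_dp
    intro x n
    simp only [comp_apply]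
    rw [jop_jop_dp, jop_jop_dp]
    refine sum_congr rfl fun r _ => ?_
    congr 1
    exact expSeq_congr K _ fun i h1 _ => h x i h1
  exact dcongr_fun this P

namespace AbIdeal

variable {K L : Type} [Field K] [CharZero K] [LieRing L] [LieAlgebra K L] [FiniteDimensional K L]
  (d : AbIdeal K L)

lemma rh_mem {w : L} (hw : w ∈ d.a) : d.rh w = 0 := by
  ext y; exact d.ab w hw _ (d.pr_mem y)

lemma rh_bracket (x y : L) : d.rh ⁅x, y⁆ = d.rh x * d.rh y - d.rh y * d.rh x := by
  ext v
  simp only [rh_apply, lsub_apply, mul_apply]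
  rw [d.pr_eq ⁅y, d.pr v⁆ (lie_mem_right K L d.a _ _ (d.pr_mem v)),
    d.pr_eq ⁅x, d.pr v⁆ (lie_mem_right K L d.a _ _ (d.pr_mem v)), lie_lie]

lemma rh_pow_eq (x : L) (i : ℕ) : d.rh x ^ (i + 1) = adL K L x ^ (i + 1) * d.pr :=
  lext fun y => d.rh_pow x y i

/-- The action on the quotient by the ideal, realized on the complement. -/
def qh : L →ₗ[K] End K L :=
  adL K L - mulLeft K (A := End K L) d.pr ∘ₗ adL K L

lemma qh_apply (x : L) : d.qh x = adL K L x - d.pr * adL K L x := rfl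

lemma qh_mem {w : L} (hw : w ∈ d.a) : d.qh w = 0 := by
  ext y
  simp [qh_apply, d.pr_eq _ (lie_mem_left K L d.a w y hw), adL_apply]

lemma qh_pow (x : L) (i : ℕ) :
    d.qh x ^ (i + 1) = adL K L x ^ (i + 1) - d.pr * adL K L x ^ (i + 1) := by
  induction i with
  | zero => simp [qh_apply]
  | succ i ih =>
    have h : adL K L x * d.pr = d.pr * adL K L x * d.pr := by
      ext y
      exact (d.pr_eq _ (lie_mem_right K L d.a x _ (d.pr_mem y))).symm
    rw [pow_succ', ih, qh_apply, pow_succ' _ (i + 1), sub_mul, mul_sub, mul_sub, ← mul_assoc _ d.pr,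
      ← mul_assoc _ d.pr, h]
    abel

lemma trace_qh (x : L) (i : ℕ) (hi : 1 ≤ i) : trace K L (d.qh x ^ i)
    = trace K L (adL K L x ^ i) - trace K L (d.rh x ^ i) := by
  obtain ⟨i, rfl⟩ := exists_eq_add_of_le' hi
  rw [qh_pow, rh_pow_eq, map_sub, LinearMap.trace_mul_comm K d.pr]

lemma dfl_eq_N {P : 𝒮 K L} (hP : IsInv K P) :
    dfl K L P = d.N (jop (fun i => dW K i - gC K i) d.rh (jop (dW K) d.qh P)) := by
  have h : d.AInv (jop (dW K) (adL K L) P) := fun w _ => jop_isInv (dW K) hP w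
  rw [dfl, comp_apply, d.symm_eq_N_jop h]
  congr 1
  apply jop_jop_congr
  intro x i hi
  rw [d.trace_qh x i hi]
  ring

lemma jop_mem_idl {I : Submodule K L} (hI : ∀ w ∈ I, w ∈ d.a) {P : 𝒮 K L}
    (hP : P ∈ idl I) : jop (fun i => dW K i - gC K i) d.rh (jop (dW K) d.qh P) ∈ idl I := by
  revert P
  change idl I ≤ (idl I).comap
    (jop (fun i => dW K i - gC K i) d.rh ∘ₗ jop (dW K) d.qh)
  refine idl_le fun w hw Q => ?_
  rw [mem_comap, comp_apply, jop_commute_mul _ _ _ (d.qh_mem (hI w hw)),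
    jop_commute_mul _ _ _ (d.rh_mem (hI w hw))]
  exact ι_mul_mem_idl hw _

end AbIdeal

/-- Data for reducing to the isotropy algebra of a generic functional on an abelian ideal. -/
structure Polar {K L : Type} [Field K] [CharZero K] [LieRing L] [LieAlgebra K L]
    (d : AbIdeal K L) (L' : Type) [LieRing L'] [LieAlgebra K L'] where
  l : L →ₗ[K] K
  h : LieSubalgebra K L
  mem_h : ∀ x, x ∈ h ↔ ∀ y, l ⁅x, d.pr y⁆ = 0
  π : h →ₗ⁅K⁆ L'
  π_surj : Function.Surjective π
  π_eq_zero : ∀ x : h, π x = 0 ↔ (x : L) ∈ d.a ∧ l x = 0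
  z : L
  z_mem : z ∈ d.a
  l_z : l z = 1
  gen : ∀ x ∈ h, ∀ φ : L →ₗ[K] K, ∃ y, φ ∘ₗ d.rh x = l ∘ₗ d.rh y

namespace Polar

variable {K L : Type} [Field K] [CharZero K] [LieRing L] [LieAlgebra K L] [FiniteDimensional K L]
  {d : AbIdeal K L} {L' : Type} [LieRing L'] [LieAlgebra K L'] [FiniteDimensional K L']
  (D : Polar d L')

/-- The map sending `x` to the functional `y ↦ l ⁅x, pr y⁆`. -/
def Φ : L →ₗ[K] (L →ₗ[K] K) := LinearMap.compRight K D.l ∘ₗ d.rh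

lemma Φ_apply (x y : L) : D.Φ x y = D.l ⁅x, d.pr y⁆ := rfl

lemma mem_h_iff (x : L) : x ∈ D.h ↔ D.Φ x = 0 := by
  rw [D.mem_h, LinearMap.ext_iff]; rfl

/-- A generalized inverse of `Φ`. -/
def g : (L →ₗ[K] K) →ₗ[K] L := (exists_ginv D.Φ).choose

lemma Φ_g_Φ (x : L) : D.Φ (D.g (D.Φ x)) = D.Φ x := (exists_ginv D.Φ).choose_spec x

/-- The projection with kernel the isotropy algebra. -/
def δ : End K L := D.g ∘ₗ D.Φ

lemma δ_apply (x : L) : D.δ x = D.g (D.Φ x) := rfl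

lemma δ_δ (x : L) : D.δ (D.δ x) = D.δ x := by rw [δ_apply, δ_apply, Φ_g_Φ]

lemma δ_of_mem {x : L} (hx : x ∈ D.h) : D.δ x = 0 := by
  rw [δ_apply, (D.mem_h_iff x).1 hx, map_zero]

lemma sub_δ_mem (x : L) : x - D.δ x ∈ D.h := by
  rw [mem_h_iff, map_sub, δ_apply, Φ_g_Φ, sub_self]

/-- The projection onto the isotropy algebra. -/
def p : L →ₗ[K] D.h :=
  LinearMap.codRestrict D.h.toSubmodule (LinearMap.id - D.δ) fun x => D.sub_δ_mem x

lemma coe_p (x : L) : (D.p x : L) = x - D.δ x := rfl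

lemma p_coe (x : D.h) : D.p x = x := Subtype.ext (by rw [coe_p, D.δ_of_mem x.2, sub_zero])

/-- The inclusion of the isotropy algebra. -/
abbrev inc : D.h →ₗ[K] L := D.h.toSubmodule.subtype

lemma mem_h_of_mem {w : L} (hw : w ∈ d.a) : w ∈ D.h := by
  rw [D.mem_h]; intro y; rw [d.ab w hw _ (d.pr_mem y), map_zero]

lemma l_lie {x w : L} (hx : x ∈ D.h) (hw : w ∈ d.a) : D.l ⁅x, w⁆ = 0 := by
  have := (D.mem_h x).1 hx w
  rwa [d.pr_eq w hw] at this

/-- The kernel of the functional on the ideal. -/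
def I : Submodule K L := d.a.toSubmodule ⊓ LinearMap.ker D.l

lemma lie_mem_I {x w : L} (hx : x ∈ D.h) (hw : w ∈ d.a) : ⁅x, w⁆ ∈ D.I :=
  ⟨lie_mem_right K L d.a _ _ hw, D.l_lie hx hw⟩

section trace

lemma Φ_lie {x : L} (hx : x ∈ D.h) (y : L) : D.Φ ⁅x, y⁆ = - (D.Φ y ∘ₗ d.rh x) := by
  ext v
  change D.l (d.rh ⁅x, y⁆ v) = - D.l (d.rh y (d.rh x v))
  rw [d.rh_bracket, lsub_apply, map_sub, mul_apply, mul_apply,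
    d.rh_apply x, (D.mem_h x).1 hx, zero_sub]

lemma Φ_ad_pow {x : L} (hx : x ∈ D.h) (i : ℕ) (y : L) :
    D.Φ ((adL K L x ^ i) y) = (-1 : K) ^ i • (D.Φ y ∘ₗ d.rh x ^ i) := by
  induction i with
  | zero => simp; rfl
  | succ i ih =>
    rw [pow_succ', mul_apply, adL_apply, D.Φ_lie hx, ih]
    ext v
    simp [pow_succ, mul_apply]

lemma trace_rh_even {x : L} (hx : x ∈ D.h) (i : ℕ) (hi : 1 ≤ i) (he : Even i) :
    trace K L (d.rh x ^ i)
      = trace K L (adL K L x ^ i)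
        - trace K L ((LinearMap.id - D.δ) * adL K L x ^ i) := by
  obtain ⟨i, rfl⟩ := exists_eq_add_of_le' hi
  have h1 : D.Φ ∘ₗ D.g ∘ₗ (d.rh x ^ (i + 1)).dualMap = (d.rh x ^ (i + 1)).dualMap := by
    apply lext
    intro φ
    obtain ⟨y, hy⟩ := D.gen x hx (φ ∘ₗ d.rh x ^ i)
    have e : (d.rh x ^ (i + 1)).dualMap φ = D.Φ y := by
      rw [LinearMap.dualMap_apply', pow_succ]
      exact hy
    simp only [comp_apply]
    rw [e, D.Φ_g_Φ]
  have h2 : (D.g ∘ₗ (d.rh x ^ (i + 1)).dualMap) ∘ₗ D.Φ = D.δ * adL K L x ^ (i + 1) := by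
    apply lext
    intro y
    rw [mul_apply, δ_apply, D.Φ_ad_pow hx, he.neg_one_pow, one_smul]
    rfl
  have h3 : trace K L (d.rh x ^ (i + 1))
      = trace K (L →ₗ[K] K) (d.rh x ^ (i + 1)).dualMap :=
    (LinearMap.trace_transpose' (R := K) (d.rh x ^ (i + 1))).symm
  rw [h3, ← h1, LinearMap.trace_comp_comm', h2, sub_mul, map_sub, ← Module.End.one_eq_id, one_mul]
  exact (sub_sub_cancel _ _).symm

lemma exists_section : ∃ σ : L' →ₗ[K] D.h, ∀ y, D.π (σ y) = y := by
  obtain ⟨σ, hσ⟩ := (D.π : D.h →ₗ[K] L').exists_rightInverse_of_surjective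
    (LinearMap.range_eq_top.2 D.π_surj)
  exact ⟨σ, fun y => dcongr_fun hσ y⟩

lemma trace_adL (x : D.h) (i : ℕ) (hi : 1 ≤ i) :
    trace K L' (adL K L' (D.π x) ^ i)
      = trace K L ((LinearMap.id - D.δ) * adL K L (x : L) ^ i)
        - trace K L (d.rh (x : L) ^ i) := by
  obtain ⟨i, rfl⟩ := exists_eq_add_of_le' hi
  obtain ⟨σ, hσ⟩ := D.exists_section
  let π' : D.h →ₗ[K] L' := D.π
  have h1 : ∀ (i : ℕ) (y : D.h), D.π ((adL K D.h x ^ i) y) = (adL K L' (D.π x) ^ i) (D.π y) := by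
    intro i y
    induction i with
    | zero => rfl
    | succ i ih => rw [pow_succ', pow_succ', mul_apply, mul_apply, ← ih,
        adL_apply, adL_apply, LieHom.map_lie]
  have h2 : ∀ (i : ℕ) (y : D.h), (((adL K D.h x ^ i) y : D.h) : L) = (adL K L (x : L) ^ i) y := by
    intro i y
    induction i with
    | zero => rfl
    | succ i ih => rw [pow_succ', pow_succ', mul_apply, mul_apply, ← ih,
        adL_apply, adL_apply, LieSubalgebra.coe_bracket]
  let q : End K L := (LinearMap.id - D.δ) - D.inc ∘ₗ σ ∘ₗ π' ∘ₗ D.p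
  have hq : ∀ y, q y = (D.p y : L) - (σ (D.π (D.p y)) : L) := fun y => rfl
  have hqm : ∀ y, q y ∈ D.I := by
    intro y
    have : D.π (D.p y - σ (D.π (D.p y))) = 0 := by rw [map_sub, hσ, sub_self]
    exact (D.π_eq_zero _).1 this
  have hqI : ∀ w ∈ D.I, q w = w := by
    intro w hw
    have e : D.p w = ⟨w, D.mem_h_of_mem hw.1⟩ := D.p_coe ⟨w, D.mem_h_of_mem hw.1⟩
    rw [hq, e, (D.π_eq_zero ⟨w, D.mem_h_of_mem hw.1⟩).2 hw, map_zero]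
    simp
  have e1 : adL K L' (D.π x) ^ (i + 1) = π' ∘ₗ (adL K D.h x ^ (i + 1)) ∘ₗ σ := by
    apply lext
    intro y
    change _ = D.π _
    rw [comp_apply, h1, hσ]
  have e2 : ((adL K D.h x ^ (i + 1)) ∘ₗ σ) ∘ₗ π'
      = D.p ∘ₗ (adL K L (x : L) ^ (i + 1)) ∘ₗ D.inc ∘ₗ σ ∘ₗ π' := by
    apply lext
    intro y
    simp only [comp_apply]
    change _ = D.p ((adL K L (x : L) ^ (i + 1)) ((σ (π' y) : D.h) : L))
    rw [← h2, p_coe]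
  have e3 : (adL K L (x : L) ^ (i + 1)) * q = d.rh (x : L) ^ (i + 1) * q := by
    apply lext
    intro y
    rw [mul_apply, mul_apply, d.rh_pow, d.pr_eq _ (hqm y).1]
  have e4 : q * d.rh (x : L) ^ (i + 1) = d.rh (x : L) ^ (i + 1) := by
    apply lext
    intro y
    rw [pow_succ', mul_apply, mul_apply, d.rh_apply]
    exact hqI _ (D.lie_mem_I x.2 (d.pr_mem _))
  have e5 : ((adL K L (x : L) ^ (i + 1)) ∘ₗ D.inc ∘ₗ σ ∘ₗ π') ∘ₗ D.p
      = (adL K L (x : L) ^ (i + 1)) * (LinearMap.id - D.δ) - (adL K L (x : L) ^ (i + 1)) * q := by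
    rw [← mul_sub, sub_sub_cancel]; rfl
  rw [e1, LinearMap.trace_comp_comm', e2, LinearMap.trace_comp_comm', e5, map_sub,
    LinearMap.trace_mul_comm K _ (LinearMap.id - D.δ), e3, LinearMap.trace_mul_comm K _ q, e4]

end trace

end Polar

end

section

lemma ι_eq_zero_iff {K V : Type} [Field K] [AddCommGroup V] [Module K V] (x : V) :
    ι K V x = 0 ↔ x = 0 := by
  refine ⟨fun h => ?_, fun h => by rw [h, map_zero]⟩
  rw [← Module.forall_dual_apply_eq_zero_iff K]
  intro φ
  have := congrArg (slift φ) h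
  simpa using this

lemma sg_jop_single {K V E A : Type} [Field K] [CharZero K] [AddCommGroup V] [Module K V]
    [FiniteDimensional K V] [AddCommGroup E] [Module K E] [Ring A] [Algebra K A]
    (c : K) (ρ : V →ₗ[K] End K E) (e f : V →ₗ[K] A)
    (h : ∀ x, f x = algebraMap K A (c * trace K E (ρ x)) + e x)
    (P : 𝒮 K V) : sg e (jop (fun i => if i = 1 then c else 0) ρ P) = sg f P := by
  have : sg e ∘ₗ jop (fun i => if i = 1 then c else 0) ρ = sg f := by
    apply ext_dp
    intro x n
    rw [comp_apply, jop_dp, map_sum, sg_dp, h, dvp_add_of_commute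
      (Algebra.commute_algebraMap_left _ _)]
    refine sum_congr rfl fun r _ => ?_
    rw [map_smul, sg_dp, ← Algebra.ofId_apply, ← map_dvp, Algebra.ofId_apply, ← asmul_def]
    congr 1
    symm
    refine eq_expSeq K _ (fun n => dvp K (c * trace K E (ρ x)) n) (by simp [dvp_zero])
      (fun n => ?_) r.1
    rw [sum_anti_range, sum_range_succ',
      sum_eq_zero fun i _ => by simp]
    simp only [← mul_dvp]
    simp
  exact dcongr_fun this P

namespace Polar

variable {K L : Type} [Field K] [CharZero K] [LieRing L] [LieAlgebra K L] [FiniteDimensional K L]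
  {d : AbIdeal K L} {L' : Type} [LieRing L'] [LieAlgebra K L'] [FiniteDimensional K L']
  (D : Polar d L')

local notation "U" => 𝒰 K L

lemma smap_mkQ_adD {w : L} (hw : w ∈ d.a) (P : 𝒮 K L) :
    smap D.I.mkQ (adD w P) = smap D.I.mkQ (ι K L D.z) * smap D.I.mkQ (pd (D.l ∘ₗ adL K L w) P) := by
  have h : ∀ x, D.I.mkQ ⁅w, x⁆ = D.l ⁅w, x⁆ • D.I.mkQ D.z := by
    intro x
    rw [← map_smul, ← sub_eq_zero, ← map_sub]
    refine (qmk_eq_zero _).2 ⟨?_, ?_⟩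
    · exact sub_mem (lie_mem_left K L d.a w x hw) (d.a.smul_mem _ D.z_mem)
    · simp [D.l_z]
  have : (smap D.I.mkQ).toLinearMap ∘ₗ (adD (K := K) w).toLinearMap
      = mulLeft K (smap D.I.mkQ (ι K L D.z)) ∘ₗ (smap D.I.mkQ).toLinearMap ∘ₗ
        (pd (D.l ∘ₗ adL K L w)).toLinearMap := by
    apply ext_dp
    intro x n
    change smap D.I.mkQ (adD w (dp x n)) = smap D.I.mkQ (ι K L D.z) *
      smap D.I.mkQ (pd (D.l ∘ₗ adL K L w) (dp x n))
    rcases n with _ | n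
    · rw [pd_dp_zero, adD, der_dp_zero]; simp
    · rw [pd_dp_succ, adD, der_dp_succ, der_ι, map_mul, comp_apply, comp_apply,
        adL_apply, smap_ι, smap_ι, h, map_smul, map_smul]
      simp only [asmul_def]
      ring
  exact dcongr_fun this P

lemma smap_mkQ_z_ne_zero : smap D.I.mkQ (ι K L D.z) ≠ 0 := by
  rw [smap_ι, Ne, ι_eq_zero_iff]
  intro h
  have h' : D.l D.z = 0 := ((qmk_eq_zero D.I).1 h).2
  rw [D.l_z] at h'
  exact one_ne_zero h'

lemma smap_mkQ_pd {w : L} (hw : w ∈ d.a) {P : 𝒮 K L} (hP : d.AInv P) :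
    smap D.I.mkQ (pd (D.l ∘ₗ adL K L w) P) = 0 := by
  have := D.smap_mkQ_adD hw P
  rw [hP w hw, map_zero] at this
  exact (mul_eq_zero.1 this.symm).resolve_left D.smap_mkQ_z_ne_zero

lemma sub_mem_idl {P : 𝒮 K L} (hP : d.AInv P) :
    P - smap D.inc (smap D.p P) ∈ idl D.I := by
  let b := finBasis K L
  have h1 : der (ι K L ∘ₗ D.δ) = - ∑ k, ι K L (D.g (b.coord k)) •
      pd (D.l ∘ₗ adL K L (d.pr (b k))) := by
    apply der_ext
    intro x
    have h : D.Φ x = - ∑ k, D.l ⁅d.pr (b k), x⁆ • b.coord k := by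
      refine b.ext fun i => ?_
      simp only [lneg_apply, lsum_apply, lsmul_apply,
        Module.Basis.coord_apply, Module.Basis.repr_self]
      rw [sum_eq_single i (fun k _ hk => by simp [Finsupp.single_apply, hk.symm]) (by simp)]
      rw [D.Φ_apply, ← lie_skew, map_neg]
      simp only [Finsupp.single_eq_same, smul_eq_mul, mul_one]
    rw [der_ι, comp_apply, D.δ_apply, h]
    simp only [map_neg, map_sum, map_smul, Derivation.neg_apply, neg_inj]
    rw [← Derivation.coeFnAddMonoidHom_apply, map_sum, Finset.sum_apply]
    refine sum_congr rfl fun k _ => ?_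
    rw [Derivation.coeFnAddMonoidHom_apply, Derivation.smul_apply, pd_ι, smul_eq_mul, mul_comm,
      ← asmul_def]
    rfl
  have h2 : smap D.I.mkQ (der (ι K L ∘ₗ D.δ) P) = 0 := by
    rw [h1, Derivation.neg_apply, map_neg, neg_eq_zero, ← Derivation.coeFnAddMonoidHom_apply,
      map_sum, Finset.sum_apply, map_sum]
    refine sum_eq_zero fun k _ => ?_
    rw [Derivation.coeFnAddMonoidHom_apply, Derivation.smul_apply, smul_eq_mul, map_mul,
      D.smap_mkQ_pd (d.pr_mem _) hP, mul_zero]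
  have h3 : D.I ≤ D.I.comap D.δ := fun w hw => by
    rw [mem_comap, D.δ_of_mem (D.mem_h_of_mem hw.1)]; exact zero_mem _
  have h4 := smap_eq_of_der D.I.mkQ D.δ (D.I.mapQ D.I D.δ h3) (fun x => rfl) D.δ_δ h2
  have h5 : P - smap (LinearMap.id - D.δ) P ∈ idl (LinearMap.ker D.I.mkQ) :=
    mem_idl_of_smap _ (by rw [map_sub, h4, sub_self])
  rw [Submodule.ker_mkQ] at h5
  rwa [smap_comp]

/-- The right ideal generated by the kernel of the functional on the ideal. -/
def J : Submodule K U := span K {u | ∃ w ∈ D.I, ∃ v, uι K L w * v = u}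

lemma mul_mem_J {w : L} (hw : w ∈ D.I) (v : U) : uι K L w * v ∈ D.J :=
  subset_span ⟨w, hw, v, rfl⟩

lemma J_le {W : Submodule K U} (h : ∀ w ∈ D.I, ∀ v, uι K L w * v ∈ W) : D.J ≤ W :=
  span_le.2 fun _ ⟨w, hw, v, e⟩ => e ▸ h w hw v

lemma J_mul_right (u : U) : D.J ≤ D.J.comap (mulRight K u) :=
  D.J_le fun w hw v => by
    rw [mem_comap, mulRight_apply, mul_assoc]; exact D.mul_mem_J hw _

lemma J_mul_left {x : L} (hx : x ∈ D.h) : D.J ≤ D.J.comap (mulLeft K (uι K L x)) :=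
  D.J_le fun w hw v => by
    rw [mem_comap, mulLeft_apply, ← mul_assoc, uι_mul_uι, add_mul, mul_assoc]
    exact add_mem (D.mul_mem_J hw _) (D.mul_mem_J (D.lie_mem_I hx hw.1) _)

lemma N_mem_J {P : 𝒮 K L} (hP : P ∈ idl D.I) : d.N P ∈ D.J := by
  revert P
  change idl D.I ≤ D.J.comap d.N
  refine idl_le fun w hw Q => ?_
  rw [mem_comap, d.N_ι_mul hw.1]
  exact D.mul_mem_J hw _

/-- The action of the isotropy algebra on the quotient by the right ideal. -/
def X : D.h →ₗ[K] End K (U ⧸ D.J) where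
  toFun x := D.J.mapQ D.J (mulLeft K (uι K L (x : L))) (D.J_mul_left x.2)
  map_add' x y := by
    apply linearMap_qext
    ext u
    simp [add_mul]
  map_smul' c x := by
    apply linearMap_qext
    ext u
    simp

lemma X_mk (x : D.h) (u : U) : D.X x (D.J.mkQ u) = D.J.mkQ (uι K L (x : L) * u) := rfl

lemma X_of_mem (x : D.h) (hx : (x : L) ∈ D.I) : D.X x = 0 := by
  apply linearMap_qext
  apply lext
  intro u
  exact (qmk_eq_zero _).2 (D.mul_mem_J hx u)

lemma X_mul (x y : D.h) : D.X x * D.X y = D.X y * D.X x + D.X ⁅x, y⁆ := by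
  apply linearMap_qext
  apply lext
  intro u
  change D.J.mkQ (uι K L (x : L) * (uι K L (y : L) * u))
    = D.J.mkQ (uι K L (y : L) * (uι K L (x : L) * u)) + D.J.mkQ (uι K L ((⁅x, y⁆ : D.h) : L) * u)
  rw [← mul_assoc, uι_mul_uι, add_mul, mul_assoc, map_add, LieSubalgebra.coe_bracket]

/-- The character of the isotropy algebra. -/
def χ : D.h →ₗ[K] K := -(2⁻¹ : K) • (trace K L ∘ₗ d.rh ∘ₗ D.inc)

lemma χ_apply (x : D.h) : D.χ x = -2⁻¹ * trace K L (d.rh (x : L)) := rfl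

lemma χ_of_mem (x : D.h) (hx : (x : L) ∈ d.a) : D.χ x = 0 := by
  rw [χ_apply, d.rh_mem hx, map_zero, mul_zero]

lemma χ_lie (x y : D.h) : D.χ ⁅x, y⁆ = 0 := by
  rw [χ_apply, LieSubalgebra.coe_bracket, d.rh_bracket, map_sub, LinearMap.trace_mul_comm, sub_self,
    mul_zero]

/-- The action twisted by the character. -/
def Y : D.h →ₗ[K] End K (U ⧸ D.J) :=
  Algebra.linearMap K (End K (U ⧸ D.J)) ∘ₗ D.χ + D.X

lemma Y_apply (x : D.h) : D.Y x = algebraMap K _ (D.χ x) + D.X x := rfl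

lemma Y_eq_zero (x : D.h) (hx : D.π x = 0) : D.Y x = 0 := by
  have h := (D.π_eq_zero x).1 hx
  rw [Y_apply, D.X_of_mem x h, D.χ_of_mem x h.1, map_zero, add_zero]

lemma Y_mul (x y : D.h) : D.Y x * D.Y y = D.Y y * D.Y x + D.Y ⁅x, y⁆ := by
  simp only [Y_apply, χ_lie, map_zero, zero_add, add_mul, mul_add, X_mul D x y]
  rw [← Algebra.commutes (D.χ x) (D.X y), ← Algebra.commutes (D.χ y) (D.X x),
    ← Algebra.commutes (D.χ x) (algebraMap K _ (D.χ y))]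
  abel

attribute [local instance] LieRing.ofAssociativeRing

/-- The induced action of the quotient of the isotropy algebra. -/
def rho : L' →ₗ⁅K⁆ End K (U ⧸ D.J) :=
  { D.Y ∘ₗ D.exists_section.choose with
    map_lie' := by
      intro x y
      have hσ := D.exists_section.choose_spec
      change D.Y (D.exists_section.choose ⁅x, y⁆) = ⁅D.Y (D.exists_section.choose x),
        D.Y (D.exists_section.choose y)⁆
      rw [LieRing.of_associative_ring_bracket, Y_mul, add_sub_cancel_left, ← sub_eq_zero, ← map_sub]
      apply Y_eq_zero
      rw [map_sub, hσ, LieHom.map_lie, hσ, hσ, sub_self] }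

lemma rho_π (x : D.h) : D.rho (D.π x) = D.Y x := by
  change D.Y (D.exists_section.choose (D.π x)) = _
  rw [← sub_eq_zero, ← map_sub]
  apply Y_eq_zero
  rw [map_sub, D.exists_section.choose_spec, sub_self]

/-- The representation of the enveloping algebra on the quotient. -/
def act : 𝒰 K L' →ₐ[K] End K (U ⧸ D.J) :=
  UniversalEnvelopingAlgebra.lift K D.rho

lemma act_symm (P : 𝒮 K D.h) : D.act (symm K L' (smap D.π P)) = sg D.Y P := by
  rw [symm, sg_smap, act, map_sg]
  refine congrArg (fun f => sg f P) (lext fun x => ?_)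
  exact (lift_uι D.rho (D.π x)).trans (D.rho_π x)

lemma N_dp_mul {w : L} (hw : w ∈ d.a) (n : ℕ) (P : 𝒮 K L) :
    d.N (dp w n * P) = dvp K (uι K L w) n * d.N P := by
  induction n generalizing P with
  | zero => simp [dvp_zero]
  | succ n ih =>
    have h : ((n + 1 : ℕ) : K) ≠ 0 := by exact_mod_cast n.succ_ne_zero
    apply smul_right_injective _ h
    change _ • _ = _ • _
    rw [← map_smul, ← smul_mul_assoc, ← ι_mul_dp, ← smul_mul_assoc, ← mul_dvp, mul_assoc,
      d.N_ι_mul hw, ih, mul_assoc]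

lemma dvp_X_mk (x : D.h) (n : ℕ) (u : U) :
    dvp K (D.X x) n (D.J.mkQ u) = D.J.mkQ (dvp K (uι K L (x : L)) n * u) := by
  have h : ∀ n, (D.X x ^ n) (D.J.mkQ u) = D.J.mkQ (uι K L (x : L) ^ n * u) := by
    intro n
    induction n with
    | zero => simp
    | succ n ih => rw [pow_succ', mul_apply, ih, X_mk, pow_succ', mul_assoc]
  rw [dvp, dvp, lsmul_apply, h, smul_mul_assoc, map_smul]

lemma mk_N (R : 𝒮 K D.h) :
    D.J.mkQ (d.N (smap D.inc R)) = sg D.X R (D.J.mkQ 1) := by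
  have : D.J.mkQ ∘ₗ d.N ∘ₗ (smap D.inc).toLinearMap
      = LinearMap.applyₗ (D.J.mkQ 1) ∘ₗ sg D.X := by
    apply ext_dp
    intro x n
    change D.J.mkQ (d.N (smap D.inc (dp x n))) = sg D.X (dp x n) (D.J.mkQ 1)
    let w : D.h := ⟨d.pr x, D.mem_h_of_mem (d.pr_mem x)⟩
    let y : D.h := x - w
    have hw : (w : L) ∈ d.a := d.pr_mem x
    have hxw : x = w + y := by simp [y]
    have hc : Commute (D.X w) (D.X y) := by
      rw [Commute, SemiconjBy, X_mul, add_eq_left]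
      apply X_of_mem
      rw [LieSubalgebra.coe_bracket, ← lie_skew]
      exact neg_mem (D.lie_mem_I y.2 hw)
    have hy : d.pr (y : L) = 0 := d.pr_sub x
    rw [smap_dp, sg_dp]
    conv_rhs => rw [hxw]
    rw [map_add, dvp_add_of_commute hc, lsum_apply]
    have e : D.inc x = (w : L) + (y : L) := congrArg Subtype.val hxw
    rw [e, dp_add, map_sum, map_sum]
    refine sum_congr rfl fun r _ => ?_
    rw [N_dp_mul hw, d.N_dp_of_pr hy, mul_apply, dvp_X_mk, dvp_X_mk, mul_one]
  exact dcongr_fun this R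

/-- The polynomial on the quotient of the isotropy algebra obtained by restriction. -/
def res (P : 𝒮 K L) : 𝒮 K L' := smap D.π (smap D.p P)

lemma res_mul (P Q : 𝒮 K L) : D.res (P * Q) = D.res P * D.res Q := by
  rw [res, map_mul, map_mul]; rfl

lemma dfl_sub_mem {P : 𝒮 K L} (hP : IsInv K P) :
    D.J.mkQ (dfl K L P) = D.act (dfl K L' (D.res P)) (D.J.mkQ 1) := by
  have hA : d.AInv P := fun w _ => hP w
  set R := smap D.p P with hR
  have h1 : jop (fun i => dW K i - gC K i) d.rh (jop (dW K) d.qh (smap D.inc R))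
      = smap D.inc (jop (fun i => if i = 1 then -2⁻¹ else 0) (d.rh ∘ₗ D.inc)
        (jop (dW K) (adL K L' ∘ₗ (D.π : D.h →ₗ[K] L')) R)) := by
    rw [← jop_smap (dW K) (dW K) (d.qh ∘ₗ D.inc) d.qh D.inc (fun _ _ _ => rfl),
      ← jop_smap (fun i => dW K i - gC K i) (fun i => dW K i - gC K i) (d.rh ∘ₗ D.inc) d.rh D.inc
        (fun _ _ _ => rfl)]
    congr 1
    apply jop_jop_congr
    intro x i hi
    change (dW K i - gC K i) * trace K L (d.rh (x : L) ^ i)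
      + dW K i * trace K L (d.qh (x : L) ^ i)
      = (if i = 1 then -2⁻¹ else 0) * trace K L (d.rh (x : L) ^ i)
      + dW K i * trace K L' (adL K L' (D.π x) ^ i)
    rw [D.trace_adL x i hi, d.trace_qh (x : L) i hi, dW, gC]
    rcases Nat.even_or_odd i with he | ho
    · have e := D.trace_rh_even x.2 i hi he
      have : i ≠ 1 := by rintro rfl; exact absurd he (by decide)
      simp only [if_neg this]
      rw [show trace K L ((LinearMap.id - D.δ) * adL K L (x : L) ^ i)
        = trace K L (adL K L (x : L) ^ i) - trace K L (d.rh (x : L) ^ i) by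
          rw [e]; ring]
      ring
    · rw [hC_odd K i (Nat.odd_iff.1 ho)]
      split_ifs <;> ring
  have h2 : D.J.mkQ (dfl K L P) = D.J.mkQ (d.N (jop (fun i => dW K i - gC K i) d.rh
      (jop (dW K) d.qh (smap D.inc R)))) := by
    rw [d.dfl_eq_N hP, ← sub_eq_zero, ← map_sub, ← map_sub, ← map_sub, ← map_sub]
    exact (qmk_eq_zero _).2
      (D.N_mem_J (d.jop_mem_idl (I := D.I) (fun w hw => hw.1) (D.sub_mem_idl hA)))
  rw [h2, h1, D.mk_N, sg_jop_single (-2⁻¹) _ D.X D.Y (fun x => rfl), ← D.act_symm,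
    jop_smap (dW K) (dW K) _ (adL K L') _ (fun _ _ _ => rfl)]
  rfl

lemma res_eq_zero {P : 𝒮 K L} (hP : P ∈ idl D.I) : D.res P = 0 := by
  let f := (smap (D.π : D.h →ₗ[K] L')).toLinearMap ∘ₗ (smap D.p).toLinearMap
  change f P = 0
  revert P
  change idl D.I ≤ LinearMap.ker f
  refine idl_le fun w hw Q => ?_
  have e : D.p w = ⟨w, D.mem_h_of_mem hw.1⟩ := D.p_coe ⟨w, D.mem_h_of_mem hw.1⟩
  change D.res (ι K L w * Q) = 0
  rw [res_mul, res, smap_ι, smap_ι, e]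
  have : (D.π : D.h →ₗ[K] L') ⟨w, D.mem_h_of_mem hw.1⟩ = 0 := (D.π_eq_zero _).2 hw
  rw [this, map_zero, zero_mul]

lemma res_isInv {P : 𝒮 K L} (hP : IsInv K P) : IsInv K (D.res P) := by
  intro y
  obtain ⟨x, rfl⟩ := D.π_surj y
  have hA : d.AInv P := fun w _ => hP w
  set R := smap D.p P with hR
  have h1 : adD (D.π x) (D.res P) = smap D.π (adD x R) :=
    (smap_der (D.π : D.h →ₗ[K] L') (adL K D.h x) (adL K L' (D.π x))
      (fun v => LieHom.map_lie D.π x v) R).symm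
  have h2 : smap D.inc (adD x R) = adD (x : L) (smap D.inc R) :=
    smap_der D.inc (adL K D.h x) (adL K L (x : L)) (fun v => rfl) R
  have h3 : smap D.inc (adD x R) ∈ idl D.I := by
    have e : adD (x : L) (P - smap D.inc R) ∈ idl D.I := by
      have hm := D.sub_mem_idl hA
      rw [← hR] at hm
      revert hm
      generalize P - smap D.inc R = F
      revert F
      change idl D.I ≤ (idl D.I).comap (adD (x : L)).toLinearMap
      refine idl_le fun w hw Q => ?_
      change adD (x : L) (ι K L w * Q) ∈ idl D.I
      rw [leibniz, smul_eq_mul, smul_eq_mul, adD, der_ι, mul_comm Q]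
      exact add_mem (ι_mul_mem_idl hw _) (ι_mul_mem_idl (D.lie_mem_I x.2 hw.1) _)
    rw [map_sub, hP, zero_sub] at e
    rw [h2]
    simpa using neg_mem e
  have h4 : smap D.p (smap D.inc (adD x R)) = adD x R := by
    rw [smap_comp, show D.p ∘ₗ D.inc = LinearMap.id from lext D.p_coe, smap_id]
  rw [h1, ← h4]
  exact D.res_eq_zero h3

/-- Right multiplication on the quotient. -/
def rm (u : U) : End K (U ⧸ D.J) := D.J.mapQ D.J (mulRight K u) (D.J_mul_right u)

lemma rm_mk (u v : U) : D.rm u (D.J.mkQ v) = D.J.mkQ (v * u) := rfl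

lemma rm_act (u : U) (v : 𝒰 K L') : D.rm u * D.act v = D.act v * D.rm u := by
  let W : Submodule K (𝒰 K L') :=
    LinearMap.eqLocus (mulLeft K (D.rm u) ∘ₗ D.act.toLinearMap)
      (mulRight K (D.rm u) ∘ₗ D.act.toLinearMap)
  have hW : W = ⊤ := by
    apply uea_induction
    · change D.rm u * D.act 1 = D.act 1 * D.rm u
      rw [map_one, mul_one, one_mul]
    · intro x v hv
      change D.rm u * D.act v = D.act v * D.rm u at hv
      change D.rm u * D.act (uι K L' x * v) = D.act (uι K L' x * v) * D.rm u
      obtain ⟨x, rfl⟩ := D.π_surj x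
      have e : D.act (uι K L' (D.π x)) = D.Y x := (lift_uι D.rho (D.π x)).trans (D.rho_π x)
      have c : D.rm u * D.Y x = D.Y x * D.rm u := by
        rw [Y_apply, mul_add, add_mul, Algebra.commutes]
        congr 1
        apply linearMap_qext
        apply lext
        intro v
        change D.J.mkQ (uι K L (x : L) * v * u) = D.J.mkQ (uι K L (x : L) * (v * u))
        rw [mul_assoc]
      rw [map_mul, e, ← mul_assoc, c, mul_assoc, hv, mul_assoc]
  exact (Submodule.eq_top_iff'.1 hW v : _)

lemma dfl_mul_sub_mem (h : DufloMul K L') {P Q : 𝒮 K L} (hP : IsInv K P)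
    (hQ : IsInv K Q) : dfl K L P * dfl K L Q - dfl K L (P * Q) ∈ D.J := by
  apply (qmk_eq_zero D.J).1
  change D.J.mkQ _ = 0
  rw [map_sub, D.dfl_sub_mem (hP.mul hQ), res_mul, h _ _ (D.res_isInv hP) (D.res_isInv hQ), map_mul D.act,
    mul_apply, ← D.dfl_sub_mem hQ, sub_eq_zero, ← rm_mk, D.dfl_sub_mem hP,
    ← mul_apply, rm_act, mul_apply, rm_mk, one_mul]

end Polar

end

section

namespace AbIdeal

variable {K L : Type} [Field K] [CharZero K] [LieRing L] [LieAlgebra K L] [FiniteDimensional K L]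
  (d : AbIdeal K L)

/-- The matrix of brackets with elements of the ideal. -/
def bm {r : ℕ} (x w : Fin r → L) : Matrix (Fin r) (Fin r) (𝒮 K L) :=
  Matrix.of fun i j => ι K L ⁅x i, d.pr (w j)⁆

lemma det_bm_eq_zero {r : ℕ} (hr : finrank K L < r) (x w : Fin r → L) :
    (d.bm x w).det = 0 := by
  have hx : ¬ LinearIndependent K x := fun h => by
    have := h.fintype_card_le_finrank
    rw [Fintype.card_fin] at this
    omega
  obtain ⟨c, hc, i, hi⟩ := Fintype.not_linearIndependent_iff.1 hx
  rw [← Matrix.exists_vecMul_eq_zero_iff]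
  refine ⟨fun i => algebraMap K _ (c i), fun h => hi ?_, ?_⟩
  · have := congrFun h i
    exact (map_eq_zero_iff _ (algebraMap K (𝒮 K L)).injective).1 this
  · funext j
    have e : ∑ i, c i • ⁅x i, d.pr (w j)⁆ = 0 := by
      have := lcongr_fun (congrArg (adL K L) hc) (d.pr (w j))
      simpa only [map_sum, map_smul, lsum_apply, lsmul_apply, map_zero,
        lzero_apply, adL_apply] using this
    simp only [Matrix.vecMul, dotProduct, bm, Matrix.of_apply, ← asmul_def, ← map_smul,
      ← map_sum]
    rw [e, map_zero]
    rfl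

lemma exists_rank : ∃ (r : ℕ) (x w : Fin r → L), (d.bm x w).det ≠ 0 ∧
    ∀ x w : Fin (r + 1) → L, (d.bm x w).det = 0 := by
  by_contra! h
  have key : ∀ r : ℕ, ∃ x w : Fin r → L, (d.bm x w).det ≠ 0 := by
    intro r
    induction r with
    | zero => exact ⟨0, 0, by simp⟩
    | succ r ih =>
      obtain ⟨x, w, hxw⟩ := ih
      exact h r x w hxw
  obtain ⟨x, w, hxw⟩ := key (finrank K L + 1)
  exact hxw (d.det_bm_eq_zero (Nat.lt_succ_self _) x w)

lemma exists_of_rank {r : ℕ} {xs ws : Fin r → L}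
    (h1 : ∀ x w : Fin (r + 1) → L, (d.bm x w).det = 0) (l : L →ₗ[K] K)
    (hl : slift l (d.bm xs ws).det ≠ 0) (x : L)
    (hx : ∀ y, l ⁅x, d.pr y⁆ = 0) (φ : L →ₗ[K] K) : ∃ y, φ ∘ₗ d.rh x = l ∘ₗ d.rh y := by
  let e : L → Fin (r + 1) → Fin (r + 1) → L := fun v i j =>
    ⁅(Fin.cons x xs : Fin (r + 1) → L) i, d.pr ((Fin.cons v ws : Fin (r + 1) → L) j)⁆
  let f : L →ₗ[K] Polynomial K := Algebra.linearMap K (Polynomial K) ∘ₗ l +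
    mulLeft K (Polynomial.X : Polynomial K) ∘ₗ Algebra.linearMap K (Polynomial K) ∘ₗ φ
  have hf : ∀ v, f v = Polynomial.C (l v) + Polynomial.X * Polynomial.C (φ v) := fun v => rfl
  let A : L → Matrix (Fin (r + 1)) (Fin (r + 1)) K := fun v => Matrix.of fun i j =>
    if i = 0 then φ (e v 0 j) else l (e v i j)
  have hA : ∀ v, (A v).det = 0 := by
    intro v
    let B : Matrix (Fin (r + 1)) (Fin (r + 1)) (Polynomial K) := Matrix.of fun i j =>
      if i = 0 then Polynomial.C (φ (e v 0 j)) else f (e v i j)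
    have h2 := congrArg (slift f) (h1 (Fin.cons x xs) (Fin.cons v ws))
    rw [map_zero, AlgHom.map_det] at h2
    have h3 : (slift f).mapMatrix (d.bm (Fin.cons x xs) (Fin.cons v ws))
        = Matrix.of fun i j => (if i = 0 then Polynomial.X else 1) * B i j := by
      ext1 i j
      simp only [AlgHom.mapMatrix_apply, Matrix.map_apply, bm, Matrix.of_apply, B]
      rw [SymmetricAlgebra.lift_ι_apply]
      split_ifs with h0
      · subst h0
        rw [hf]
        simp only [Fin.cons_zero, hx, e]
        simp
      · rw [one_mul]
    rw [h3, Matrix.det_mul_column, Fin.prod_univ_succ] at h2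
    simp only [Fin.succ_ne_zero, if_true, if_false, prod_const_one, mul_one,
      mul_eq_zero, Polynomial.X_ne_zero, false_or] at h2
    have h4 := congrArg (Polynomial.evalRingHom (0 : K)) h2
    rw [map_zero, RingHom.map_det] at h4
    rw [← h4]
    congr 1
    ext1 i j
    simp only [A, B, RingHom.mapMatrix_apply, Matrix.map_apply, Matrix.of_apply]
    split_ifs <;> simp [hf]
  let c : Fin r → K := fun i => (-1) ^ ((i.succ : Fin (r + 1)) : ℕ) *
    ((A 0).submatrix (i.succ).succAbove Fin.succ).det
  have hd0 : ∀ v, ((A v).submatrix (0 : Fin (r + 1)).succAbove Fin.succ).det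
      = slift l (d.bm xs ws).det := by
    intro v
    rw [AlgHom.map_det]
    congr 1
    ext1 i j
    simp [A, e, bm, Fin.succ_ne_zero]
  have hsub : ∀ v (i : Fin r → Fin (r + 1)), (A v).submatrix i Fin.succ = (A 0).submatrix i (Fin.succ : Fin r → _) := by
    intro v i
    ext1 a b
    simp [A, e]
  set Δ := slift l (d.bm xs ws).det with hΔ
  have key : ∀ v, φ ⁅x, d.pr v⁆ * Δ + ∑ i, c i * l ⁅xs i, d.pr v⁆ = 0 := by
    intro v
    have := hA v
    rw [Matrix.det_succ_column_zero, Fin.sum_univ_succ, hd0] at this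
    rw [← this]
    congr 1
    · simp [A, e]
    · refine sum_congr rfl fun i _ => ?_
      rw [hsub]
      simp only [A, e, c, Matrix.of_apply, Fin.succ_ne_zero, if_false, Fin.cons_succ, Fin.cons_zero]
      ring
  refine ⟨-(Δ⁻¹ • ∑ i, c i • xs i), lext fun v => ?_⟩
  simp only [comp_apply, rh_apply]
  have e2 : l ⁅-(Δ⁻¹ • ∑ i, c i • xs i), d.pr v⁆ = -(Δ⁻¹ * ∑ i, c i * l ⁅xs i, d.pr v⁆) := by
    rw [← rh_apply]
    simp only [map_neg, map_smul, map_sum, lneg_apply, lsmul_apply,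
      lsum_apply, rh_apply, smul_eq_mul]
  rw [e2, eq_neg_of_add_eq_zero_right (key v)]
  field_simp

/-- The isotropy algebra of a functional on the ideal. -/
def iso (l : L →ₗ[K] K) : LieSubalgebra K L where
  carrier := {x | ∀ y, l ⁅x, d.pr y⁆ = 0}
  zero_mem' y := by simp
  add_mem' hx hy v := by rw [add_lie, map_add, hx, hy, add_zero]
  smul_mem' c x hx v := by rw [smul_lie, map_smul, hx, smul_zero]
  lie_mem' {x y} hx hy v := by
    rw [lie_lie, map_sub, ← d.pr_eq _ (lie_mem_right K L d.a y _ (d.pr_mem v)),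
      ← d.pr_eq _ (lie_mem_right K L d.a x _ (d.pr_mem v)), hx, hy, sub_zero]

/-- The kernel of the functional as an ideal of the isotropy algebra. -/
def isoKer (l : L →ₗ[K] K) : LieIdeal K (d.iso l) where
  carrier := {x | (x : L) ∈ d.a ∧ l x = 0}
  zero_mem' := ⟨d.a.zero_mem, map_zero _⟩
  add_mem' hx hy := ⟨d.a.add_mem hx.1 hy.1, by
    rw [AddMemClass.coe_add, map_add, hx.2, hy.2, add_zero]⟩
  smul_mem' c x hx := ⟨d.a.smul_mem c hx.1, by
    rw [SetLike.val_smul, map_smul, hx.2, smul_zero]⟩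
  lie_mem {x y} hy := by
    refine ⟨lie_mem_right K L d.a _ _ hy.1, ?_⟩
    rw [LieSubalgebra.coe_bracket, ← d.pr_eq _ hy.1]
    exact x.2 _

lemma exists_polar (l : L →ₗ[K] K) {w₀ : L} (hw₀ : w₀ ∈ d.a) (hl₀ : l w₀ ≠ 0)
    (hd : (∃ x : L, ∃ y ∈ d.a, w₀ = ⁅x, y⁆) ∨ 2 ≤ finrank K d.a)
    (gen : ∀ x, (∀ y, l ⁅x, d.pr y⁆ = 0) → ∀ φ : L →ₗ[K] K, ∃ y, φ ∘ₗ d.rh x = l ∘ₗ d.rh y) :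
    ∃ (L' : Type) (_ : LieRing L') (_ : LieAlgebra K L') (_ : FiniteDimensional K L')
      (D : Polar d L'), D.l = l ∧ finrank K L' < finrank K L := by
  let π : d.iso l →ₗ⁅K⁆ (d.iso l ⧸ d.isoKer l) :=
    { (d.isoKer l).toSubmodule.mkQ with map_lie' := rfl }
  have hπ : Function.Surjective π := (d.isoKer l).toSubmodule.mkQ_surjective
  have hπ0 : ∀ x : d.iso l, π x = 0 ↔ (x : L) ∈ d.a ∧ l x = 0 := fun x =>
    qmk_eq_zero (d.isoKer l).toSubmodule
  have hfd : FiniteDimensional K (d.iso l ⧸ d.isoKer l) :=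
    Module.Finite.of_surjective (π : d.iso l →ₗ[K] _) hπ
  refine ⟨d.iso l ⧸ d.isoKer l, inferInstance, inferInstance, hfd,
    { l := l, h := d.iso l, mem_h := fun x => Iff.rfl, π := π, π_surj := hπ, π_eq_zero := hπ0,
      z := (l w₀)⁻¹ • w₀, z_mem := d.a.smul_mem _ hw₀, l_z := by simp [hl₀],
      gen := fun x hx φ => gen x hx φ }, rfl, ?_⟩
  have h1 : finrank K (d.iso l ⧸ d.isoKer l) ≤ finrank K (d.iso l) :=
    LinearMap.finrank_le_finrank_of_surjective (f := (π : d.iso l →ₗ[K] _)) hπ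
  have h2 : finrank K (d.iso l) ≤ finrank K L :=
    Submodule.finrank_le (d.iso l).toSubmodule
  by_contra! h3
  rcases hd with ⟨x, y, hy, rfl⟩ | hd
  · have : (d.iso l).toSubmodule = ⊤ := Submodule.eq_top_of_finrank_eq (le_antisymm h2 (h3.trans h1))
    have hx : x ∈ (d.iso l).toSubmodule := this ▸ Submodule.mem_top
    have := hx y
    rw [d.pr_eq y hy] at this
    exact hl₀ this
  · have hinj : Function.Injective (π : d.iso l →ₗ[K] (d.iso l ⧸ d.isoKer l)) :=
      (LinearMap.injective_iff_surjective_of_finrank_eq_finrank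
        (le_antisymm (h2.trans h3) h1)).2 hπ
    have hinj2 : Function.Injective (l ∘ₗ d.a.toSubmodule.subtype) := by
      rw [injective_iff_map_eq_zero]
      intro w hw
      have hm : (w : L) ∈ d.iso l := fun y => by
        rw [d.ab _ w.2 _ (d.pr_mem y), map_zero]
      have : π ⟨w, hm⟩ = 0 := (hπ0 _).2 ⟨w.2, hw⟩
      have := hinj (this.trans (map_zero π).symm)
      have h5 : (w : L) = ((0 : d.iso l) : L) := congrArg Subtype.val this
      exact Subtype.ext h5
    have := LinearMap.finrank_le_finrank_of_injective hinj2
    rw [Module.finrank_self] at this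
    exact absurd (hd.trans this) (by norm_num)

lemma dufloMul_of_generic {w₀ : L} (hw₀ : w₀ ∈ d.a) (h₀ : w₀ ≠ 0)
    (hd : (∃ x : L, ∃ y ∈ d.a, w₀ = ⁅x, y⁆) ∨ 2 ≤ finrank K d.a)
    (ih : ∀ (L' : Type) [LieRing L'] [LieAlgebra K L'] [FiniteDimensional K L'],
      finrank K L' < finrank K L → DufloMul K L') : DufloMul K L := by
  intro P Q hP hQ
  obtain ⟨r, xs, ws, hxw, hmax⟩ := d.exists_rank
  obtain ⟨G, hG⟩ := d.N_surjective (dfl K L P * dfl K L Q - dfl K L (P * Q))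
  have hG0 : G * (d.bm xs ws).det * ι K L w₀ = 0 := by
    apply eq_zero_of_forall_lift
    intro l
    rw [map_mul, map_mul, SymmetricAlgebra.lift_ι_apply]
    by_cases h1 : slift l (d.bm xs ws).det = 0
    · rw [h1, mul_zero, zero_mul]
    by_cases h2 : l w₀ = 0
    · rw [h2, mul_zero]
    obtain ⟨L', i1, i2, i3, D, hDl, hlt⟩ := d.exists_polar l hw₀ h2 hd
      (fun x hx φ => d.exists_of_rank hmax l h1 x hx φ)
    have hJ := D.dfl_mul_sub_mem (ih L' hlt) hP hQ
    have hJ2 : D.J ≤ (idl D.I).map d.N := D.J_le fun w hw v => by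
      obtain ⟨V, rfl⟩ := d.N_surjective v
      exact ⟨_, ι_mul_mem_idl hw V, d.N_ι_mul hw.1 V⟩
    obtain ⟨G', hG', e⟩ := hJ2 hJ
    obtain rfl : G' = G := d.N_injective (e.trans hG.symm)
    have : idl D.I ≤ LinearMap.ker (slift l).toLinearMap := idl_le fun w hw V => by
      rw [LinearMap.mem_ker, AlgHom.toLinearMap_apply, map_mul, SymmetricAlgebra.lift_ι_apply,
        ← hDl, show D.l w = 0 from hw.2, zero_mul]
    rw [show slift l G' = 0 from this hG', zero_mul, zero_mul]
  have : G = 0 := by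
    rcases mul_eq_zero.1 hG0 with h | h
    · exact (mul_eq_zero.1 h).resolve_right hxw
    · exact absurd ((ι_eq_zero_iff _).1 h) h₀
  rw [this, map_zero] at hG
  exact (sub_eq_zero.1 hG.symm).symm

end AbIdeal

/-- An abelian ideal with a choice of complement. -/
lemma exists_abIdeal {K L : Type} [Field K] [LieRing L] [LieAlgebra K L] (a : LieIdeal K L)
    (ha : ∀ x ∈ a, ∀ y ∈ a, ⁅x, y⁆ = 0) : ∃ d : AbIdeal K L, d.a = a := by
  obtain ⟨f, hf⟩ := a.toSubmodule.subtype.exists_leftInverse_of_injective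
    (Submodule.ker_subtype _)
  exact ⟨⟨a, a.toSubmodule.subtype ∘ₗ f, ha, fun x => (f x).2,
    fun x hx => congrArg Subtype.val (dcongr_fun hf (⟨x, hx⟩ : a.toSubmodule))⟩, rfl⟩

theorem dufloMul_of_abelian_ideal {K L : Type} [Field K] [CharZero K] [LieRing L] [LieAlgebra K L]
    [FiniteDimensional K L] (a : LieIdeal K L) (ha : ∀ x ∈ a, ∀ y ∈ a, ⁅x, y⁆ = 0)
    (hd : (∃ x : L, ∃ y ∈ a, ⁅x, y⁆ ≠ 0) ∨ 2 ≤ finrank K a)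
    (ih : ∀ (L' : Type) [LieRing L'] [LieAlgebra K L'] [FiniteDimensional K L'],
      finrank K L' < finrank K L → DufloMul K L') : DufloMul K L := by
  obtain ⟨d, rfl⟩ := exists_abIdeal a ha
  rcases hd with ⟨x, y, hy, h⟩ | hd
  · exact d.dufloMul_of_generic (lie_mem_right K L d.a x y hy) h (Or.inl ⟨x, y, hy, rfl⟩) ih
  · have : Nontrivial d.a := Module.nontrivial_of_finrank_pos (R := K) (by omega)
    obtain ⟨w, hw⟩ := exists_ne (0 : d.a)
    exact d.dufloMul_of_generic w.2 (fun h => hw (Subtype.ext h)) (Or.inr hd) ih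

end

section

attribute [local instance] LieRing.ofAssociativeRing LieAlgebra.ofAssociativeAlgebra

/-- A decomposition of a Lie algebra into a subalgebra and the symplectic part of a Heisenberg
ideal. -/
structure Heis (K L H V : Type) [Field K] [LieRing L] [LieAlgebra K L] [LieRing H]
    [LieAlgebra K H] [AddCommGroup V] [Module K V] where
  inc : H →ₗ⁅K⁆ L
  iV : V →ₗ[K] L
  p : L →ₗ[K] H
  pV : L →ₗ[K] V
  p_inc : ∀ h, p (inc h) = h
  p_iV : ∀ v, p (iV v) = 0
  pV_inc : ∀ h, pV (inc h) = 0
  pV_iV : ∀ v, pV (iV v) = v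
  sum_eq : ∀ x, inc (p x) + iV (pV x) = x
  a : H →ₗ[K] End K V
  a_eq : ∀ h v, ⁅inc h, iV v⁆ = iV (a h v)
  ω : V →ₗ[K] V →ₗ[K] K
  c : H
  c_ne : c ≠ 0
  c_cen : ∀ x : L, ⁅x, inc c⁆ = 0
  ω_eq : ∀ v w, ⁅iV v, iV w⁆ = ω v w • inc c
  ω_nd : ∀ v, (∀ w, ω v w = 0) → v = 0

namespace Heis

variable {K L H V : Type} [Field K] [CharZero K] [LieRing L] [LieAlgebra K L] [LieRing H]
    [LieAlgebra K H] [AddCommGroup V] [Module K V] [FiniteDimensional K L]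
    [FiniteDimensional K H] [FiniteDimensional K V] (d : Heis K L H V)

lemma inc_inj {x y : H} (h : d.inc x = d.inc y) : x = y := by rw [← d.p_inc x, h, d.p_inc]

lemma iV_inj {x y : V} (h : d.iV x = d.iV y) : x = y := by rw [← d.pV_iV x, h, d.pV_iV]

lemma inc_c_ne : d.inc d.c ≠ 0 := fun h => d.c_ne (d.inc_inj (by rw [h, map_zero]))

lemma smul_c_inj {r s : K} (h : r • d.inc d.c = s • d.inc d.c) : r = s :=
  smul_left_injective K d.inc_c_ne h

lemma ω_swap (v w : V) : d.ω v w = -d.ω w v := by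
  apply d.smul_c_inj
  rw [neg_smul, ← d.ω_eq, ← d.ω_eq, lie_skew]

lemma lie_iV_inc (v : V) (h : H) : ⁅d.iV v, d.inc h⁆ = -d.iV (d.a h v) := by
  rw [← d.a_eq, lie_skew]

lemma ω_a (h : H) (v w : V) : d.ω (d.a h v) w = -d.ω v (d.a h w) := by
  have := leibniz_lie (d.inc h) (d.iV v) (d.iV w)
  rw [d.ω_eq, lie_smul, d.c_cen, smul_zero, d.a_eq, d.a_eq, d.ω_eq, d.ω_eq, ← add_smul] at this
  have h0 := (smul_eq_zero.1 this.symm).resolve_right d.inc_c_ne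
  linear_combination h0

lemma a_lie (x y : H) : d.a ⁅x, y⁆ = d.a x * d.a y - d.a y * d.a x := by
  ext v
  apply d.iV_inj
  rw [← d.a_eq, LieHom.map_lie, lsub_apply, map_sub, mul_apply,
    mul_apply, ← d.a_eq, ← d.a_eq, ← d.a_eq, ← d.a_eq, lie_lie]

lemma a_c : d.a d.c = 0 := by
  ext v
  apply d.iV_inj
  rw [← d.a_eq, ← lie_skew, d.c_cen]; simp

lemma ω_surj (ξ : V →ₗ[K] K) : ∃ v, d.ω v = ξ := by
  have hi : Function.Injective d.ω :=
    (injective_iff_map_eq_zero d.ω).2 fun v hv => d.ω_nd v fun w => by rw [hv]; rfl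
  exact (LinearMap.injective_iff_surjective_of_finrank_eq_finrank
    (Subspace.dual_finrank_eq (K := K) (V := V)).symm).1 hi ξ

/-- The dual basis with respect to the symplectic form. -/
def up (k : Fin (finrank K V)) : V := (d.ω_surj ((finBasis K V).coord k)).choose

lemma ω_up (k : Fin (finrank K V)) : d.ω (d.up k) = (finBasis K V).coord k :=
  (d.ω_surj ((finBasis K V).coord k)).choose_spec

lemma sum_dn (w : V) : ∑ k, d.ω w (d.up k) • finBasis K V k = -w := by
  simp only [d.ω_swap w, d.ω_up, neg_smul, sum_neg_distrib]
  congr 1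
  exact (finBasis K V).sum_repr w

lemma sum_up (w : V) : ∑ k, d.ω w (finBasis K V k) • d.up k = w := by
  rw [← sub_eq_zero]
  refine d.ω_nd _ fun y => ?_
  rw [map_sub, map_sum, lsub_apply, lsum_apply]
  simp only [map_smul, lsmul_apply, d.ω_up, smul_eq_mul]
  rw [sub_eq_zero]
  conv_rhs => rw [← (finBasis K V).sum_repr y, map_sum]
  exact sum_congr rfl fun k _ => by rw [map_smul, smul_eq_mul, mul_comm]; rfl

lemma sum_inv {M : Type} [AddCommGroup M] [Module K M] (f : V →ₗ[K] V →ₗ[K] M) (x : H) :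
    ∑ k, f (finBasis K V k) (d.a x (d.up k)) = -∑ k, f (d.a x (finBasis K V k)) (d.up k) := by
  have h1 : ∀ k, d.a x (d.up k) = -∑ j, (finBasis K V).coord k (d.a x (finBasis K V j)) • d.up j := fun k => by
    conv_lhs => rw [← d.sum_up (d.a x (d.up k))]
    simp only [d.ω_a, d.ω_up, neg_smul, sum_neg_distrib]
  have h2 : ∀ j, ∑ k, (finBasis K V).coord k (d.a x (finBasis K V j)) • f (finBasis K V k) (d.up j)
      = f (d.a x (finBasis K V j)) (d.up j) := fun j => by
    conv_rhs => rw [← (finBasis K V).sum_repr (d.a x (finBasis K V j)), map_sum, lsum_apply]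
    exact sum_congr rfl fun k _ => by rw [map_smul]; rfl
  simp only [h1, map_neg, map_sum, map_smul, sum_neg_distrib]
  rw [sum_comm]
  simp only [h2]

lemma p_lie (x : H) (y : L) : d.p ⁅d.inc x, y⁆ = ⁅x, d.p y⁆ := by
  conv_lhs => rw [← d.sum_eq y, lie_add, ← LieHom.map_lie, d.a_eq, map_add, d.p_inc, d.p_iV,
    add_zero]

section quant

variable {A : Type} [Ring A] [Algebra K A] (κ : K) (hκ : κ ≠ 0)
  (τ : 𝒰 K L →ₐ[K] A)
  (hτ : τ (uι K L (d.inc d.c)) = algebraMap K A κ)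

/-- The images of the symplectic generators. -/
def e : V →ₗ[K] A := τ.toLinearMap ∘ₗ uι K L ∘ₗ d.iV

/-- The images of the remaining generators. -/
def X : H →ₗ[K] A := τ.toLinearMap ∘ₗ uι K L ∘ₗ d.inc.toLinearMap

lemma e_apply (v : V) : d.e τ v = τ (uι K L (d.iV v)) := rfl

lemma X_apply (x : H) : d.X τ x = τ (uι K L (d.inc x)) := rfl

include hτ in
lemma e_e (v w : V) : d.e τ v * d.e τ w = d.e τ w * d.e τ v + algebraMap K A (κ * d.ω v w) := by
  rw [e_apply, e_apply, ← map_mul, uι_mul_uι, map_add, map_mul, d.ω_eq, map_smul, map_smul, hτ,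
    mul_comm κ, map_mul, asmul_def]

lemma X_e (x : H) (v : V) : d.X τ x * d.e τ v = d.e τ v * d.X τ x + d.e τ (d.a x v) := by
  rw [e_apply, X_apply, ← map_mul, uι_mul_uι, map_add, map_mul, d.a_eq]; rfl

lemma X_X (x y : H) : d.X τ x * d.X τ y = d.X τ y * d.X τ x + d.X τ ⁅x, y⁆ := by
  rw [X_apply, X_apply, ← map_mul, uι_mul_uι, map_add, map_mul, X_apply, LieHom.map_lie]

/-- The quadratic elements implementing the action on the symplectic part. -/
def γ : H →ₗ[K] A where
  toFun x := (2⁻¹ * κ⁻¹ : K) • ∑ k, d.e τ (d.a x (finBasis K V k)) * d.e τ (d.up k)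
  map_add' x y := by simp [add_mul, sum_add_distrib]
  map_smul' r x := by
    simp only [map_smul, lsmul_apply, smul_mul_assoc, ← smul_sum, RingHom.id_apply]
    rw [smul_comm]

lemma γ_apply (x : H) : d.γ κ τ x
    = (2⁻¹ * κ⁻¹ : K) • ∑ k, d.e τ (d.a x (finBasis K V k)) * d.e τ (d.up k) := rfl

include hκ hτ in
lemma γ_e (x : H) (v : V) : d.γ κ τ x * d.e τ v = d.e τ v * d.γ κ τ x + d.e τ (d.a x v) := by
  have h1 : ∀ k, d.e τ (d.a x (finBasis K V k)) * d.e τ (d.up k) * d.e τ v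
      = d.e τ v * (d.e τ (d.a x (finBasis K V k)) * d.e τ (d.up k))
        + (κ * d.ω (d.a x (finBasis K V k)) v) • d.e τ (d.up k)
        + (κ * d.ω (d.up k) v) • d.e τ (d.a x (finBasis K V k)) := fun k => by
    rw [mul_assoc, d.e_e κ τ hτ (d.up k) v, mul_add, ← mul_assoc, d.e_e κ τ hτ _ v, add_mul,
      mul_assoc, ← Algebra.commutes, asmul_def, asmul_def]
  have h2 : ∑ k, (κ * d.ω (d.a x (finBasis K V k)) v) • d.e τ (d.up k) = κ • d.e τ (d.a x v) := by
    conv_rhs => rw [← d.sum_up (d.a x v), map_sum, smul_sum]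
    refine sum_congr rfl fun k _ => ?_
    rw [map_smul, smul_smul, d.ω_a x v, d.ω_swap]
  have h3 : ∑ k, (κ * d.ω (d.up k) v) • d.e τ (d.a x (finBasis K V k)) = κ • d.e τ (d.a x v) := by
    conv_rhs => rw [← (finBasis K V).sum_repr v, map_sum, map_sum, smul_sum]
    refine sum_congr rfl fun k _ => ?_
    rw [map_smul, map_smul, smul_smul, d.ω_up]; rfl
  rw [γ_apply, smul_mul_assoc, sum_mul]
  simp only [h1, sum_add_distrib]
  rw [h2, h3, ← mul_sum, smul_add, smul_add, mul_smul_comm, smul_smul, add_assoc, ← add_smul]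
  congr 1
  rw [show 2⁻¹ * κ⁻¹ * κ + 2⁻¹ * κ⁻¹ * κ = (1 : K) by field_simp; norm_num, one_smul]

include hκ hτ in
lemma ρ_γ (x y : H) : (d.X τ x - d.γ κ τ x) * d.γ κ τ y
    = d.γ κ τ y * (d.X τ x - d.γ κ τ x) := by
  have h : ∀ v, Commute (d.X τ x - d.γ κ τ x) (d.e τ v) := fun v => by
    rw [Commute, SemiconjBy, sub_mul, mul_sub, d.X_e, d.γ_e κ hκ τ hτ]; abel
  rw [γ_apply]
  exact ((Commute.sum_right _ _ _ fun k _ => (h _).mul_right (h _)).smul_right _).eq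

lemma X_γ (x y : H) : d.X τ x * d.γ κ τ y = d.γ κ τ y * d.X τ x + d.γ κ τ ⁅x, y⁆ := by
  have h := d.sum_inv (LinearMap.mul K A |>.compl₁₂ (d.e τ ∘ₗ d.a y) (d.e τ)) x
  simp only [LinearMap.compl₁₂_apply, comp_apply, LinearMap.mul_apply'] at h
  have h1 : ∀ v w, d.X τ x * (d.e τ v * d.e τ w) = d.e τ v * d.e τ w * d.X τ x
      + d.e τ (d.a x v) * d.e τ w + d.e τ v * d.e τ (d.a x w) := fun v w => by
    rw [← mul_assoc, d.X_e, add_mul, mul_assoc, d.X_e]; noncomm_ring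
  simp only [γ_apply, mul_smul_comm, mul_sum, h1, sum_add_distrib, h, d.a_lie,
    smul_mul_assoc, sum_mul, lsub_apply, map_sub, sub_mul,
    sum_sub_distrib, mul_apply]
  rw [← smul_add]
  congr 1
  abel

/-- The generators commuting with the symplectic part. -/
def ρ : H →ₗ⁅K⁆ A :=
  { d.X τ - d.γ κ τ with
    map_lie' := fun {x y} => by
      change d.X τ ⁅x, y⁆ - d.γ κ τ ⁅x, y⁆
        = ⁅d.X τ x - d.γ κ τ x, d.X τ y - d.γ κ τ y⁆
      have h1 := d.ρ_γ κ hκ τ hτ x y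
      have h2 := d.X_X τ x y
      have h3 := d.X_γ κ τ y x
      rw [← lie_skew y x, map_neg] at h3
      rw [LieRing.of_associative_ring_bracket, mul_sub, sub_mul _ _ (d.X τ x - d.γ κ τ x), h1,
        sub_sub_sub_cancel_right, mul_sub, sub_mul, h2, h3]
      abel }

end quant

end Heis

end

section

attribute [local instance] LieRing.ofAssociativeRing LieAlgebra.ofAssociativeAlgebra

section

variable {K V W M A : Type} [Field K] [CharZero K] [AddCommGroup V] [Module K V] [AddCommGroup W]
  [Module K W] [AddCommGroup M] [Module K M] [Ring A] [Algebra K A]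

lemma sum_pd_dp_succ {κ : Type} [Fintype κ] (b : Basis κ K W)
    (G : W →ₗ[K] 𝒮 K W →ₗ[K] M) (x : W) (n : ℕ) :
    ∑ k, G (b k) (pd (b.coord k) (dp x (n + 1))) = G x (dp x n) := by
  simp only [pd_dp_succ, map_smul]
  exact sum_coord_map b (G.flip (dp x n)) x

lemma sum_pd_smap {κ κ' : Type} [Fintype κ] [Fintype κ'] (b : Basis κ K W)
    (b' : Basis κ' K V) (i : V →ₗ[K] W) (G : W →ₗ[K] 𝒮 K W →ₗ[K] M)
    (f : 𝒮 K V) : ∑ k, G (b k) (pd (b.coord k) (smap i f))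
      = ∑ j, G (i (b' j)) (smap i (pd (b'.coord j) f)) := by
  have : ∑ k, G (b k) ∘ₗ (pd (b.coord k)).toLinearMap ∘ₗ (smap i).toLinearMap
      = ∑ j, G (i (b' j)) ∘ₗ (smap i).toLinearMap ∘ₗ (pd (b'.coord j)).toLinearMap := by
    apply ext_dp
    intro x n
    simp only [lsum_apply, comp_apply, AlgHom.toLinearMap_apply,
      Derivation.coeFn_coe, smap_dp]
    rcases n with _ | n
    · simp [pd_dp_zero]
    · rw [sum_pd_dp_succ]
      have := sum_pd_dp_succ b' (LinearMap.compl₁₂ G i (smap i).toLinearMap) x n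
      simpa using this.symm
  simpa [lsum_apply] using dcongr_fun this f

lemma eul_eq {κ : Type} [Fintype κ] (b : Basis κ K V) (P : 𝒮 K V) :
    ∑ k, ι K V (b k) * pd (b.coord k) P = eul P := by
  have : ∑ k, mulLeft K (ι K V (b k)) ∘ₗ (pd (b.coord k)).toLinearMap
      = eul.toLinearMap := by
    apply ext_dp
    rintro x (_ | n)
    · simp [pd_dp_zero]
    · have := sum_pd_dp_succ b (mulι K V) x n
      simp only [mulι_apply] at this
      simpa [lsum_apply, eul_dp, ι_mul_dp] using this
  simpa [lsum_apply] using dcongr_fun this P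

lemma eul_smap (i : V →ₗ[K] W) (f : 𝒮 K V) : eul (smap i f) = smap i (eul f) := by
  have : eul.toLinearMap ∘ₗ (smap i).toLinearMap = (smap i).toLinearMap ∘ₗ eul.toLinearMap := by
    apply ext_dp
    intro x n
    simp [eul_dp]
  exact dcongr_fun this f

variable [FiniteDimensional K V] [FiniteDimensional K W]

/-- The Euler recursion for the symmetrization of `P * f` with `f` supported on a subspace. -/
lemma sg_mul_eul (e : W →ₗ[K] A) (i : V →ₗ[K] W) (P : 𝒮 K W)
    (f : 𝒮 K V) : sg e (eul P * smap i f) + sg e (P * smap i (eul f))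
      = ∑ k, e (finBasis K W k) * sg e (pd ((finBasis K W).coord k) P * smap i f)
      + ∑ k, e (i (finBasis K V k))
        * sg e (P * smap i (pd ((finBasis K V).coord k) f)) := by
  have h1 := sg_eul e (finBasis K W) (P * smap i f)
  have h2 := sum_pd_smap (finBasis K W) (finBasis K V) i
    (LinearMap.compl₁₂ (LinearMap.mul K A) e (sg e ∘ₗ mulLeft K P)) f
  simp only [LinearMap.compl₁₂_apply, comp_apply, LinearMap.mul_apply',
    mulLeft_apply] at h2
  rw [← h2, ← eul_smap, ← map_add, ← sum_add_distrib]
  simp only [← mul_add, ← map_add]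
  rw [leibniz, smul_eq_mul, smul_eq_mul] at h1
  rw [add_comm, mul_comm (eul P), h1]
  refine sum_congr rfl fun k _ => ?_
  rw [pd_mul, add_comm]

end

namespace Heis

variable {K L H V : Type} [Field K] [CharZero K] [LieRing L] [LieAlgebra K L] [LieRing H]
    [LieAlgebra K H] [AddCommGroup V] [Module K V] [FiniteDimensional K L]
    [FiniteDimensional K H] [FiniteDimensional K V] (d : Heis K L H V)

variable {A : Type} [Ring A] [Algebra K A] (κ : K) (hκ : κ ≠ 0)
  (τ : 𝒰 K L →ₐ[K] A)
  (hτ : τ (uι K L (d.inc d.c)) = algebraMap K A κ)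

/-- Gaussian integration along the symplectic part. -/
def gauss (x : H) : GaussData K V (𝒮 K V) A where
  ε := 1
  m := mulι K V
  p := pdL
  vac := 1
  e := d.e τ
  B := κ • d.ω
  X := d.X τ x
  a := d.a x
  q n := τ.toLinearMap ∘ₗ symm K L ∘ₗ mulLeft K (dp (d.inc x) n)
    ∘ₗ (smap d.iV).toLinearMap
  κ := Fin (finrank K V)
  fin := inferInstance
  u k := κ⁻¹ • d.a x (finBasis K V k)
  v k := d.up k
  ε_mul := one_mul 1
  p_m ξ w f := by simp only [mulι_apply, pdL_apply, pd_ι_mul, one_smul]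
  m_m w w' f := by simp only [mulι_apply, one_smul]; exact mul_left_comm _ _ _
  p_p ξ η f := by simp only [pdL_apply, one_smul]; exact pd_comm _ _ _
  p_vac ξ := by rw [pdL_apply]; exact (pd ξ).map_one_eq_zero
  e_e w w' := by
    rw [one_smul, d.e_e κ τ hτ, add_sub_cancel_left]; rfl
  X_e w := by rw [d.X_e, add_sub_cancel_left]
  q_vac := by
    simp [dp_zero, symm, sg_one]
  q_zero f := by
    have h := congrArg τ (sg_mul_eul (uι K L) d.iV 1 f)
    simp only [Derivation.map_one_eq_zero, zero_mul, map_zero, zero_add, mul_zero,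
      sum_const_zero, one_mul, map_sum, map_mul] at h
    simp only [mulι_apply, pdL_apply, eul_eq]
    simpa [dp_zero, symm, e_apply] using h
  q_succ n f := by
    have h := congrArg τ (sg_mul_eul (uι K L) d.iV (dp (d.inc x) (n + 1)) f)
    have h2 := sum_pd_dp_succ (finBasis K L) (LinearMap.compl₁₂
      (LinearMap.mul K (𝒰 K L)) (uι K L)
        (sg (uι K L) ∘ₗ mulRight K (smap d.iV f))) (d.inc x) n
    simp only [LinearMap.compl₁₂_apply, comp_apply, LinearMap.mul_apply',
      mulRight_apply] at h2
    rw [h2, eul_dp, smul_mul_assoc, map_smul, map_add τ, map_smul, map_add τ, map_mul τ,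
      map_sum τ] at h
    simp only [map_mul τ] at h
    simp only [mulι_apply, pdL_apply, eul_eq]
    exact h
  B_swap w w' := by
    simp only [lsmul_apply, smul_eq_mul]; rw [d.ω_swap]; ring
  sum_u w := by
    simp only [lsmul_apply, smul_eq_mul, map_smul]
    simp only [← mul_assoc, mul_inv_cancel₀ hκ, inv_mul_cancel₀ hκ, one_mul]
    have := d.sum_up (d.a x w)
    simp only [d.ω_a, neg_smul, sum_neg_distrib] at this
    rw [← this, neg_neg]
  sum_v w := by
    simp only [lsmul_apply, smul_eq_mul, one_mul, smul_smul]
    have := congrArg (d.a x) (d.sum_dn w)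
    simp only [map_sum, map_smul, map_neg] at this
    rw [← this]
    refine sum_congr rfl fun k _ => ?_
    congr 1; field_simp

/-- The quadratic polynomials implementing the action on the symplectic part. -/
def lam : H →ₗ[K] 𝒮 K L where
  toFun x := (2⁻¹ * κ⁻¹ : K) • ∑ k, ι K L (d.iV (d.a x (finBasis K V k)))
    * ι K L (d.iV (d.up k))
  map_add' x y := by simp [add_mul, sum_add_distrib]
  map_smul' r x := by
    simp only [map_smul, lsmul_apply, smul_mul_assoc, ← smul_sum, RingHom.id_apply]
    rw [smul_comm]

lemma lam_apply (x : H) : d.lam κ x = (2⁻¹ * κ⁻¹ : K) •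
    ∑ k, ι K L (d.iV (d.a x (finBasis K V k))) * ι K L (d.iV (d.up k)) := rfl

/-- The classical counterpart of `Heis.ρ`. -/
def ψ : 𝒮 K H →ₐ[K] 𝒮 K L :=
  slift (ι K L ∘ₗ d.inc.toLinearMap - d.lam κ)

lemma smap_lam (x : H) (f : 𝒮 K V) :
    smap d.iV ((-(d.gauss κ hκ τ hτ x).lam) f) = -d.lam κ x * smap d.iV f := by
  rw [lneg_apply, GaussData.lam_apply, lam_apply, map_neg, map_smul, map_sum, neg_mul,
    smul_mul_assoc, mul_smul, sum_mul, smul_sum (r := κ⁻¹)]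
  congr 2
  refine sum_congr rfl fun k _ => ?_
  change smap d.iV (ι K V (κ⁻¹ • d.a x (finBasis K V k)) * (ι K V (d.up k) * f)) = _
  rw [map_mul, map_mul, smap_ι, smap_ι, map_smul, map_smul, smul_mul_assoc, mul_assoc]

lemma smap_G (x : H) (n : ℕ) : smap d.iV ((d.gauss κ hκ τ hτ x).G n) = dvp K (-d.lam κ x) n := by
  have : ∀ n, smap d.iV (((-(d.gauss κ hκ τ hτ x).lam) ^ n) 1) = (-d.lam κ x) ^ n := by
    intro n
    induction n with
    | zero => simp
    | succ n ih => rw [pow_succ', mul_apply, smap_lam, ih, pow_succ']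
  rw [GaussData.G, dvp, dvp, lsmul_apply, map_smul, ← this]; rfl

lemma symm_ψ (P : 𝒮 K H) : τ (symm K L (d.ψ κ P))
    = sg (d.ρ κ hκ τ hτ : H →ₗ[K] A) (jop (-dW K) d.a P) := by
  have : τ.toLinearMap ∘ₗ symm K L ∘ₗ (d.ψ κ).toLinearMap
      = sg (d.ρ κ hκ τ hτ : H →ₗ[K] A) ∘ₗ jop (-dW K) d.a := by
    refine ext_dp fun x n => ?_
    have h1 : d.ψ κ (dp x n) = ∑ r ∈ antidiagonal n, dp (d.inc x) r.1 * dvp K (-d.lam κ x) r.2 := by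
      rw [← dvp_ι, map_dvp, ψ, lift_ι_apply, lsub_apply, sub_eq_add_neg,
        dvp_add_of_commute (Commute.all _ _)]
      rfl
    have h2 : τ (symm K L (d.ψ κ (dp x n))) = (d.gauss κ hκ τ hτ x).Ψ n := by
      rw [h1, GaussData.Ψ, map_sum, map_sum]
      refine sum_congr rfl fun r _ => ?_
      rw [← d.smap_G κ hκ τ hτ]; rfl
    change τ (symm K L (d.ψ κ (dp x n))) = _
    rw [h2, GaussData.Ψ_eq, comp_apply, jop_dp, map_sum]
    refine sum_congr rfl fun r _ => ?_
    rw [map_smul, sg_dp, jsym]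
    have h3 : (d.gauss κ hκ τ hτ x).gam = d.γ κ τ x := by
      rw [GaussData.gam, γ_apply, mul_smul, smul_sum (r := κ⁻¹)]
      congr 1
      refine sum_congr rfl fun k _ => ?_
      change d.e τ (κ⁻¹ • d.a x (finBasis K V k)) * d.e τ (d.up k) = _
      rw [map_smul, smul_mul_assoc]
    rw [h3]
    have h4 : (fun i => -(2⁻¹ * (1 : K)) * hC K i * trace K V (d.a x ^ i))
        = fun i => (-dW K) i * trace K V (d.a x ^ i) := by
      ext i; rw [Pi.neg_apply, dW]; ring
    change expSeq K (fun i => -(2⁻¹ * (1 : K)) * hC K i * trace K V (d.a x ^ i)) r.1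
      • _ = _
    rw [h4]; rfl
  exact dcongr_fun this P

end Heis

end

section

attribute [local instance] LieRing.ofAssociativeRing LieAlgebra.ofAssociativeAlgebra

lemma trace_pow_eq_of_flag {K L : Type} [Field K] [AddCommGroup L] [Module K L]
    [FiniteDimensional K L] (F₁ F₂ : Submodule K L) (S T : End K L)
    (hS₁ : ∀ x ∈ F₁, S x ∈ F₁) (hS₂ : ∀ x ∈ F₂, S x ∈ F₂)
    (hT₁ : ∀ x ∈ F₁, T x ∈ F₁) (hT₂ : ∀ x ∈ F₂, T x ∈ F₂) (h₃ : ∀ x, (S - T) x ∈ F₂)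
    (h₂ : ∀ x ∈ F₂, (S - T) x ∈ F₁) (h₁ : ∀ x ∈ F₁, (S - T) x = 0) (i : ℕ) :
    trace K L (S ^ i) = trace K L (T ^ i) := by
  have hT : ∀ n, (∀ x ∈ F₁, (T ^ n) x ∈ F₁) ∧ ∀ x ∈ F₂, (T ^ n) x ∈ F₂ := by
    intro n
    induction n with
    | zero => exact ⟨fun x hx => hx, fun x hx => hx⟩
    | succ n ih =>
      rw [pow_succ']
      exact ⟨fun x hx => hT₁ _ (ih.1 x hx), fun x hx => hT₂ _ (ih.2 x hx)⟩
  have h : ∀ n, (∀ x, (S ^ n - T ^ n) x ∈ F₂) ∧ (∀ x ∈ F₂, (S ^ n - T ^ n) x ∈ F₁)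
      ∧ ∀ x ∈ F₁, (S ^ n - T ^ n) x = 0 := by
    intro n
    induction n with
    | zero => simp
    | succ n ih =>
      have e : S ^ (n + 1) - T ^ (n + 1) = S * (S ^ n - T ^ n) + (S - T) * T ^ n := by
        rw [pow_succ', pow_succ']; noncomm_ring
      rw [e]
      refine ⟨fun x => F₂.add_mem (hS₂ _ (ih.1 x)) (h₃ _),
        fun x hx => F₁.add_mem (hS₁ _ (ih.2.1 x hx)) (h₂ _ ((hT n).2 x hx)), fun x hx => ?_⟩
      rw [ladd_apply, mul_apply, mul_apply, ih.2.2 x hx,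
        h₁ _ ((hT n).1 x hx), map_zero, add_zero]
  rw [← sub_eq_zero, ← map_sub]
  refine (LinearMap.isNilpotent_trace_of_isNilpotent ⟨3, ?_⟩).eq_zero
  ext x
  exact (h i).2.2 _ ((h i).2.1 _ ((h i).1 x))

namespace Heis

variable {K L H V : Type} [Field K] [CharZero K] [LieRing L] [LieAlgebra K L] [LieRing H]
    [LieAlgebra K H] [AddCommGroup V] [Module K V] [FiniteDimensional K L]
    [FiniteDimensional K H] [FiniteDimensional K V] (d : Heis K L H V)

lemma trace_inc (h : H) (i : ℕ) : trace K L (adL K L (d.inc h) ^ i)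
    = trace K H (adL K H h ^ i) + trace K V (d.a h ^ i) := by
  have hH : ∀ x, (adL K L (d.inc h) ^ i) (d.inc x) = d.inc ((adL K H h ^ i) x) := by
    induction i with
    | zero => simp
    | succ i ih =>
      intro x
      rw [pow_succ', mul_apply, ih, pow_succ', mul_apply, adL_apply,
        adL_apply, LieHom.map_lie]
  have hV : ∀ v, (adL K L (d.inc h) ^ i) (d.iV v) = d.iV ((d.a h ^ i) v) := by
    clear hH
    induction i with
    | zero => simp
    | succ i ih =>
      intro x
      rw [pow_succ', mul_apply, ih, pow_succ', mul_apply, adL_apply, d.a_eq]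
  have e : adL K L (d.inc h) ^ i = (d.inc.toLinearMap ∘ₗ adL K H h ^ i) ∘ₗ d.p
      + (d.iV ∘ₗ d.a h ^ i) ∘ₗ d.pV := by
    ext x
    conv_lhs => rw [← d.sum_eq x, map_add, hH, hV]
    rfl
  rw [e, map_add, LinearMap.trace_comp_comm', LinearMap.trace_comp_comm' d.pV]
  congr 2
  · ext x; exact d.p_inc _
  · ext x; exact d.pV_iV _

lemma trace_p (x : L) (i : ℕ) : trace K L (adL K L x ^ i)
    = trace K L (adL K L (d.inc (d.p x)) ^ i) := by
  have hx : adL K L x - adL K L (d.inc (d.p x)) = adL K L (d.iV (d.pV x)) := by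
    rw [← map_sub]; congr 1; rw [sub_eq_iff_eq_add']; exact (d.sum_eq x).symm
  have hV : ∀ v, d.iV v ∈ LinearMap.range d.iV ⊔ K ∙ d.inc d.c := fun v =>
    (le_sup_left : LinearMap.range d.iV ≤ _) ⟨v, rfl⟩
  have hc : ∀ r : K, r • d.inc d.c ∈ LinearMap.range d.iV ⊔ K ∙ d.inc d.c := fun r =>
    (le_sup_right : (K ∙ d.inc d.c) ≤ _) (smul_mem _ _ (mem_span_singleton_self _))
  have h₁ : ∀ y, ∀ z ∈ K ∙ d.inc d.c, adL K L y z = 0 := by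
    intro y z hz
    obtain ⟨r, rfl⟩ := mem_span_singleton.1 hz
    rw [map_smul, adL_apply, d.c_cen, smul_zero]
  have h₂ : ∀ v, ∀ z ∈ LinearMap.range d.iV ⊔ K ∙ d.inc d.c,
      adL K L (d.iV v) z ∈ K ∙ d.inc d.c := by
    intro v z hz
    obtain ⟨_, ⟨w, rfl⟩, y, hy, rfl⟩ := Submodule.mem_sup.1 hz
    rw [map_add, h₁ _ y hy, add_zero, adL_apply, d.ω_eq]
    exact smul_mem _ _ (mem_span_singleton_self _)
  have h₃ : ∀ y, ∀ z ∈ LinearMap.range d.iV ⊔ K ∙ d.inc d.c,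
      adL K L y z ∈ LinearMap.range d.iV ⊔ K ∙ d.inc d.c := by
    intro y z hz
    obtain ⟨_, ⟨w, rfl⟩, y', hy, rfl⟩ := Submodule.mem_sup.1 hz
    rw [map_add, h₁ _ y' hy, add_zero, adL_apply, ← d.sum_eq y, add_lie, d.a_eq, d.ω_eq]
    exact Submodule.add_mem _ (hV _) (hc _)
  refine trace_pow_eq_of_flag (K ∙ d.inc d.c) (LinearMap.range d.iV ⊔ K ∙ d.inc d.c) _ _
    (fun z hz => ?_) (h₃ _) (fun z hz => ?_) (h₃ _) (fun z => ?_) (fun z hz => ?_)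
    (fun z hz => ?_) i
  · rw [h₁ _ z hz]; exact zero_mem _
  · rw [h₁ _ z hz]; exact zero_mem _
  · rw [hx, adL_apply, ← d.sum_eq z, lie_add, d.lie_iV_inc, d.ω_eq, ← map_neg]
    exact Submodule.add_mem _ (hV _) (hc _)
  · rw [hx]; exact h₂ _ z hz
  · rw [hx]; exact h₁ _ z hz

lemma smap_p_jop (P : 𝒮 K L) : smap d.p (jop (dW K) (adL K L) P)
    = jop (dW K) d.a (jop (dW K) (adL K H) (smap d.p P)) := by
  rw [jop_jop (dW K) (dW K) (dW K) d.a (adL K H) (adL K L ∘ₗ d.inc.toLinearMap)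
    (fun x i _ => ?_), jop_smap (dW K) (dW K) (adL K L) (adL K L ∘ₗ d.inc.toLinearMap) d.p
    (fun x i _ => ?_)]
  · rw [d.trace_p x]; rfl
  · rw [← mul_add, add_comm, ← d.trace_inc]; rfl

lemma isInv_smap_p {P : 𝒮 K L} (hP : IsInv K P) : IsInv K (smap d.p P) := fun x => by
  have := smap_der d.p (adL K L (d.inc x)) (adL K H x) (fun y => d.p_lie x y) P
  exact this.symm.trans ((congrArg _ (hP (d.inc x))).trans (map_zero _))

section

variable (κ : K)

/-- The multiples of the central generator minus a scalar. -/
def W : Submodule K (𝒮 K L) :=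
  LinearMap.range (mulLeft K (ι K L (d.inc d.c) - algebraMap K _ κ))

lemma mem_W {F : 𝒮 K L} :
    F ∈ d.W κ ↔ ∃ G, (ι K L (d.inc d.c) - algebraMap K _ κ) * G = F := Iff.rfl

lemma mul_mem_W (G : 𝒮 K L) {F : 𝒮 K L} (hF : F ∈ d.W κ) :
    G * F ∈ d.W κ := by
  obtain ⟨F', rfl⟩ := hF
  exact ⟨G * F', mul_left_comm _ _ _⟩

lemma map_mem_W (φ : 𝒮 K L →ₐ[K] 𝒮 K L)
    (h : φ (ι K L (d.inc d.c)) = ι K L (d.inc d.c)) {F : 𝒮 K L} (hF : F ∈ d.W κ) :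
    φ F ∈ d.W κ := by
  obtain ⟨F', rfl⟩ := hF
  rw [mulLeft_apply, map_mul, map_sub, h, AlgHom.commutes]
  exact ⟨_, rfl⟩

/-- Translation by the quadratic polynomials. -/
def Φ (s : K) : 𝒮 K L →ₐ[K] 𝒮 K L :=
  slift (ι K L + s • (d.lam κ ∘ₗ d.p))

lemma Φ_ι (s : K) (x : L) : d.Φ κ s (ι K L x) = ι K L x + s • d.lam κ (d.p x) :=
  SymmetricAlgebra.lift_ι_apply _ _

lemma Φ_iV (s : K) (v : V) : d.Φ κ s (ι K L (d.iV v)) = ι K L (d.iV v) := by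
  rw [Φ_ι, d.p_iV, map_zero, smul_zero, add_zero]

lemma Φ_c (s : K) : d.Φ κ s (ι K L (d.inc d.c)) = ι K L (d.inc d.c) := by
  rw [Φ_ι, d.p_inc, lam_apply, d.a_c]; simp

lemma Φ_lam (s : K) (x : H) : d.Φ κ s (d.lam κ x) = d.lam κ x := by
  rw [lam_apply, map_smul, map_sum]
  simp only [map_mul, Φ_iV]

lemma Φ_Φ (s : K) (F : 𝒮 K L) : d.Φ κ s (d.Φ κ (-s) F) = F := by
  have : (d.Φ κ s).comp (d.Φ κ (-s)) = AlgHom.id K _ := by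
    apply algHom_ext
    ext x
    change d.Φ κ s (d.Φ κ (-s) (ι K L x)) = ι K L x
    rw [Φ_ι, map_add, map_smul, Φ_lam, Φ_ι, neg_smul, add_neg_cancel_right]
  exact dcongr_fun this F

lemma adD_lam (v : V) (h : H) : adD (d.iV v) (d.lam κ h)
    = -(κ⁻¹ • (ι K L (d.inc d.c) * ι K L (d.iV (d.a h v)))) := by
  have h1 : ∀ w, adD (d.iV v) (ι K L (d.iV w)) = d.ω v w • ι K L (d.inc d.c) := fun w => by
    rw [adD, der_ι, comp_apply, adL_apply, d.ω_eq, map_smul]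
  have h2 := congrArg (fun w => ι K L (d.inc d.c) * ι K L (d.iV w)) (d.sum_up (d.a h v))
  have h3 := congrArg (fun w => ι K L (d.inc d.c) * ι K L (d.iV (d.a h w))) (d.sum_dn v)
  simp only [map_sum, map_smul, map_neg, mul_sum, mul_smul_comm, d.ω_a, neg_smul,
    sum_neg_distrib, mul_neg] at h2 h3
  rw [lam_apply, Derivation.map_smul, map_sum]
  simp only [leibniz, h1, smul_eq_mul, sum_add_distrib, mul_smul_comm]
  simp only [mul_comm _ (ι K L (d.inc d.c))]
  rw [h3, neg_eq_iff_eq_neg.1 h2, ← two_smul K, smul_smul, smul_neg,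
    show 2⁻¹ * κ⁻¹ * 2 = κ⁻¹ by ring]

lemma adD_Φ (hκ : κ ≠ 0) (v : V) (F : 𝒮 K L) :
    adD (d.iV v) (d.Φ κ (-1) F) - d.Φ κ (-1) (κ • pd (d.ω v ∘ₗ d.pV) F) ∈ d.W κ := by
  induction F using SymmetricAlgebra.induction with
  | algebraMap r =>
    rw [AlgHom.commutes, Derivation.map_algebraMap, Derivation.map_algebraMap, smul_zero, map_zero,
      sub_zero]
    exact zero_mem _
  | ι y =>
    refine ⟨algebraMap K _ (d.ω v (d.pV y)) + κ⁻¹ • ι K L (d.iV (d.a (d.p y) v)), ?_⟩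
    have h1 : adD (d.iV v) (ι K L y) = d.ω v (d.pV y) • ι K L (d.inc d.c)
        - ι K L (d.iV (d.a (d.p y) v)) := by
      rw [adD, der_ι, comp_apply, adL_apply]
      conv_lhs => rw [← d.sum_eq y, lie_add, d.lie_iV_inc, d.ω_eq, map_add, map_neg, map_smul]
      abel
    rw [Φ_ι, map_add (adD (d.iV v)), Derivation.map_smul, h1, adD_lam, pd_ι, map_smul, AlgHom.commutes,
      mulLeft_apply]
    simp only [Algebra.algebraMap_eq_smul_one, comp_apply, sub_mul, mul_add,
      mul_smul_comm, smul_mul_assoc, mul_one, one_mul, smul_smul, mul_inv_cancel₀ hκ,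
      inv_mul_cancel₀ hκ]
    match_scalars <;> field_simp
  | mul F G hF hG =>
    have := (d.W κ).add_mem (d.mul_mem_W κ (d.Φ κ (-1) F) hG) (d.mul_mem_W κ (d.Φ κ (-1) G) hF)
    convert this using 1
    simp only [map_mul, leibniz, smul_eq_mul, map_add, map_smul, smul_add, mul_sub,
      mul_smul_comm]
    ring
  | add F G hF hG =>
    have := (d.W κ).add_mem hF hG
    convert this using 1
    simp only [map_add, smul_add]
    abel

lemma sub_ψ_mem (hκ : κ ≠ 0) {R : 𝒮 K L} (hR : ∀ v, adD (d.iV v) R = 0) :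
    R - d.ψ κ (smap d.p R) ∈ d.W κ := by
  have h1 : ∀ v, pd (d.ω v ∘ₗ d.pV) (d.Φ κ 1 R) ∈ d.W κ := fun v => by
    have h := d.adD_Φ κ hκ v (d.Φ κ 1 R)
    have h2 := d.Φ_Φ κ (-1) R
    rw [neg_neg] at h2
    rw [h2, hR, zero_sub, neg_mem_iff] at h
    have h3 := d.map_mem_W κ (d.Φ κ 1) (d.Φ_c κ 1) h
    rw [Φ_Φ] at h3
    exact ((d.W κ).smul_mem_iff hκ).1 h3
  have h4 : der (ι K L ∘ₗ (d.iV ∘ₗ d.pV))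
      = ∑ k, ι K L (d.iV (finBasis K V k)) • pd ((finBasis K V).coord k ∘ₗ d.pV) := by
    refine der_ext fun x => ?_
    rw [der_ι, ← Derivation.coeFnAddMonoidHom_apply, map_sum, Finset.sum_apply]
    simp only [Derivation.coeFnAddMonoidHom_apply, Derivation.smul_apply, pd_ι, smul_eq_mul,
      comp_apply]
    conv_lhs => rw [← (finBasis K V).sum_repr (d.pV x), map_sum, map_sum]
    refine sum_congr rfl fun k _ => ?_
    rw [map_smul, map_smul, asmul_def, mul_comm]; rfl
  have h5 : d.Φ κ 1 R - smap (LinearMap.id - d.iV ∘ₗ d.pV) (d.Φ κ 1 R) ∈ d.W κ := by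
    refine sub_smap_mem_of_der (d.W κ) (d.iV ∘ₗ d.pV) (fun x => ?_) (fun F hF => ?_) ?_
    · simp only [comp_apply, d.pV_iV]
    · obtain ⟨F', rfl⟩ := hF
      refine ⟨der (ι K L ∘ₗ (d.iV ∘ₗ d.pV)) F', ?_⟩
      rw [mulLeft_apply, mulLeft_apply, leibniz, map_sub, der_ι,
        Derivation.map_algebraMap, comp_apply, comp_apply, d.pV_inc]
      simp
    · rw [h4, ← Derivation.coeFnAddMonoidHom_apply, map_sum, Finset.sum_apply]
      refine Submodule.sum_mem _ fun k _ => ?_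
      rw [← d.ω_up]
      exact d.mul_mem_W κ (ι K L (d.iV (finBasis K V k))) (h1 (d.up k))
  have h6 : (smap (LinearMap.id - d.iV ∘ₗ d.pV)).comp (d.Φ κ 1)
      = (smap d.inc.toLinearMap).comp (smap d.p) := by
    apply algHom_ext
    ext x
    change smap _ (d.Φ κ 1 (ι K L x)) = smap _ (smap _ (ι K L x))
    have h7 : ∀ v, (LinearMap.id - d.iV ∘ₗ d.pV : L →ₗ[K] L) (d.iV v) = 0 := fun v => by
      simp [d.pV_iV]
    rw [Φ_ι, lam_apply, map_add, map_smul, map_smul, map_sum]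
    simp only [map_mul, smap_ι, h7, map_zero, mul_zero, sum_const_zero, smul_zero, add_zero]
    congr 1
    change x - d.iV (d.pV x) = d.inc (d.p x)
    rw [sub_eq_iff_eq_add]; exact (d.sum_eq x).symm
  have h8 : (d.Φ κ (-1)).comp (smap d.inc.toLinearMap) = d.ψ κ := by
    apply algHom_ext
    ext x
    change d.Φ κ (-1) (smap _ (ι K H x)) = d.ψ κ (ι K H x)
    rw [smap_ι, Φ_ι, ψ, SymmetricAlgebra.lift_ι_apply, neg_smul, one_smul, sub_eq_add_neg]
    change _ + -d.lam κ (d.p (d.inc x)) = _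
    rw [d.p_inc]; rfl
  have h9 := d.map_mem_W κ (d.Φ κ (-1)) (d.Φ_c κ (-1)) h5
  have h10 : smap (LinearMap.id - d.iV ∘ₗ d.pV) (d.Φ κ 1 R) = smap d.inc.toLinearMap (smap d.p R) :=
    dcongr_fun h6 R
  have h2 := d.Φ_Φ κ (-1) R
  rw [neg_neg] at h2
  rw [h10, map_sub, h2] at h9
  rw [← h8]
  exact h9

lemma symm_ι_mul (F : 𝒮 K L) : symm K L (ι K L (d.inc d.c) * F)
    = uι K L (d.inc d.c) * symm K L F :=
  sg_ι_mul_of_commute (uι K L) _ (fun x => by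
    rw [uι_mul_uι, ← lie_skew, d.c_cen, neg_zero, map_zero, add_zero]) F

lemma symm_sub_mul (F : 𝒮 K L) :
    symm K L ((ι K L (d.inc d.c) - algebraMap K _ κ) * F)
      = (uι K L (d.inc d.c) - algebraMap K _ κ) * symm K L F := by
  rw [sub_mul, map_sub, symm_ι_mul, sub_mul, ← asmul_def, ← asmul_def, map_smul]

variable {A : Type} [Ring A] [Algebra K A] (hκ : κ ≠ 0)
  (τ : 𝒰 K L →ₐ[K] A)
  (hτ : τ (uι K L (d.inc d.c)) = algebraMap K A κ)

lemma map_dfl {P : 𝒮 K L} (hP : IsInv K P) : τ (dfl K L P)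
    = UniversalEnvelopingAlgebra.lift K (d.ρ κ hκ τ hτ) (dfl K H (smap d.p P)) := by
  have hR := jop_isInv (dW K) hP
  obtain ⟨F, hF⟩ := (d.mem_W κ).1 (d.sub_ψ_mem κ hκ (fun v => hR (d.iV v)))
  have h1 : τ (symm K L (jop (dW K) (adL K L) P))
      = τ (symm K L (d.ψ κ (smap d.p (jop (dW K) (adL K L) P)))) := by
    rw [← sub_eq_zero, ← map_sub, ← map_sub, ← hF, symm_sub_mul, map_mul τ, map_sub, hτ,
      AlgHom.commutes, sub_self, zero_mul]
  change τ (symm K L (jop (dW K) (adL K L) P)) = _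
  rw [h1, d.symm_ψ κ hκ τ hτ, smap_p_jop, jop_neg_cancel', dfl_apply, map_sg]
  refine congrArg (fun f => sg f _) (lext fun x => ?_)
  exact (lift_uι (d.ρ κ hκ τ hτ) x).symm

end

include d in
theorem dufloMul (ih : DufloMul K H) : DufloMul K L := by
  intro P Q hP hQ
  obtain ⟨G, hG⟩ := symm_surjective (dfl K L (P * Q) - dfl K L P * dfl K L Q)
  suffices hs : G = 0 by
    rw [hs, map_zero] at hG
    exact sub_eq_zero.1 hG.symm
  have hcc : ∀ u, uι K L (d.inc d.c) * u = u * uι K L (d.inc d.c) := fun u => by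
    obtain ⟨F, rfl⟩ := symm_surjective u
    rw [← sub_eq_zero, ← symm_adD]
    have : adD (d.inc d.c) = (0 : Derivation K (𝒮 K L) _) := der_ext fun x => by
      rw [adD, der_ι, comp_apply, adL_apply, ← lie_skew, d.c_cen]; simp
    rw [this, Derivation.zero_apply, map_zero]
  have key : ∀ l : L →ₗ[K] K, l (d.inc d.c) ≠ 0 → slift l G = 0 := by
    intro l hl
    set κ := l (d.inc d.c) with hκ
    let z := uι K L (d.inc d.c) - algebraMap K _ κ
    have hz : ∀ u, z * u = u * z := fun u => by
      rw [sub_mul, mul_sub, hcc, Algebra.commutes]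
    let J := Ideal.span {z}
    have : J.IsTwoSided := ⟨fun {a} b ha => by
      obtain ⟨u, rfl⟩ := Ideal.mem_span_singleton'.1 ha
      exact Ideal.mem_span_singleton'.2 ⟨u * b, by rw [mul_assoc, mul_assoc, hz]⟩⟩
    let τ := Ideal.Quotient.mkₐ K J
    have hτ : τ (uι K L (d.inc d.c)) = algebraMap K _ κ := by
      rw [← AlgHom.commutes τ κ, ← sub_eq_zero, ← map_sub]
      exact Ideal.Quotient.eq_zero_iff_mem.2 (Ideal.mem_span_singleton_self _)
    have h1 : τ (symm K L G) = 0 := by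
      rw [hG, map_sub, map_mul τ, d.map_dfl κ hl τ hτ hP, d.map_dfl κ hl τ hτ hQ,
        d.map_dfl κ hl τ hτ (hP.mul hQ), map_mul (smap d.p),
        ih _ _ (d.isInv_smap_p hP) (d.isInv_smap_p hQ), map_mul, sub_self]
    obtain ⟨u, hu⟩ := Ideal.mem_span_singleton'.1 (Ideal.Quotient.eq_zero_iff_mem.1 h1)
    obtain ⟨F, rfl⟩ := symm_surjective u
    rw [← hz, ← d.symm_sub_mul] at hu
    rw [← symm_injective hu, map_mul, map_sub, SymmetricAlgebra.lift_ι_apply, AlgHom.commutes,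
      ← hκ]
    simp
  have h2 : G * ι K L (d.inc d.c) = 0 := eq_zero_of_forall_lift fun l => by
    rw [map_mul, SymmetricAlgebra.lift_ι_apply]
    by_cases hl : l (d.inc d.c) = 0
    · rw [hl, mul_zero]
    · rw [key l hl, zero_mul]
  refine (mul_eq_zero.1 h2).resolve_right fun h => d.inc_c_ne ?_
  exact (ι_eq_zero_iff _).1 h

end Heis

end

section

theorem dufloMul_of_heisenberg {K L : Type} [Field K] [CharZero K] [LieRing L] [LieAlgebra K L]
    [FiniteDimensional K L] (b : LieIdeal K L) {c : L} (hc0 : c ≠ 0) (hc : ∀ x : L, ⁅x, c⁆ = 0)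
    (hcb : c ∈ b) (hb : ∀ x ∈ b, ∀ y ∈ b, ⁅x, y⁆ ∈ span K {c})
    (hab : ∀ I : LieIdeal K L, (∀ x ∈ I, ∀ y ∈ I, ⁅x, y⁆ = 0) →
      ∀ x ∈ I, x ∈ span K {c})
    (hne : ∃ x ∈ b, x ∉ span K {c})
    (ih : ∀ (L' : Type) [LieRing L'] [LieAlgebra K L'] [FiniteDimensional K L'],
      finrank K L' < finrank K L → DufloMul K L') : DufloMul K L := by
  obtain ⟨l, hl⟩ := (LinearMap.toSpanSingleton K L c).exists_leftInverse_of_injective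
    (LinearMap.ker_toSpanSingleton K hc0)
  replace hl : l c = 1 := by simpa using dcongr_fun hl (1 : K)
  have hb' : ∀ x ∈ b, ∀ y ∈ b, ⁅x, y⁆ = l ⁅x, y⁆ • c := fun x hx y hy => by
    obtain ⟨k, hk⟩ := mem_span_singleton.1 (hb x hx y hy)
    rw [← hk, map_smul, hl, smul_eq_mul, mul_one]
  have hc' : ∀ x : L, ⁅c, x⁆ = 0 := fun x => by rw [← lie_skew, hc, neg_zero]
  let V : Submodule K L := b.toSubmodule ⊓ LinearMap.ker l
  have hV : ∀ {v : L}, v ∈ V ↔ v ∈ b ∧ l v = 0 := Iff.rfl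
  have hproj : ∀ y ∈ b, y - l y • c ∈ V := fun y hy =>
    hV.2 ⟨sub_mem hy (b.smul_mem _ hcb), by simp [hl]⟩
  let R : LieIdeal K L :=
    { carrier := {x | x ∈ b ∧ ∀ y ∈ b, ⁅x, y⁆ = 0}
      zero_mem' := ⟨b.zero_mem, fun y _ => zero_lie y⟩
      add_mem' := fun {x y} hx hy => ⟨b.add_mem hx.1 hy.1, fun z hz => by
        rw [add_lie, hx.2 z hz, hy.2 z hz, add_zero]⟩
      smul_mem' := fun k x hx => ⟨b.smul_mem k hx.1, fun z hz => by
        rw [smul_lie, hx.2 z hz, smul_zero]⟩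
      lie_mem := fun {x y} hy => ⟨b.lie_mem hy.1, fun z hz => by
        rw [lie_lie, hy.2 z hz, hy.2 _ (b.lie_mem hz), lie_zero, sub_zero]⟩ }
  have hnd : ∀ v ∈ V, (∀ w ∈ V, l ⁅v, w⁆ = 0) → v = 0 := by
    intro v hv h
    have hvR : v ∈ R := ⟨hv.1, fun y hy => by
      have h1 := h _ (hproj y hy)
      rw [lie_sub, lie_smul, hc, smul_zero, sub_zero] at h1
      rw [hb' v hv.1 y hy, h1, zero_smul]⟩
    obtain ⟨k, rfl⟩ := mem_span_singleton.1
      (hab R (fun x hx y hy => hx.2 y hy.1) v hvR)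
    have := (hV.1 hv).2
    rw [map_smul, hl, smul_eq_mul, mul_one] at this
    rw [this, zero_smul]
  let H : LieSubalgebra K L :=
    { carrier := {x | ∀ v ∈ V, l ⁅x, v⁆ = 0}
      zero_mem' := fun v _ => by simp
      add_mem' := fun {x y} hx hy v hv => by
        rw [add_lie, map_add, hx v hv, hy v hv, add_zero]
      smul_mem' := fun k x hx v hv => by rw [smul_lie, map_smul, hx v hv, smul_zero]
      lie_mem' := fun {x y} hx hy v hv => by
        rw [lie_lie, map_sub, hx _ (hV.2 ⟨b.lie_mem hv.1, hy v hv⟩),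
          hy _ (hV.2 ⟨b.lie_mem hv.1, hx v hv⟩), sub_zero] }
  have hH : ∀ {x : L}, x ∈ H ↔ ∀ v ∈ V, l ⁅x, v⁆ = 0 := Iff.rfl
  let β : L →ₗ[K] Module.Dual K V := LinearMap.mk₂ K (fun x (v : V) => l ⁅x, (v : L)⁆)
    (by simp) (by simp) (by simp) (by simp)
  have hβ : ∀ x (v : V), β x v = l ⁅x, (v : L)⁆ := fun _ _ => rfl
  let ω : V →ₗ[K] Module.Dual K V := β ∘ₗ V.subtype
  have hω : Function.Injective ω := (injective_iff_map_eq_zero ω).2 fun v hv =>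
    Subtype.ext (hnd v v.2 fun w hw => dcongr_fun hv (⟨w, hw⟩ : V))
  let e := LinearMap.linearEquivOfInjective ω hω (Subspace.dual_finrank_eq).symm
  have he : ∀ v, e v = ω v := fun _ => rfl
  let pV : L →ₗ[K] V := e.symm.toLinearMap ∘ₗ β
  have hpV : ∀ x, ω (pV x) = β x := fun x => by rw [← he]; exact e.apply_symm_apply _
  have hpH : ∀ x, x - pV x ∈ H := fun x => hH.2 fun v hv => by
    have := dcongr_fun (hpV x) (⟨v, hv⟩ : V)
    rw [sub_lie, map_sub, sub_eq_zero]
    exact this.symm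
  have hVV : ∀ v : V, pV v = v := fun v => hω (by rw [hpV]; rfl)
  have hVH : ∀ h ∈ H, pV h = 0 := fun h hh => hω (by
    rw [hpV, map_zero]
    exact lext fun v => hh v v.2)
  have hcH : c ∈ H := hH.2 fun v _ => by rw [hc', map_zero]
  let d : Heis K L H V :=
    { inc := H.incl
      iV := V.subtype
      p := (LinearMap.id - V.subtype ∘ₗ pV).codRestrict H.toSubmodule hpH
      pV := pV
      p_inc := fun h => Subtype.ext (show (h : L) - pV h = h by simp [hVH h h.2])
      p_iV := fun v => Subtype.ext (show (v : L) - pV v = 0 by simp [hVV])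
      pV_inc := fun h => hVH h h.2
      pV_iV := hVV
      sum_eq := fun x => sub_add_cancel x (pV x : L)
      a := LinearMap.mk₂ K (fun (h : H) (v : V) => (⟨⁅(h : L), (v : L)⁆,
        hV.2 ⟨b.lie_mem v.2.1, h.2 v v.2⟩⟩ : V)) (fun _ _ _ => Subtype.ext (by simp))
        (fun _ _ _ => Subtype.ext (by simp)) (fun _ _ _ => Subtype.ext (by simp))
        (fun _ _ _ => Subtype.ext (by simp))
      a_eq := fun h v => rfl
      ω := ω
      c := ⟨c, hcH⟩
      c_ne := fun h => hc0 (congrArg Subtype.val h)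
      c_cen := hc
      ω_eq := fun v w => hb' v v.2.1 w w.2.1
      ω_nd := fun v h => hω (by rw [map_zero]; exact lext h) }
  refine d.dufloMul (ih H (Submodule.finrank_lt fun h => ?_))
  obtain ⟨x, hx, hxc⟩ := hne
  have h1 : x - l x • c = 0 := hnd _ (hproj x hx) (hH.1 (by
    change _ ∈ H.toSubmodule
    rw [h]
    trivial))
  exact hxc (mem_span_singleton.2 ⟨l x, (sub_eq_zero.1 h1).symm⟩)

end

section

section

variable {K L Q : Type} [Field K] [CharZero K] [LieRing L] [LieAlgebra K L]
  [FiniteDimensional K L] [LieRing Q] [LieAlgebra K Q] [FiniteDimensional K Q]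

lemma killingForm_apply_lie [LieAlgebra.IsKilling K Q] (x y z : Q) :
    killingForm K Q ⁅x, y⁆ z = killingForm K Q x ⁅y, z⁆ :=
  LieModule.traceForm_apply_lie_apply K Q Q x y z

lemma killingForm_injective [LieAlgebra.IsKilling K Q] :
    Function.Injective (killingForm K Q) :=
  LinearMap.ker_eq_bot.1 (LieAlgebra.IsKilling.ker_killingForm_eq_bot K Q)

lemma dufloMul_of_isKilling [LieAlgebra.IsKilling K L] : DufloMul K L :=
  InvForm.dufloMul
    { B := killingForm K L
      symm := LieModule.traceForm_comm K L L
      inv := killingForm_apply_lie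
      nondeg := fun x h => killingForm_injective (by rw [map_zero]; exact lext h) }

/-- A one-dimensional central extension of a semisimple Lie algebra carries an invariant form. -/
theorem dufloMul_of_central_extension [LieAlgebra.IsKilling K Q] (f : L →ₗ⁅K⁆ Q)
    (hf : Function.Surjective f) {c : L} (hc0 : c ≠ 0) (hc : ∀ x : L, ⁅x, c⁆ = 0)
    (hker : ∀ x, f x = 0 ↔ x ∈ span K {c}) : DufloMul K L := by
  obtain ⟨l, hl⟩ := (LinearMap.toSpanSingleton K L c).exists_leftInverse_of_injective
    (LinearMap.ker_toSpanSingleton K hc0)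
  replace hl : l c = 1 := by simpa using dcongr_fun hl (1 : K)
  obtain ⟨s, hs⟩ := (f : L →ₗ[K] Q).exists_rightInverse_of_surjective (LinearMap.range_eq_top.2 hf)
  replace hs : ∀ u, f (s u) = u := fun u => dcongr_fun hs u
  have hc' : ∀ x : L, ⁅c, x⁆ = 0 := fun x => by rw [← lie_skew, hc, neg_zero]
  have hfc : f c = 0 := (hker c).2 (mem_span_singleton_self c)
  have hsf : ∀ x, ∃ k : K, s (f x) = x + k • c := fun x => by
    obtain ⟨k, hk⟩ := mem_span_singleton.1
      ((hker (s (f x) - x)).1 (by rw [map_sub, hs, sub_self]))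
    exact ⟨k, by rw [hk]; abel⟩
  let F : Q →ₗ[K] Module.Dual K Q := LinearMap.mk₂ K (fun u v => l ⁅s u, s v⁆)
    (by simp) (by simp) (by simp) (by simp)
  have hF : ∀ x y, F (f x) (f y) = l ⁅x, y⁆ := fun x y => by
    obtain ⟨k, hk⟩ := hsf x
    obtain ⟨k', hk'⟩ := hsf y
    change l ⁅s (f x), s (f y)⁆ = _
    rw [hk, hk']
    simp [hc, hc']
  let κ := killingForm K Q
  have hκc : ∀ x y, κ x y = κ y x := LieModule.traceForm_comm K Q Q
  have hκi : ∀ x y z, κ ⁅x, y⁆ z = κ x ⁅y, z⁆ := killingForm_apply_lie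
  let e := LinearMap.linearEquivOfInjective κ killingForm_injective
    (Subspace.dual_finrank_eq).symm
  let D₀ : Q →ₗ[K] Q := e.symm.toLinearMap ∘ₗ F
  have hD₀ : ∀ u, κ (D₀ u) = F u := fun u => e.apply_symm_apply _
  let D : LieDerivation K Q Q :=
    { D₀ with
      leibniz' := fun u v => killingForm_injective (lext fun w => by
        obtain ⟨x, rfl⟩ := hf u
        obtain ⟨y, rfl⟩ := hf v
        obtain ⟨z, rfl⟩ := hf w
        change κ (D₀ ⁅f x, f y⁆) (f z) = κ (⁅f x, D₀ (f y)⁆ - ⁅f y, D₀ (f x)⁆) (f z)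
        rw [← lie_skew (f x) (D₀ (f y)), ← lie_skew (f y) (D₀ (f x)), map_sub, map_neg, map_neg,
          lsub_apply, lneg_apply, lneg_apply, hκi, hκi, hD₀, hD₀, hD₀,
          ← LieHom.map_lie, ← LieHom.map_lie, ← LieHom.map_lie, hF, hF, hF, lie_lie, map_sub]
        ring) }
  obtain ⟨q, hq⟩ := LieDerivation.IsKilling.exists_eq_ad D
  have hq' : ∀ u, D₀ u = ⁅q, u⁆ := fun u => ((dcongr_fun hq u).symm.trans (LieDerivation.ad_apply_apply K Q q u) : D u = _)
  let r : L →ₗ[K] K := l - κ q ∘ₗ (f : L →ₗ[K] Q)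
  have hr : ∀ x, r x = l x - κ q (f x) := fun _ => rfl
  have hrl : ∀ x y, r ⁅x, y⁆ = 0 := fun x y => by
    rw [hr, ← hF, ← hD₀, hq', hκi, LieHom.map_lie, sub_self]
  have hrc : r c = 1 := by rw [hr, hfc, map_zero, sub_zero, hl]
  let B : L →ₗ[K] L →ₗ[K] K := LinearMap.mk₂ K (fun x y => κ (f x) (f y) + r x * r y)
    (fun x y z => by simp only [map_add, ladd_apply]; ring)
    (fun k x y => by simp only [map_smul, lsmul_apply, smul_eq_mul]; ring)
    (fun x y z => by simp only [map_add]; ring)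
    (fun k x y => by simp only [map_smul, smul_eq_mul]; ring)
  have hB : ∀ x y, B x y = κ (f x) (f y) + r x * r y := fun _ _ => rfl
  refine InvForm.dufloMul (L := L) ⟨B, fun x y => ?_, fun x y z => ?_, fun x hx => ?_⟩
  · rw [hB, hB, hκc, mul_comm]
  · rw [hB, hB, hrl, hrl, zero_mul, mul_zero, LieHom.map_lie, LieHom.map_lie, hκi]
  · have h1 : r x = 0 := by simpa [hB, hfc, hrc] using hx c
    have h2 : f x = 0 := killingForm_injective (K := K) (by
      rw [map_zero]
      refine lext fun v => ?_
      obtain ⟨y, rfl⟩ := hf v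
      simpa [hB, h1] using hx y)
    obtain ⟨k, rfl⟩ := mem_span_singleton.1 ((hker x).1 h2)
    rw [map_smul, hrc, smul_eq_mul, mul_one] at h1
    rw [h1, zero_smul]

end

lemma isKilling_of_forall_abelian {K L : Type} [Field K] [CharZero K] [LieRing L]
    [LieAlgebra K L] [FiniteDimensional K L]
    (h : ∀ I : LieIdeal K L, (∀ x ∈ I, ∀ y ∈ I, ⁅x, y⁆ = 0) → ∀ x ∈ I, x = 0) :
    LieAlgebra.IsKilling K L := by
  have : LieAlgebra.HasTrivialRadical K L :=
    (LieAlgebra.hasTrivialRadical_iff_no_abelian_ideals K L).2 fun I hI =>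
      (LieSubmodule.eq_bot_iff I).2 (h I fun x hx y hy =>
        congrArg Subtype.val (hI.trivial ⟨x, hx⟩ ⟨y, hy⟩))
  infer_instance

/-- The Duflo map of every finite-dimensional Lie algebra is multiplicative on invariants. -/
theorem dufloMul (n : ℕ) : ∀ (K L : Type) [Field K] [CharZero K] [LieRing L] [LieAlgebra K L]
    [FiniteDimensional K L], finrank K L = n → DufloMul K L := by
  induction n using strong_induction_on with
  | _ n ih' =>
  intro K L _ _ _ _ _ hn
  have ih : ∀ (L' : Type) [LieRing L'] [LieAlgebra K L'] [FiniteDimensional K L'],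
      finrank K L' < finrank K L → DufloMul K L' :=
    fun L' _ _ _ h => ih' _ (hn ▸ h) K L' rfl
  by_contra hne
  have h1 : ∀ I : LieIdeal K L, (∀ x ∈ I, ∀ y ∈ I, ⁅x, y⁆ = 0) →
      (∀ y ∈ I, ∀ x : L, ⁅x, y⁆ = 0) ∧ finrank K I ≤ 1 := by
    intro I hI
    by_contra h
    refine hne (dufloMul_of_abelian_ideal I hI ?_ ih)
    by_contra h'
    push Not at h'
    exact h ⟨fun y hy x => h'.1 x y hy, by omega⟩
  have hcen : ∀ {y : L}, y ∈ LieAlgebra.center K L ↔ ∀ x : L, ⁅x, y⁆ = 0 :=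
    fun {y} => LieModule.mem_maxTrivSubmodule K L L y
  obtain ⟨c, hcZ, hc0⟩ : ∃ c ∈ LieAlgebra.center K L, c ≠ 0 := by
    by_contra! h
    have := isKilling_of_forall_abelian (K := K) (L := L) fun I hI x hx =>
      h x (hcen.2 ((h1 I hI).1 x hx))
    exact hne dufloMul_of_isKilling
  have hZ : ∀ x, x ∈ LieAlgebra.center K L ↔ x ∈ span K {c} := by
    refine fun x => ⟨fun hx => ?_, fun hx => ?_⟩
    · obtain ⟨k, hk⟩ := (finrank_eq_one_iff_of_nonzero' (⟨c, hcZ⟩ : LieAlgebra.center K L)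
        (fun h => hc0 (congrArg Subtype.val h))).1 (le_antisymm
          (h1 _ fun x _ y hy => hcen.1 hy x).2 (Nat.one_le_iff_ne_zero.2 fun h =>
            hc0 (congrArg Subtype.val (Subsingleton.elim
              (h := Module.finrank_zero_iff.1 h) (⟨c, hcZ⟩ : LieAlgebra.center K L) 0))))
        ⟨x, hx⟩
      exact mem_span_singleton.2 ⟨k, congrArg Subtype.val hk⟩
    · obtain ⟨k, rfl⟩ := mem_span_singleton.1 hx
      exact (LieAlgebra.center K L).smul_mem k hcZ
  let Q := L ⧸ LieAlgebra.center K L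
  have : FiniteDimensional K Q :=
    inferInstanceAs (FiniteDimensional K (L ⧸ (LieAlgebra.center K L).toSubmodule))
  let f : L →ₗ⁅K⁆ Q :=
    { (LieSubmodule.Quotient.mk' (LieAlgebra.center K L) : L →ₗ[K] Q) with
      map_lie' := fun {x y} => LieSubmodule.Quotient.mk_bracket _ x y }
  have hf : Function.Surjective f := LieSubmodule.Quotient.surjective_mk' _
  have hker : ∀ x, f x = 0 ↔ x ∈ span K {c} := fun x =>
    (LieSubmodule.Quotient.mk_eq_zero' (N := LieAlgebra.center K L)).trans (hZ x)
  by_cases hQ : ∀ I : LieIdeal K Q, (∀ x ∈ I, ∀ y ∈ I, ⁅x, y⁆ = 0) → ∀ x ∈ I, x = 0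
  · have := isKilling_of_forall_abelian hQ
    exact hne (dufloMul_of_central_extension f hf hc0 (hcen.1 hcZ) hker)
  · push Not at hQ
    obtain ⟨I, hI, u, hu, hu0⟩ := hQ
    obtain ⟨x, rfl⟩ := hf u
    have hmem : ∀ {x : L}, x ∈ I.comap f ↔ f x ∈ I := LieIdeal.mem_comap
    refine hne (dufloMul_of_heisenberg (I.comap f) hc0 (hcen.1 hcZ) (hmem.2 ?_)
      (fun x hx y hy => (hker _).1 ?_) (fun J hJ x hx => (hZ x).1 (hcen.2 ((h1 J hJ).1 x hx)))
      ⟨x, hmem.2 hu, fun h => hu0 ((hker x).2 h)⟩ ih)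
    · rw [(hker c).2 (mem_span_singleton_self c)]
      exact I.zero_mem
    · rw [LieHom.map_lie]
      exact hI _ (hmem.1 hx) _ (hmem.1 hy)

end

section

lemma sum_pow_eq_sum_ofFn {R : Type} [Semiring R] {m : ℕ} (a : Fin m → R) (n : ℕ) :
    (∑ j, a j) ^ n = ∑ f : Fin n → Fin m, (List.ofFn fun j => a (f j)).prod := by
  induction n with
  | zero => simp
  | succ n ih =>
    rw [pow_succ', ih, sum_mul_sum, ← Fintype.sum_prod_type',
      ← (Fin.consEquiv fun _ : Fin (n + 1) => Fin m).sum_comp]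
    exact Fintype.sum_congr _ _ fun p => by simp [Fin.consEquiv, List.ofFn_succ]

lemma prod_ofFn_smul {K R : Type} [CommSemiring K] [Semiring R] [Algebra K R] {n : ℕ}
    (x : Fin n → K) (a : Fin n → R) :
    (List.ofFn fun j => x j • a j).prod = (∏ j, x j) • (List.ofFn a).prod := by
  induction n with
  | zero => simp
  | succ n ih =>
    rw [List.ofFn_succ, List.prod_cons, ih, List.ofFn_succ, List.prod_cons, Fin.prod_univ_succ,
      smul_mul_smul_comm]

lemma sum_smul_pow {K R : Type} [CommSemiring K] [Semiring R] [Algebra K R] {m : ℕ}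
    (x : Fin m → K) (a : Fin m → R) (n : ℕ) :
    (∑ j, x j • a j) ^ n
      = ∑ f : Fin n → Fin m, (∏ j, x (f j)) • (List.ofFn fun j => a (f j)).prod := by
  rw [sum_pow_eq_sum_ofFn]
  exact sum_congr rfl fun f _ => prod_ofFn_smul _ _

lemma exists_perm_of_ofFn_perm {n m : ℕ} (f g : Fin n → Fin m)
    (h : (List.ofFn f).Perm (List.ofFn g)) : ∃ σ : Equiv.Perm (Fin n), f = g ∘ σ := by
  have : f ∘ Tuple.sort f = g ∘ Tuple.sort g := List.ofFn_injective <|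
    (((Tuple.sort f).ofFn_comp_perm f).trans
      (h.trans ((Tuple.sort g).ofFn_comp_perm g).symm)).eq_of_pairwise'
      (Tuple.monotone_sort f).sortedLE_ofFn.pairwise
      (Tuple.monotone_sort g).sortedLE_ofFn.pairwise
  refine ⟨(Tuple.sort f).symm.trans (Tuple.sort g), funext fun i => ?_⟩
  simpa using congrFun this ((Tuple.sort f).symm i)

lemma sum_perm_get {R : Type} [Semiring R] {n m : ℕ} (u : Fin m → R) (f : Fin n → Fin m)
    (l : List (Fin m)) (h : l.Perm (List.ofFn f)) :
    ∑ σ : Equiv.Perm (Fin l.length), (List.ofFn fun j => u (l.get (σ j))).prod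
      = ∑ σ : Equiv.Perm (Fin n), (List.ofFn fun j => u (f (σ j))).prod := by
  obtain rfl : n = l.length := by simpa using h.length_eq.symm
  obtain ⟨τ, hτ⟩ := exists_perm_of_ofFn_perm l.get f (by rwa [List.ofFn_get])
  rw [hτ]
  exact Equiv.sum_comp (Equiv.mulLeft τ)
    fun σ : Equiv.Perm (Fin l.length) => (List.ofFn fun j => u (f (σ j))).prod

variable {K L : Type} [Field K] [CharZero K] [LieRing L] [LieAlgebra K L] {m : ℕ}
  (b : Basis (Fin m) K L)

lemma equivMvPolynomial_ι (x : L) : equivMvPolynomial b (ι K L x) = linPoly b x := by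
  conv_lhs => rw [← b.sum_repr x]
  simp only [map_sum, map_smul, equivMvPolynomial_ι_apply, linPoly]

lemma symmMonomial_sum_single {n : ℕ} (f : Fin n → Fin m) :
    symmMonomial b (∑ j, Finsupp.single (f j) 1) = (n.factorial : K)⁻¹ •
      ∑ σ : Equiv.Perm (Fin n), (List.ofFn fun j => uι K L (b (f (σ j)))).prod := by
  have h : (Finsupp.toMultiset (∑ j, Finsupp.single (f j) 1)).toList.Perm (List.ofFn f) := by
    rw [← Multiset.coe_eq_coe, Multiset.coe_toList, map_sum, ← Fin.univ_val_map]
    simp only [Finsupp.toMultiset_single, one_smul]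
    conv_rhs => rw [← Multiset.sum_map_singleton (Multiset.map f univ.val), Multiset.map_map]
    rfl
  have hn := h.length_eq
  rw [List.length_ofFn] at hn
  rw [symmMonomial, ← sum_perm_get (fun i => uι K L (b i)) f _ h]
  nth_rw 1 [hn]
  rfl

/-- The symmetrization map as a linear map. -/
def symmetrizationL : MvPolynomial (Fin m) K →ₗ[K] 𝒰 K L :=
  (MvPolynomial.basisMonomials (Fin m) K).constr K (symmMonomial b)

lemma symmetrizationL_apply (P : MvPolynomial (Fin m) K) :
    symmetrizationL b P = symmetrization b P :=
  (MvPolynomial.basisMonomials (Fin m) K).constr_apply K (symmMonomial b) P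

lemma symmetrizationL_monomial (α : Fin m →₀ ℕ) :
    symmetrizationL b (MvPolynomial.monomial α 1) = symmMonomial b α := by
  have h := (MvPolynomial.basisMonomials (Fin m) K).constr_basis K (symmMonomial b) α
  rwa [MvPolynomial.coe_basisMonomials] at h

lemma symmetrizationL_pow (x : L) (n : ℕ) :
    symmetrizationL b (linPoly b x ^ n) = uι K L x ^ n := by
  have hx : uι K L x = ∑ j, b.repr x j • uι K L (b j) := by
    conv_lhs => rw [← b.sum_repr x, map_sum]
    simp only [map_smul]
  have h1 : ∀ f : Fin n → Fin m, (List.ofFn fun j => (MvPolynomial.X (f j) : MvPolynomial _ K)).prod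
      = MvPolynomial.monomial (∑ j, Finsupp.single (f j) 1) 1 := fun f => by
    rw [MvPolynomial.monomial_sum_one, List.prod_ofFn]
    rfl
  rw [linPoly, sum_smul_pow, hx, sum_smul_pow, map_sum]
  simp only [map_smul, h1, symmetrizationL_monomial, symmMonomial_sum_single, smul_comm _
    (n.factorial : K)⁻¹, ← smul_sum]
  rw [inv_smul_eq_iff₀ (by exact_mod_cast n.factorial_ne_zero)]
  conv_lhs => simp only [smul_sum]
  rw [sum_comm, sum_congr rfl (g := fun _ => ∑ f : Fin n → Fin m,
    (∏ j, b.repr x (f j)) • (List.ofFn fun j => uι K L (b (f j))).prod), sum_const,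
    card_univ, Fintype.card_perm, Fintype.card_fin, Nat.cast_smul_eq_nsmul]
  intro σ _
  rw [← (Equiv.arrowCongr σ (Equiv.refl (Fin m))).sum_comp]
  refine sum_congr rfl fun f _ => ?_
  simp only [Equiv.arrowCongr_apply, Equiv.coe_refl, Function.id_comp, Function.comp_apply,
    Equiv.symm_apply_apply, id_eq]
  rw [Equiv.prod_comp σ.symm fun j => b.repr x (f j)]

lemma symmetrizationL_equiv [FiniteDimensional K L] (P : 𝒮 K L) :
    symmetrizationL b (equivMvPolynomial b P) = symm K L P := by
  induction P using dp_induction with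
  | h x n =>
    rw [symm_dp, dp, dvp, map_smul, map_smul, map_pow, equivMvPolynomial_ι, symmetrizationL_pow]
  | hz => simp
  | ha P Q hP hQ => rw [map_add, map_add, map_add, hP, hQ]
  | hs a P hP => rw [map_smul, map_smul, map_smul, hP]

end

section

open MvPolynomial

variable {K L : Type} [Field K] [CharZero K] [LieRing L] [LieAlgebra K L] {m : ℕ}
  (b : Basis (Fin m) K L)

/-- The divided power of degree `n - k` as a polynomial, or zero if `n < k`. -/
def mvdp (x : L) (n k : ℕ) : MvPolynomial (Fin m) K :=
  if k ≤ n then equivMvPolynomial b (dp x (n - k)) else 0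

lemma equivMvPolynomial_dp (x : L) (n : ℕ) :
    equivMvPolynomial b (dp x n) = (n.factorial : K)⁻¹ • linPoly b x ^ n := by
  rw [dp, map_smul, map_pow, equivMvPolynomial_ι]

lemma pderiv_linPoly (x : L) (i : Fin m) : pderiv i (linPoly b x) = C (b.repr x i) := by
  rw [linPoly, map_sum, sum_eq_single i]
  · rw [Derivation.map_smul, pderiv_X_self, smul_eq_C_mul, mul_one]
  · intro j _ hj
    rw [Derivation.map_smul, pderiv_X_of_ne hj, smul_zero]
  · simp

lemma pderiv_mvdp (x : L) (n k : ℕ) (i : Fin m) :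
    pderiv i (mvdp b x n k) = b.repr x i • mvdp b x n (k + 1) := by
  rcases lt_trichotomy n k with h | rfl | h
  · rw [mvdp, mvdp, if_neg (by omega), if_neg (by omega), map_zero, smul_zero]
  · rw [mvdp, mvdp, if_pos le_rfl, if_neg (by omega), Nat.sub_self, dp_zero, map_one, smul_zero,
      pderiv_one]
  · obtain ⟨j, rfl⟩ : ∃ j, n = k + 1 + j := ⟨n - (k + 1), by omega⟩
    rw [mvdp, mvdp, if_pos (by omega), if_pos (by omega), show k + 1 + j - k = j + 1 by omega,
      Nat.add_sub_cancel_left, equivMvPolynomial_dp, equivMvPolynomial_dp, Derivation.map_smul,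
      Derivation.leibniz_pow, pderiv_linPoly, Nat.add_sub_cancel, ← Nat.cast_smul_eq_nsmul K,
      smul_smul, smul_eq_mul, mul_comm _ (C _), ← smul_eq_C_mul, smul_comm, mul_comm,
      inv_factorial_succ]

lemma pderiv_pow_mvdp (x : L) (n k : ℕ) (i : Fin m) (a : ℕ) :
    (((pderiv i).toLinearMap : End K (MvPolynomial (Fin m) K)) ^ a) (mvdp b x n k)
      = b.repr x i ^ a • mvdp b x n (k + a) := by
  induction a with
  | zero => simp
  | succ a ih =>
    rw [pow_succ', mul_apply, ih, map_smul, pow_succ, mul_smul]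
    exact congrArg _ (pderiv_mvdp b x n _ i)

lemma diffOpMon_mvdp (α : Fin m →₀ ℕ) (x : L) (n : ℕ) :
    diffOpMon (K := K) α (mvdp b x n 0) = (∏ i, b.repr x i ^ α i) • mvdp b x n α.degree := by
  have h : ∀ l : List (Fin m), (l.map fun i =>
      (((pderiv i).toLinearMap : End K (MvPolynomial (Fin m) K)) ^ (α i))).prod
        (mvdp b x n 0) = (l.map fun i => b.repr x i ^ α i).prod • mvdp b x n (l.map α).sum := by
    intro l
    induction l with
    | nil => simp
    | cons i l ih =>
      rw [List.map_cons, List.prod_cons, mul_apply, ih, map_smul, pderiv_pow_mvdp,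
        smul_smul, List.map_cons, List.prod_cons, List.map_cons, List.sum_cons, mul_comm, add_comm]
  rw [diffOpMon, h, Fin.prod_univ_def, Finsupp.degree_eq_sum, Fin.sum_univ_def]

/-- A differential operator as a linear map. -/
def diffOpL (δ : MvPolynomial (Fin m) K) : End K (MvPolynomial (Fin m) K) :=
  ∑ α ∈ δ.support, coeff α δ • diffOpMon (K := K) α

lemma diffOpL_apply (δ P : MvPolynomial (Fin m) K) : diffOpL δ P = diffOp δ P := by
  simp [diffOpL, diffOp, lsum_apply]

lemma diffOpL_dp {δ : MvPolynomial (Fin m) K} {r : ℕ} (hδ : δ.IsHomogeneous r) (x : L) (n : ℕ) :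
    diffOpL δ (equivMvPolynomial b (dp x n)) = eval (b.repr x) δ • mvdp b x n r := by
  have h : equivMvPolynomial b (dp x n) = mvdp b x n 0 := by simp [mvdp]
  rw [diffOpL, lsum_apply, eval_eq', sum_smul]
  refine sum_congr rfl fun α hα => ?_
  rw [lsmul_apply, h, diffOpMon_mvdp, smul_smul, Finsupp.degree_eq_weight_one]
  exact congrArg _ (congrArg _ (hδ (mem_support_iff.mp hα)))

lemma isHomogeneous_equivMvPolynomial_dp (x : L) (n : ℕ) :
    (equivMvPolynomial b (dp (K := K) x n)).IsHomogeneous n := by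
  rw [equivMvPolynomial_dp]
  have h : (linPoly b x).IsHomogeneous 1 :=
    IsHomogeneous.sum _ _ _ fun i _ => by
      rw [smul_eq_C_mul]
      exact zero_add 1 ▸ (isHomogeneous_C _ _).mul (isHomogeneous_X K i)
  rw [smul_eq_C_mul]
  have := (isHomogeneous_C (Fin m) (n.factorial : K)⁻¹).mul (h.pow n)
  rwa [zero_add, one_mul] at this

lemma diffOpL_homogeneousComponent {δ : MvPolynomial (Fin m) K} {r : ℕ} (hδ : δ.IsHomogeneous r)
    (j : ℕ) (hj : j < r) (P : 𝒮 K L) :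
    diffOpL δ (homogeneousComponent j (equivMvPolynomial b P)) = 0 := by
  induction P using dp_induction with
  | h x n =>
    rw [homogeneousComponent_of_mem (isHomogeneous_equivMvPolynomial_dp b x n)]
    split_ifs with h
    · rw [diffOpL_dp b hδ, mvdp, if_neg (by omega), smul_zero]
    · rw [map_zero]
  | hz => simp
  | ha P Q hP hQ => simp only [map_add, hP, hQ, add_zero]
  | hs a P hP => simp only [map_smul, hP, smul_zero]

lemma diffOpL_eq_zero {δ : MvPolynomial (Fin m) K} {r : ℕ} (hδ : δ.IsHomogeneous r)
    (P : 𝒮 K L) (hP : (equivMvPolynomial b P).totalDegree < r) :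
    diffOpL δ (equivMvPolynomial b P) = 0 := by
  rw [← sum_homogeneousComponent (equivMvPolynomial b P), map_sum]
  refine sum_eq_zero fun j hj => diffOpL_homogeneousComponent b hδ j ?_ P
  rw [mem_range] at hj
  omega

end

section

open MvPolynomial

variable {K L : Type} [Field K] [CharZero K] [LieRing L] [LieAlgebra K L] {m : ℕ}

/-- Restriction of a polynomial function to the line through `p`, as a power series. -/
def lineSeries (p : Fin m → K) : MvPolynomial (Fin m) K →ₐ[K] PowerSeries K :=
  aeval fun i => p i • (PowerSeries.X : PowerSeries K)

lemma coeff_lineSeries (p : Fin m → K) (G : MvPolynomial (Fin m) K) (r : ℕ) :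
    PowerSeries.coeff r (lineSeries p G) = eval p (homogeneousComponent r G) := by
  induction G using MvPolynomial.induction_on' with
  | monomial α a =>
    have h : lineSeries p (monomial α a) = (a * ∏ i, p i ^ α i) • PowerSeries.X ^ α.degree := by
      rw [lineSeries, aeval_monomial, Finsupp.prod_fintype _ _ (by simp), Finsupp.degree_eq_sum,
        ← prod_pow_eq_pow_sum, mul_smul, ← prod_smul, asmul_def]
      simp only [smul_pow]
    rw [h, map_smul, PowerSeries.coeff_X_pow,
      homogeneousComponent_of_mem (isHomogeneous_monomial a rfl)]
    split_ifs
    · rw [eval_monomial, Finsupp.prod_fintype _ _ (by simp), smul_eq_mul, mul_one]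
    · simp
  | add P Q hP hQ => simp only [map_add, hP, hQ]

lemma lineSeries_adTracePoly (b : Basis (Fin m) K L) (x : L) (n : ℕ) :
    lineSeries (b.repr x) (adTracePoly b n)
      = trace K L (adL K L x ^ n) • PowerSeries.X ^ n := by
  have hx : adL K L x = ∑ j, b.repr x j • adL K L (b j) := by
    conv_lhs => rw [← b.sum_repr x, map_sum]
    simp only [map_smul]
  rw [hx, sum_smul_pow, map_sum, sum_smul, adTracePoly, map_sum]
  refine sum_congr rfl fun f _ => ?_
  rw [map_smul, map_smul, map_prod, smul_assoc, smul_comm]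
  simp only [lineSeries, aeval_X]
  rw [prod_smul, prod_const, card_univ, Fintype.card_fin]
  rfl

lemma cast_expSeq (a : ℕ → ℚ) (n : ℕ) :
    ((expSeq ℚ a n : ℚ) : K) = expSeq K (fun i => (a i : K)) n := by
  refine eq_expSeq K (fun i => (a i : K)) (fun n => ((expSeq ℚ a n : ℚ) : K)) (by simp)
    (fun n => ?_) n
  have h := expSeq_succ ℚ a n
  simp only [smul_eq_mul] at h ⊢
  exact_mod_cast congrArg (fun q : ℚ => (q : K)) h

lemma cast_hC (i : ℕ) : ((hC ℚ (i + 1) : ℚ) : K) = hC K (i + 1) := by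
  refine expSeq_injective K (A := fun i => ((hC ℚ i : ℚ) : K)) (fun n => ?_) i
  rw [← cast_expSeq, ← shC_eq, ← shC_eq, shC, shC]
  split_ifs <;> push_cast <;> rfl

lemma four_mul_eq_hC (c : ℕ → ℚ) (hc0 : c 0 = 0)
    (hc : expPS (PowerSeries.mk fun n => 4 * c n) = sinhHalfSeries) (i : ℕ) :
    4 * c (i + 1) = hC ℚ (i + 1) := by
  refine expSeq_injective ℚ (A := fun i => 4 * c i) (fun n => ?_) i
  have h := congrArg (PowerSeries.coeff n) hc
  have h1 := coeff_sum_pow_eq_expSeq (K := ℚ) (PowerSeries.mk fun n => 4 * c n)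
    (by simp [hc0]) n n le_rfl
  simp only [PowerSeries.coeff_mk] at h1
  rw [← h1, ← shC_eq, map_sum]
  rw [expPS, sinhHalfSeries, PowerSeries.coeff_mk, PowerSeries.coeff_mk] at h
  simpa only [map_smul, smul_eq_mul, shC] using h

lemma eval_dufloSymbol (b : Basis (Fin m) K L) (c : ℕ → ℚ) (hc0 : c 0 = 0)
    (hc : expPS (PowerSeries.mk fun n => 4 * c n) = sinhHalfSeries) (r : ℕ) (x : L) :
    eval (b.repr x) (dufloSymbol b c r) = jsym (dW K) (adL K L) x r := by
  rw [dufloSymbol, ← coeff_lineSeries, map_sum (lineSeries _)]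
  simp only [map_smul (lineSeries _), map_pow, map_sum (lineSeries _), lineSeries_adTracePoly]
  rw [coeff_sum_pow_eq_expSeq _ _ _ _ le_rfl, jsym]
  · refine expSeq_congr K r fun i h1 hi => ?_
    simp only [map_sum, map_smul, PowerSeries.coeff_X_pow, smul_eq_mul, mul_ite, mul_one, mul_zero]
    rcases Nat.even_or_odd' i with ⟨j, rfl | rfl⟩
    · rw [sum_eq_single j]
      · obtain ⟨k, rfl⟩ : ∃ k, j = k + 1 := ⟨j - 1, by omega⟩
        rw [if_pos rfl, dW, show 2 * (k + 1) = 2 * k + 1 + 1 by ring, ← cast_hC,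
          ← four_mul_eq_hC c hc0 hc]
        push_cast
        ring
      · intro j' _ h
        rw [if_neg (by omega)]
      · intro h
        exact absurd (mem_Icc.2 ⟨by omega, by omega⟩) h
    · rw [dW, hC_odd K _ (by omega), mul_zero, zero_mul]
      exact sum_eq_zero fun j' _ => by rw [if_neg (by omega)]
  · simp only [map_sum, map_smul, PowerSeries.coeff_X_pow, smul_eq_mul, mul_ite, mul_one, mul_zero]
    exact sum_eq_zero fun j hj => by
      rw [mem_Icc] at hj
      rw [if_neg (by omega)]

lemma dufloSymbol_isHomogeneous (b : Basis (Fin m) K L) (c : ℕ → ℚ) (r : ℕ) :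
    (dufloSymbol b c r).IsHomogeneous r :=
  homogeneousComponent_isHomogeneous _ _

lemma sum_symmetrizationL [FiniteDimensional K L] (b : Basis (Fin m) K L) (c : ℕ → ℚ)
    (hc0 : c 0 = 0) (hc : expPS (PowerSeries.mk fun n => 4 * c n) = sinhHalfSeries)
    (P : 𝒮 K L) : ∃ N₀, ∀ N, N₀ ≤ N →
      ∑ r ∈ range N, symmetrizationL b (diffOpL (dufloSymbol b c r) (equivMvPolynomial b P))
        = dfl K L P := by
  induction P using dp_induction with
  | h x n =>
    refine ⟨n + 1, fun N hN => ?_⟩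
    rw [dfl, comp_apply, jop_dp, sum_anti_range,
      map_sum, ← sum_subset (Finset.range_subset_range.2 hN)]
    · refine sum_congr rfl fun r hr => ?_
      rw [mem_range] at hr
      rw [diffOpL_dp b (dufloSymbol_isHomogeneous b c r), eval_dufloSymbol b c hc0 hc, mvdp,
        if_pos (by omega), map_smul, map_smul, symmetrizationL_equiv]
    · intro r _ hr
      rw [mem_range] at hr
      rw [diffOpL_dp b (dufloSymbol_isHomogeneous b c r), mvdp, if_neg (by omega), smul_zero,
        map_zero]
  | hz => exact ⟨0, fun N _ => by simp⟩
  | ha P Q hP hQ =>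
    obtain ⟨N, hN⟩ := hP
    obtain ⟨N', hN'⟩ := hQ
    refine ⟨max N N', fun M hM => ?_⟩
    simp only [map_add, sum_add_distrib, hN M (le_of_max_le_left hM),
      hN' M (le_of_max_le_right hM)]
  | hs a P hP =>
    obtain ⟨N, hN⟩ := hP
    refine ⟨N, fun M hM => ?_⟩
    simp only [map_smul, ← smul_sum, hN M hM]

lemma duflo_equiv [FiniteDimensional K L] (b : Basis (Fin m) K L) (c : ℕ → ℚ)
    (hc0 : c 0 = 0) (hc : expPS (PowerSeries.mk fun n => 4 * c n) = sinhHalfSeries)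
    (P : 𝒮 K L) : duflo b c (equivMvPolynomial b P) = dfl K L P := by
  obtain ⟨N, hN⟩ := sum_symmetrizationL b c hc0 hc P
  rw [← hN _ (le_max_left N ((equivMvPolynomial b P).totalDegree + 1)), duflo]
  simp only [← symmetrizationL_apply, ← diffOpL_apply]
  refine sum_subset (Finset.range_subset_range.2 (le_max_right _ _)) fun r _ hr => ?_
  rw [mem_range] at hr
  rw [diffOpL_eq_zero b (dufloSymbol_isHomogeneous b c r) P (by omega), map_zero]

lemma adS_equiv (b : Basis (Fin m) K L) (x : L) (P : 𝒮 K L) :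
    adS b x (equivMvPolynomial b P) = equivMvPolynomial b (adD x P) := by
  have hX : ∀ y : L, adS b x (linPoly b y) = linPoly b ⁅x, y⁆ := fun y => by
    have h : linPoly b ⁅x, y⁆ = ∑ j, b.repr y j • linPoly b ⁅x, b j⁆ := by
      conv_lhs => rw [← equivMvPolynomial_ι, ← b.sum_repr y, lie_sum]
      simp only [lie_smul, map_sum, map_smul, equivMvPolynomial_ι]
    rw [h]
    conv_lhs => rw [linPoly, map_sum]
    refine sum_congr rfl fun j _ => ?_
    rw [map_smul]
    exact congrArg _ (mkDerivation_X _ _ _)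
  induction P using SymmetricAlgebra.induction with
  | algebraMap a =>
    rw [AlgEquiv.commutes, Derivation.map_algebraMap, map_zero]
    exact Derivation.map_algebraMap _ _
  | ι y =>
    rw [equivMvPolynomial_ι, hX, adD, der_ι]
    exact (equivMvPolynomial_ι b _).symm
  | mul P Q hP hQ =>
    rw [leibniz, map_mul (equivMvPolynomial b), map_add, smul_eq_mul, smul_eq_mul,
      map_mul (equivMvPolynomial b), map_mul (equivMvPolynomial b), ← hP, ← hQ]
    exact leibniz _ _ _
  | add P Q hP hQ => simp only [map_add, hP, hQ]

lemma forall_adS_eq_zero_iff (b : Basis (Fin m) K L) (P : MvPolynomial (Fin m) K) :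
    (∀ x : L, adS b x P = 0) ↔ IsInv K ((equivMvPolynomial b).symm P) := by
  refine forall_congr' fun x => ?_
  rw [← map_eq_zero_iff (equivMvPolynomial b) (equivMvPolynomial b).injective, ← adS_equiv,
    AlgEquiv.apply_symm_apply]

end

end Duflo

end

noncomputable section

variable {K : Type} [Field K] [CharZero K]
variable {L : Type} [LieRing L] [LieAlgebra K L]
variable {m : ℕ}

/-- **Duflo's theorem.**  The Duflo map `D` restricts to an algebra isomorphism from
`S(g)^g` onto `U(g)^g`: it maps `S(g)^g` into `U(g)^g`, is injective and surjective onto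
`U(g)^g` there, and satisfies `D(PQ) = D(P)·D(Q)` for invariant `P, Q`. -/
theorem duflo_map_algebra_isomorphism
    (b : Module.Basis (Fin m) K L)
    (c : ℕ → ℚ) (hc0 : c 0 = 0)
    (hc : expPS (PowerSeries.mk fun n => 4 * c n) = sinhHalfSeries) :
    -- D maps S(g)^g into U(g)^g
    (∀ P : MvPolynomial (Fin m) K, (∀ x : L, adS b x P = 0) →
      ∀ x : L, UniversalEnvelopingAlgebra.ι K x * duflo b c P
        = duflo b c P * UniversalEnvelopingAlgebra.ι K x) ∧
    -- D is injective on S(g)^g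
    (∀ P Q : MvPolynomial (Fin m) K, (∀ x : L, adS b x P = 0) → (∀ x : L, adS b x Q = 0) →
      duflo b c P = duflo b c Q → P = Q) ∧
    -- D maps S(g)^g onto U(g)^g
    (∀ u : UniversalEnvelopingAlgebra K L,
      (∀ x : L, UniversalEnvelopingAlgebra.ι K x * u = u * UniversalEnvelopingAlgebra.ι K x) →
      ∃ P : MvPolynomial (Fin m) K, (∀ x : L, adS b x P = 0) ∧ duflo b c P = u) ∧
    -- D is multiplicative on S(g)^g
    (∀ P Q : MvPolynomial (Fin m) K, (∀ x : L, adS b x P = 0) → (∀ x : L, adS b x Q = 0) →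
      duflo b c (P * Q) = duflo b c P * duflo b c Q) := by
  have : FiniteDimensional K L := Module.Finite.of_basis b
  have hD : ∀ P, duflo b c P = Duflo.dfl K L ((SymmetricAlgebra.equivMvPolynomial b).symm P) :=
    fun P => by rw [← Duflo.duflo_equiv b c hc0 hc, AlgEquiv.apply_symm_apply]
  simp only [Duflo.forall_adS_eq_zero_iff, hD, map_mul]
  refine ⟨fun P hP => Duflo.isInv_iff _ |>.1 hP, fun P Q _ _ h =>
    (SymmetricAlgebra.equivMvPolynomial b).symm.injective (Duflo.dfl_bijective.1 h),
    fun u hu => ?_, fun P Q hP hQ => Duflo.dufloMul _ K L rfl _ _ hP hQ⟩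
  obtain ⟨P, rfl⟩ := Duflo.dfl_bijective.2 u
  refine ⟨SymmetricAlgebra.equivMvPolynomial b P, ?_, ?_⟩ <;> rw [AlgEquiv.symm_apply_apply]
  exact (Duflo.isInv_iff P).2 hu

end
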